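/- Let Ω ⊂ ℝ² be an open neighborhood of the origin and let Φ ∈ C^∞(Ω) satisfy ∂₂Φ(0,0) = 0 and ∂₂²Φ(0,0) ≠ 0. Let 1 < p, q < ∞ satisfy 1/(2p) < 1/q ≤ 1/p and 1/q > 3/p − 1. Then there exists a neighborhood U ⊂ Ω of the origin such that for every cutoff η ∈ C₀^∞(ℝ²) supported in U there exists a constant C = C(p, q, Φ, η) with ‖Mf‖_{L^q(ℝ³)} ≤ C ‖f‖_{L^p(ℝ³)} for all f ∈ C₀^∞(ℝ³), where Mf(y) = sup_{t∈[1,2]} |∫_{ℝ²} f(y − t(x₁, x₂, Φ(x₁,x₂))) η(x) dx|. -/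

import Mathlib

open MeasureTheory Set
open scoped ENNReal

/-- The maximal operator associated with the hypersurface `(x₁, x₂, Φ(x₁,x₂))` in `ℝ³` and
isotropic dilations, with supremum over `t ∈ [1,2]`:
`M f (y) = sup_{t ∈ [1,2]} |∫_{ℝ²} f(y - t (x₁, x₂, Φ(x₁,x₂))) η(x) dx|`. -/
noncomputable def maxOpSurfIso (Φ : ℝ × ℝ → ℝ) (η : ℝ × ℝ → ℝ)
    (f : ℝ × ℝ × ℝ → ℝ) (y : ℝ × ℝ × ℝ) : ℝ :=
  ⨆ t : Set.Icc (1 : ℝ) 2,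
    |∫ x : ℝ × ℝ, f (y.1 - t * x.1, y.2.1 - t * x.2, y.2.2 - t * Φ x) * η x|


/-- Smooth functions of one variable. -/
abbrev Smooth (f : ℝ → ℝ) : Prop := ContDiff ℝ (⊤ : ℕ∞) f

/-- Pointwise control of derivatives up to order `N`. -/
def Jet (N : ℕ) (A D : ℝ) (f : ℝ → ℝ) (x : ℝ) : Prop :=
  ∀ i ≤ N, |iteratedDeriv i f x| ≤ A * D ^ i

theorem Jet.mono {N : ℕ} {A A' D D' : ℝ} {f : ℝ → ℝ} {x : ℝ} (h : Jet N A D f x)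
    (hA : A ≤ A') (hA0 : 0 ≤ A) (hD0 : 0 ≤ D) (hD : D ≤ D') : Jet N A' D' f x := by
  intro i hi
  refine (h i hi).trans ?_
  have : 0 ≤ A' := hA0.trans hA
  gcongr

theorem Jet.mul {N : ℕ} {A A' D D' : ℝ} {f g : ℝ → ℝ} {x : ℝ} (hf : Smooth f) (hg : Smooth g)
    (h : Jet N A D f x) (h' : Jet N A' D' g x) (hD : 0 ≤ D) :
    Jet N (A * A') (D + D') (fun y => f y * g y) x := by
  intro i hi
  have hA : 0 ≤ A := by have := (abs_nonneg _).trans (h 0 (Nat.zero_le _)); simpa using this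
  have hA' : 0 ≤ A' := by have := (abs_nonneg _).trans (h' 0 (Nat.zero_le _)); simpa using this
  rw [iteratedDeriv_fun_mul (hf.contDiffAt.of_le (by exact_mod_cast le_top))
    (hg.contDiffAt.of_le (by exact_mod_cast le_top)), add_pow, Finset.mul_sum]
  refine (Finset.abs_sum_le_sum_abs _ _).trans (Finset.sum_le_sum fun k hk => ?_)
  have hk' : k ≤ i := Nat.lt_succ_iff.mp (Finset.mem_range.mp hk)
  rw [abs_mul, abs_mul, Nat.abs_cast]
  calc (i.choose k : ℝ) * |iteratedDeriv k f x| * |iteratedDeriv (i - k) g x|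
      ≤ (i.choose k : ℝ) * (A * D ^ k) * (A' * D' ^ (i - k)) := by
        gcongr
        · exact h k (hk'.trans hi)
        · exact h' (i - k) ((Nat.sub_le _ _).trans hi)
    _ = _ := by ring

theorem Jet.comp {N : ℕ} {A D : ℝ} {X h : ℝ → ℝ} {x : ℝ} (hX : Smooth X) (hh : Smooth h)
    (hA : ∀ i ≤ N, |iteratedDeriv i X (h x)| ≤ A)
    (hD0 : 0 ≤ D) (hD : ∀ i, 1 ≤ i → i ≤ N → |iteratedDeriv i h x| ≤ D ^ i) :
    Jet N (N.factorial * A) D (fun y => X (h y)) x := by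
  intro i hi
  have hA0 : 0 ≤ A := (abs_nonneg _).trans (hA 0 (Nat.zero_le _))
  have := norm_iteratedFDeriv_comp_le (𝕜 := ℝ) (g := X) (f := h) (n := i)
    (N := ((⊤ : ℕ∞) : WithTop ℕ∞)) hX hh (by exact_mod_cast le_top) x (C := A) (D := D)
    (fun j hj => by
      rw [norm_iteratedFDeriv_eq_norm_iteratedDeriv]; exact hA j (hj.trans hi))
    (fun j hj hj' => by
      rw [norm_iteratedFDeriv_eq_norm_iteratedDeriv]; exact hD j hj (hj'.trans hi))
  rw [norm_iteratedFDeriv_eq_norm_iteratedDeriv] at this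
  refine (show |iteratedDeriv i (fun y => X (h y)) x| ≤ _ from this).trans ?_
  have : (i.factorial : ℝ) ≤ N.factorial := by exact_mod_cast Nat.factorial_le hi
  gcongr

theorem Jet.zero_of_notMem {N : ℕ} {A D : ℝ} {f : ℝ → ℝ} {x : ℝ} (hx : x ∉ tsupport f)
    (hA : 0 ≤ A) (hD : 0 ≤ D) : Jet N A D f x := by
  intro i _
  have h : f =ᶠ[nhds x] fun _ => 0 := notMem_tsupport_iff_eventuallyEq.mp hx
  rw [h.iteratedDeriv_eq, iteratedDeriv_const]
  split_ifs <;> simp <;> positivity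

/-- Division estimate. -/
theorem div_jet (N : ℕ) : ∃ K : ℝ, 0 ≤ K ∧ ∀ (w H b : ℝ → ℝ) (x A D : ℝ),
    ContDiffAt ℝ (⊤ : ℕ∞) w x → ContDiffAt ℝ (⊤ : ℕ∞) H x →
    (fun y => w y * H y) =ᶠ[nhds x] b → 0 ≤ D →
    (∀ j ≤ N, |iteratedDeriv j H x| ≤ |H x| * D ^ j) → Jet N A D b x →
    ∀ i ≤ N, |iteratedDeriv i w x| * |H x| ≤ K * A * D ^ i := by
  induction N with
  | zero =>
    refine ⟨1, zero_le_one, fun w H b x A D _ _ hb _ _ hj i hi => ?_⟩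
    have := hj 0 le_rfl
    obtain rfl : i = 0 := by omega
    simp only [iteratedDeriv_zero, pow_zero, mul_one, one_mul] at this ⊢
    rw [← hb.eq_of_nhds, abs_mul] at this
    exact this
  | succ N ih =>
    obtain ⟨K, hK, ih⟩ := ih
    refine ⟨K + 1 + 2 ^ (N + 1) * K, by positivity, fun w H b x A D hw hH hb hD hHj hj i hi => ?_⟩
    have hA : 0 ≤ A := by have := (abs_nonneg _).trans (hj 0 (Nat.zero_le _)); simpa using this
    have ih' := ih w H b x A D hw hH hb hD (fun j h => hHj j (by omega)) (fun j h => hj j (by omega))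
    rcases Nat.lt_or_ge i (N + 1) with h | h
    · refine (ih' i (by omega)).trans ?_
      have : 0 ≤ 2 ^ (N + 1) * K := by positivity
      gcongr
      linarith
    obtain rfl : i = N + 1 := by omega
    have e := hj (N + 1) le_rfl
    rw [← hb.iteratedDeriv_eq, iteratedDeriv_fun_mul (hw.of_le (by exact_mod_cast le_top))
      (hH.of_le (by exact_mod_cast le_top)), Finset.sum_range_succ] at e
    simp only [Nat.choose_self, Nat.cast_one, one_mul, Nat.sub_self, iteratedDeriv_zero] at e
    have e2 : |∑ k ∈ Finset.range (N + 1), ((N + 1).choose k : ℝ) * iteratedDeriv k w x *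
        iteratedDeriv (N + 1 - k) H x| ≤ 2 ^ (N + 1) * K * A * D ^ (N + 1) := by
      refine (Finset.abs_sum_le_sum_abs _ _).trans ?_
      calc _ ≤ ∑ k ∈ Finset.range (N + 1), ((N + 1).choose k : ℝ) * (K * A * D ^ (N + 1)) := by
            refine Finset.sum_le_sum fun k hk => ?_
            have hk' : k ≤ N := Nat.lt_succ_iff.mp (Finset.mem_range.mp hk)
            rw [abs_mul, abs_mul, Nat.abs_cast, mul_assoc]
            refine mul_le_mul_of_nonneg_left ?_ (Nat.cast_nonneg _)
            calc |iteratedDeriv k w x| * |iteratedDeriv (N + 1 - k) H x|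
                ≤ |iteratedDeriv k w x| * (|H x| * D ^ (N + 1 - k)) := by
                  gcongr; exact hHj _ (by omega)
              _ = (|iteratedDeriv k w x| * |H x|) * D ^ (N + 1 - k) := by ring
              _ ≤ (K * A * D ^ k) * D ^ (N + 1 - k) := by gcongr ?_ * _; exact ih' k hk'
              _ = K * A * (D ^ k * D ^ (N + 1 - k)) := by ring
              _ = _ := by rw [← pow_add]; congr 2; omega
        _ = (∑ k ∈ Finset.range (N + 1), ((N + 1).choose k : ℝ)) * (K * A * D ^ (N + 1)) := by
            rw [Finset.sum_mul]
        _ ≤ 2 ^ (N + 1) * (K * A * D ^ (N + 1)) := by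
            gcongr
            have h1 := Nat.sum_range_choose (N + 1)
            rw [Finset.sum_range_succ] at h1
            have : ∑ k ∈ Finset.range (N + 1), (N + 1).choose k ≤ 2 ^ (N + 1) := by omega
            exact_mod_cast this
        _ = _ := by ring
    rw [← abs_mul]
    have e3 : 0 ≤ K * A * D ^ (N + 1) := by positivity
    have := abs_le.mp e
    have := abs_le.mp e2
    rw [abs_le]
    constructor <;> nlinarith

/-- Non-stationary phase. -/
theorem nonstat (N : ℕ) : ∃ C : ℝ, 0 ≤ C ∧ ∀ (b G : ℝ → ℝ) (Ξ : ℕ → ℝ → ℝ)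
    (l ρ D A Mx p q : ℝ), Smooth b → Smooth G → 0 < l → 0 < ρ → 0 ≤ D → p ≤ q →
    tsupport b ⊆ Icc p q →
    (∀ s ∈ tsupport b, ρ ≤ |deriv G s| ∧
      ∀ j ≤ N, |iteratedDeriv j (deriv G) s| ≤ |deriv G s| * D ^ j) →
    (∀ s, Jet N A D b s) → (∀ k x, HasDerivAt (Ξ k) (Ξ (k + 1) x) x) → (∀ x, |Ξ 0 x| ≤ Mx) →
    |∫ s, b s * Ξ N (l * G s)| ≤ C * A * Mx * (q - p) * (D / (l * ρ)) ^ N := by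
  induction N with
  | zero =>
    refine ⟨1, zero_le_one, fun b G Ξ l ρ D A Mx p q hb hG hl hρ hD hpq hsupp hG' hj hΞ hM => ?_⟩
    have hA : 0 ≤ A := by
      have := (abs_nonneg _).trans (hj 0 0 (Nat.zero_le _)); simpa using this
    have hM0 : 0 ≤ Mx := (abs_nonneg _).trans (hM 0)
    have h1 : ∫ s, b s * Ξ 0 (l * G s) = ∫ s in Icc p q, b s * Ξ 0 (l * G s) := by
      rw [setIntegral_eq_integral_of_forall_compl_eq_zero]
      intro s hs
      rw [image_eq_zero_of_notMem_tsupport (fun h => hs (hsupp h)), zero_mul]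
    rw [h1, pow_zero, mul_one, one_mul, ← Real.norm_eq_abs]
    have := norm_setIntegral_le_of_norm_le_const (μ := volume) (s := Icc p q)
      (f := fun s => b s * Ξ 0 (l * G s)) (C := A * Mx) (by simp) (fun s _ => by
        rw [norm_mul]
        have h2 := hj s 0 le_rfl
        simp at h2
        exact mul_le_mul h2 (hM _) (norm_nonneg _) hA)
    simpa [hpq] using this
  | succ N ih =>
    obtain ⟨C, hC, ih⟩ := ih
    obtain ⟨K, hK, hdiv⟩ := div_jet (N + 1)
    refine ⟨C * K, by positivity, fun b G Ξ l ρ D A Mx p q hb hG hl hρ hD hpq hsupp hG' hj hΞ hM => ?_⟩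
    have hA : 0 ≤ A := by
      have := (abs_nonneg _).trans (hj 0 0 (Nat.zero_le _)); simpa using this
    have hM0 : 0 ≤ Mx := (abs_nonneg _).trans (hM 0)
    have hG1 : Smooth (deriv G) := (contDiff_infty_iff_deriv.mp hG).2
    set w : ℝ → ℝ := fun s => b s / deriv G s with hw
    have hne : ∀ s ∈ tsupport b, deriv G s ≠ 0 := fun s hs h0 => by
      have := (hG' s hs).1; rw [h0, abs_zero] at this; linarith
    have hz : ∀ s, s ∉ tsupport b → w =ᶠ[nhds s] fun _ => 0 := fun s hs => by
      have h : b =ᶠ[nhds s] fun _ => 0 := notMem_tsupport_iff_eventuallyEq.mp hs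
      filter_upwards [h] with y hy
      simp [hw, hy]
    have hws : Smooth w := by
      rw [Smooth, contDiff_iff_contDiffAt]
      intro s
      by_cases hs : s ∈ tsupport b
      · exact hb.contDiffAt.div hG1.contDiffAt (hne s hs)
      · exact (contDiffAt_const (c := (0 : ℝ))).congr_of_eventuallyEq (hz s hs)
    have hwt : tsupport w ⊆ tsupport b := by
      intro s hs
      by_contra h
      exact (notMem_tsupport_iff_eventuallyEq.mpr (hz s h)) hs
    have hwj : ∀ s, ∀ i ≤ N + 1, |iteratedDeriv i w s| ≤ K * A / ρ * D ^ i := by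
      intro s
      by_cases hs : s ∈ tsupport b
      · intro i hi
        have h1 := hdiv w (deriv G) b s A D hws.contDiffAt hG1.contDiffAt ?_ hD (hG' s hs).2 (hj s) i hi
        · have h2 := (hG' s hs).1
          rw [div_mul_eq_mul_div, le_div_iff₀ hρ]
          exact (mul_le_mul_of_nonneg_left h2 (abs_nonneg _)).trans h1
        · have : ∀ᶠ y in nhds s, deriv G y ≠ 0 :=
            hG1.continuous.continuousAt.eventually_ne (hne s hs)
          filter_upwards [this] with y hy
          simp [hw, hy]
      · exact Jet.zero_of_notMem (fun h => hs (hwt h)) (by positivity) hD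
    have hw1 : Smooth (deriv w) := (contDiff_infty_iff_deriv.mp hws).2
    set b1 : ℝ → ℝ := fun s => (-1 / l) * deriv w s with hb1
    have hb1s : Smooth b1 := contDiff_const.mul hw1
    have hdt : tsupport b1 ⊆ tsupport b := by
      refine (closure_mono ?_).trans ((tsupport_deriv_subset (𝕜 := ℝ) (f := w)).trans hwt)
      intro s hs
      simp only [Function.mem_support, hb1] at hs ⊢
      exact right_ne_zero_of_mul hs
    have key : ∫ s, b s * Ξ (N + 1) (l * G s) = ∫ s, b1 s * Ξ N (l * G s) := by
      have hcb : HasCompactSupport b := HasCompactSupport.of_support_subset_isCompact isCompact_Icc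
        ((subset_tsupport b).trans hsupp)
      have hcw : HasCompactSupport w := HasCompactSupport.of_support_subset_isCompact isCompact_Icc
        ((subset_tsupport w).trans (hwt.trans hsupp))
      have hΞc : ∀ k, Continuous (Ξ k) := fun k =>
        continuous_iff_continuousAt.mpr fun x => (hΞ k x).continuousAt
      have hGc := hG.continuous
      have hv : ∀ s, HasDerivAt (fun s => Ξ N (l * G s)) (Ξ (N + 1) (l * G s) * (l * deriv G s)) s :=
        fun s => (hΞ N (l * G s)).comp s (((hG.differentiable (by simp)) s).hasDerivAt.const_mul l)
      have ibp := integral_mul_deriv_eq_deriv_mul_of_integrable (u := w) (u' := deriv w)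
        (v := fun s => Ξ N (l * G s)) (v' := fun s => Ξ (N + 1) (l * G s) * (l * deriv G s))
        (fun x _ => ((hws.differentiable (by simp)) x).hasDerivAt) (fun x _ => hv x)
        ?_ ?_ ?_
      · have e1 : ∀ s, b s * Ξ (N + 1) (l * G s) =
            (1 / l) * (w s * (Ξ (N + 1) (l * G s) * (l * deriv G s))) := by
          intro s
          by_cases hs : s ∈ tsupport b
          · have := hne s hs
            simp only [hw]; field_simp
          · simp [hw, image_eq_zero_of_notMem_tsupport hs]
        simp_rw [e1, hb1, mul_assoc]
        rw [integral_const_mul, integral_const_mul, ibp]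
        ring
      · have h1 := hΞc (N + 1)
        have h2 := hG1.continuous
        exact (hws.continuous.mul ((h1.comp (by fun_prop)).mul (by fun_prop))).integrable_of_hasCompactSupport hcw.mul_right
      · have h1 := hΞc N
        exact (hw1.continuous.mul (h1.comp (by fun_prop))).integrable_of_hasCompactSupport hcw.deriv.mul_right
      · have h1 := hΞc N
        exact (hws.continuous.mul (h1.comp (by fun_prop))).integrable_of_hasCompactSupport hcw.mul_right
    rw [key]
    refine (ih b1 G Ξ l ρ D (K * A * D / (l * ρ)) Mx p q hb1s hG hl hρ hD hpq (hdt.trans hsupp)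
      (fun s hs => ⟨(hG' s (hdt hs)).1, fun j h => (hG' s (hdt hs)).2 j (by omega)⟩) ?_ hΞ hM).trans
      (le_of_eq ?_)
    · intro s i hi
      have h1 := hwj s (i + 1) (by omega)
      rw [iteratedDeriv_succ'] at h1
      rw [hb1, iteratedDeriv_const_mul_field, abs_mul]
      have : |(-1 / l)| = 1 / l := by rw [abs_div, abs_neg, abs_one, abs_of_pos hl]
      rw [this]
      calc 1 / l * |iteratedDeriv i (deriv w) s| ≤ 1 / l * (K * A / ρ * D ^ (i + 1)) := by gcongr
        _ = _ := by rw [pow_succ]; field_simp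
    · rw [pow_succ]; field_simp

theorem Smooth.iteratedDeriv {f : ℝ → ℝ} (hf : Smooth f) (i : ℕ) : Smooth (iteratedDeriv i f) := by
  rw [Smooth, iteratedDeriv_eq_iterate]
  exact ContDiff.iterate_deriv i hf

theorem smooth_deriv {f : ℝ → ℝ} (hf : Smooth f) : Smooth (deriv f) :=
  (contDiff_infty_iff_deriv.mp hf).2

theorem tsupport_sub_of {f : ℝ → ℝ} {p q : ℝ} (h : ∀ x, f x ≠ 0 → p ≤ x ∧ x ≤ q) :
    tsupport f ⊆ Icc p q :=
  closure_minimal (fun x hx => h x hx) isClosed_Icc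

theorem hcs_of {f : ℝ → ℝ} {p q : ℝ} (h : ∀ x, f x ≠ 0 → p ≤ x ∧ x ≤ q) :
    HasCompactSupport f :=
  HasCompactSupport.of_support_subset_isCompact isCompact_Icc (fun x hx => h x hx)

theorem bdd_jet {f : ℝ → ℝ} (hf : Smooth f) (hc : HasCompactSupport f) (N : ℕ) :
    ∃ A : ℝ, 0 ≤ A ∧ ∀ i ≤ N, ∀ x, |iteratedDeriv i f x| ≤ A := by
  have h : ∀ i, ∃ A : ℝ, ∀ x, |iteratedDeriv i f x| ≤ A := fun i => by
    obtain ⟨A, hA⟩ := (hc.iteratedFDeriv (𝕜 := ℝ) i).exists_bound_of_continuous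
      (hf.continuous_iteratedFDeriv (m := i) (by exact_mod_cast le_top))
    refine ⟨A, fun x => ?_⟩
    have := hA x
    rwa [norm_iteratedFDeriv_eq_norm_iteratedDeriv] at this
  choose A hA using h
  refine ⟨∑ i ∈ Finset.range (N + 1), |A i|, Finset.sum_nonneg fun _ _ => abs_nonneg _, ?_⟩
  intro i hi x
  refine (hA i x).trans ((le_abs_self _).trans ?_)
  exact Finset.single_le_sum (f := fun i => |A i|) (fun _ _ => abs_nonneg _)
    (Finset.mem_range.mpr (by omega))

/-- primitive of a compactly supported smooth function -/
theorem exists_prim {f : ℝ → ℝ} (hf : Smooth f) (hs : ∀ x, f x ≠ 0 → |x| ≤ 1) :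
    ∃ T : ℝ → ℝ, Smooth T ∧ (∀ x, HasDerivAt T (f x) x) ∧ (∀ x, x ≤ -1 → T x = 0) ∧
      (∀ x, 1 ≤ x → T x = ∫ y, f y) := by
  have hd : ∀ x, HasDerivAt (fun x => ∫ y in (-1)..x, f y) (f x) x := fun x =>
    intervalIntegral.integral_hasDerivAt_right (hf.continuous.intervalIntegrable _ _)
      hf.continuous.stronglyMeasurable.stronglyMeasurableAtFilter hf.continuous.continuousAt
  refine ⟨fun x => ∫ y in (-1)..x, f y, ?_, hd, ?_, ?_⟩
  · rw [Smooth, contDiff_infty_iff_deriv]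
    refine ⟨fun x => (hd x).differentiableAt, ?_⟩
    have : deriv (fun x => ∫ y in (-1)..x, f y) = f := funext fun x => (hd x).deriv
    rw [this]; exact hf
  · intro x hx
    change ∫ y in (-1)..x, f y = 0
    rw [intervalIntegral.integral_symm, intervalIntegral.integral_of_le hx]
    rw [setIntegral_eq_zero_of_ae_eq_zero]
    · simp
    have : ∀ᵐ y : ℝ, y ≠ -1 := by simp [ae_iff, measure_singleton]
    filter_upwards [this] with y h1 h2
    by_contra h
    have := abs_le.mp (hs y h)
    exact h1 (le_antisymm h2.2 this.1)
  · intro x hx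
    have h1 : (-1 : ℝ) ≤ x := by linarith
    change ∫ y in (-1)..x, f y = _
    rw [intervalIntegral.integral_of_le h1]
    apply setIntegral_eq_integral_of_ae_compl_eq_zero
    have : ∀ᵐ y : ℝ, y ≠ -1 := by simp [ae_iff, measure_singleton]
    filter_upwards [this] with y h1 h2
    by_contra h
    have := abs_le.mp (hs y h)
    exact h2 ⟨lt_of_le_of_ne this.1 (Ne.symm h1), this.2.trans hx⟩

theorem smooth_dil {f : ℝ → ℝ} (hf : Smooth f) (c : ℝ) : Smooth (fun x => f (c * x)) :=
  hf.comp (contDiff_const.mul contDiff_id)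

theorem prim_step {f : ℝ → ℝ} (hf : Smooth f) (hs : ∀ x, f x ≠ 0 → |x| ≤ 1) (k : ℕ) (d : ℝ) :
    ∃ Θ : ℝ → ℝ, Smooth Θ ∧ (∀ x, Θ x ≠ 0 → |x| ≤ 1) ∧
      ∀ x, iteratedDeriv (k + 1) Θ x = d * (2 ^ (k + 1) * iteratedDeriv k f (2 * x) - iteratedDeriv k f x) := by
  obtain ⟨T, hT, hd, h0, h1⟩ := exists_prim hf hs
  have hT2 := smooth_dil hT 2
  refine ⟨fun x => d * (T (2 * x) - T x), contDiff_const.mul (hT2.sub hT), ?_, ?_⟩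
  · intro x hx
    by_contra h
    apply hx
    change d * (T (2 * x) - T x) = 0
    rcases lt_abs.mp (not_le.mp h) with h | h
    · rw [h1 x h.le, h1 (2 * x) (by linarith)]; simp
    · rw [h0 x (by linarith), h0 (2 * x) (by linarith)]; simp
  · intro x
    have hder : deriv T = f := funext fun x => (hd x).deriv
    rw [iteratedDeriv_const_mul_field]
    have := iteratedDeriv_sub (n := k + 1) (x := x) (f := fun x => T (2 * x)) (g := T)
      (hT2.contDiffAt.of_le (by exact_mod_cast le_top)) (hT.contDiffAt.of_le (by exact_mod_cast le_top))
    change iteratedDeriv (k + 1) (fun x => T (2 * x) - T x) x = _ at this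
    rw [this, iteratedDeriv_comp_const_mul (hT.of_le (by exact_mod_cast le_top))]
    simp only [iteratedDeriv_succ', hder]

theorem exists_moll (N : ℕ) : ∃ φ Θ : ℝ → ℝ, Smooth φ ∧ Smooth Θ ∧ (∀ x, φ x ≠ 0 → |x| ≤ 1) ∧
    (∀ x, Θ x ≠ 0 → |x| ≤ 1) ∧ ∫ x, φ x = 1 ∧
    ∀ x, 2 * φ (2 * x) - φ x = iteratedDeriv (N + 1) Θ x := by
  induction N with
  | zero =>
    let bp : ContDiffBump (0 : ℝ) := ⟨1 / 2, 1, by norm_num, by norm_num⟩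
    have hs : ∀ x, bp.normed volume x ≠ 0 → |x| ≤ 1 := by
      intro x hx
      have : x ∈ Function.support (bp.normed volume) := hx
      rw [bp.support_normed_eq] at this
      have h2 := mem_ball_zero_iff.mp this
      exact le_of_lt h2
    have hsm : Smooth (bp.normed volume) := bp.contDiff_normed
    obtain ⟨Θ, h1, h2, h3⟩ := prim_step hsm hs 0 1
    refine ⟨bp.normed volume, Θ, hsm, h1, hs, h2, bp.integral_normed, fun x => ?_⟩
    rw [h3]; simp
  | succ N ih =>
    obtain ⟨φ, Θ, hφ, hΘ, hφs, hΘs, hintg, hid⟩ := ih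
    have hne : (2 : ℝ) ^ (N + 1) - 1 ≠ 0 := by
      have : (1 : ℝ) < 2 ^ (N + 1) := one_lt_pow₀ (by norm_num) (by omega)
      linarith
    set e : ℝ := ((2 : ℝ) ^ (N + 1) - 1)⁻¹ with he
    obtain ⟨Θ', h1, h2, h3⟩ := prim_step hΘ hΘs (N + 1) e
    refine ⟨fun x => e * (2 ^ (N + 1) * (2 * φ (2 * x)) - φ x), Θ', ?_, h1, ?_, h2, ?_, ?_⟩
    · exact contDiff_const.mul ((contDiff_const.mul (contDiff_const.mul (smooth_dil hφ 2))).sub hφ)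
    · intro x hx
      by_contra h
      apply hx
      have a1 : φ x = 0 := by by_contra h'; exact h (hφs x h')
      have a2 : φ (2 * x) = 0 := by
        by_contra h'; have := hφs _ h'; rw [abs_mul] at this
        norm_num at this
        apply h; nlinarith [abs_nonneg x]
      simp [a1, a2]
    · have hc : HasCompactSupport φ := hcs_of fun x hx => abs_le.mp (hφs x hx)
      have hi : Integrable φ := hφ.continuous.integrable_of_hasCompactSupport hc
      have hi2 : Integrable (fun x => φ (2 * x)) := hi.comp_mul_left' (by norm_num)
      rw [integral_const_mul, integral_sub ((hi2.const_mul _).const_mul _) hi,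
        integral_const_mul, integral_const_mul, Measure.integral_comp_mul_left, hintg]
      rw [he]
      simp only [smul_eq_mul, abs_inv, abs_two]
      field_simp
    · intro x
      rw [h3, ← hid, ← hid]
      ring

/-- Partition bump. -/
theorem exists_part : ∃ β : ℝ → ℝ, Smooth β ∧ (∀ x, β x ≠ 0 → |x| ≤ 1) ∧
    ∀ (n : ℕ) (x : ℝ), |x| ≤ n → ∑ j ∈ Finset.range (2 * n + 1), β (x - ((j : ℝ) - n)) = 1 := by
  refine ⟨fun x => Real.smoothTransition (x + 1) - Real.smoothTransition x, ?_, ?_, ?_⟩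
  · exact (Real.smoothTransition.contDiff.comp (contDiff_id.add contDiff_const)).sub
      Real.smoothTransition.contDiff
  · intro x hx
    by_contra h
    apply hx
    rcases lt_abs.mp (not_le.mp h) with h | h
    · simp only [Real.smoothTransition.one_of_one_le h.le, Real.smoothTransition.one_of_one_le (show 1 ≤ x + 1 by linarith), sub_self]
    · simp only [Real.smoothTransition.zero_of_nonpos (show x ≤ 0 by linarith), Real.smoothTransition.zero_of_nonpos (show x + 1 ≤ 0 by linarith), sub_self]
  · intro n x hx
    have := Finset.sum_range_sub' (fun j : ℕ => Real.smoothTransition (x - ((j : ℝ) - n) + 1)) (2 * n + 1)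
    have e : ∀ j : ℕ, Real.smoothTransition (x - ((j : ℝ) - n) + 1) - Real.smoothTransition (x - ((j : ℝ) - n))
      = Real.smoothTransition (x - ((j : ℝ) - n) + 1) - Real.smoothTransition (x - (((j + 1 : ℕ) : ℝ) - n) + 1) := by
      intro j; congr 2; push_cast; ring
    simp only [e]
    rw [this]
    have := abs_le.mp hx
    rw [Real.smoothTransition.one_of_one_le (by push_cast; linarith), Real.smoothTransition.zero_of_nonpos (by push_cast; linarith)]
    simp

theorem exists_cut : ∃ ω : ℝ → ℝ, Smooth ω ∧ (∀ x, ω x ≠ 0 → |x| ≤ 2) ∧ (∀ x, |x| ≤ 1 → ω x = 1) ∧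
    (∀ x, 0 ≤ ω x ∧ ω x ≤ 1) := by
  refine ⟨fun x => Real.smoothTransition (2 - x) * Real.smoothTransition (2 + x), ?_, ?_, ?_, ?_⟩
  · exact (Real.smoothTransition.contDiff.comp (contDiff_const.sub contDiff_id)).mul
      (Real.smoothTransition.contDiff.comp (contDiff_const.add contDiff_id))
  · intro x hx
    by_contra h
    apply hx
    rcases lt_abs.mp (not_le.mp h) with h | h
    · simp only [Real.smoothTransition.zero_of_nonpos (show 2 - x ≤ 0 by linarith), zero_mul]
    · simp only [Real.smoothTransition.zero_of_nonpos (show 2 + x ≤ 0 by linarith), mul_zero]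
  · intro x hx
    have := abs_le.mp hx
    simp only [Real.smoothTransition.one_of_one_le (show 1 ≤ 2 - x by linarith), Real.smoothTransition.one_of_one_le (show 1 ≤ 2 + x by linarith), mul_one]
  · intro x
    have h1 := Real.smoothTransition.nonneg (2 - x)
    have h2 := Real.smoothTransition.nonneg (2 + x)
    have h3 := Real.smoothTransition.le_one (2 - x)
    have h4 := Real.smoothTransition.le_one (2 + x)
    exact ⟨mul_nonneg h1 h2, mul_le_one₀ h3 h2 h4⟩

/-- A family of curves with uniform bounds and the cinematic curvature condition. -/
structure Fam (N : ℕ) (c B : ℝ) (g a S : ℝ → ℝ → ℝ) : Prop where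
  c_pos : 0 < c
  B_one : 1 ≤ B
  g_sm : ∀ t ∈ Icc (1 : ℝ) 2, Smooth (g t)
  a_sm : ∀ t ∈ Icc (1 : ℝ) 2, Smooth (a t)
  a_supp : ∀ t ∈ Icc (1 : ℝ) 2, ∀ s, a t s ≠ 0 → |s| ≤ 1
  a_jet : ∀ t ∈ Icc (1 : ℝ) 2, ∀ j ≤ N, ∀ s, |iteratedDeriv j (a t) s| ≤ B
  g_one : ∀ t ∈ Icc (1 : ℝ) 2, ∀ s, |s| ≤ 1 → |deriv (g t) s| ≤ B
  g_jet : ∀ t ∈ Icc (1 : ℝ) 2, ∀ j ≤ N, ∀ s, |iteratedDeriv (j + 1) (deriv (g t)) s| ≤ B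
  g_conv : ∀ t ∈ Icc (1 : ℝ) 2, ∀ s, c ≤ deriv (deriv (g t)) s
  g_lip : ∀ t ∈ Icc (1 : ℝ) 2, ∀ t' ∈ Icc (1 : ℝ) 2, ∀ s,
    |g t s - g t' s| ≤ B * (1 + s ^ 2) * |t - t'|
  g_lip1 : ∀ t ∈ Icc (1 : ℝ) 2, ∀ t' ∈ Icc (1 : ℝ) 2, ∀ j ≤ N, ∀ s, |s| ≤ 1 →
    |iteratedDeriv j (deriv (g t)) s - iteratedDeriv j (deriv (g t')) s| ≤ B * |t - t'|
  S_inv : ∀ t ∈ Icc (1 : ℝ) 2, ∀ σ, deriv (g t) (S t σ) = σ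
  cin : ∀ t ∈ Icc (1 : ℝ) 2, ∀ t' ∈ Icc (1 : ℝ) 2, t' ≤ t → ∀ σ' σ, σ' ≤ σ →
    c * (t - t') * (σ - σ') ≤ (S t σ - S t' σ) - (S t σ' - S t' σ')

/-- Legendre transform. -/
noncomputable def qq (g S : ℝ → ℝ → ℝ) (t σ : ℝ) : ℝ := g t (S t σ) - σ * S t σ

namespace Fam

variable {N : ℕ} {c B : ℝ} {g a S : ℝ → ℝ → ℝ}

theorem B_pos (F : Fam N c B g a S) : 0 < B := lt_of_lt_of_le one_pos F.B_one

theorem hasDeriv (F : Fam N c B g a S) {t : ℝ} (ht : t ∈ Icc (1 : ℝ) 2) (s : ℝ) :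
    HasDerivAt (g t) (deriv (g t) s) s :=
  ((F.g_sm t ht).differentiable (by simp) s).hasDerivAt

theorem hasDeriv1 (F : Fam N c B g a S) {t : ℝ} (ht : t ∈ Icc (1 : ℝ) 2) (s : ℝ) :
    HasDerivAt (deriv (g t)) (deriv (deriv (g t)) s) s :=
  ((smooth_deriv (F.g_sm t ht)).differentiable (by simp) s).hasDerivAt

theorem g2_le (F : Fam N c B g a S) {t : ℝ} (ht : t ∈ Icc (1 : ℝ) 2) (s : ℝ) :
    deriv (deriv (g t)) s ≤ B := by
  have := (le_abs_self _).trans (F.g_jet t ht 0 (Nat.zero_le _) s)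
  rwa [iteratedDeriv_succ, iteratedDeriv_zero] at this

theorem mono1 (F : Fam N c B g a S) {t : ℝ} (ht : t ∈ Icc (1 : ℝ) 2) {s s' : ℝ} (h : s' ≤ s) :
    c * (s - s') ≤ deriv (g t) s - deriv (g t) s' ∧
    deriv (g t) s - deriv (g t) s' ≤ B * (s - s') := by
  rcases h.eq_or_lt with rfl | h
  · simp
  obtain ⟨x, _, hx⟩ := exists_hasDerivAt_eq_slope (deriv (g t)) (deriv (deriv (g t))) h
    (smooth_deriv (F.g_sm t ht)).continuous.continuousOn (fun x _ => F.hasDeriv1 ht x)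
  rw [eq_div_iff (by linarith)] at hx
  rw [← hx]
  have h1 := F.g_conv t ht x
  have h2 := F.g2_le ht x
  have : 0 ≤ s - s' := by linarith
  constructor <;> gcongr

theorem abs1 (F : Fam N c B g a S) {t : ℝ} (ht : t ∈ Icc (1 : ℝ) 2) (s s' : ℝ) :
    c * |s - s'| ≤ |deriv (g t) s - deriv (g t) s'| ∧
    |deriv (g t) s - deriv (g t) s'| ≤ B * |s - s'| := by
  have hc := F.c_pos
  rcases le_total s' s with h | h
  · have := F.mono1 ht h
    have h0 : 0 ≤ s - s' := by linarith
    rw [abs_of_nonneg h0, abs_of_nonneg (le_trans (by positivity) this.1)]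
    exact this
  · have := F.mono1 ht h
    have h0 : 0 ≤ s' - s := by linarith
    rw [abs_sub_comm, abs_sub_comm (deriv (g t) s), abs_of_nonneg h0,
      abs_of_nonneg (le_trans (by positivity) this.1)]
    exact this

theorem S_left (F : Fam N c B g a S) {t : ℝ} (ht : t ∈ Icc (1 : ℝ) 2) (s : ℝ) :
    S t (deriv (g t) s) = s := by
  have h := (F.abs1 ht (S t (deriv (g t) s)) s).1
  rw [F.S_inv t ht, sub_self, abs_zero] at h
  have := abs_nonneg (S t (deriv (g t) s) - s)
  have hc := F.c_pos
  have : |S t (deriv (g t) s) - s| = 0 := by nlinarith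
  linarith [abs_eq_zero.mp this]

theorem S_lip (F : Fam N c B g a S) {t : ℝ} (ht : t ∈ Icc (1 : ℝ) 2) (σ σ' : ℝ) :
    c * |S t σ - S t σ'| ≤ |σ - σ'| := by
  have h := (F.abs1 ht (S t σ) (S t σ')).1
  rwa [F.S_inv t ht, F.S_inv t ht] at h

theorem S_bdd (F : Fam N c B g a S) {t : ℝ} (ht : t ∈ Icc (1 : ℝ) 2) {σ : ℝ} (h : |σ| ≤ B) :
    |S t σ| ≤ 2 * B / c := by
  have h1 := (F.abs1 ht (S t σ) 0).1
  rw [F.S_inv t ht, sub_zero] at h1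
  have h2 := F.g_one t ht 0 (by simp)
  rw [le_div_iff₀ F.c_pos, mul_comm]
  refine h1.trans ((abs_sub _ _).trans ?_)
  linarith

theorem tay (F : Fam N c B g a S) {t : ℝ} (ht : t ∈ Icc (1 : ℝ) 2) (s s0 : ℝ) :
    0 ≤ g t s - g t s0 - deriv (g t) s0 * (s - s0) ∧
    g t s - g t s0 - deriv (g t) s0 * (s - s0) ≤ B * (s - s0) ^ 2 := by
  have hc := F.c_pos
  rcases lt_trichotomy s s0 with h | rfl | h
  · obtain ⟨x, hx', hx⟩ := exists_hasDerivAt_eq_slope (g t) (deriv (g t)) h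
      (F.g_sm t ht).continuous.continuousOn (fun x _ => F.hasDeriv ht x)
    rw [eq_div_iff (by linarith)] at hx
    have h1 := F.mono1 ht hx'.2.le
    have h2 : 0 ≤ s0 - x := by linarith [hx'.2]
    have h3 : s0 - x ≤ s0 - s := by linarith [hx'.1]
    have h5 : g t s - g t s0 - deriv (g t) s0 * (s - s0) =
      (deriv (g t) s0 - deriv (g t) x) * (s0 - s) := by linarith
    have h4 : 0 ≤ s0 - s := by linarith
    have h6 : 0 ≤ c * (s0 - x) := by positivity
    rw [h5]
    refine ⟨mul_nonneg (by linarith) h4, ?_⟩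
    have h7 : B * (s0 - x) ≤ B * (s0 - s) := by
      have := F.B_pos; gcongr
    nlinarith
  · simp
  · obtain ⟨x, hx', hx⟩ := exists_hasDerivAt_eq_slope (g t) (deriv (g t)) h
      (F.g_sm t ht).continuous.continuousOn (fun x _ => F.hasDeriv ht x)
    rw [eq_div_iff (by linarith)] at hx
    have h1 := F.mono1 ht hx'.1.le
    have h2 : 0 ≤ x - s0 := by linarith [hx'.1]
    have h3 : x - s0 ≤ s - s0 := by linarith [hx'.2]
    have h5 : g t s - g t s0 - deriv (g t) s0 * (s - s0) =
      (deriv (g t) x - deriv (g t) s0) * (s - s0) := by linarith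
    have h4 : 0 ≤ s - s0 := by linarith
    have h6 : 0 ≤ c * (x - s0) := by positivity
    rw [h5]
    refine ⟨mul_nonneg (by linarith) h4, ?_⟩
    have h7 : B * (x - s0) ≤ B * (s - s0) := by
      have := F.B_pos; gcongr
    nlinarith

theorem q_min (F : Fam N c B g a S) {t : ℝ} (ht : t ∈ Icc (1 : ℝ) 2) (s σ : ℝ) :
    qq g S t σ ≤ g t s - σ * s ∧ g t s - σ * s ≤ qq g S t σ + B * (s - S t σ) ^ 2 := by
  have := F.tay ht s (S t σ)
  rw [F.S_inv t ht] at this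
  unfold qq
  constructor <;> linarith

theorem q_deriv (F : Fam N c B g a S) {t : ℝ} (ht : t ∈ Icc (1 : ℝ) 2) (σ : ℝ) :
    HasDerivAt (qq g S t) (-S t σ) σ := by
  have hc := F.c_pos
  rw [hasDerivAt_iff_isLittleO]
  have : (fun x => qq g S t x - qq g S t σ - (x - σ) • (-S t σ)) =O[nhds σ] fun x => (x - σ) ^ 2 := by
    refine Asymptotics.IsBigO.of_bound (1 / c) (Filter.Eventually.of_forall fun x => ?_)
    have h1 := (F.q_min ht (S t σ) x).1
    have h2 := (F.q_min ht (S t x) σ).1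
    have h3 : g t (S t σ) = qq g S t σ + σ * S t σ := by unfold qq; ring
    have h4 : g t (S t x) = qq g S t x + x * S t x := by unfold qq; ring
    have h5 := F.S_lip ht x σ
    rw [Real.norm_eq_abs, Real.norm_eq_abs, smul_eq_mul, abs_of_nonneg (sq_nonneg (x - σ)), ← sq_abs (x - σ)]
    have h6 : |S t x - S t σ| * |x - σ| ≤ 1 / c * |x - σ| ^ 2 := by
      rw [one_div, inv_mul_eq_div, le_div_iff₀ hc]
      nlinarith [abs_nonneg (x - σ)]
    refine le_trans ?_ h6
    have h7 : (S t x - S t σ) * (x - σ) ≤ |S t x - S t σ| * |x - σ| := by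
      rw [← abs_mul]; exact le_abs_self _
    rw [abs_le]
    constructor <;> nlinarith [mul_nonneg (abs_nonneg (S t x - S t σ)) (abs_nonneg (x - σ))]
  refine this.trans_isLittleO ?_
  have h0 : Filter.Tendsto (fun x : ℝ => x - σ) (nhds σ) (nhds 0) := by
    have : Continuous (fun x : ℝ => x - σ) := by fun_prop
    simpa using this.tendsto σ
  have := (Asymptotics.isLittleO_pow_id (𝕜 := ℝ) (n := 2) (by norm_num)).comp_tendsto h0
  exact this

theorem Q_conv (F : Fam N c B g a S) {t t' : ℝ} (ht : t ∈ Icc (1 : ℝ) 2) (ht' : t' ∈ Icc (1 : ℝ) 2)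
    (h : t' ≤ t) (x σ : ℝ) :
    (qq g S t x - qq g S t' x) - (qq g S t σ - qq g S t' σ) + (S t σ - S t' σ) * (x - σ)
      ≤ - (c / 2 * (t - t') * (x - σ) ^ 2) := by
  set Hf : ℝ → ℝ := fun x => (qq g S t x - qq g S t' x) - (qq g S t σ - qq g S t' σ) +
    (S t σ - S t' σ) * (x - σ) + c / 2 * (t - t') * (x - σ) ^ 2 with hHf
  have hd : ∀ x, HasDerivAt Hf ((- S t x - - S t' x) + (S t σ - S t' σ) + c * (t - t') * (x - σ)) x := by
    intro x
    have h1 := ((F.q_deriv ht x).sub (F.q_deriv ht' x)).sub_const (qq g S t σ - qq g S t' σ)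
    have h2 := ((hasDerivAt_id x).sub_const σ).const_mul (S t σ - S t' σ)
    have h3 := (((hasDerivAt_id x).sub_const σ).pow 2).const_mul (c / 2 * (t - t'))
    have := (h1.add h2).add h3
    refine this.congr_deriv ?_
    simp only [id, Nat.cast_ofNat, Nat.add_one_sub_one, pow_one, mul_one]
    ring
  have hcont : Continuous Hf := continuous_iff_continuousAt.mpr fun x => (hd x).continuousAt
  have h0 : Hf σ = 0 := by simp [hHf]
  suffices hx : Hf x ≤ 0 by simp only [hHf] at hx; linarith
  rw [← h0]
  rcases le_total σ x with hs | hs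
  · refine antitoneOn_of_deriv_nonpos (convex_Ici σ) hcont.continuousOn
      (fun y _ => (hd y).differentiableAt.differentiableWithinAt) ?_ (mem_Ici.mpr le_rfl) hs hs
    intro y hy
    rw [interior_Ici] at hy
    rw [(hd y).deriv]
    have := F.cin t ht t' ht' h σ y (le_of_lt hy)
    linarith
  · refine monotoneOn_of_deriv_nonneg (convex_Iic σ) hcont.continuousOn
      (fun y _ => (hd y).differentiableAt.differentiableWithinAt) ?_ hs (mem_Iic.mpr le_rfl) hs
    intro y hy
    rw [interior_Iic] at hy
    rw [(hd y).deriv]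
    have := F.cin t ht t' ht' h y σ (le_of_lt hy)
    linarith

theorem q_lip (F : Fam N c B g a S) {t t' : ℝ} (ht : t ∈ Icc (1 : ℝ) 2) (ht' : t' ∈ Icc (1 : ℝ) 2)
    {σ : ℝ} (hσ : |σ| ≤ B) :
    |qq g S t σ - qq g S t' σ| ≤ B * (1 + (2 * B / c) ^ 2) * |t - t'| := by
  have key : ∀ t ∈ Icc (1 : ℝ) 2, ∀ t' ∈ Icc (1 : ℝ) 2,
      qq g S t σ - qq g S t' σ ≤ B * (1 + (2 * B / c) ^ 2) * |t - t'| := by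
    intro t ht t' ht'
    have h1 := (F.q_min ht (S t' σ) σ).1
    have h2 := (le_abs_self _).trans (F.g_lip t ht t' ht' (S t' σ))
    have h3 : (S t' σ) ^ 2 ≤ (2 * B / c) ^ 2 := by
      rw [← sq_abs]; have := F.S_bdd ht' hσ; gcongr
    have hB := F.B_pos
    have h4 : B * (1 + S t' σ ^ 2) * |t - t'| ≤ B * (1 + (2 * B / c) ^ 2) * |t - t'| := by gcongr
    have h5 : qq g S t' σ = g t' (S t' σ) - σ * S t' σ := rfl
    linarith
  rw [abs_le]
  have h1 := key t ht t' ht'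
  have h2 := key t' ht' t ht
  rw [abs_sub_comm] at h2
  constructor <;> linarith

end Fam

/-- support function of a curve with parameters `P = (y₁, y₂, t)` -/
noncomputable def hh (g S : ℝ → ℝ → ℝ) (P : ℝ × ℝ × ℝ) (σ : ℝ) : ℝ :=
  P.2.1 - σ * P.1 - qq g S P.2.2 σ

/-- Approximate tangency of two curves at direction `σ`. -/
def TangAt (g S : ℝ → ℝ → ℝ) (B δ r : ℝ) (P P' : ℝ × ℝ × ℝ) (σ : ℝ) : Prop :=
  |σ| ≤ B ∧ |hh g S P σ - hh g S P' σ| ≤ δ ∧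
  ∀ x, |x - σ| ≤ 10 * r → (P'.2.2 ≤ P.2.2 → -δ ≤ hh g S P x - hh g S P' x) ∧
    (P.2.2 ≤ P'.2.2 → hh g S P x - hh g S P' x ≤ δ)

namespace Fam

variable {N : ℕ} {c B : ℝ} {g a S : ℝ → ℝ → ℝ}

theorem hh_cont (F : Fam N c B g a S) {P : ℝ × ℝ × ℝ} (hP : P.2.2 ∈ Icc (1 : ℝ) 2) :
    Continuous (hh g S P) := by
  have : Continuous (qq g S P.2.2) :=
    continuous_iff_continuousAt.mpr fun x => (F.q_deriv hP x).continuousAt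
  unfold hh
  fun_prop

theorem mid (F : Fam N c B g a S) {P P' P1 : ℝ × ℝ × ℝ} (hP : P.2.2 ∈ Icc (1 : ℝ) 2)
    (hP' : P'.2.2 ∈ Icc (1 : ℝ) 2) {δ r σ σ' : ℝ} (h : TangAt g S B δ r P P1 σ)
    (h' : TangAt g S B δ r P' P1 σ') (hs : |σ - σ'| ≤ 10 * r)
    (hsg : (P1.2.2 ≤ P.2.2 ∧ P1.2.2 ≤ P'.2.2) ∨ (P.2.2 ≤ P1.2.2 ∧ P'.2.2 ≤ P1.2.2)) :
    ∃ x ∈ uIcc σ σ', |hh g S P x - hh g S P' x| ≤ 2 * δ := by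
  have hδ : 0 ≤ δ := (abs_nonneg _).trans h.2.1
  have a1 := abs_le.mp h.2.1
  have a2 := abs_le.mp h'.2.1
  have a3 := h.2.2 σ' (by rwa [abs_sub_comm])
  have a4 := h'.2.2 σ hs
  have hr : 0 ≤ 10 * r := (abs_nonneg _).trans hs
  have hL : Continuous (fun x => hh g S P x - hh g S P' x) := (F.hh_cont hP).sub (F.hh_cont hP')
  by_cases e1 : |hh g S P σ - hh g S P' σ| ≤ 2 * δ
  · exact ⟨σ, left_mem_uIcc, e1⟩
  by_cases e2 : |hh g S P σ' - hh g S P' σ'| ≤ 2 * δ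
  · exact ⟨σ', right_mem_uIcc, e2⟩
  rw [abs_le, not_and_or, not_le, not_le] at e1 e2
  have : (0 : ℝ) ∈ uIcc (hh g S P σ - hh g S P' σ) (hh g S P σ' - hh g S P' σ') := by
    rw [mem_uIcc]
    rcases hsg with ⟨s1, s2⟩ | ⟨s1, s2⟩
    · have b3 := a3.1 s1
      have b4 := a4.1 s2
      left
      constructor
      · rcases e1 with e1 | e1 <;> linarith
      · rcases e2 with e2 | e2 <;> linarith
    · have b3 := a3.2 s1
      have b4 := a4.2 s2
      right
      constructor
      · rcases e2 with e2 | e2 <;> linarith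
      · rcases e1 with e1 | e1 <;> linarith
  obtain ⟨x, hx, hx0⟩ := intermediate_value_uIcc (f := fun x => hh g S P x - hh g S P' x) hL.continuousOn this
  exact ⟨x, hx, by simp only at hx0; rw [hx0]; simpa using hδ⟩

theorem two_pt (F : Fam N c B g a S) {P P' : ℝ × ℝ × ℝ} (hP : P.2.2 ∈ Icc (1 : ℝ) 2)
    (hP' : P'.2.2 ∈ Icc (1 : ℝ) 2) {δ r e x1 x2 : ℝ} (hx : 10 * r ≤ |x1 - x2|)
    (h1 : |hh g S P x1 - hh g S P' x1| ≤ 2 * δ) (h2 : |hh g S P x2 - hh g S P' x2| ≤ 2 * δ)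
    (b1 : |x1| ≤ B) (b2 : |x2| ≤ B) (ht : |P.2.2 - P'.2.2| ≤ e) :
    10 * r * |P.1 - P'.1| ≤ 2 * (2 * δ + B * (1 + (2 * B / c) ^ 2) * e) ∧
    |(P.2.1 - P'.2.1) - x1 * (P.1 - P'.1)| ≤ 2 * δ + B * (1 + (2 * B / c) ^ 2) * e := by
  have hB := F.B_pos
  have q1 := (F.q_lip hP hP' b1).trans (mul_le_mul_of_nonneg_left ht (by positivity))
  have q2 := (F.q_lip hP hP' b2).trans (mul_le_mul_of_nonneg_left ht (by positivity))
  set E := B * (1 + (2 * B / c) ^ 2) * e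
  unfold hh at h1 h2
  rw [abs_le] at h1 h2 q1 q2
  have k1 : |(P.2.1 - P'.2.1) - x1 * (P.1 - P'.1)| ≤ 2 * δ + E := by
    rw [abs_le]; constructor <;> linarith
  have k2 : |(P.2.1 - P'.2.1) - x2 * (P.1 - P'.1)| ≤ 2 * δ + E := by
    rw [abs_le]; constructor <;> linarith
  refine ⟨?_, k1⟩
  calc 10 * r * |P.1 - P'.1| ≤ |x1 - x2| * |P.1 - P'.1| := by gcongr
    _ = |((P.2.1 - P'.2.1) - x2 * (P.1 - P'.1)) - ((P.2.1 - P'.2.1) - x1 * (P.1 - P'.1))| := by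
        rw [← abs_mul]; congr 1; ring
    _ ≤ _ := abs_sub _ _
    _ ≤ _ := by linarith

theorem three_pt (F : Fam N c B g a S) {P P' : ℝ × ℝ × ℝ} (hP : P.2.2 ∈ Icc (1 : ℝ) 2)
    (hP' : P'.2.2 ∈ Icc (1 : ℝ) 2) {δ r x1 x2 x3 : ℝ} (hr : 0 < r) (hx : x1 + 10 * r ≤ x2)
    (hx' : x2 + 10 * r ≤ x3)
    (h1 : |hh g S P x1 - hh g S P' x1| ≤ 2 * δ) (h2 : |hh g S P x2 - hh g S P' x2| ≤ 2 * δ)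
    (h3 : |hh g S P x3 - hh g S P' x3| ≤ 2 * δ) :
    10 * c * r ^ 2 * |P.2.2 - P'.2.2| ≤ δ := by
  have hc := F.c_pos
  wlog h : P'.2.2 ≤ P.2.2 generalizing P P'
  · rw [abs_sub_comm]
    rw [abs_sub_comm] at h1 h2 h3
    exact this hP' hP h1 h2 h3 (le_of_lt (not_le.mp h))
  rw [abs_of_nonneg (sub_nonneg.mpr h)]
  have k1 := F.Q_conv hP hP' h x1 x2
  have k3 := F.Q_conv hP hP' h x3 x2
  set τ := P.2.2 - P'.2.2
  have hτ : 0 ≤ τ := sub_nonneg.mpr h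
  have e1 : (10 * r) ^ 2 ≤ (x1 - x2) ^ 2 := by rw [← neg_sq (x1 - x2)]; gcongr; linarith
  have e3 : (10 * r) ^ 2 ≤ (x3 - x2) ^ 2 := by gcongr; linarith
  have f1 : c / 2 * τ * (10 * r) ^ 2 ≤ c / 2 * τ * (x1 - x2) ^ 2 := by gcongr
  have f3 : c / 2 * τ * (10 * r) ^ 2 ≤ c / 2 * τ * (x3 - x2) ^ 2 := by gcongr
  unfold hh at h1 h2 h3
  rw [abs_le] at h1 h2 h3
  set d := S P.2.2 x2 - S P'.2.2 x2 - (P.1 - P'.1) with hd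
  have g1 : (S P.2.2 x2 - S P'.2.2 x2) * (x1 - x2) = d * (x1 - x2) + (P.1 - P'.1) * (x1 - x2) := by
    rw [hd]; ring
  have g3 : (S P.2.2 x2 - S P'.2.2 x2) * (x3 - x2) = d * (x3 - x2) + (P.1 - P'.1) * (x3 - x2) := by
    rw [hd]; ring
  rcases le_total 0 d with hd0 | hd0
  · have : 0 ≤ d * (x3 - x2) := mul_nonneg hd0 (by linarith)
    nlinarith
  · have : 0 ≤ d * (x1 - x2) := mul_nonneg_of_nonpos_of_nonpos hd0 (by linarith)
    nlinarith

end Fam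

/-- A direction cut-off with centre `ctr`. -/
structure Cut (N : ℕ) (A ctr : ℝ) (X : ℝ → ℝ) : Prop where
  sm : Smooth X
  supp : ∀ x, X x ≠ 0 → |x - ctr| ≤ 1
  jet : ∀ i ≤ N, ∀ x, |iteratedDeriv i X x| ≤ A

/-- The amplitude. -/
noncomputable def amp (g a : ℝ → ℝ → ℝ) (X : ℝ → ℝ) (r t s : ℝ) : ℝ :=
  a t s * X (deriv (g t) s / r)

/-- a fixed cut-off -/
noncomputable def om : ℝ → ℝ := Classical.choose exists_cut

theorem om_sm : Smooth om := (Classical.choose_spec exists_cut).1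
theorem om_supp : ∀ x, om x ≠ 0 → |x| ≤ 2 := (Classical.choose_spec exists_cut).2.1
theorem om_one : ∀ x, |x| ≤ 1 → om x = 1 := (Classical.choose_spec exists_cut).2.2.1
theorem om_bd : ∀ x, 0 ≤ om x ∧ om x ≤ 1 := (Classical.choose_spec exists_cut).2.2.2

theorem Jet.shift {N : ℕ} {A D z : ℝ} {f : ℝ → ℝ} {x : ℝ} (h : Jet N A D f (x - z)) :
    Jet N A D (fun y => f (y - z)) x := by
  intro i hi
  rw [iteratedDeriv_comp_sub_const]
  exact h i hi

/-- phase function -/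
noncomputable def GG (g : ℝ → ℝ → ℝ) (t t' z1 z2 s : ℝ) : ℝ := z2 - g t s + g t' (s - z1)

namespace Fam

variable {N : ℕ} {c B : ℝ} {g a S : ℝ → ℝ → ℝ}

theorem GG_sm (F : Fam N c B g a S) {t t' : ℝ} (ht : t ∈ Icc (1 : ℝ) 2) (ht' : t' ∈ Icc (1 : ℝ) 2)
    (z1 z2 : ℝ) : Smooth (GG g t t' z1 z2) :=
  (contDiff_const.sub (F.g_sm t ht)).add ((F.g_sm t' ht').comp (contDiff_id.sub contDiff_const))

theorem GG_deriv (F : Fam N c B g a S) {t t' : ℝ} (ht : t ∈ Icc (1 : ℝ) 2)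
    (ht' : t' ∈ Icc (1 : ℝ) 2) (z1 z2 : ℝ) :
    deriv (GG g t t' z1 z2) = fun s => deriv (g t') (s - z1) - deriv (g t) s := by
  funext s
  have h1 := (F.hasDeriv ht s).const_sub z2
  have h2 := (F.hasDeriv ht' (s - z1)).comp_sub_const s z1
  rw [(show HasDerivAt (GG g t t' z1 z2) _ s from h1.add h2).deriv]
  ring

theorem GG_jet (F : Fam N c B g a S) {t t' : ℝ} (ht : t ∈ Icc (1 : ℝ) 2)
    (ht' : t' ∈ Icc (1 : ℝ) 2) (z1 z2 : ℝ) {s : ℝ} (hs : |s| ≤ 1) (j : ℕ) (hj : j ≤ N) :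
    |iteratedDeriv j (deriv (GG g t t' z1 z2)) s| ≤
      (B + B * (1 + B) / c) * (|t - t'| + |deriv (GG g t t' z1 z2) s|) := by
  have hc := F.c_pos
  have hB := F.B_pos
  rw [F.GG_deriv ht ht']
  have sm := smooth_deriv (F.g_sm t ht)
  have sm' := smooth_deriv (F.g_sm t' ht')
  have sm2 : Smooth (fun s => deriv (g t') (s - z1)) := sm'.comp (contDiff_id.sub contDiff_const)
  have e := iteratedDeriv_sub (n := j) (x := s) (f := fun s => deriv (g t') (s - z1)) (g := deriv (g t))
      (sm2.contDiffAt.of_le (by exact_mod_cast le_top)) (sm.contDiffAt.of_le (by exact_mod_cast le_top))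
  change iteratedDeriv j (fun s => deriv (g t') (s - z1) - deriv (g t) s) s = _ at e
  rw [e, iteratedDeriv_comp_sub_const]
  have h1 := F.g_lip1 t ht t' ht' j hj s hs
  have h2 : |iteratedDeriv j (deriv (g t')) (s - z1) - iteratedDeriv j (deriv (g t')) s| ≤ B * |z1| := by
    have := Convex.norm_image_sub_le_of_norm_deriv_le (f := iteratedDeriv j (deriv (g t')))
      (C := B) (s := univ) (x := s) (y := s - z1)
      (fun x _ => (sm'.iteratedDeriv j).differentiable (by simp) x)
      (fun x _ => by
        rw [← iteratedDeriv_succ]; exact F.g_jet t' ht' j hj x)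
      convex_univ (mem_univ _) (mem_univ _)
    simpa using this
  have h3 := (F.abs1 ht' (s - z1) s).1
  have h4 : |deriv (g t') (s - z1) - deriv (g t') s| ≤
      |deriv (g t') (s - z1) - deriv (g t) s| + B * |t - t'| := by
    have h5 := F.g_lip1 t ht t' ht' 0 (Nat.zero_le _) s hs
    simp only [iteratedDeriv_zero] at h5
    have : deriv (g t') (s - z1) - deriv (g t') s =
      (deriv (g t') (s - z1) - deriv (g t) s) + (deriv (g t) s - deriv (g t') s) := by ring
    rw [this]
    exact (abs_add_le _ _).trans (by linarith)
  have h5 : |s - z1 - s| = |z1| := by rw [sub_right_comm, sub_self, zero_sub, abs_neg]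
  rw [h5] at h3
  have h6 : |z1| ≤ (|deriv (g t') (s - z1) - deriv (g t) s| + B * |t - t'|) / c := by
    rw [le_div_iff₀ hc]; linarith
  set d := |deriv (g t') (s - z1) - deriv (g t) s|
  have hd : 0 ≤ d := abs_nonneg _
  have h7 : iteratedDeriv j (deriv (g t')) (s - z1) - iteratedDeriv j (deriv (g t)) s =
    (iteratedDeriv j (deriv (g t')) (s - z1) - iteratedDeriv j (deriv (g t')) s) -
    (iteratedDeriv j (deriv (g t)) s - iteratedDeriv j (deriv (g t')) s) := by ring
  rw [h7]
  refine (abs_sub _ _).trans ((add_le_add h2 h1).trans ?_)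
  have hτ := abs_nonneg (t - t')
  calc B * |z1| + B * |t - t'| ≤ B * ((d + B * |t - t'|) / c) + B * |t - t'| := by gcongr
    _ = (B + B * B / c) * |t - t'| + B / c * d := by ring
    _ ≤ (B + B * (1 + B) / c) * |t - t'| + (B + B * (1 + B) / c) * d := by
        gcongr
        · linarith
        · have : B / c ≤ B * (1 + B) / c := by gcongr; nlinarith
          linarith
    _ = _ := by ring

theorem amp_sm (F : Fam N c B g a S) {t : ℝ} (ht : t ∈ Icc (1 : ℝ) 2) {A ctr : ℝ} {X : ℝ → ℝ}
    (hX : Cut N A ctr X) (r : ℝ) : Smooth (amp g a X r t) :=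
  (F.a_sm t ht).mul (hX.sm.comp ((smooth_deriv (F.g_sm t ht)).div_const r))

theorem amp_jet (F : Fam N c B g a S) {t : ℝ} (ht : t ∈ Icc (1 : ℝ) 2) {A ctr : ℝ} {X : ℝ → ℝ}
    (hX : Cut N A ctr X) {r : ℝ} (hr : 0 < r) (hr1 : r ≤ 1) (s : ℝ) :
    Jet N (B * (N.factorial * A)) (2 * B / r) (amp g a X r t) s := by
  have hB := F.B_pos
  have hB1 := F.B_one
  have hA : 0 ≤ A := (abs_nonneg _).trans (hX.jet 0 (Nat.zero_le _) 0)
  have h1 : 1 ≤ B / r := by rw [le_div_iff₀ hr]; linarith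
  have j1 : Jet N B 1 (a t) s := fun i hi => by simpa using F.a_jet t ht i hi s
  have sm := smooth_deriv (F.g_sm t ht)
  have j2 : Jet N (N.factorial * A) (B / r) (fun s => X (deriv (g t) s / r)) s := by
    refine Jet.comp hX.sm (sm.div_const r) (fun i hi => hX.jet i hi _) (by positivity) ?_
    intro i hi1 hi
    rw [iteratedDeriv_div_const, abs_div, abs_of_pos hr]
    obtain ⟨k, rfl⟩ : ∃ k, i = k + 1 := ⟨i - 1, by omega⟩
    have := F.g_jet t ht k (by omega) s
    calc _ ≤ B / r := by gcongr
      _ ≤ (B / r) ^ (k + 1) := le_self_pow₀ h1 (by omega)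
  refine (Jet.mul (F.a_sm t ht) (hX.sm.comp (sm.div_const r)) j1 j2 zero_le_one).mono le_rfl
    (by positivity) (by positivity) ?_
  have : 2 * B / r = B / r + B / r := by ring
  rw [this]; linarith

theorem amp_supp (F : Fam N c B g a S) {t : ℝ} (ht : t ∈ Icc (1 : ℝ) 2) {X : ℝ → ℝ}
    {r s : ℝ} (h : amp g a X r t s ≠ 0) : |s| ≤ 1 :=
  F.a_supp t ht s (left_ne_zero_of_mul h)

end Fam

theorem om_jet (N : ℕ) : ∃ A : ℝ, 1 ≤ A ∧ ∀ i ≤ N, ∀ x, |iteratedDeriv i (fun x => 1 - om x) x| ≤ A := by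
  obtain ⟨A, hA, h⟩ := bdd_jet om_sm (hcs_of fun x hx => abs_le.mp (om_supp x hx)) N
  refine ⟨A + 1, by linarith, fun i hi x => ?_⟩
  rcases Nat.eq_zero_or_pos i with rfl | hp
  · have := om_bd x
    rw [iteratedDeriv_zero, abs_le]
    constructor <;> linarith
  · rw [iteratedDeriv_const_sub hp, iteratedDeriv_neg, abs_neg]
    exact (h i hi x).trans (by linarith)

theorem ns_part (N : ℕ) (c B A : ℝ) : ∃ C : ℝ, 0 ≤ C ∧ ∀ (g a S : ℝ → ℝ → ℝ),
    Fam N c B g a S → ∀ t ∈ Icc (1 : ℝ) 2, ∀ t' ∈ Icc (1 : ℝ) 2, ∀ (X X' : ℝ → ℝ) (ctr ctr' : ℝ),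
    Cut N A ctr X → Cut N A ctr' X' → ∀ (r ρ l z1 z2 w Mx : ℝ) (Θ : ℝ → ℝ), 0 < r → r ≤ 1 → 0 < ρ →
    0 < l → Smooth Θ → (∀ x, |Θ x| ≤ Mx) →
    |∫ s, amp g a X r t s * amp g a X' r t' (s - z1) * (1 - om (deriv (GG g t t' z1 z2) s / ρ)) *
      iteratedDeriv N Θ (w + l * GG g t t' z1 z2 s)| ≤
      C * Mx * ((1 / r + |t - t'| / ρ) / (l * ρ)) ^ N := by
  obtain ⟨C0, hC0, hns⟩ := nonstat N
  obtain ⟨Ao, hAo, hoj⟩ := om_jet N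
  by_cases hpos : 0 < c ∧ 1 ≤ B
  swap
  · exact ⟨0, le_rfl, fun g a S F => absurd ⟨F.c_pos, F.B_one⟩ hpos⟩
  obtain ⟨hc, hB1⟩ := hpos
  have hB : 0 < B := by linarith
  set K0 := B + B * (1 + B) / c with hK0
  have hK1 : 1 ≤ K0 := by
    have : 0 ≤ B * (1 + B) / c := by positivity
    rw [hK0]; linarith
  set K1 := 4 * B + 2 * K0 with hKK
  set AA := (B * (N.factorial * A)) * (B * (N.factorial * A)) * (N.factorial * Ao) with hAA
  have hAA0 : 0 ≤ AA := mul_nonneg (mul_self_nonneg _) (by positivity)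
  refine ⟨C0 * AA * 2 * K1 ^ N, by positivity, ?_⟩
  intro g a S F t ht t' ht' X X' ctr ctr' hX hX' r ρ l z1 z2 w Mx Θ hr hr1 hρ hl hΘ hM
  set G := GG g t t' z1 z2 with hG
  have hGs : Smooth G := F.GG_sm ht ht' z1 z2
  have hG1 : Smooth (deriv G) := smooth_deriv hGs
  set τ := |t - t'| with hτ
  have hτ0 : 0 ≤ τ := abs_nonneg _
  set D := 4 * B / r + 2 * K0 * (τ / ρ + 1) with hD
  have hD0 : 0 ≤ D := by positivity
  set b : ℝ → ℝ := fun s => amp g a X r t s * amp g a X' r t' (s - z1) * (1 - om (deriv G s / ρ)) with hb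
  have s1 := F.amp_sm ht hX r
  have s2 : Smooth (fun s => amp g a X' r t' (s - z1)) :=
    (F.amp_sm ht' hX' r).comp (contDiff_id.sub contDiff_const)
  have s3o : Smooth (fun x => 1 - om x) := contDiff_const.sub om_sm
  have s3 : Smooth (fun s => 1 - om (deriv G s / ρ)) := s3o.comp (hG1.div_const ρ)
  have hbs : Smooth b := (s1.mul s2).mul s3
  have hbsupp : ∀ s, b s ≠ 0 → -1 ≤ s ∧ s ≤ 1 := fun s h =>
    abs_le.mp (F.amp_supp ht (left_ne_zero_of_mul (left_ne_zero_of_mul h)))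
  have hts := tsupport_sub_of hbsupp
  have hts2 : ∀ s ∈ tsupport b, ρ ≤ |deriv G s| := by
    have : tsupport b ⊆ {s | ρ ≤ |deriv G s|} := by
      refine closure_minimal (fun s hs => ?_) (isClosed_le continuous_const hG1.continuous.abs)
      by_contra h
      apply right_ne_zero_of_mul hs
      change ¬ (ρ ≤ _) at h
      rw [om_one, sub_self]
      rw [abs_div, abs_of_pos hρ, div_le_one hρ]
      linarith
    exact fun s hs => this hs
  have jetG : ∀ s, |s| ≤ 1 → ∀ j ≤ N, |iteratedDeriv j (deriv G) s| ≤ K0 * (τ + |deriv G s|) :=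
    fun s hs j hj => F.GG_jet ht ht' z1 z2 hs j hj
  have key := hns b G (fun k x => iteratedDeriv k Θ (w + x)) l ρ D AA Mx (-1) 1 hbs hGs hl hρ hD0
    (by norm_num) hts ?_ ?_ ?_ ?_
  · refine key.trans ?_
    have hM0 : 0 ≤ Mx := (abs_nonneg _).trans (hM 0)
    have : D / (l * ρ) ≤ K1 * ((1 / r + τ / ρ) / (l * ρ)) := by
      rw [← mul_div_assoc]
      gcongr
      have h1 : 1 ≤ 1 / r := by rw [le_div_iff₀ hr]; linarith
      have h2 : 0 ≤ τ / ρ := by positivity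
      rw [hD, hKK]
      have : 4 * B / r = 4 * B * (1 / r) := by ring
      rw [this]
      nlinarith
    calc _ ≤ C0 * AA * Mx * (1 - -1) * (K1 * ((1 / r + τ / ρ) / (l * ρ))) ^ N := by gcongr
      _ = _ := by rw [mul_pow]; ring
  · intro s hs
    refine ⟨hts2 s hs, fun j hj => ?_⟩
    rcases Nat.eq_zero_or_pos j with rfl | hj0
    · simp
    have h1 := jetG s (abs_le.mpr (hts hs)) j hj
    have h2 := hts2 s hs
    calc _ ≤ K0 * (τ + |deriv G s|) := h1
      _ ≤ K0 * (τ / ρ * |deriv G s| + |deriv G s|) := by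
          gcongr
          rw [div_mul_eq_mul_div, le_div_iff₀ hρ]; gcongr
      _ = |deriv G s| * (K0 * (τ / ρ + 1)) := by ring
      _ ≤ |deriv G s| * (K0 * (τ / ρ + 1)) ^ j := by
          gcongr
          refine le_self_pow₀ ?_ (by omega)
          have : 0 ≤ τ / ρ := by positivity
          nlinarith
      _ ≤ _ := by
          gcongr
          have : 0 ≤ τ / ρ := by positivity
          have h3 : 0 ≤ 4 * B / r := by positivity
          nlinarith
  · intro s
    by_cases hs : s ∈ tsupport b
    swap
    · exact Jet.zero_of_notMem hs hAA0 hD0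
    have hs1 : |s| ≤ 1 := abs_le.mpr (hts hs)
    have j1 := F.amp_jet ht hX hr hr1 s
    have j2 := (F.amp_jet ht' hX' hr hr1 (s - z1)).shift
    have j3 : Jet N (N.factorial * Ao) (2 * K0 * (τ / ρ + 1)) (fun s => 1 - om (deriv G s / ρ)) s := by
      by_cases h2 : |deriv G s| ≤ 2 * ρ
      · refine Jet.comp (X := fun x => 1 - om x) (h := fun s => deriv G s / ρ) s3o (hG1.div_const ρ) (fun i hi => hoj i hi _) (by positivity) ?_
        intro i hi1 hi
        rw [iteratedDeriv_div_const, abs_div, abs_of_pos hρ]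
        calc _ ≤ K0 * (τ + 2 * ρ) / ρ := by
              gcongr
              refine (jetG s hs1 i hi).trans ?_
              gcongr
          _ = K0 * (τ / ρ + 2) := by field_simp
          _ ≤ 2 * K0 * (τ / ρ + 1) := by
              have : 0 ≤ τ / ρ := by positivity
              nlinarith
          _ ≤ _ := by
              refine le_self_pow₀ ?_ (by omega)
              have : 0 ≤ τ / ρ := by positivity
              nlinarith
      · have he : (fun s => 1 - om (deriv G s / ρ)) =ᶠ[nhds s] fun _ => 1 := by
          have : ∀ᶠ y in nhds s, 2 * ρ < |deriv G y| :=
            continuousAt_const.eventually_lt hG1.continuous.abs.continuousAt (not_le.mp h2)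
          filter_upwards [this] with y hy
          have : om (deriv G y / ρ) = 0 := by
            by_contra h
            have := om_supp _ h
            rw [abs_div, abs_of_pos hρ, div_le_iff₀ hρ] at this
            linarith
          rw [this, sub_zero]
        intro i _
        rw [he.iteratedDeriv_eq, iteratedDeriv_const]
        have hf : (1 : ℝ) ≤ N.factorial := by exact_mod_cast Nat.factorial_pos N
        split_ifs with h
        · subst h
          simp only [abs_one, pow_zero, mul_one]
          nlinarith
        · simp; positivity
    have jj := (j1.mul s1 s2 j2 (by positivity)).mul (s1.mul s2) s3 j3 (by positivity)
    refine jj.mono le_rfl hAA0 (by positivity) (le_of_eq ?_)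
    rw [hD]; ring
  · intro k x
    have := ((hΘ.iteratedDeriv k).differentiable (by simp) (w + x)).hasDerivAt
    rw [← iteratedDeriv_succ] at this
    have h2 := this.comp_const_add w x
    exact h2
  · intro x; simpa using hM (w + x)

/-- Points of stationary phase. -/
structure GoodPt (g : ℝ → ℝ → ℝ) (r l ρ γ γ' : ℝ) (P P' : ℝ × ℝ × ℝ) (s : ℝ) : Prop where
  h1 : |s| ≤ 1
  h2 : |s - (P.1 - P'.1)| ≤ 1
  h3 : |deriv (g P.2.2) s - γ * r| ≤ r
  h4 : |deriv (g P'.2.2) (s - (P.1 - P'.1)) - γ' * r| ≤ r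
  h5 : |deriv (g P'.2.2) (s - (P.1 - P'.1)) - deriv (g P.2.2) s| ≤ 2 * ρ
  h6 : |GG g P.2.2 P'.2.2 (P.1 - P'.1) (P.2.1 - P'.2.1) s| ≤ 2 / l

namespace Fam

variable {N : ℕ} {c B : ℝ} {g a S : ℝ → ℝ → ℝ}

theorem good_diam (F : Fam N c B g a S) {P P' : ℝ × ℝ × ℝ} (hP : P.2.2 ∈ Icc (1 : ℝ) 2)
    (hP' : P'.2.2 ∈ Icc (1 : ℝ) 2) {r l ρ γ γ' s s' : ℝ}
    (h : GoodPt g r l ρ γ γ' P P' s) (h' : GoodPt g r l ρ γ γ' P P' s') :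
    c * |s - s'| ≤ 2 * r ∧ c ^ 3 * |P.2.2 - P'.2.2| * |s - s'| ≤ 4 * ρ := by
  have hc := F.c_pos
  set z := P.1 - P'.1
  set σ1 := deriv (g P.2.2) s with e1
  set σ2 := deriv (g P.2.2) s' with e2
  have d1 := (F.abs1 hP s s').1
  rw [← e1, ← e2] at d1
  have hs : c * |s - s'| ≤ 2 * r := by
    refine d1.trans ?_
    have : σ1 - σ2 = (σ1 - γ * r) - (σ2 - γ * r) := by ring
    rw [this]
    exact (abs_sub _ _).trans (by linarith [h.h3, h'.h3])
  refine ⟨hs, ?_⟩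
  have a1 : c * |S P'.2.2 σ1 - (s - z)| ≤ 2 * ρ := by
    have := F.S_lip hP' σ1 (deriv (g P'.2.2) (s - z))
    rw [F.S_left hP'] at this
    rw [abs_sub_comm σ1] at this
    exact this.trans h.h5
  have a2 : c * |S P'.2.2 σ2 - (s' - z)| ≤ 2 * ρ := by
    have := F.S_lip hP' σ2 (deriv (g P'.2.2) (s' - z))
    rw [F.S_left hP'] at this
    rw [abs_sub_comm σ2] at this
    exact this.trans h'.h5
  have b1 : S P.2.2 σ1 = s := F.S_left hP s
  have b2 : S P.2.2 σ2 = s' := F.S_left hP s'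
  -- difference of S
  set d := (S P.2.2 σ1 - S P'.2.2 σ1) - (S P.2.2 σ2 - S P'.2.2 σ2) with hd
  have hdb : c * |d| ≤ 4 * ρ := by
    have : d = (S P'.2.2 σ2 - (s' - z)) - (S P'.2.2 σ1 - (s - z)) := by rw [hd, b1, b2]; ring
    rw [this]
    have := abs_sub (S P'.2.2 σ2 - (s' - z)) (S P'.2.2 σ1 - (s - z))
    nlinarith
  have cin' : c * |P.2.2 - P'.2.2| * |σ1 - σ2| ≤ |d| := by
    rcases le_total P'.2.2 P.2.2 with ht | ht <;> rcases le_total σ2 σ1 with hσ | hσ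
    · rw [abs_of_nonneg (sub_nonneg.mpr ht), abs_of_nonneg (sub_nonneg.mpr hσ)]
      have := F.cin _ hP _ hP' ht _ _ hσ
      exact (this.trans (le_of_eq hd.symm)).trans (le_abs_self d)
    · rw [abs_of_nonneg (sub_nonneg.mpr ht), abs_sub_comm, abs_of_nonneg (sub_nonneg.mpr hσ)]
      have := F.cin _ hP _ hP' ht _ _ hσ
      refine le_trans (this.trans (le_of_eq ?_)) (neg_le_abs d)
      rw [hd]; ring
    · rw [abs_sub_comm, abs_of_nonneg (sub_nonneg.mpr ht), abs_of_nonneg (sub_nonneg.mpr hσ)]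
      have := F.cin _ hP' _ hP ht _ _ hσ
      refine le_trans (this.trans (le_of_eq ?_)) (neg_le_abs d)
      rw [hd]; ring
    · rw [abs_sub_comm, abs_of_nonneg (sub_nonneg.mpr ht), abs_sub_comm, abs_of_nonneg (sub_nonneg.mpr hσ)]
      have := F.cin _ hP' _ hP ht _ _ hσ
      refine le_trans (this.trans (le_of_eq ?_)) (le_abs_self d)
      rw [hd]; ring
  set τ := |P.2.2 - P'.2.2|
  have hτ : 0 ≤ τ := abs_nonneg _
  calc c ^ 3 * τ * |s - s'| = c ^ 2 * τ * (c * |s - s'|) := by ring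
    _ ≤ c ^ 2 * τ * |σ1 - σ2| := by gcongr
    _ = c * (c * τ * |σ1 - σ2|) := by ring
    _ ≤ c * |d| := by gcongr
    _ ≤ _ := hdb

set_option maxHeartbeats 1000000 in
theorem good_tang (F : Fam N c B g a S) {P P' : ℝ × ℝ × ℝ} (hP : P.2.2 ∈ Icc (1 : ℝ) 2)
    (hP' : P'.2.2 ∈ Icc (1 : ℝ) 2) {r l ρ γ γ' s κ : ℝ} (hr : 0 < r) (hρ : 0 < ρ) (hκ : 0 ≤ κ)
    (h : GoodPt g r l ρ γ γ' P P' s) (k1 : 1 / l ≤ κ) (k2 : ρ ^ 2 ≤ κ)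
    (k3 : ρ ^ 2 ≤ κ * |P.2.2 - P'.2.2| ∨ ρ * r ≤ κ) (k4 : ρ ≤ r) :
    TangAt g S B ((2 + 4 * B / c ^ 2 + 2 / c ^ 3 + 20 / c) * κ) r P P' (deriv (g P.2.2) s) ∧
    |γ - γ'| ≤ 4 ∧ c * |P.1 - P'.1| ≤ 2 * ρ + B * |P.2.2 - P'.2.2| ∧
    |P.2.1 - P'.2.1| ≤ 2 / l + 2 * B * |P.2.2 - P'.2.2| + B * |P.1 - P'.1| := by
  have hc := F.c_pos
  have hB := F.B_pos
  have h1 := h.h1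
  have h2 := h.h2
  have h3 := h.h3
  have h4 := h.h4
  have h5 := h.h5
  have h6 := h.h6
  have hb := F.g_one _ hP s h1
  set z := P.1 - P'.1 with hz
  set σ := deriv (g P.2.2) s with e1
  set σ' := deriv (g P'.2.2) (s - z) with e2
  set τ := |P.2.2 - P'.2.2| with hτd
  have hτ : 0 ≤ τ := abs_nonneg _
  have a1 : c * |(s - z) - S P'.2.2 σ| ≤ 2 * ρ := by
    have := F.S_lip hP' σ' σ
    rw [e2, F.S_left hP'] at this
    exact this.trans h.h5
  have a1' : |(s - z) - S P'.2.2 σ| ≤ 2 * ρ / c := by rw [le_div_iff₀ hc]; linarith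
  have b1 : S P.2.2 σ = s := F.S_left hP s
  have hD : |hh g S P σ - hh g S P' σ| ≤ (2 + 4 * B / c ^ 2) * κ := by
    have q1 := F.q_min hP' (s - z) σ
    have q2 : qq g S P.2.2 σ = g P.2.2 s - σ * s := by unfold qq; rw [b1]
    have q3 : B * ((s - z) - S P'.2.2 σ) ^ 2 ≤ 4 * B / c ^ 2 * κ := by
      rw [← sq_abs]
      calc _ ≤ B * (2 * ρ / c) ^ 2 := by gcongr
        _ = 4 * B / c ^ 2 * ρ ^ 2 := by ring
        _ ≤ _ := by gcongr
    have q4 : |GG g P.2.2 P'.2.2 z (P.2.1 - P'.2.1) s| ≤ 2 * κ := by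
      refine h6.trans ?_
      have : 2 / l = 2 * (1 / l) := by ring
      rw [this]; linarith
    have q5 : GG g P.2.2 P'.2.2 z (P.2.1 - P'.2.1) s =
      P.2.1 - P'.2.1 - g P.2.2 s + g P'.2.2 (s - z) := rfl
    rw [q5] at q4
    have q6 : hh g S P σ - hh g S P' σ = P.2.1 - P'.2.1 - σ * z - qq g S P.2.2 σ + qq g S P'.2.2 σ := by
      unfold hh; rw [hz]; ring
    rw [q6, q2]
    have q7 : (2 + 4 * B / c ^ 2) * κ = 2 * κ + 4 * B / c ^ 2 * κ := by ring
    have q8 : 0 ≤ 4 * B / c ^ 2 * κ := by positivity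
    rw [q7]
    rw [abs_le] at q4 ⊢
    constructor <;> linarith [q4.1, q4.2, q1.1, q1.2]
  have hq3 : 0 ≤ 2 / c ^ 3 * κ := by positivity
  have hq4 : 0 ≤ 20 / c * κ := by positivity
  -- the quadratic estimate
  have quad : ∀ x, |x - σ| ≤ 10 * r →
      2 * ρ / c * |x - σ| - c / 2 * τ * (x - σ) ^ 2 ≤ 2 / c ^ 3 * κ + 20 / c * κ := by
    intro x hx
    rcases k3 with k3 | k3
    · rcases hτ.eq_or_lt with h0 | h0
      · rw [← h0, mul_zero] at k3
        exact absurd k3 (not_le.mpr (by positivity))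
      have : 2 * ρ / c * |x - σ| - c / 2 * τ * (x - σ) ^ 2 ≤ 2 * ρ ^ 2 / (c ^ 3 * τ) := by
        rw [le_div_iff₀ (by positivity), ← sq_abs (x - σ)]
        have e : (2 * ρ / c * |x - σ| - c / 2 * τ * |x - σ| ^ 2) * (c ^ 3 * τ) =
          2 * ρ * (c ^ 2 * τ * |x - σ|) - (c ^ 2 * τ * |x - σ|) ^ 2 / 2 := by field_simp
        rw [e]
        nlinarith [sq_nonneg (2 * ρ - c ^ 2 * τ * |x - σ|)]
      have e2 : 2 * ρ ^ 2 / (c ^ 3 * τ) ≤ 2 / c ^ 3 * κ := by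
        rw [div_le_iff₀ (by positivity)]
        have : 2 / c ^ 3 * κ * (c ^ 3 * τ) = 2 * (κ * τ) := by field_simp
        rw [this]; linarith
      linarith
    · have e : 2 * ρ / c * |x - σ| ≤ 20 / c * κ := by
        calc _ ≤ 2 * ρ / c * (10 * r) := by gcongr
          _ = 20 / c * (ρ * r) := by ring
          _ ≤ _ := by gcongr
      have : 0 ≤ c / 2 * τ * (x - σ) ^ 2 := by positivity
      linarith
  have lin : ∀ x, |((s - z) - S P'.2.2 σ) * (x - σ)| ≤ 2 * ρ / c * |x - σ| := by
    intro x; rw [abs_mul]; gcongr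
  refine ⟨⟨hb, hD.trans ?_, fun x hx => ⟨fun ht => ?_, fun ht => ?_⟩⟩, ?_, ?_, ?_⟩
  · have e : (2 + 4 * B / c ^ 2 + 2 / c ^ 3 + 20 / c) * κ =
      (2 + 4 * B / c ^ 2) * κ + 2 / c ^ 3 * κ + 20 / c * κ := by ring
    rw [e]; linarith
  · have Q := F.Q_conv hP hP' ht x σ
    rw [b1] at Q
    rw [show τ = P.2.2 - P'.2.2 from abs_of_nonneg (sub_nonneg.mpr ht)] at quad
    have q := quad x hx
    have L := abs_le.mp (lin x)
    have D := abs_le.mp hD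
    have : hh g S P x - hh g S P' x = (hh g S P σ - hh g S P' σ) + ((s - z) - S P'.2.2 σ) * (x - σ)
      - ((qq g S P.2.2 x - qq g S P'.2.2 x) - (qq g S P.2.2 σ - qq g S P'.2.2 σ) +
      (s - S P'.2.2 σ) * (x - σ)) := by unfold hh; rw [hz]; ring
    rw [this]
    have e : (2 + 4 * B / c ^ 2 + 2 / c ^ 3 + 20 / c) * κ =
      (2 + 4 * B / c ^ 2) * κ + 2 / c ^ 3 * κ + 20 / c * κ := by ring
    rw [e]
    linarith [L.1, D.1]
  · have Q := F.Q_conv hP' hP ht x σ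
    rw [b1] at Q
    rw [show τ = P'.2.2 - P.2.2 by rw [hτd, abs_sub_comm]; exact abs_of_nonneg (sub_nonneg.mpr ht)] at quad
    have q := quad x hx
    have L := abs_le.mp (lin x)
    have D := abs_le.mp hD
    have : hh g S P x - hh g S P' x = (hh g S P σ - hh g S P' σ) + ((s - z) - S P'.2.2 σ) * (x - σ)
      + ((qq g S P'.2.2 x - qq g S P.2.2 x) - (qq g S P'.2.2 σ - qq g S P.2.2 σ) +
      (S P'.2.2 σ - s) * (x - σ)) := by unfold hh; rw [hz]; ring
    rw [this]
    have e : (2 + 4 * B / c ^ 2 + 2 / c ^ 3 + 20 / c) * κ =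
      (2 + 4 * B / c ^ 2) * κ + 2 / c ^ 3 * κ + 20 / c * κ := by ring
    rw [e]
    linarith [L.2, D.2]
  · have : (γ - γ') * r = (σ' - γ' * r) - (σ - γ * r) - (σ' - σ) := by ring
    have h7 : |(γ - γ') * r| ≤ 4 * r := by
      rw [this]
      refine (abs_sub _ _).trans ?_
      have := abs_sub (σ' - γ' * r) (σ - γ * r)
      linarith
    rw [abs_mul, abs_of_pos hr] at h7
    exact le_of_mul_le_mul_right h7 hr
  · have k := (F.abs1 hP' (s - z) s).1
    have h7 : |s - z - s| = |z| := by rw [sub_right_comm, sub_self, zero_sub, abs_neg]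
    rw [h7] at k
    refine k.trans ?_
    have h8 := F.g_lip1 _ hP _ hP' 0 (Nat.zero_le _) s h1
    simp only [iteratedDeriv_zero] at h8
    have : deriv (g P'.2.2) (s - z) - deriv (g P'.2.2) s = (σ' - σ) + (σ - deriv (g P'.2.2) s) := by
      rw [e2]; ring
    rw [this]
    exact (abs_add_le _ _).trans (by linarith)
  · have h7 := F.g_lip _ hP _ hP' s
    have h8 : |g P'.2.2 (s - z) - g P'.2.2 s| ≤ B * |z| := by
      have := Convex.norm_image_sub_le_of_norm_deriv_le (f := g P'.2.2)
        (C := B) (s := Icc (-1) 1) (x := s) (y := s - z)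
        (fun x _ => (F.g_sm _ hP').differentiable (by simp) x)
        (fun x hx => F.g_one _ hP' x (abs_le.mpr hx))
        (convex_Icc _ _) (abs_le.mp h1) (abs_le.mp h2)
      simpa using this
    have h9 : B * (1 + s ^ 2) * τ ≤ 2 * B * τ := by
      have : s ^ 2 ≤ 1 := by rw [sq_le_one_iff_abs_le_one]; exact h1
      nlinarith [mul_nonneg hB.le hτ]
    have q5 : GG g P.2.2 P'.2.2 z (P.2.1 - P'.2.1) s =
      P.2.1 - P'.2.1 - g P.2.2 s + g P'.2.2 (s - z) := rfl
    rw [q5] at h6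
    rw [abs_le] at h6 h7 h8 ⊢
    constructor <;> linarith [h6.1, h6.2, h7.1, h7.2, h8.1, h8.2]

end Fam

theorem abs_int_le {f : ℝ → ℝ} {s0 d M : ℝ} (hd : 0 ≤ d) (h : ∀ s, f s ≠ 0 → |s - s0| ≤ d)
    (hM : ∀ s, |f s| ≤ M) : |∫ s, f s| ≤ 2 * d * M := by
  have e : ∫ s, f s = ∫ s in Icc (s0 - d) (s0 + d), f s := by
    rw [setIntegral_eq_integral_of_forall_compl_eq_zero]
    intro s hs
    by_contra h0
    have := abs_le.mp (h s h0)
    exact hs ⟨by linarith, by linarith⟩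
  rw [e]
  have := norm_setIntegral_le_of_norm_le_const (μ := volume) (f := f) (s := Icc (s0 - d) (s0 + d)) (C := M)
    (by simp) (fun x _ => hM x)
  rw [Real.norm_eq_abs] at this
  refine this.trans (le_of_eq ?_)
  rw [Real.volume_real_Icc_of_le (by linarith)]
  ring

/-- Quantitative tangency relation. -/
def Tg (g S : ℝ → ℝ → ℝ) (B K l Λ r : ℝ) (P : ℝ × ℝ × ℝ) (γ : ℝ) (P' : ℝ × ℝ × ℝ) (γ' : ℝ) : Prop :=
  (∃ σ, TangAt g S B (K * (Λ ^ 2 / l)) r P P' σ ∧ |σ - γ * r| ≤ r) ∧ |γ - γ'| ≤ 4 ∧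
  |P.1 - P'.1| ≤ K * (Λ * (|P.2.2 - P'.2.2| + 1 / (l * r))) ∧
  |P.2.1 - P'.2.1| ≤ K * (Λ * (|P.2.2 - P'.2.2| + 1 / (l * r)))

/-- decay weight -/
noncomputable def ww (l : ℝ) (P P' : ℝ × ℝ × ℝ) : ℝ := 1 / Real.sqrt (max (l * |P.2.2 - P'.2.2|) 1)

theorem ww_nonneg (l : ℝ) (P P' : ℝ × ℝ × ℝ) : 0 ≤ ww l P P' := by unfold ww; positivity

theorem TangAt.mono {g S : ℝ → ℝ → ℝ} {B δ δ' r σ : ℝ} {P P' : ℝ × ℝ × ℝ} (h : TangAt g S B δ r P P' σ)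
    (hd : δ ≤ δ') : TangAt g S B δ' r P P' σ :=
  ⟨h.1, h.2.1.trans hd, fun x hx => ⟨fun ht => by linarith [(h.2.2 x hx).1 ht],
    fun ht => by linarith [(h.2.2 x hx).2 ht]⟩⟩

set_option maxHeartbeats 1000000 in
theorem I_bound (N : ℕ) (c B A : ℝ) : ∃ K : ℝ, 1 ≤ K ∧ ∀ (g a S : ℝ → ℝ → ℝ),
    Fam N c B g a S → ∀ P P' : ℝ × ℝ × ℝ, P.2.2 ∈ Icc (1 : ℝ) 2 → P'.2.2 ∈ Icc (1 : ℝ) 2 →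
    ∀ (X X' : ℝ → ℝ) (γ γ' : ℝ),
    Cut N A γ X → Cut N A γ' X' → ∀ (r l Λ w Mx : ℝ) (Θ : ℝ → ℝ), 0 < r → r ≤ 1 → 1 ≤ Λ →
    0 < l → Λ ^ 2 ≤ l * r ^ 2 → |w| ≤ 1 →
    Smooth Θ → (∀ x, |Θ x| ≤ Mx) → (∀ x, |iteratedDeriv N Θ x| ≤ Mx) →
    (∀ x, iteratedDeriv N Θ x ≠ 0 → |x| ≤ 1) →
    (¬ Tg g S B K l Λ r P γ P' γ' →
      |∫ s, amp g a X r P.2.2 s * amp g a X' r P'.2.2 (s - (P.1 - P'.1)) *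
      iteratedDeriv N Θ (w + l * GG g P.2.2 P'.2.2 (P.1 - P'.1) (P.2.1 - P'.2.1) s)| ≤
      K * Mx * (1 / Λ) ^ N) ∧
    |∫ s, amp g a X r P.2.2 s * amp g a X' r P'.2.2 (s - (P.1 - P'.1)) *
      iteratedDeriv N Θ (w + l * GG g P.2.2 P'.2.2 (P.1 - P'.1) (P.2.1 - P'.2.1) s)| ≤
      K * Mx * ((1 / Λ) ^ N + Λ * ww l P P') := by
  obtain ⟨C, hC, hns⟩ := ns_part N c B A
  by_cases hpos : 0 < c ∧ 1 ≤ B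
  swap
  · exact ⟨1, le_rfl, fun g a S F => absurd ⟨F.c_pos, F.B_one⟩ hpos⟩
  obtain ⟨hc, hB1⟩ := hpos
  have hB : 0 < B := by linarith
  set K1 := 2 + 4 * B / c ^ 2 + 2 / c ^ 3 + 20 / c with hK1
  set K2 := (4 + B) / c with hK2
  set K3 := 2 + 2 * B + B * K2 with hK3
  set K4 := C * 2 ^ N with hK4
  set K5 := 2 * (2 + 2 / c + 4 / c ^ 3) * ((B * A) ^ 2) with hK5
  have p1 : 0 ≤ K1 := by positivity
  have p2 : 0 ≤ K2 := by positivity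
  have p3 : 0 ≤ K3 := by positivity
  have p4 : 0 ≤ K4 := by positivity
  have p5 : 0 ≤ K5 := by positivity
  set K := 1 + K1 + K2 + K3 + K4 + K5 with hK
  have kk1 : K1 ≤ K := by linarith
  have kk2 : K2 ≤ K := by linarith
  have kk3 : K3 ≤ K := by linarith
  have kk4 : K4 ≤ K := by linarith
  have kk5 : K5 ≤ K := by linarith
  refine ⟨K, by linarith, ?_⟩
  intro g a S F P P' hP hP' X X' γ γ' hX hX' r l Λ w Mx Θ hr hr1 hΛ hl hlr hw hΘ hM hM' hsupp
  have hM0 : 0 ≤ Mx := (abs_nonneg _).trans (hM 0)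
  have hA : 0 ≤ A := (abs_nonneg _).trans (hX.jet 0 (Nat.zero_le _) 0)
  set τ := |P.2.2 - P'.2.2| with hτd
  have hτ : 0 ≤ τ := abs_nonneg _
  have hτ1 : τ ≤ 1 := by rw [hτd, abs_le]; constructor <;> linarith [hP.1, hP.2, hP'.1, hP'.2]
  set ρ := Λ * max (Real.sqrt (τ / l)) (1 / (l * r)) with hρd
  have hΛ0 : 0 < Λ := by linarith
  have hm1 : 1 / (l * r) ≤ max (Real.sqrt (τ / l)) (1 / (l * r)) := le_max_right _ _
  have hm0 : Real.sqrt (τ / l) ≤ max (Real.sqrt (τ / l)) (1 / (l * r)) := le_max_left _ _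
  have hlr0 : 0 < 1 / (l * r) := by positivity
  have hρ : 0 < ρ := mul_pos hΛ0 (lt_of_lt_of_le hlr0 hm1)
  have hρ1 : Λ / (l * r) ≤ ρ := by
    rw [hρd]; calc Λ / (l * r) = Λ * (1 / (l * r)) := by ring
      _ ≤ _ := by gcongr
  have hρ2 : Λ ^ 2 * (τ / l) ≤ ρ ^ 2 := by
    rw [hρd, mul_pow]
    gcongr
    calc τ / l = Real.sqrt (τ / l) ^ 2 := (Real.sq_sqrt (by positivity)).symm
      _ ≤ _ := by gcongr
  have hl1 : 1 ≤ l := by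
    have : r ^ 2 ≤ 1 := pow_le_one₀ hr.le hr1
    nlinarith only [this, hlr, one_le_pow₀ hΛ (n := 2), hl, mul_le_mul_of_nonneg_left this hl.le]
  have hlr2 : 1 ≤ l * r ^ 2 := le_trans (one_le_pow₀ hΛ) hlr
  have cases : (ρ = Λ * Real.sqrt (τ / l) ∧ 1 / (l * r) ≤ Real.sqrt (τ / l)) ∨
      (ρ = Λ / (l * r) ∧ Real.sqrt (τ / l) ≤ 1 / (l * r)) := by
    rcases le_total (Real.sqrt (τ / l)) (1 / (l * r)) with h | h
    · right; rw [hρd, max_eq_right h]; exact ⟨by ring, h⟩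
    · left; rw [hρd, max_eq_left h]; exact ⟨rfl, h⟩
  have hsq : Real.sqrt (τ / l) ^ 2 = τ / l := Real.sq_sqrt (by positivity)
  -- small facts about ρ
  have f1 : ρ ^ 2 ≤ Λ ^ 2 / l := by
    rcases cases with ⟨h, _⟩ | ⟨h, _⟩
    · rw [h, mul_pow, hsq, ← mul_div_assoc]; gcongr; nlinarith only [sq_nonneg Λ, hτ1, hτ]
    · rw [h, div_pow, div_le_div_iff₀ (by positivity) hl]
      have : (l * r) ^ 2 = l * (l * r ^ 2) := by ring
      rw [this]
      have : 0 ≤ Λ ^ 2 := by positivity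
      nlinarith only [mul_nonneg (mul_nonneg this hl.le) (sub_nonneg.mpr hlr2)]
  have f2 : ρ ^ 2 ≤ Λ ^ 2 / l * τ ∨ ρ * r ≤ Λ ^ 2 / l := by
    rcases cases with ⟨h, _⟩ | ⟨h, _⟩
    · left; rw [h, mul_pow, hsq]; exact le_of_eq (by ring)
    · right; rw [h, div_mul_eq_mul_div, div_le_div_iff₀ (by positivity) hl]
      have : Λ ≤ Λ ^ 2 := by nlinarith only [hΛ]
      have h2 : 0 ≤ r * l := by positivity
      nlinarith only [mul_le_mul_of_nonneg_right this h2]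
  have f3 : ρ ≤ r := by
    have : ρ ^ 2 ≤ r ^ 2 := f1.trans (by rw [div_le_iff₀ hl]; linarith)
    exact le_of_sq_le_sq this hr.le
  have f4 : ρ ≤ Λ * (τ + 1 / (l * r)) := by
    rw [hρd]; gcongr
    refine max_le ?_ (by linarith)
    have h1 : 1 / l ≤ 1 / (l * r) := by
      apply one_div_le_one_div_of_le (by positivity); nlinarith only [hl, hr1]
    refine Real.sqrt_le_iff.mpr ⟨by positivity, ?_⟩
    calc τ / l = τ * (1 / l) := by ring
      _ ≤ τ * (1 / (l * r)) := by gcongr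
      _ ≤ _ := by nlinarith only [mul_nonneg hτ hlr0.le, sq_nonneg τ, sq_nonneg (1 / (l * r))]
  -- the two parts
  set z := P.1 - P'.1 with hz
  set G := GG g P.2.2 P'.2.2 z (P.2.1 - P'.2.1) with hG
  set b : ℝ → ℝ := fun s => amp g a X r P.2.2 s * amp g a X' r P'.2.2 (s - z) with hb
  set ψ := iteratedDeriv N Θ with hψ
  have hGs : Smooth G := F.GG_sm hP hP' _ _
  have hG1 : Smooth (deriv G) := smooth_deriv hGs
  have hψs : Smooth ψ := hΘ.iteratedDeriv N
  have s1 := F.amp_sm hP hX r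
  have s2 : Smooth (fun s => amp g a X' r P'.2.2 (s - z)) :=
    (F.amp_sm hP' hX' r).comp (contDiff_id.sub contDiff_const)
  have hbc : Continuous b := s1.continuous.mul s2.continuous
  have hbsupp : ∀ s, b s ≠ 0 → -1 ≤ s ∧ s ≤ 1 := fun s h =>
    abs_le.mp (F.amp_supp hP (left_ne_zero_of_mul h))
  have hbcs := hcs_of hbsupp
  have hψc : Continuous (fun s => ψ (w + l * G s)) :=
    hψs.continuous.comp (continuous_const.add (continuous_const.mul hGs.continuous))
  have hoc : Continuous (fun s => om (deriv G s / ρ)) :=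
    om_sm.continuous.comp (hG1.continuous.div_const ρ)
  have i1 : Integrable (fun s => b s * (1 - om (deriv G s / ρ)) * ψ (w + l * G s)) := by
    refine Continuous.integrable_of_hasCompactSupport (by fun_prop) ?_
    exact (hbcs.mul_right).mul_right
  have i2 : Integrable (fun s => b s * om (deriv G s / ρ) * ψ (w + l * G s)) := by
    refine Continuous.integrable_of_hasCompactSupport (by fun_prop) ?_
    exact (hbcs.mul_right).mul_right
  have hsplit : ∫ s, b s * ψ (w + l * G s) = (∫ s, b s * (1 - om (deriv G s / ρ)) * ψ (w + l * G s)) +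
      ∫ s, b s * om (deriv G s / ρ) * ψ (w + l * G s) := by
    rw [← integral_add i1 i2]; congr 1; funext s; ring
  have hN := hns g a S F _ hP _ hP' X X' γ γ' hX hX' r ρ l z (P.2.1 - P'.2.1) w Mx Θ hr hr1 hρ hl hΘ hM
  change |∫ s, b s * (1 - om (deriv G s / ρ)) * ψ (w + l * G s)| ≤ C * Mx * ((1 / r + τ / ρ) / (l * ρ)) ^ N at hN
  have hE : (1 / r + τ / ρ) / (l * ρ) ≤ 2 / Λ := by
    have e1 : 1 / r / (l * ρ) ≤ 1 / Λ := by
      rw [div_div]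
      apply one_div_le_one_div_of_le hΛ0
      rw [div_le_iff₀ (by positivity)] at hρ1
      linarith
    have e2 : τ / ρ / (l * ρ) ≤ 1 / Λ := by
      rw [div_div, div_le_div_iff₀ (by positivity) hΛ0]
      have : Λ ^ 2 * τ ≤ l * ρ ^ 2 := by
        have := mul_le_mul_of_nonneg_left hρ2 hl.le
        calc Λ ^ 2 * τ = l * (Λ ^ 2 * (τ / l)) := by field_simp
          _ ≤ _ := this
      nlinarith only [this, mul_nonneg (mul_nonneg hτ hΛ0.le) (sub_nonneg.mpr hΛ)]
    calc (1 / r + τ / ρ) / (l * ρ) = 1 / r / (l * ρ) + τ / ρ / (l * ρ) := by ring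
      _ ≤ 1 / Λ + 1 / Λ := by linarith
      _ = _ := by ring
  have hN' : |∫ s, b s * (1 - om (deriv G s / ρ)) * ψ (w + l * G s)| ≤ K * Mx * (1 / Λ) ^ N := by
    refine hN.trans ?_
    calc C * Mx * ((1 / r + τ / ρ) / (l * ρ)) ^ N ≤ C * Mx * (2 / Λ) ^ N := by gcongr
      _ = K4 * Mx * (1 / Λ) ^ N := by
        rw [hK4, show (2 : ℝ) / Λ = 2 * (1 / Λ) by ring, mul_pow]; ring
      _ ≤ _ := by gcongr
  have hgood : ∀ s, b s * om (deriv G s / ρ) * ψ (w + l * G s) ≠ 0 → GoodPt g r l ρ γ γ' P P' s := by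
    intro s hs
    have n1 := left_ne_zero_of_mul (left_ne_zero_of_mul hs)
    have n2 := right_ne_zero_of_mul (left_ne_zero_of_mul hs)
    have n3 := right_ne_zero_of_mul hs
    have n4 := left_ne_zero_of_mul n1
    have n5 := right_ne_zero_of_mul n1
    have m4 := hX.supp _ (right_ne_zero_of_mul n4)
    have m5 := hX'.supp _ (right_ne_zero_of_mul n5)
    have aux : ∀ x γ : ℝ, |x / r - γ| ≤ 1 → |x - γ * r| ≤ r := by
      intro x γ h
      have : x - γ * r = (x / r - γ) * r := by field_simp
      rw [this, abs_mul, abs_of_pos hr]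
      nlinarith only [h, hr]
    refine ⟨F.amp_supp hP n4, F.amp_supp hP' n5, aux _ _ m4, aux _ _ m5, ?_, ?_⟩
    · have := om_supp _ n2
      rw [hG, F.GG_deriv hP hP', abs_div, abs_of_pos hρ, div_le_iff₀ hρ] at this
      exact this
    · have := hsupp _ n3
      have h2 : |l * G s| ≤ 2 := by
        have e : l * G s = (w + l * G s) - w := by ring
        rw [e]; exact (abs_sub _ _).trans (by linarith)
      rw [abs_mul, abs_of_pos hl] at h2
      rw [le_div_iff₀ hl]; linarith
  have hbd : ∀ s, |b s * om (deriv G s / ρ) * ψ (w + l * G s)| ≤ (B * A) ^ 2 * Mx := by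
    intro s
    have ab : ∀ t ∈ Icc (1 : ℝ) 2, ∀ (X : ℝ → ℝ) (γ : ℝ), Cut N A γ X → ∀ s, |amp g a X r t s| ≤ B * A := by
      intro t ht X γ hX s
      unfold amp
      rw [abs_mul]
      have := F.a_jet t ht 0 (Nat.zero_le _) s
      have h2 := hX.jet 0 (Nat.zero_le _) (deriv (g t) s / r)
      rw [iteratedDeriv_zero] at this h2
      gcongr
    have o := om_bd (deriv G s / ρ)
    rw [abs_mul, abs_mul, abs_mul, abs_of_nonneg o.1]
    have q1 := ab _ hP X γ hX s
    have q2 := ab _ hP' X' γ' hX' (s - z)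
    calc _ ≤ (B * A) * (B * A) * 1 * Mx := by
          gcongr
          · exact o.1
          · exact o.2
          · exact hM' _
      _ = _ := by ring
  change (_ → |∫ s, b s * ψ (w + l * G s)| ≤ _) ∧ |∫ s, b s * ψ (w + l * G s)| ≤ _
  rw [hsplit]
  by_cases hex : ∃ s0, GoodPt g r l ρ γ γ' P P' s0
  swap
  · have h0 : ∫ s, b s * om (deriv G s / ρ) * ψ (w + l * G s) = 0 := by
      have : (fun s => b s * om (deriv G s / ρ) * ψ (w + l * G s)) = fun _ => 0 := by
        funext s; by_contra h; exact hex ⟨s, hgood s h⟩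
      rw [this]; simp
    rw [h0, add_zero]
    refine ⟨fun _ => hN', hN'.trans ?_⟩
    have := ww_nonneg l P P'
    gcongr
    exact le_add_of_nonneg_right (mul_nonneg hΛ0.le this)
  obtain ⟨s0, hs0⟩ := hex
  have hT := F.good_tang hP hP' hr hρ (κ := Λ ^ 2 / l) (by positivity) hs0
    (by gcongr; exact one_le_pow₀ hΛ) f1 f2 f3
  obtain ⟨t1, t2, t3, t4⟩ := hT
  set Z := Λ * (τ + 1 / (l * r)) with hZ
  have hZ0 : 0 ≤ Z := by positivity
  have hτZ : τ ≤ Z := by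
    rw [hZ]; nlinarith only [hlr0, mul_nonneg (sub_nonneg.mpr hΛ) (add_nonneg hτ hlr0.le)]
  have hlZ : 1 / l ≤ Z := by
    have h1 : 1 / l ≤ 1 / (l * r) := by
      apply one_div_le_one_div_of_le (by positivity); nlinarith only [hl, hr1]
    rw [hZ]; nlinarith only [h1, hτ, mul_nonneg (sub_nonneg.mpr hΛ) (add_nonneg hτ hlr0.le)]
  have z1b : |z| ≤ K2 * Z := by
    rw [hK2, div_mul_eq_mul_div, le_div_iff₀ hc]
    nlinarith only [t3, f4, hZ0, mul_le_mul_of_nonneg_left hτZ hB.le]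
  have tg : Tg g S B K l Λ r P γ P' γ' := by
    refine ⟨⟨_, t1.mono ?_, hs0.h3⟩, t2, z1b.trans ?_, t4.trans ?_⟩
    · gcongr
    · change _ ≤ K * Z; gcongr
    · change _ ≤ K * Z
      have : 2 / l = 2 * (1 / l) := by ring
      rw [this]
      calc _ ≤ 2 * Z + 2 * B * Z + B * (K2 * Z) := by gcongr
        _ = K3 * Z := by rw [hK3]; ring
        _ ≤ _ := by gcongr
  refine ⟨fun h => absurd tg h, ?_⟩
  have key : |∫ s, b s * om (deriv G s / ρ) * ψ (w + l * G s)| ≤ K5 * Mx * (Λ * ww l P P') := by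
    set W := Real.sqrt (max (l * τ) 1) with hW
    have hW1 : 1 ≤ W := by rw [hW, Real.one_le_sqrt]; exact le_max_right _ _
    have hww : Λ * ww l P P' = Λ / W := by unfold ww; rw [← hτd, ← hW]; ring
    have hd : ∀ s, b s * om (deriv G s / ρ) * ψ (w + l * G s) ≠ 0 →
        |s - s0| ≤ (2 + 2 / c + 4 / c ^ 3) * (Λ / W) := by
      intro s hs
      have hs := hgood s hs
      obtain ⟨d1, d2⟩ := F.good_diam hP hP' hs hs0
      have hLW : 0 < Λ / W := by positivity
      have pc : 0 < 2 / c := by positivity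
      have pc3 : 0 < 4 / c ^ 3 := by positivity
      rcases le_or_gt (l * τ) 1 with h | h
      · have : W = 1 := by rw [hW, max_eq_right h, Real.sqrt_one]
        rw [this, div_one]
        have h3 : |s - s0| ≤ 2 := (abs_sub _ _).trans (by linarith [hs.h1, hs0.h1])
        nlinarith only [h3, hΛ, mul_pos pc hΛ0, mul_pos pc3 hΛ0]
      have hτ0 : 0 < τ := by
        rcases hτ.eq_or_lt with h0 | h0
        · rw [← h0] at h; simp at h; linarith
        · exact h0
      have hW2 : W = Real.sqrt (l * τ) := by rw [hW, max_eq_left h.le]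
      have hWs : W ^ 2 = l * τ := by rw [hW2]; exact Real.sq_sqrt (by positivity)
      have hW0 : 0 < W := by linarith
      rcases cases with ⟨e, _⟩ | ⟨e, e'⟩
      · have e3 : Real.sqrt (τ / l) = τ / W := by
          have : τ / l = (τ / W) ^ 2 := by rw [div_pow, hWs]; field_simp
          rw [this, Real.sqrt_sq (by positivity)]
        rw [e, e3] at d2
        have : |s - s0| ≤ 4 / c ^ 3 * (Λ / W) := by
          have e4 : 4 / c ^ 3 * (Λ / W) = (4 * (Λ * (τ / W))) / (c ^ 3 * τ) := by field_simp
          rw [e4, le_div_iff₀ (by positivity)]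
          change c ^ 3 * τ * |s - s0| ≤ _ at d2
          linarith
        nlinarith only [this, mul_pos pc hLW, hLW]
      · have e3 : r ≤ 1 / W := by
          have : (r * W) ^ 2 ≤ 1 ^ 2 := by
            have h1 : Real.sqrt (τ / l) ^ 2 ≤ (1 / (l * r)) ^ 2 := by gcongr
            rw [hsq, div_pow, div_le_div_iff₀ hl (by positivity)] at h1
            rw [mul_pow, hWs]
            have h2 : l * (r ^ 2 * (l * τ)) ≤ l * 1 := by linarith
            have := le_of_mul_le_mul_left h2 hl
            linarith
          rw [le_div_iff₀ hW0]
          exact le_of_sq_le_sq this zero_le_one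
        have : |s - s0| ≤ 2 / c * (Λ / W) := by
          have h5 : |s - s0| ≤ 2 / c * r := by
            rw [div_mul_eq_mul_div, le_div_iff₀ hc]; linarith
          refine h5.trans ?_
          gcongr
          exact e3.trans (by gcongr)
        nlinarith only [this, mul_pos pc3 hLW, hLW]
    have := abs_int_le (by positivity) hd hbd
    refine this.trans (le_of_eq ?_)
    rw [hww, hK5]; ring
  refine (abs_add_le _ _).trans ?_
  rw [mul_add]
  have := ww_nonneg l P P'
  refine add_le_add hN' (key.trans ?_)
  gcongr

/-- The kernel of a frequency localised averaging operator. -/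
noncomputable def Ker (g : ℝ → ℝ → ℝ) (ψ : ℝ → ℝ) (l : ℝ) (b : ℝ → ℝ) (P : ℝ × ℝ × ℝ) (x : ℝ × ℝ) : ℝ :=
  b (P.1 - x.1) * (l * ψ (l * (P.2.1 - x.2 - g P.2.2 (P.1 - x.1))))

/-- pairing -/
noncomputable def wv (g : ℝ → ℝ → ℝ) (ψ : ℝ → ℝ) (l : ℝ) (f : ℝ × ℝ → ℝ) (b : ℝ → ℝ) (P : ℝ × ℝ × ℝ) : ℝ :=
  ∫ x, f x * Ker g ψ l b P x

/-- correlation of kernels -/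
noncomputable def kk (g : ℝ → ℝ → ℝ) (ψ : ℝ → ℝ) (l : ℝ) (b b' : ℝ → ℝ) (P P' : ℝ × ℝ × ℝ) : ℝ :=
  ∫ x, Ker g ψ l b P x * Ker g ψ l b' P' x

theorem hcs_shear {H : ℝ × ℝ → ℝ} {γ : ℝ → ℝ} (hγ : Continuous γ) {R : ℝ}
    (hH : ∀ z, H z ≠ 0 → |z.1| ≤ R ∧ |z.2| ≤ R) (u v : ℝ) :
    HasCompactSupport (fun x : ℝ × ℝ => H (u - x.1, v - x.2 - γ (u - x.1))) := by
  have hK : IsCompact (Icc (-R) R ×ˢ Icc (-R) R) := isCompact_Icc.prod isCompact_Icc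
  refine HasCompactSupport.of_support_subset_isCompact
    (hK.image (f := fun z : ℝ × ℝ => (u - z.1, v - z.2 - γ z.1)) (by fun_prop)) ?_
  intro x hx
  have := hH _ hx
  exact ⟨(u - x.1, v - x.2 - γ (u - x.1)), ⟨abs_le.mp this.1, abs_le.mp this.2⟩, by ext <;> simp <;> ring⟩

theorem int_shear {H : ℝ × ℝ → ℝ} {γ : ℝ → ℝ} (hγ : Continuous γ) (hc : Continuous H) {R : ℝ}
    (hH : ∀ z, H z ≠ 0 → |z.1| ≤ R ∧ |z.2| ≤ R) (u v : ℝ) :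
    ∫ x : ℝ × ℝ, H (u - x.1, v - x.2 - γ (u - x.1)) = ∫ s, ∫ y, H (s, y) := by
  have hi : Integrable (fun x : ℝ × ℝ => H (u - x.1, v - x.2 - γ (u - x.1))) :=
    Continuous.integrable_of_hasCompactSupport (by fun_prop) (hcs_shear hγ hH u v)
  rw [Measure.volume_eq_prod, integral_prod _ (by rwa [← Measure.volume_eq_prod])]
  rw [← integral_sub_left_eq_self (fun s => ∫ y, H (s, y)) volume u]
  congr 1
  funext x
  rw [← integral_sub_left_eq_self (fun y => H (u - x, y)) volume (v - γ (u - x))]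
  congr 1
  funext y
  congr 2
  ring

section
variable {g : ℝ → ℝ → ℝ} {ψ : ℝ → ℝ} {l : ℝ}

theorem bpsi_supp {b : ℝ → ℝ} (hl : 1 ≤ l) (hb : ∀ s, b s ≠ 0 → |s| ≤ 1)
    (hψ : ∀ s, ψ s ≠ 0 → |s| ≤ 1) (z : ℝ × ℝ) (h : b z.1 * (l * ψ (l * z.2)) ≠ 0) :
    |z.1| ≤ 1 ∧ |z.2| ≤ 1 := by
  have h1 := hb _ (left_ne_zero_of_mul h)
  have h2 := hψ _ (right_ne_zero_of_mul (right_ne_zero_of_mul h))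
  refine ⟨h1, ?_⟩
  rw [abs_mul, abs_of_pos (by linarith : (0 : ℝ) < l)] at h2
  nlinarith only [h2, hl, abs_nonneg z.2]

theorem Ker_cont {b : ℝ → ℝ} (hb : Continuous b) (hψ : Continuous ψ) {P : ℝ × ℝ × ℝ}
    (hg : Continuous (g P.2.2)) : Continuous (Ker g ψ l b P) := by
  unfold Ker; fun_prop

theorem Ker_hcs {b : ℝ → ℝ} (hl : 1 ≤ l) (hb : ∀ s, b s ≠ 0 → |s| ≤ 1)
    (hψ : ∀ s, ψ s ≠ 0 → |s| ≤ 1) {P : ℝ × ℝ × ℝ} (hg : Continuous (g P.2.2)) :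
    HasCompactSupport (Ker g ψ l b P) :=
  hcs_shear (H := fun z => b z.1 * (l * ψ (l * z.2))) hg (bpsi_supp hl hb hψ) P.1 P.2.1

theorem int_dil (hl : 1 ≤ l) (h : ℝ → ℝ) : ∫ v, l * h (l * v) = ∫ v, h v := by
  have hl0 : 0 < l := by linarith
  rw [integral_const_mul, Measure.integral_comp_mul_left h l, smul_eq_mul, abs_of_pos (by positivity)]
  field_simp

theorem wv_le {b : ℝ → ℝ} (hl : 1 ≤ l) (hbc : Continuous b) (hb : ∀ s, b s ≠ 0 → |s| ≤ 1)
    (hψc : Continuous ψ) (hψ : ∀ s, ψ s ≠ 0 → |s| ≤ 1) {P : ℝ × ℝ × ℝ} (hg : Continuous (g P.2.2))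
    {f : ℝ × ℝ → ℝ} (hf : ∀ x, |f x| ≤ 1) :
    |wv g ψ l f b P| ≤ (∫ s, |b s|) * ∫ v, |ψ v| := by
  have hl0 : 0 < l := by linarith
  have e := int_shear (H := fun z => |b z.1 * (l * ψ (l * z.2))|) hg (by fun_prop) (R := 1)
    (fun z hz => bpsi_supp hl hb hψ z (by simpa using hz)) P.1 P.2.1
  have e2 : ∫ s, ∫ y, |b s * (l * ψ (l * y))| = (∫ s, |b s|) * ∫ v, |ψ v| := by
    rw [← integral_mul_const]
    congr 1; funext s
    rw [← int_dil hl (fun v => |ψ v|), ← integral_const_mul]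
    congr 1; funext y
    rw [abs_mul, abs_mul, abs_of_pos hl0]
  simp only at e
  rw [← e2, ← e]
  have := norm_integral_le_of_norm_le (μ := volume) (f := fun x => f x * Ker g ψ l b P x)
    (g := fun x => |Ker g ψ l b P x|)
    ((Ker_cont hbc hψc hg).integrable_of_hasCompactSupport (Ker_hcs hl hb hψ hg)).abs
    (Filter.Eventually.of_forall fun x => by
      rw [Real.norm_eq_abs, abs_mul]
      exact mul_le_of_le_one_left (abs_nonneg _) (hf x))
  exact this

theorem wv_le' {b : ℝ → ℝ} (hl : 1 ≤ l) {Mb Mψ : ℝ} (hb : ∀ s, |b s| ≤ Mb) (hψ : ∀ s, |ψ s| ≤ Mψ)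
    {P : ℝ × ℝ × ℝ} {f : ℝ × ℝ → ℝ} (hf : Integrable f) :
    |wv g ψ l f b P| ≤ Mb * (l * Mψ) * ∫ x, |f x| := by
  have hM0 : 0 ≤ Mb := (abs_nonneg _).trans (hb 0)
  have := norm_integral_le_of_norm_le (μ := volume) (f := fun x => f x * Ker g ψ l b P x)
    (g := fun x => Mb * (l * Mψ) * |f x|) (hf.abs.const_mul _)
    (Filter.Eventually.of_forall fun x => by
      rw [Real.norm_eq_abs, abs_mul, mul_comm]
      gcongr
      unfold Ker
      rw [abs_mul, abs_mul, abs_of_nonneg (by linarith : 0 ≤ l)]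
      gcongr
      · exact hb _
      · exact hψ _)
  rw [integral_const_mul] at this
  exact this

theorem kk_le {b b' : ℝ → ℝ} (hl : 1 ≤ l) (hbc : Continuous b) (hb : ∀ s, b s ≠ 0 → |s| ≤ 1)
    (hbc' : Continuous b') (hb' : ∀ s, b' s ≠ 0 → |s| ≤ 1)
    (hψc : Continuous ψ) (hψ : ∀ s, ψ s ≠ 0 → |s| ≤ 1) {P P' : ℝ × ℝ × ℝ} (hg : Continuous (g P.2.2))
    (hg' : Continuous (g P'.2.2)) {Mx I : ℝ} (hM : ∀ x, |ψ x| ≤ Mx)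
    (hI : ∀ w, |w| ≤ 1 → |∫ s, b s * b' (s - (P.1 - P'.1)) *
      ψ (w + l * GG g P.2.2 P'.2.2 (P.1 - P'.1) (P.2.1 - P'.2.1) s)| ≤ I) :
    |kk g ψ l b b' P P'| ≤ 2 * Mx * l * I := by
  have hl0 : 0 < l := by linarith
  set z := P.1 - P'.1 with hz
  set G := GG g P.2.2 P'.2.2 z (P.2.1 - P'.2.1) with hG
  have hGc : Continuous G := by rw [hG]; unfold GG; fun_prop
  have e1 : kk g ψ l b b' P P' = ∫ s, ∫ y, b s * b' (s - z) * (l * (l * (ψ (l * y) * ψ (l * y + l * G s)))) := by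
    have := int_shear (H := fun x => b x.1 * b' (x.1 - z) * (l * (l * (ψ (l * x.2) * ψ (l * x.2 + l * G x.1)))))
      (γ := fun s => g P'.2.2 (s - z)) (by fun_prop) (by fun_prop) (R := 1) ?_ P.1 P'.2.1
    · rw [← this]
      unfold kk Ker
      congr 1; funext x
      have q1 : P.1 - x.1 - z = P'.1 - x.1 := by rw [hz]; ring
      have q2 : l * (P.2.1 - x.2 - g P.2.2 (P.1 - x.1)) =
        l * (P'.2.1 - x.2 - g P'.2.2 (P'.1 - x.1)) + l * G (P.1 - x.1) := by
        rw [hG]; unfold GG; rw [q1]; ring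
      simp only
      rw [q1, q2]; ring
    · intro x hx
      refine ⟨hb _ (left_ne_zero_of_mul (left_ne_zero_of_mul hx)), ?_⟩
      have := hψ _ (left_ne_zero_of_mul (right_ne_zero_of_mul (right_ne_zero_of_mul
        (right_ne_zero_of_mul hx))))
      rw [abs_mul, abs_of_pos hl0] at this
      nlinarith only [this, hl, abs_nonneg x.2]
  have e2 : ∀ s, ∫ y, b s * b' (s - z) * (l * (l * (ψ (l * y) * ψ (l * y + l * G s)))) =
      ∫ v, b s * b' (s - z) * (l * (ψ v * ψ (v + l * G s))) := by
    intro s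
    rw [integral_const_mul, integral_const_mul, integral_const_mul, integral_const_mul]
    have := int_dil hl (fun v => ψ v * ψ (v + l * G s))
    rw [integral_const_mul] at this
    rw [this, integral_const_mul]
  have e3 : ∫ s, ∫ v, b s * b' (s - z) * (l * (ψ v * ψ (v + l * G s))) =
      ∫ v, ∫ s, b s * b' (s - z) * (l * (ψ v * ψ (v + l * G s))) := by
    refine integral_integral_swap_of_hasCompactSupport (f := fun s v => b s * b' (s - z) *
      (l * (ψ v * ψ (v + l * G s)))) (by fun_prop) ?_
    refine HasCompactSupport.of_support_subset_isCompact (K := Icc (-1) 1 ×ˢ Icc (-1) 1)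
      (isCompact_Icc.prod isCompact_Icc) ?_
    intro x hx
    exact ⟨abs_le.mp (hb _ (left_ne_zero_of_mul (left_ne_zero_of_mul hx))),
      abs_le.mp (hψ _ (left_ne_zero_of_mul (right_ne_zero_of_mul (right_ne_zero_of_mul hx))))⟩
  have e4 : ∀ v, ∫ s, b s * b' (s - z) * (l * (ψ v * ψ (v + l * G s))) =
      l * ψ v * ∫ s, b s * b' (s - z) * ψ (v + l * G s) := by
    intro v
    rw [← integral_const_mul]; congr 1; funext s; ring
  have hI0 : 0 ≤ I := (abs_nonneg _).trans (hI 0 (by simp))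
  have hM0 : 0 ≤ Mx := (abs_nonneg _).trans (hM 0)
  rw [e1]
  simp only [e2]
  rw [e3]
  simp only [e4]
  have := abs_int_le (s0 := 0) (d := 1) (M := l * Mx * I) zero_le_one
    (f := fun v => l * ψ v * ∫ s, b s * b' (s - z) * ψ (v + l * G s))
    (fun v hv => by simpa using hψ v (right_ne_zero_of_mul (left_ne_zero_of_mul hv))) ?_
  · exact this.trans (le_of_eq (by ring))
  · intro v
    by_cases hv : ψ v = 0
    · simp only [hv]; simp; positivity
    rw [abs_mul, abs_mul, abs_of_pos hl0]
    have := hI v (hψ v hv)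
    gcongr
    exact hM v

end

/-- The `TT*` inequality. -/
theorem TTstar {ι : Type*} (T : Finset ι) (f : ℝ × ℝ → ℝ) (hf : ∀ x, |f x| ≤ 1) (hfi : Integrable f)
    (Kr : ι → ℝ × ℝ → ℝ) (hc : ∀ i, i ∈ T → Continuous (Kr i)) (hs : ∀ i, i ∈ T → HasCompactSupport (Kr i)) :
    (∑ i ∈ T, |∫ x, f x * Kr i x|) ^ 2 ≤ (∫ x, |f x|) * ∑ i ∈ T, ∑ j ∈ T, |∫ x, Kr i x * Kr j x| := by
  set ε : ι → ℝ := fun i => SignType.sign (∫ x, f x * Kr i x) with hε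
  have hε1 : ∀ i, |ε i| ≤ 1 := by
    intro i
    simp only [hε]
    rcases lt_trichotomy (∫ x, f x * Kr i x) 0 with h | h | h
    · rw [sign_neg h]; simp
    · rw [h]; simp
    · rw [sign_pos h]; simp
  set Ψ : ℝ × ℝ → ℝ := fun x => ∑ i ∈ T, ε i * Kr i x with hΨ
  have hΨc : Continuous Ψ := continuous_finsetSum T fun i hi => continuous_const.mul (hc i hi)
  have hii : ∀ i ∈ T, Integrable (fun x => f x * Kr i x) := fun i hi => by
    obtain ⟨C, hC⟩ := (hs i hi).exists_bound_of_continuous (hc i hi)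
    exact hfi.mul_bdd (c := C) (hc i hi).aestronglyMeasurable (Filter.Eventually.of_forall hC)
  have hkk : ∀ i ∈ T, ∀ j ∈ T, Integrable (fun x => Kr i x * Kr j x) := fun i hi j hj =>
    ((hc i hi).mul (hc j hj)).integrable_of_hasCompactSupport ((hs i hi).mul_right)
  have hA : ∑ i ∈ T, |∫ x, f x * Kr i x| = ∫ x, f x * Ψ x := by
    have : ∀ x, f x * Ψ x = ∑ i ∈ T, ε i * (f x * Kr i x) := by
      intro x; rw [hΨ, Finset.mul_sum]; refine Finset.sum_congr rfl fun i _ => by ring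
    simp only [this]
    rw [integral_finsetSum T fun i hi => (hii i hi).const_mul _]
    refine Finset.sum_congr rfl fun i _ => ?_
    rw [integral_const_mul]
    exact (sign_mul_self _).symm
  have hsq : ∀ x, Ψ x ^ 2 = ∑ i ∈ T, ∑ j ∈ T, ε i * ε j * (Kr i x * Kr j x) := by
    intro x
    rw [hΨ, sq, Finset.sum_mul_sum]
    refine Finset.sum_congr rfl fun i _ => Finset.sum_congr rfl fun j _ => by ring
  have hQi : Integrable (fun x => Ψ x ^ 2) := by
    simp only [hsq]
    exact integrable_finsetSum T fun i hi => integrable_finsetSum T fun j hj =>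
      (hkk i hi j hj).const_mul _
  have hQ : ∫ x, Ψ x ^ 2 ≤ ∑ i ∈ T, ∑ j ∈ T, |∫ x, Kr i x * Kr j x| := by
    simp only [hsq]
    rw [integral_finsetSum T fun i hi => integrable_finsetSum T fun j hj =>
      (hkk i hi j hj).const_mul _]
    refine Finset.sum_le_sum fun i hi => ?_
    rw [integral_finsetSum T fun j hj => (hkk i hi j hj).const_mul _]
    refine Finset.sum_le_sum fun j hj => ?_
    rw [integral_const_mul]
    refine (le_abs_self _).trans ?_
    rw [abs_mul, abs_mul]
    have h1 := hε1 i
    have h2 := hε1 j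
    calc _ ≤ 1 * 1 * |∫ x, Kr i x * Kr j x| := by gcongr
      _ = _ := by ring
  have hfΨ : Integrable (fun x => f x * Ψ x) := by
    have : ∀ x, f x * Ψ x = ∑ i ∈ T, ε i * (f x * Kr i x) := by
      intro x; rw [hΨ, Finset.mul_sum]; refine Finset.sum_congr rfl fun i _ => by ring
    simp only [this]
    exact integrable_finsetSum T fun i hi => (hii i hi).const_mul _
  set A := ∑ i ∈ T, |∫ x, f x * Kr i x| with hAd
  have hA0 : 0 ≤ A := Finset.sum_nonneg fun i _ => abs_nonneg _
  set m := ∫ x, |f x| with hm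
  have hm0 : 0 ≤ m := integral_nonneg fun x => abs_nonneg _
  set Q := ∫ x, Ψ x ^ 2
  have hQ0 : 0 ≤ Q := integral_nonneg fun x => sq_nonneg _
  have key : ∀ θ : ℝ, 2 * θ * A ≤ θ ^ 2 * m + Q := by
    intro θ
    rw [hA, hm, ← integral_const_mul, ← integral_const_mul, ← integral_add (hfi.abs.const_mul _) hQi]
    refine integral_mono (hfΨ.const_mul _) ((hfi.abs.const_mul _).add hQi) fun x => ?_
    have h1 := hf x
    have h2 : f x * Ψ x * θ ≤ |f x| * |Ψ x * θ| := by
      rw [← abs_mul, mul_assoc]; exact le_abs_self _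
    have h3 : 2 * |Ψ x * θ| ≤ Ψ x ^ 2 + θ ^ 2 := by
      rw [abs_mul, ← sq_abs (Ψ x), ← sq_abs θ]; nlinarith only [sq_nonneg (|Ψ x| - |θ|)]
    have h4 : |f x| * (2 * |Ψ x * θ|) ≤ |f x| * (Ψ x ^ 2 + θ ^ 2) := by gcongr
    simp only
    nlinarith only [h1, h2, h4, abs_nonneg (f x), mul_nonneg (sub_nonneg.mpr h1) (sq_nonneg (Ψ x))]
  have fin : A ^ 2 ≤ m * Q := by
    rcases hm0.eq_or_lt with h0 | h0
    · have k := key (Q + 1)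
      rw [← h0, mul_zero, zero_add] at k
      have k1 := key ((Q + 1) / A)
      rcases hA0.eq_or_lt with ha | ha
      · rw [← ha, ← h0]; simp
      · rw [← h0, mul_zero, zero_add, mul_assoc, div_mul_cancel₀ _ ha.ne'] at k1
        linarith
    · have k := key (A / m)
      have e : 2 * (A / m) * A = 2 * (A ^ 2 / m) := by ring
      have e2 : (A / m) ^ 2 * m = A ^ 2 / m := by field_simp
      rw [e, e2] at k
      have : A ^ 2 / m ≤ Q := by linarith
      rwa [div_le_iff₀ h0, mul_comm] at this
  exact fin.trans (mul_le_mul_of_nonneg_left hQ hm0)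

/-- Working environment: family of curves, mollifier, test function, correlation bounds. -/
structure Env (N : ℕ) (c B A K l Λ : ℝ) (g a S : ℝ → ℝ → ℝ) (ψ : ℝ → ℝ) (f : ℝ × ℝ → ℝ) : Prop where
  fam : Fam N c B g a S
  hΛ : 1 ≤ Λ
  hl : 1 ≤ l
  hK : 1 ≤ K
  hA : 0 ≤ A
  ψc : Continuous ψ
  ψs : ∀ s, ψ s ≠ 0 → |s| ≤ 1
  ψb : ∀ s, |ψ s| ≤ K
  fb : ∀ x, |f x| ≤ 1
  fi : Integrable f
  k0 : ∀ P P' : ℝ × ℝ × ℝ, P.2.2 ∈ Icc (1 : ℝ) 2 → P'.2.2 ∈ Icc (1 : ℝ) 2 →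
    ∀ (X X' : ℝ → ℝ) (γ γ' r : ℝ), Cut N A γ X → Cut N A γ' X' → 0 < r → r ≤ 1 → Λ ^ 2 ≤ l * r ^ 2 →
    ¬ Tg g S B K l Λ r P γ P' γ' →
    |kk g ψ l (amp g a X r P.2.2) (amp g a X' r P'.2.2) P P'| ≤ K * l * (1 / Λ) ^ N
  k1 : ∀ P P' : ℝ × ℝ × ℝ, P.2.2 ∈ Icc (1 : ℝ) 2 → P'.2.2 ∈ Icc (1 : ℝ) 2 →
    ∀ (X X' : ℝ → ℝ) (γ γ' r : ℝ), Cut N A γ X → Cut N A γ' X' → 0 < r → r ≤ 1 → Λ ^ 2 ≤ l * r ^ 2 →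
    |kk g ψ l (amp g a X r P.2.2) (amp g a X' r P'.2.2) P P'| ≤ K * l * ((1 / Λ) ^ N + Λ * ww l P P')

theorem exists_env (N : ℕ) (c B A Mx : ℝ) (hA : 0 ≤ A) : ∃ K : ℝ, 1 ≤ K ∧ ∀ (g a S : ℝ → ℝ → ℝ),
    Fam N c B g a S → ∀ (l Λ : ℝ) (Θ : ℝ → ℝ) (f : ℝ × ℝ → ℝ), 1 ≤ Λ → 1 ≤ l →
    Smooth Θ → (∀ x, |Θ x| ≤ Mx) → (∀ x, |iteratedDeriv N Θ x| ≤ Mx) →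
    (∀ x, iteratedDeriv N Θ x ≠ 0 → |x| ≤ 1) → (∀ x, |f x| ≤ 1) → Integrable f →
    Env N c B A K l Λ g a S (iteratedDeriv N Θ) f := by
  obtain ⟨K0, hK0, hI⟩ := I_bound N c B A
  by_cases hMx : 0 ≤ Mx
  swap
  · exact ⟨1, le_rfl, fun g a S F l Λ Θ f h1 h2 h3 h4 =>
      absurd ((abs_nonneg _).trans (h4 0)) hMx⟩
  set K := K0 + Mx + 2 * Mx * (K0 * Mx) with hK
  have hq : 0 ≤ 2 * Mx * (K0 * Mx) := by positivity
  have kk0 : K0 ≤ K := by linarith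
  have kk1 : 2 * Mx * (K0 * Mx) ≤ K := by linarith
  refine ⟨K, by linarith, ?_⟩
  intro g a S F l Λ Θ f hΛ hl hΘ hM hM' hs hf hfi
  have hl0 : 0 < l := by linarith
  have hΛ0 : 0 < Λ := by linarith
  have gc : ∀ t ∈ Icc (1 : ℝ) 2, Continuous (g t) := fun t ht => (F.g_sm t ht).continuous
  have hψc : Continuous (iteratedDeriv N Θ) := (hΘ.iteratedDeriv N).continuous
  refine ⟨F, hΛ, hl, by linarith, hA, hψc, hs, fun s => (hM' s).trans (by linarith), hf, hfi, ?_, ?_⟩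
  · intro P P' hP hP' X X' γ γ' r hX hX' hr hr1 hlr hT
    have hT' : ¬ Tg g S B K0 l Λ r P γ P' γ' := by
      rintro ⟨⟨σ, q1, q2⟩, q3, q4, q5⟩
      refine hT ⟨⟨σ, q1.mono (by gcongr), q2⟩, q3, q4.trans (by gcongr), q5.trans (by gcongr)⟩
    have := kk_le hl (F.amp_sm hP hX r).continuous (fun s => F.amp_supp hP)
      (F.amp_sm hP' hX' r).continuous (fun s => F.amp_supp hP') hψc hs (gc _ hP) (gc _ hP') hM'
      (fun w hw => (hI g a S F P P' hP hP' X X' γ γ' hX hX' r l Λ w Mx Θ hr hr1 hΛ hl0 hlr hw hΘ hM hM' hs).1 hT')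
    refine this.trans ?_
    calc _ = (2 * Mx * (K0 * Mx)) * l * (1 / Λ) ^ N := by ring
      _ ≤ _ := by gcongr
  · intro P P' hP hP' X X' γ γ' r hX hX' hr hr1 hlr
    have := kk_le hl (F.amp_sm hP hX r).continuous (fun s => F.amp_supp hP)
      (F.amp_sm hP' hX' r).continuous (fun s => F.amp_supp hP') hψc hs (gc _ hP) (gc _ hP') hM'
      (fun w hw => (hI g a S F P P' hP hP' X X' γ γ' hX hX' r l Λ w Mx Θ hr hr1 hΛ hl0 hlr hw hΘ hM hM' hs).2)
    refine this.trans ?_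
    have := ww_nonneg l P P'
    calc _ = (2 * Mx * (K0 * Mx)) * l * ((1 / Λ) ^ N + Λ * ww l P P') := by ring
      _ ≤ _ := by gcongr

open Classical in
/-- Weighted degree. -/
noncomputable def deg (T : (ℝ × ℝ × ℝ) → (ℝ × ℝ × ℝ) → Prop) (l : ℝ) (Q : Finset (ℝ × ℝ × ℝ))
    (P : ℝ × ℝ × ℝ) : ℝ := ∑ P' ∈ Q with T P P', ww l P P'

theorem deg_eq (T : (ℝ × ℝ × ℝ) → (ℝ × ℝ × ℝ) → Prop) [∀ P P', Decidable (T P P')]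
    (l : ℝ) (Q : Finset (ℝ × ℝ × ℝ))
    (P : ℝ × ℝ × ℝ) : deg T l Q P = ∑ P' ∈ Q, if T P P' then ww l P P' else 0 := by
  unfold deg; rw [Finset.sum_filter]
  refine Finset.sum_congr rfl fun P' _ => ?_
  congr

namespace Env
variable {N : ℕ} {c B A K l Λ : ℝ} {g a S : ℝ → ℝ → ℝ} {ψ : ℝ → ℝ} {f : ℝ × ℝ → ℝ}

/-- Few points have small degree. -/
theorem few_bad (E : Env N c B A K l Λ g a S ψ f) {r : ℝ} (hr : 0 < r) (hr1 : r ≤ 1)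
    (hlr : Λ ^ 2 ≤ l * r ^ 2) (Q : Finset (ℝ × ℝ × ℝ)) (hQ : ∀ P ∈ Q, P.2.2 ∈ Icc (1 : ℝ) 2)
    (X : ℝ × ℝ × ℝ → ℝ → ℝ) (γ : ℝ × ℝ × ℝ → ℝ) (hX : ∀ P ∈ Q, Cut N A (γ P) (X P))
    {α m : ℝ} (hα : 0 < α) (hm : 0 < m) (hmf : ∫ x, |f x| ≤ m)
    (hw : ∀ P ∈ Q, α ≤ |wv g ψ l f (amp g a (X P) r P.2.2) P|)
    (htail : 8 * m * K * l * (1 / Λ) ^ N ≤ α ^ 2)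
    (Bd : Finset (ℝ × ℝ × ℝ)) (hBd : Bd ⊆ Q)
    (hbad : ∀ P ∈ Bd, deg (fun P P' => Tg g S B K l Λ r P (γ P) P' (γ P')) l Q P <
      α ^ 2 * Q.card / (8 * m * K * l * Λ)) :
    (Bd.card : ℝ) ≤ Q.card / 4 := by
  classical
  have hK := E.hK
  have hl := E.hl
  have hΛ := E.hΛ
  have F := E.fam
  have hK0 : 0 < K := by linarith
  have hl0 : 0 < l := by linarith
  have hΛ0 : 0 < Λ := by linarith
  set n : ℝ := (Q.card : ℝ) with hn
  have hn0 : 0 ≤ n := Nat.cast_nonneg _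
  have gc : ∀ t ∈ Icc (1 : ℝ) 2, Continuous (g t) := fun t ht => (F.g_sm t ht).continuous
  have tt := TTstar Bd f E.fb E.fi (fun P => Ker g ψ l (amp g a (X P) r P.2.2) P)
    (fun P hP => Ker_cont (F.amp_sm (hQ P (hBd hP)) (hX P (hBd hP)) r).continuous E.ψc (gc _ (hQ P (hBd hP))))
    (fun P hP => Ker_hcs hl (fun s => F.amp_supp (hQ P (hBd hP))) E.ψs (gc _ (hQ P (hBd hP))))
  have h1 : (Bd.card : ℝ) * α ≤ ∑ P ∈ Bd, |∫ x, f x * Ker g ψ l (amp g a (X P) r P.2.2) P x| := by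
    rw [← nsmul_eq_mul]
    exact Finset.card_nsmul_le_sum _ _ _ fun P hP => hw P (hBd hP)
  have h2 : ∑ P ∈ Bd, ∑ P' ∈ Bd, |∫ x, Ker g ψ l (amp g a (X P) r P.2.2) P x *
      Ker g ψ l (amp g a (X P') r P'.2.2) P' x| ≤ Bd.card * (α ^ 2 * n / (4 * m)) := by
    rw [← nsmul_eq_mul]
    refine Finset.sum_le_card_nsmul _ _ _ fun P hP => ?_
    have hd := hbad P hP
    rw [deg_eq] at hd
    calc _ ≤ ∑ P' ∈ Q, |∫ x, Ker g ψ l (amp g a (X P) r P.2.2) P x *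
            Ker g ψ l (amp g a (X P') r P'.2.2) P' x| :=
          Finset.sum_le_sum_of_subset_of_nonneg hBd fun _ _ _ => abs_nonneg _
      _ ≤ ∑ P' ∈ Q, (K * l * (1 / Λ) ^ N + K * l * Λ *
            (if Tg g S B K l Λ r P (γ P) P' (γ P') then ww l P P' else 0)) := by
          refine Finset.sum_le_sum fun P' hP' => ?_
          split_ifs with h
          · have := E.k1 P P' (hQ P (hBd hP)) (hQ P' hP') _ _ _ _ r (hX P (hBd hP)) (hX P' hP') hr hr1 hlr
            exact this.trans (le_of_eq (by ring))
          · have := E.k0 P P' (hQ P (hBd hP)) (hQ P' hP') _ _ _ _ r (hX P (hBd hP)) (hX P' hP') hr hr1 hlr h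
            exact this.trans (le_of_eq (by ring))
      _ = n * (K * l * (1 / Λ) ^ N) + K * l * Λ * ∑ P' ∈ Q,
            (if Tg g S B K l Λ r P (γ P) P' (γ P') then ww l P P' else 0) := by
          rw [Finset.sum_add_distrib, Finset.sum_const, nsmul_eq_mul, Finset.mul_sum]
      _ ≤ n * (α ^ 2 / (8 * m)) + K * l * Λ * (α ^ 2 * n / (8 * m * K * l * Λ)) := by
          gcongr
          rw [le_div_iff₀ (by positivity)]
          linarith
      _ = _ := by field_simp; ring
  have h3 : (Bd.card * α) ^ 2 ≤ m * (Bd.card * (α ^ 2 * n / (4 * m))) := by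
    calc _ ≤ _ := pow_le_pow_left₀ (by positivity) h1 2
      _ ≤ _ := tt
      _ ≤ m * (Bd.card * (α ^ 2 * n / (4 * m))) := by gcongr
  rcases Nat.eq_zero_or_pos Bd.card with h0 | h0
  · rw [h0]; simp; positivity
  have h0' : (0 : ℝ) < Bd.card := by exact_mod_cast h0
  have e : m * (Bd.card * (α ^ 2 * n / (4 * m))) = (α ^ 2 * Bd.card) * (n / 4) := by field_simp
  rw [e] at h3
  have e2 : (Bd.card * α) ^ 2 = (α ^ 2 * Bd.card) * Bd.card := by ring
  rw [e2] at h3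
  exact le_of_mul_le_mul_left h3 (by positivity)

end Env

/-- Counting lemma. -/
theorem count_le {l : ℝ} (hl : 1 ≤ l) (Q : Finset (ℝ × ℝ × ℝ))
    (hinj : ∀ P ∈ Q, ∀ P' ∈ Q, ⌊l * P.1⌋ = ⌊l * P'.1⌋ → ⌊l * P.2.1⌋ = ⌊l * P'.2.1⌋ → P = P')
    (y1 y2 μ e b : ℝ) (he : 0 ≤ e) (hb : 0 ≤ b) (h1 : ∀ P ∈ Q, |P.1 - y1| ≤ e)
    (h2 : ∀ P ∈ Q, |(P.2.1 - y2) - μ * (P.1 - y1)| ≤ b) :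
    (Q.card : ℝ) ≤ (2 * (l * e) + 2) * (2 * (l * b) + 2 * |μ| + 6) := by
  classical
  have hl0 : 0 < l := by linarith
  set i0 := ⌈l * (y1 - e) - 1⌉
  set i1 := ⌊l * (y1 + e)⌋
  set u := l * (y2 - μ * y1)
  set j0 := ⌈u - l * b - 2 - |μ|⌉
  set j1 := ⌊u + l * b + 2 + |μ|⌋
  have hcard : Q.card ≤ (Finset.Icc i0 i1 ×ˢ Finset.Icc j0 j1).card := by
    refine Finset.card_le_card_of_injOn
      (fun P => (⌊l * P.1⌋, ⌊l * P.2.1⌋ - ⌊μ * ⌊l * P.1⌋⌋)) ?_ ?_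
    · intro P hP
      have k1 := abs_le.mp (h1 P hP)
      have k2 := abs_le.mp (h2 P hP)
      have f1 := Int.floor_le (l * P.1)
      have f2 := Int.lt_floor_add_one (l * P.1)
      have f3 := Int.floor_le (l * P.2.1)
      have f4 := Int.lt_floor_add_one (l * P.2.1)
      have f5 := Int.floor_le (μ * ⌊l * P.1⌋)
      have f6 := Int.lt_floor_add_one (μ * ⌊l * P.1⌋)
      have f7 : |μ * ⌊l * P.1⌋ - μ * (l * P.1)| ≤ |μ| := by
        rw [← mul_sub, abs_mul]
        refine mul_le_of_le_one_right (abs_nonneg _) ?_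
        rw [abs_le]; constructor <;> linarith
      rw [abs_le] at f7
      have g1 := mul_le_mul_of_nonneg_left k1.1 hl0.le
      have g2 := mul_le_mul_of_nonneg_left k1.2 hl0.le
      have g3 := mul_le_mul_of_nonneg_left k2.1 hl0.le
      have g4 := mul_le_mul_of_nonneg_left k2.2 hl0.le
      have eu : u = l * (y2 - μ * y1) := rfl
      simp only [Finset.coe_product, Finset.coe_Icc, mem_prod, mem_Icc]
      refine ⟨⟨Int.ceil_le.mpr ?_, Int.le_floor.mpr ?_⟩, Int.ceil_le.mpr ?_, Int.le_floor.mpr ?_⟩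
      · linarith
      · linarith
      · push_cast; linarith
      · push_cast; linarith
    · intro P hP P' hP' h
      simp only [Prod.mk.injEq] at h
      refine hinj P hP P' hP' h.1 ?_
      have := h.2
      rw [h.1] at this
      linarith
  have c1 : ((Finset.Icc i0 i1).card : ℝ) ≤ 2 * (l * e) + 2 := by
    rw [Int.card_Icc]
    have a1 := Int.floor_le (l * (y1 + e))
    have a2 := Int.le_ceil (l * (y1 - e) - 1)
    have : (0 : ℝ) ≤ 2 * (l * e) + 2 := by positivity
    rcases le_total 0 (i1 + 1 - i0) with h | h
    · rw [show (((i1 + 1 - i0).toNat : ℕ) : ℝ) = (((i1 + 1 - i0).toNat : ℤ) : ℝ) by norm_cast,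
        Int.toNat_of_nonneg h]
      push_cast
      linarith
    · rw [Int.toNat_of_nonpos h]; simpa using this
  have c2 : ((Finset.Icc j0 j1).card : ℝ) ≤ 2 * (l * b) + 2 * |μ| + 6 := by
    rw [Int.card_Icc]
    have a1 := Int.floor_le (u + l * b + 2 + |μ|)
    have a2 := Int.le_ceil (u - l * b - 2 - |μ|)
    have : (0 : ℝ) ≤ 2 * (l * b) + 2 * |μ| + 6 := by positivity
    rcases le_total 0 (j1 + 1 - j0) with h | h
    · rw [show (((j1 + 1 - j0).toNat : ℕ) : ℝ) = (((j1 + 1 - j0).toNat : ℤ) : ℝ) by norm_cast,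
        Int.toNat_of_nonneg h]
      push_cast
      linarith
    · rw [Int.toNat_of_nonpos h]; simpa using this
  calc (Q.card : ℝ) ≤ ((Finset.Icc i0 i1).card : ℝ) * (Finset.Icc j0 j1).card := by
        rw [Finset.card_product] at hcard; exact_mod_cast hcard
    _ ≤ _ := by gcongr

/-- All constants are dominated by `Λ`. -/
structure Big (c B K l Λ : ℝ) : Prop where
  L100 : 100 ≤ Λ
  K_le : K ≤ Λ
  B_le : B ≤ Λ
  c_le : 1 ≤ c * Λ
  log_le : 1 + Real.log (l + 4) ≤ Λ

/-- Finite set of points with distinct cells. -/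
structure Pts (l : ℝ) (Q : Finset (ℝ × ℝ × ℝ)) : Prop where
  t_mem : ∀ P ∈ Q, P.2.2 ∈ Icc (1 : ℝ) 2
  inj : ∀ P ∈ Q, ∀ P' ∈ Q, ⌊l * P.1⌋ = ⌊l * P'.1⌋ → ⌊l * P.2.1⌋ = ⌊l * P'.2.1⌋ → P = P'

theorem Pts.mono {l : ℝ} {Q Q' : Finset (ℝ × ℝ × ℝ)} (h : Pts l Q) (hs : Q' ⊆ Q) : Pts l Q' :=
  ⟨fun P hP => h.t_mem P (hs hP), fun P hP P' hP' => h.inj P (hs hP) P' (hs hP')⟩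

theorem floor_close {l x y : ℝ} (hl : 1 ≤ l) (h : ⌊l * x⌋ = ⌊l * y⌋) : |x - y| ≤ 1 / l := by
  have hl0 : 0 < l := by linarith
  have f1 := Int.floor_le (l * x)
  have f2 := Int.lt_floor_add_one (l * x)
  have f3 := Int.floor_le (l * y)
  have f4 := Int.lt_floor_add_one (l * y)
  rw [h] at f1 f2
  have : |l * x - l * y| ≤ 1 := by
    rw [abs_le]; constructor <;> linarith only [f1, f2, f3, f4]
  rw [← mul_sub, abs_mul, abs_of_pos hl0] at this
  rw [le_div_iff₀ hl0]; linarith only [this]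

theorem slot_mem {l t : ℝ} (hl : 1 ≤ l) (ht : t ∈ Icc (1 : ℝ) 2) : ⌊l * t⌋ ∈ Finset.Icc ⌊l⌋ ⌊2 * l⌋ := by
  rw [Finset.mem_Icc]
  constructor
  · apply Int.floor_le_floor; nlinarith only [ht.1, hl]
  · apply Int.floor_le_floor; nlinarith only [ht.2, hl]

theorem slot_card {l : ℝ} (hl : 1 ≤ l) : ((Finset.Icc ⌊l⌋ ⌊2 * l⌋).card : ℝ) ≤ 3 * l := by
  have h : ⌊l⌋ ≤ ⌊2 * l⌋ := Int.floor_le_floor (by linarith)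
  rw [Int.card_Icc]
  rw [show (((⌊2 * l⌋ + 1 - ⌊l⌋).toNat : ℕ) : ℝ) = (((⌊2 * l⌋ + 1 - ⌊l⌋).toNat : ℤ) : ℝ) by norm_cast,
    Int.toNat_of_nonneg (by linarith)]
  push_cast
  have f1 := Int.floor_le (2 * l)
  have f2 := Int.lt_floor_add_one l
  linarith

/-- harmonic sums over integer intervals -/
theorem int_harm (a b k0 : ℤ) (h0 : k0 ∈ Finset.Icc a b) :
    ∑ k ∈ Finset.Icc a b, (1 : ℝ) / (|(k : ℝ) - k0| + 1) ≤ 2 * (1 + Real.log ((b : ℝ) - a + 1)) := by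
  rw [Finset.mem_Icc] at h0
  have hh : ∀ n : ℕ, (n : ℝ) ≤ (b : ℝ) - a + 1 → ∑ i ∈ Finset.range n, (1 : ℝ) / ((i : ℝ) + 1) ≤ 1 + Real.log ((b : ℝ) - a + 1) := by
    intro n hn
    rcases Nat.eq_zero_or_pos n with rfl | hn0
    · simp
      have : (a : ℝ) ≤ b := by exact_mod_cast h0.1.trans h0.2
      have := Real.log_nonneg (x := (b : ℝ) - a + 1) (by linarith)
      linarith
    have h1 := harmonic_le_one_add_log n
    rw [harmonic] at h1
    push_cast at h1
    calc _ = ∑ i ∈ Finset.range n, ((i : ℝ) + 1)⁻¹ := by simp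
      _ ≤ _ := h1
      _ ≤ _ := by
        have : (0 : ℝ) < n := by exact_mod_cast hn0
        have := Real.log_le_log this hn
        linarith
  have split : ∑ k ∈ Finset.Icc a b, (1 : ℝ) / (|(k : ℝ) - k0| + 1) ≤
      ∑ k ∈ Finset.Icc a k0, (1 : ℝ) / (|(k : ℝ) - k0| + 1) + ∑ k ∈ Finset.Icc k0 b, (1 : ℝ) / (|(k : ℝ) - k0| + 1) := by
    rw [← Finset.sum_union_inter]
    have : Finset.Icc a b ⊆ Finset.Icc a k0 ∪ Finset.Icc k0 b := by
      intro k hk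
      rw [Finset.mem_union, Finset.mem_Icc, Finset.mem_Icc]
      rw [Finset.mem_Icc] at hk
      omega
    refine (Finset.sum_le_sum_of_subset_of_nonneg this fun _ _ _ => by positivity).trans ?_
    exact le_add_of_nonneg_right (Finset.sum_nonneg fun _ _ => by positivity)
  refine split.trans ?_
  have s1 : ∑ k ∈ Finset.Icc a k0, (1 : ℝ) / (|(k : ℝ) - k0| + 1) ≤ ∑ i ∈ Finset.range ((k0 - a).toNat + 1), (1 : ℝ) / ((i : ℝ) + 1) := by
    refine le_of_eq (Finset.sum_nbij (fun k => (k0 - k).toNat) ?_ ?_ ?_ ?_)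
    · intro k hk; simp only [Finset.mem_Icc, Finset.mem_range] at *; omega
    · intro k hk k' hk' h; simp only [Finset.coe_Icc, mem_Icc] at *; omega
    · intro i hi
      simp only [Finset.coe_range, mem_Iio, Finset.coe_Icc, mem_image, mem_Icc] at *
      exact ⟨k0 - i, by omega, by omega⟩
    · intro k hk
      simp only [Finset.mem_Icc] at hk
      have : (((k0 - k).toNat : ℕ) : ℝ) = |(k : ℝ) - k0| := by
        rw [abs_sub_comm, abs_of_nonneg (sub_nonneg.mpr (by exact_mod_cast hk.2)),
          show (((k0 - k).toNat : ℕ) : ℝ) = (((k0 - k).toNat : ℤ) : ℝ) by norm_cast, Int.toNat_of_nonneg (by omega)]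
        push_cast; rfl
      rw [this]
  have s2 : ∑ k ∈ Finset.Icc k0 b, (1 : ℝ) / (|(k : ℝ) - k0| + 1) ≤ ∑ i ∈ Finset.range ((b - k0).toNat + 1), (1 : ℝ) / ((i : ℝ) + 1) := by
    refine le_of_eq (Finset.sum_nbij (fun k => (k - k0).toNat) ?_ ?_ ?_ ?_)
    · intro k hk; simp only [Finset.mem_Icc, Finset.mem_range] at *; omega
    · intro k hk k' hk' h; simp only [Finset.coe_Icc, mem_Icc] at *; omega
    · intro i hi
      simp only [Finset.coe_range, mem_Iio, Finset.coe_Icc, mem_image, mem_Icc] at *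
      exact ⟨k0 + i, by omega, by omega⟩
    · intro k hk
      simp only [Finset.mem_Icc] at hk
      have : (((k - k0).toNat : ℕ) : ℝ) = |(k : ℝ) - k0| := by
        rw [abs_of_nonneg (sub_nonneg.mpr (by exact_mod_cast hk.1)),
          show (((k - k0).toNat : ℕ) : ℝ) = (((k - k0).toNat : ℤ) : ℝ) by norm_cast, Int.toNat_of_nonneg (by omega)]
        push_cast; rfl
      rw [this]
  have c1 : (((k0 - a).toNat + 1 : ℕ) : ℝ) ≤ (b : ℝ) - a + 1 := by
    have : (((k0 - a).toNat + 1 : ℕ) : ℤ) ≤ b - a + 1 := by push_cast; omega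
    exact_mod_cast this
  have c2 : (((b - k0).toNat + 1 : ℕ) : ℝ) ≤ (b : ℝ) - a + 1 := by
    have : (((b - k0).toNat + 1 : ℕ) : ℤ) ≤ b - a + 1 := by push_cast; omega
    exact_mod_cast this
  linarith [s1.trans (hh _ c1), s2.trans (hh _ c2)]

theorem slot_harm {c B K l Λ : ℝ} (hB : Big c B K l Λ) (hl : 1 ≤ l) {t : ℝ} (ht : t ∈ Icc (1 : ℝ) 2) :
    ∑ k ∈ Finset.Icc ⌊l⌋ ⌊2 * l⌋, (1 : ℝ) / (|(k : ℝ) - ⌊l * t⌋| + 1) ≤ 2 * Λ := by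
  refine (int_harm _ _ _ (slot_mem hl ht)).trans ?_
  have f1 := Int.floor_le (2 * l)
  have f2 := Int.lt_floor_add_one l
  have f3 : (⌊l⌋ : ℝ) ≤ ⌊2 * l⌋ := by exact_mod_cast (Int.floor_le_floor (by linarith) : ⌊l⌋ ≤ ⌊2 * l⌋)
  have := Real.log_le_log (x := (⌊2 * l⌋ : ℝ) - ⌊l⌋ + 1) (y := l + 4) (by linarith) (by linarith)
  linarith [hB.log_le]

theorem ww_le_one (l : ℝ) (P P' : ℝ × ℝ × ℝ) : ww l P P' ≤ 1 := by
  unfold ww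
  rw [div_le_one (by positivity)]
  exact Real.one_le_sqrt.mpr (le_max_right _ _)

theorem ww_sq (l : ℝ) (P P' : ℝ × ℝ × ℝ) : ww l P P' ^ 2 = 1 / max (l * |P.2.2 - P'.2.2|) 1 := by
  unfold ww
  rw [div_pow, Real.sq_sqrt (by positivity)]; simp

theorem ww_slot {l : ℝ} (hl : 1 ≤ l) (P P' : ℝ × ℝ × ℝ) :
    ww l P P' ^ 2 ≤ 3 * (1 / (|(⌊l * P.2.2⌋ : ℝ) - ⌊l * P'.2.2⌋| + 1)) := by
  rw [ww_sq, mul_one_div, div_le_div_iff₀ (by positivity) (by positivity)]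
  have hl0 : 0 < l := by linarith
  have f1 := Int.floor_le (l * P.2.2)
  have f2 := Int.lt_floor_add_one (l * P.2.2)
  have f3 := Int.floor_le (l * P'.2.2)
  have f4 := Int.lt_floor_add_one (l * P'.2.2)
  have : |(⌊l * P.2.2⌋ : ℝ) - ⌊l * P'.2.2⌋| ≤ l * |P.2.2 - P'.2.2| + 1 := by
    have e : l * |P.2.2 - P'.2.2| = |l * P.2.2 - l * P'.2.2| := by
      rw [← mul_sub, abs_mul, abs_of_pos hl0]
    rw [e]
    have g1 := neg_abs_le (l * P.2.2 - l * P'.2.2)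
    have g2 := le_abs_self (l * P.2.2 - l * P'.2.2)
    rw [abs_le]; constructor <;> linarith only [f1, f2, f3, f4, g1, g2]
  have m1 := le_max_left (l * |P.2.2 - P'.2.2|) 1
  have m2 := le_max_right (l * |P.2.2 - P'.2.2|) 1
  linarith only [this, m1, m2]

/-- pigeonhole in real form -/
theorem card_fiber {ι κ : Type*} [DecidableEq κ] (s : Finset ι) (t : Finset κ) (φ : ι → κ)
    (hφ : ∀ i ∈ s, φ i ∈ t) {M : ℝ} (h : ∀ k ∈ t, ((s.filter fun i => φ i = k).card : ℝ) ≤ M) :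
    (s.card : ℝ) ≤ t.card * M := by
  rw [Finset.card_eq_sum_card_fiberwise hφ]
  push_cast
  rw [← nsmul_eq_mul]
  exact Finset.sum_le_card_nsmul _ _ _ h

namespace Env
variable {N : ℕ} {c B A K l Λ : ℝ} {g a S : ℝ → ℝ → ℝ} {ψ : ℝ → ℝ} {f : ℝ × ℝ → ℝ}

theorem tg_mid (E : Env N c B A K l Λ g a S ψ f) {r : ℝ} {P P' P1 : ℝ × ℝ × ℝ} {γ γ' γ1 : ℝ}
    (hr : 0 < r)
    (hP : P.2.2 ∈ Icc (1 : ℝ) 2) (hP' : P'.2.2 ∈ Icc (1 : ℝ) 2)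
    (h : Tg g S B K l Λ r P γ P1 γ1) (h' : Tg g S B K l Λ r P' γ' P1 γ1)
    (hsg : P.2.2 ≤ P1.2.2 ↔ P'.2.2 ≤ P1.2.2) :
    ∃ x, |x| ≤ B ∧ |x - γ1 * r| ≤ 5 * r ∧ |hh g S P x - hh g S P' x| ≤ 2 * (K * (Λ ^ 2 / l)) := by
  obtain ⟨⟨σ, t1, s1⟩, c1, -⟩ := h
  obtain ⟨⟨σ', t2, s2⟩, c2, -⟩ := h'
  have k1 : |σ - γ1 * r| ≤ 5 * r := by
    have : |γ * r - γ1 * r| ≤ 4 * r := by rw [← sub_mul, abs_mul, abs_of_pos hr]; gcongr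
    linarith only [abs_sub_le σ (γ * r) (γ1 * r), this, s1]
  have k2 : |σ' - γ1 * r| ≤ 5 * r := by
    have : |γ' * r - γ1 * r| ≤ 4 * r := by rw [← sub_mul, abs_mul, abs_of_pos hr]; gcongr
    linarith only [abs_sub_le σ' (γ' * r) (γ1 * r), this, s2]
  have k3 : |σ - σ'| ≤ 10 * r := by
    have := abs_sub_le σ (γ1 * r) σ'
    rw [abs_sub_comm (γ1 * r)] at this
    linarith only [this, k1, k2]
  obtain ⟨x, hx, hx'⟩ := E.fam.mid hP hP' t1 t2 k3 (by
    by_cases hh : P.2.2 ≤ P1.2.2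
    · exact Or.inr ⟨hh, hsg.mp hh⟩
    · exact Or.inl ⟨(not_le.mp hh).le, (not_le.mp fun h => hh (hsg.mpr h)).le⟩)
  have hb1 := abs_le.mp t1.1
  have hb2 := abs_le.mp t2.1
  have hk1 := abs_le.mp k1
  have hk2 := abs_le.mp k2
  rw [mem_uIcc] at hx
  refine ⟨x, ?_, ?_, hx'⟩ <;> rw [abs_le] <;> rcases hx with hx | hx <;>
    constructor <;> linarith only [hx, hb1, hb2, hk1, hk2]

theorem lE_le (hB : Big c B K l Λ) (hB0 : 0 < B) (hc : 0 < c) (_hK : 1 ≤ K) :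
    2 * (K * Λ ^ 2) + B * (1 + (2 * B / c) ^ 2) ≤ Λ ^ 6 := by
  have hL := hB.L100
  have hL0 : 0 < Λ := by linarith
  have h1 : 2 * B / c ≤ 2 * Λ ^ 2 := by
    rw [div_le_iff₀ hc]
    have := mul_le_mul_of_nonneg_left hB.c_le (by positivity : 0 ≤ 2 * Λ)
    nlinarith only [this, hB.B_le]
  have h0 : 0 ≤ 2 * B / c := by positivity
  calc _ ≤ 2 * (Λ * Λ ^ 2) + Λ * (1 + (2 * Λ ^ 2) ^ 2) := by
        gcongr
        · exact hB.K_le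
        · exact hB.B_le
    _ ≤ Λ ^ 6 := by
        have e1 : Λ ≤ Λ ^ 5 := le_self_pow₀ (by linarith) (by norm_num)
        have e2 : Λ ^ 3 ≤ Λ ^ 5 := pow_le_pow_right₀ (by linarith) (by norm_num)
        have e3 : 100 * Λ ^ 5 ≤ Λ * Λ ^ 5 := by gcongr
        have : 0 < Λ ^ 5 := by positivity
        nlinarith only [e1, e2, e3, this]

theorem sep_x {r γa γb γ1 γ2 x1 x2 : ℝ} (hr : 0 < r) (h : 28 ≤ |γa - γb|) (ha : |γa - γ1| ≤ 4)
    (hb : |γb - γ2| ≤ 4) (c1 : |x1 - γ1 * r| ≤ 5 * r) (c2 : |x2 - γ2 * r| ≤ 5 * r) :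
    10 * r ≤ |x1 - x2| := by
  have sep : 20 ≤ |γ1 - γ2| := by
    have t1 := abs_sub_le γa γ1 γb
    have t2 := abs_sub_le γ1 γ2 γb
    rw [abs_sub_comm γ2] at t2
    linarith only [h, ha, hb, t1, t2]
  have s1 : 20 * r ≤ |γ1 * r - γ2 * r| := by rw [← sub_mul, abs_mul, abs_of_pos hr]; gcongr
  have t1 := abs_sub_le (γ1 * r) x1 (γ2 * r)
  have t2 := abs_sub_le x1 x2 (γ2 * r)
  rw [abs_sub_comm (γ1 * r) x1] at t1
  linarith only [s1, t1, t2, c1, c2]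

/-- Number of points in one time slot, tangent to two given ones in separated directions. -/
theorem two_count (E : Env N c B A K l Λ g a S ψ f) (hB : Big c B K l Λ) {r : ℝ} (hr : 0 < r) (hr1 : r ≤ 1)
    (Q : Finset (ℝ × ℝ × ℝ)) (hQ : Pts l Q) (γ1 γ2 : ℝ × ℝ × ℝ → ℝ)
    (hγ : ∀ P ∈ Q, 28 ≤ |γ1 P - γ2 P|) (P1 P2 : ℝ × ℝ × ℝ) 
    (h1 : ∀ P ∈ Q, Tg g S B K l Λ r P (γ1 P) P1 (γ1 P1))
    (h2 : ∀ P ∈ Q, Tg g S B K l Λ r P (γ2 P) P2 (γ2 P2))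
    (ht : ∀ P ∈ Q, ∀ P' ∈ Q, |P.2.2 - P'.2.2| ≤ 1 / l) :
    (Q.card : ℝ) ≤ Λ ^ 14 / r := by
  classical
  have hL := hB.L100
  have hL0 : 0 < Λ := by linarith
  have hl := E.hl
  have hl0 : 0 < l := by linarith
  have hB0 := E.fam.B_pos
  have lE := lE_le hB hB0 E.fam.c_pos E.hK
  have key : (Q.card : ℝ) ≤ (Finset.univ : Finset (Bool × Bool)).card * (Λ ^ 13 / r) := by
    refine card_fiber Q Finset.univ (fun P => (decide (P.2.2 ≤ P1.2.2), decide (P.2.2 ≤ P2.2.2)))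
      (fun _ _ => Finset.mem_univ _) fun k _ => ?_
    set W := Q.filter fun P => (decide (P.2.2 ≤ P1.2.2), decide (P.2.2 ≤ P2.2.2)) = k with hW
    rcases W.eq_empty_or_nonempty with h0 | ⟨P0, hP0⟩
    · rw [h0]; simp; positivity
    have hWQ : W ⊆ Q := Finset.filter_subset _ _
    have hsg : ∀ P ∈ W, (P.2.2 ≤ P1.2.2 ↔ P0.2.2 ≤ P1.2.2) ∧ (P.2.2 ≤ P2.2.2 ↔ P0.2.2 ≤ P2.2.2) := by
      intro P hP
      have a1 := (Finset.mem_filter.mp hP).2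
      have a2 := (Finset.mem_filter.mp hP0).2
      rw [← a2, Prod.mk.injEq, decide_eq_decide, decide_eq_decide] at a1
      exact a1
    set e := 2 * (K * (Λ ^ 2 / l)) + B * (1 + (2 * B / c) ^ 2) * (1 / l) with he
    have hle : l * e ≤ Λ ^ 6 := by
      have : l * e = 2 * (K * Λ ^ 2) + B * (1 + (2 * B / c) ^ 2) := by rw [he]; field_simp
      rw [this]; exact lE
    have he0 : 0 ≤ e := by have := E.hK; positivity
    have main : ∀ P ∈ W, |P.1 - P0.1| ≤ e / (5 * r) ∧
        |(P.2.1 - P0.2.1) - (γ1 P1 * r) * (P.1 - P0.1)| ≤ 2 * e ∧ |γ1 P1 * r| ≤ B + 5 := by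
      intro P hP
      have hPQ := hWQ hP
      have hP0Q := hWQ hP0
      obtain ⟨x1, b1, c1, d1⟩ := E.tg_mid hr (hQ.t_mem P hPQ) (hQ.t_mem P0 hP0Q) (h1 P hPQ) (h1 P0 hP0Q) (hsg P hP).1
      obtain ⟨x2, b2, c2, d2⟩ := E.tg_mid hr (hQ.t_mem P hPQ) (hQ.t_mem P0 hP0Q) (h2 P hPQ) (h2 P0 hP0Q) (hsg P hP).2
      have sep' := sep_x hr (hγ P hPQ) (h1 P hPQ).2.1 (h2 P hPQ).2.1 c1 c2
      obtain ⟨w1, w2⟩ := E.fam.two_pt (hQ.t_mem P hPQ) (hQ.t_mem P0 hP0Q) sep' d1 d2 b1 b2 (ht P hPQ P0 hP0Q)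
      rw [← he] at w1 w2
      have w3 : |P.1 - P0.1| ≤ e / (5 * r) := by
        rw [le_div_iff₀ (by positivity)]; linarith only [w1]
      refine ⟨w3, ?_, ?_⟩
      · have a1 : (P.2.1 - P0.2.1) - (γ1 P1 * r) * (P.1 - P0.1) =
          ((P.2.1 - P0.2.1) - x1 * (P.1 - P0.1)) + (x1 - γ1 P1 * r) * (P.1 - P0.1) := by ring
        rw [a1]
        refine (abs_add_le _ _).trans ?_
        have : |(x1 - γ1 P1 * r) * (P.1 - P0.1)| ≤ 5 * r * (e / (5 * r)) := by
          rw [abs_mul]; gcongr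
        rw [mul_div_cancel₀ _ (by positivity)] at this
        linarith only [this, w2]
      · have := abs_sub_abs_le_abs_sub (γ1 P1 * r) x1
        rw [abs_sub_comm (γ1 P1 * r)] at this
        linarith only [this, c1, b1, hr1]
    have cnt := count_le hl W (hQ.mono hWQ).inj P0.1 P0.2.1 (γ1 P1 * r) (e / (5 * r)) (2 * e) (by positivity)
      (by positivity) (fun P hP => (main P hP).1) (fun P hP => (main P hP).2.1)
    have hμ := (main P0 hP0).2.2
    refine cnt.trans ?_
    have u1 : 2 * (l * (e / (5 * r))) + 2 ≤ 3 * Λ ^ 6 / r := by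
      rw [show l * (e / (5 * r)) = (l * e) / 5 / r by field_simp]
      have : 2 ≤ 2 * Λ ^ 6 / r := by
        rw [le_div_iff₀ hr]
        have : 1 ≤ Λ ^ 6 := one_le_pow₀ (by linarith)
        nlinarith only [this, hr1]
      calc _ ≤ 2 * (Λ ^ 6 / 5 / r) + 2 * Λ ^ 6 / r := by gcongr
        _ = (12 / 5) * (Λ ^ 6 / r) := by ring
        _ ≤ 3 * (Λ ^ 6 / r) := by gcongr; norm_num
        _ = _ := by ring
    have u2 : 2 * (l * (2 * e)) + 2 * |γ1 P1 * r| + 6 ≤ 30 * Λ ^ 6 := by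
      have q1 : Λ ≤ Λ ^ 6 := le_self_pow₀ (by linarith) (by norm_num)
      have q2 := hB.B_le
      linarith only [q1, q2, hle, hμ, hL]
    calc _ ≤ (3 * Λ ^ 6 / r) * (30 * Λ ^ 6) := by gcongr
      _ = 90 * Λ ^ 12 / r := by ring
      _ ≤ Λ * Λ ^ 12 / r := by gcongr; linarith
      _ = _ := by ring
  refine key.trans ?_
  have : ((Finset.univ : Finset (Bool × Bool)).card : ℝ) = 4 := by simp
  rw [this]
  calc 4 * (Λ ^ 13 / r) ≤ Λ * (Λ ^ 13 / r) := by gcongr; linarith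
    _ = _ := by ring

end Env

theorem slot_sum {l : ℝ} (hl : 1 ≤ l) (H : Finset (ℝ × ℝ × ℝ)) (hH : ∀ P ∈ H, P.2.2 ∈ Icc (1 : ℝ) 2)
    (φ : ℤ → ℝ) (hφ : ∀ k, 0 ≤ φ k) {M : ℝ}
    (hM : ∀ k : ℤ, ((H.filter fun P => ⌊l * P.2.2⌋ = k).card : ℝ) ≤ M) :
    ∑ P ∈ H, φ ⌊l * P.2.2⌋ ≤ M * ∑ k ∈ Finset.Icc ⌊l⌋ ⌊2 * l⌋, φ k := by
  rw [← Finset.sum_fiberwise_of_maps_to (t := Finset.Icc ⌊l⌋ ⌊2 * l⌋) (g := fun P : ℝ × ℝ × ℝ => ⌊l * P.2.2⌋)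
    (fun P hP => slot_mem hl (hH P hP)), Finset.mul_sum]
  refine Finset.sum_le_sum fun k _ => ?_
  calc ∑ P ∈ H with ⌊l * P.2.2⌋ = k, φ ⌊l * P.2.2⌋ = ∑ P ∈ H with ⌊l * P.2.2⌋ = k, φ k :=
        Finset.sum_congr rfl fun P hP => by rw [(Finset.mem_filter.mp hP).2]
    _ = (H.filter fun P => ⌊l * P.2.2⌋ = k).card * φ k := by rw [Finset.sum_const, nsmul_eq_mul]
    _ ≤ M * φ k := mul_le_mul_of_nonneg_right (hM k) (hφ k)

namespace Env
variable {N : ℕ} {c B A K l Λ : ℝ} {g a S : ℝ → ℝ → ℝ} {ψ : ℝ → ℝ} {f : ℝ × ℝ → ℝ}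

/-- The basic `L²` estimate. -/
theorem E2 (E : Env N c B A K l Λ g a S ψ f) (hB : Big c B K l Λ) (hlr : Λ ^ 4 ≤ l)
    (Q : Finset (ℝ × ℝ × ℝ)) (hQ : Pts l Q)
    (X : ℝ × ℝ × ℝ → ℝ → ℝ) (γ : ℝ × ℝ × ℝ → ℝ) (hX : ∀ P ∈ Q, Cut N A (γ P) (X P))
    {α m : ℝ} (hα : 0 < α) (hm : 0 < m) (hmf : ∫ x, |f x| ≤ m)
    (hw : ∀ P ∈ Q, α ≤ |wv g ψ l f (amp g a (X P) (1 / Λ) P.2.2) P|)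
    (htail : 8 * m * K * l * (1 / Λ) ^ N ≤ α ^ 2) :
    α ^ 2 * Q.card ≤ Λ ^ 12 * l ^ 2 * m := by
  classical
  have hL := hB.L100
  have hL0 : 0 < Λ := by linarith
  have hl := E.hl
  have hl0 : 0 < l := by linarith
  have hK0 : 0 < K := by linarith [E.hK]
  have hr : 0 < 1 / Λ := by positivity
  have hr1 : 1 / Λ ≤ 1 := by rw [div_le_one hL0]; linarith
  have hlr' : Λ ^ 2 ≤ l * (1 / Λ) ^ 2 := by
    rw [div_pow, one_pow, mul_one_div, le_div_iff₀ (by positivity)]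
    calc _ = Λ ^ 4 := by ring
      _ ≤ l := hlr
  have key : ∀ k ∈ Finset.Icc ⌊l⌋ ⌊2 * l⌋, ((Q.filter fun P => ⌊l * P.2.2⌋ = k).card : ℝ) ≤
      Λ ^ 11 * l * m / α ^ 2 := by
    intro k _
    set W := Q.filter fun P => ⌊l * P.2.2⌋ = k with hW
    have hWQ : W ⊆ Q := Finset.filter_subset _ _
    have hWP := hQ.mono hWQ
    by_contra hcon
    rw [not_le, div_lt_iff₀ (by positivity)] at hcon
    have hd : ∀ P ∈ W, deg (fun P P' => Tg g S B K l Λ (1 / Λ) P (γ P) P' (γ P')) l W P <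
        α ^ 2 * W.card / (8 * m * K * l * Λ) := by
      intro P hP
      have b1 : deg (fun P P' => Tg g S B K l Λ (1 / Λ) P (γ P) P' (γ P')) l W P ≤ Λ ^ 8 := by
        unfold deg
        set H := W.filter fun P' => Tg g S B K l Λ (1 / Λ) P (γ P) P' (γ P') with hH
        have hHW : H ⊆ W := Finset.filter_subset _ _
        have z : ∀ P' ∈ H, |P'.1 - P.1| ≤ 2 * Λ ^ 3 / l ∧ |(P'.2.1 - P.2.1) - 0 * (P'.1 - P.1)| ≤ 2 * Λ ^ 3 / l := by
          intro P' hP'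
          have t1 := (Finset.mem_filter.mp hP').2
          have t2 := (Finset.mem_filter.mp (hHW hP')).2
          have t3 := (Finset.mem_filter.mp hP).2
          have t4 := floor_close hl (t3.trans t2.symm)
          have t5 : K * (Λ * (|P.2.2 - P'.2.2| + 1 / (l * (1 / Λ)))) ≤ 2 * Λ ^ 3 / l := by
            calc _ ≤ Λ * (Λ * (1 / l + 1 / (l * (1 / Λ)))) := by gcongr; exact hB.K_le
              _ = Λ ^ 2 * (1 + Λ) / l := by field_simp
              _ ≤ Λ ^ 2 * (2 * Λ) / l := by gcongr; linarith
              _ = _ := by ring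
          refine ⟨?_, ?_⟩
          · rw [abs_sub_comm]; exact t1.2.2.1.trans t5
          · rw [zero_mul, sub_zero, abs_sub_comm]; exact t1.2.2.2.trans t5
        have cnt := count_le hl H (hWP.mono hHW).inj P.1 P.2.1 0 (2 * Λ ^ 3 / l) (2 * Λ ^ 3 / l) (by positivity)
          (by positivity) (fun P hP => (z P hP).1) (fun P hP => (z P hP).2)
        have e : l * (2 * Λ ^ 3 / l) = 2 * Λ ^ 3 := by field_simp
        rw [e, abs_zero] at cnt
        have h3 : 1 ≤ Λ ^ 3 := one_le_pow₀ (by linarith)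
        calc ∑ P' ∈ H, ww l P P' ≤ H.card * 1 := by
              rw [← nsmul_eq_mul]; exact Finset.sum_le_card_nsmul _ _ _ fun P' _ => ww_le_one _ _ _
          _ = H.card := mul_one _
          _ ≤ _ := cnt
          _ ≤ (6 * Λ ^ 3) * (10 * Λ ^ 3) := by gcongr <;> linarith only [h3]
          _ = 60 * Λ ^ 6 := by ring
          _ ≤ Λ ^ 2 * Λ ^ 6 := by gcongr; nlinarith only [hL]
          _ = _ := by ring
      refine b1.trans_lt ?_
      rw [lt_div_iff₀ (by positivity)]
      calc Λ ^ 8 * (8 * m * K * l * Λ) ≤ Λ ^ 8 * (8 * m * Λ * l * Λ) := by gcongr; exact hB.K_le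
        _ = (8 : ℝ) * (Λ ^ 10 * l * m) := by ring
        _ ≤ Λ * (Λ ^ 10 * l * m) := by gcongr; linarith
        _ = Λ ^ 11 * l * m := by ring
        _ < W.card * α ^ 2 := hcon
        _ = _ := mul_comm _ _
    have := E.few_bad hr hr1 hlr' W hWP.t_mem X γ (fun P hP => hX P (hWQ hP)) hα hm hmf
      (fun P hP => hw P (hWQ hP)) htail W subset_rfl hd
    have c0 : (W.card : ℝ) = 0 := by
      have : (0 : ℝ) ≤ W.card := Nat.cast_nonneg _
      linarith
    rw [c0, zero_mul] at hcon
    exact absurd hcon (not_lt.mpr (by positivity))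
  have tot := card_fiber Q _ (fun P => ⌊l * P.2.2⌋) (fun P hP => slot_mem hl (hQ.t_mem P hP)) key
  calc α ^ 2 * Q.card ≤ α ^ 2 * ((3 * l) * (Λ ^ 11 * l * m / α ^ 2)) := by
        refine mul_le_mul_of_nonneg_left (tot.trans ?_) (by positivity)
        exact mul_le_mul_of_nonneg_right (slot_card hl) (by positivity)
    _ = 3 * (Λ ^ 11 * l ^ 2 * m) := by field_simp
    _ ≤ Λ * (Λ ^ 11 * l ^ 2 * m) := by gcongr; linarith
    _ = _ := by ring

/-- The bilinear estimate. -/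
theorem bil (E : Env N c B A K l Λ g a S ψ f) (hB : Big c B K l Λ) {r : ℝ} (hr : 0 < r) (hr1 : r ≤ 1)
    (hlr : Λ ^ 2 ≤ l * r ^ 2)
    (Q : Finset (ℝ × ℝ × ℝ)) (hQ : Pts l Q)
    (X1 X2 : ℝ × ℝ × ℝ → ℝ → ℝ) (γ1 γ2 : ℝ × ℝ × ℝ → ℝ) (hX1 : ∀ P ∈ Q, Cut N A (γ1 P) (X1 P))
    (hX2 : ∀ P ∈ Q, Cut N A (γ2 P) (X2 P)) (hγ : ∀ P ∈ Q, 28 ≤ |γ1 P - γ2 P|)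
    {α m : ℝ} (hα : 0 < α) (hm : 0 < m) (hmf : ∫ x, |f x| ≤ m)
    (hw1 : ∀ P ∈ Q, α ≤ |wv g ψ l f (amp g a (X1 P) r P.2.2) P|)
    (hw2 : ∀ P ∈ Q, α ≤ |wv g ψ l f (amp g a (X2 P) r P.2.2) P|)
    (htail : 8 * m * K * l * (1 / Λ) ^ N ≤ α ^ 2) :
    α ^ 4 * Q.card ≤ Λ ^ 22 * l ^ 2 * m ^ 2 / r := by
  classical
  have hL := hB.L100
  have hL0 : 0 < Λ := by linarith
  have hl := E.hl
  have hl0 : 0 < l := by linarith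
  have hK0 : 0 < K := by linarith [E.hK]
  set T1 := fun P P' => Tg g S B K l Λ r P (γ1 P) P' (γ1 P') with hT1
  set T2 := fun P P' => Tg g S B K l Λ r P (γ2 P) P' (γ2 P') with hT2
  set n : ℝ := (Q.card : ℝ) with hn
  set D := α ^ 2 * n / (8 * m * K * l * Λ) with hD
  have hD0 : 0 ≤ D := by positivity
  set B1 := Q.filter fun P => deg T1 l Q P < D
  set B2 := Q.filter fun P => deg T2 l Q P < D
  have hb1 := E.few_bad hr hr1 hlr Q hQ.t_mem X1 γ1 hX1 hα hm hmf hw1 htail B1 (Finset.filter_subset _ _)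
    (fun P hP => (Finset.mem_filter.mp hP).2)
  have hb2 := E.few_bad hr hr1 hlr Q hQ.t_mem X2 γ2 hX2 hα hm hmf hw2 htail B2 (Finset.filter_subset _ _)
    (fun P hP => (Finset.mem_filter.mp hP).2)
  rw [← hn] at hb1 hb2
  set G := Q \ (B1 ∪ B2) with hG
  have hGQ : G ⊆ Q := Finset.sdiff_subset
  have hGc : n / 2 ≤ G.card := by
    have h1 : Q.card - (B1 ∪ B2).card ≤ G.card := Finset.le_card_sdiff (B1 ∪ B2) Q
    have h2 := Finset.card_union_le B1 B2
    have h3 : Q.card ≤ G.card + (B1.card + B2.card) := by omega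
    have h4 : n ≤ (G.card : ℝ) + (B1.card + B2.card) := by rw [hn]; exact_mod_cast h3
    linarith
  have low : n / 2 * D ^ 2 ≤ ∑ P ∈ G, deg T1 l Q P * deg T2 l Q P := by
    calc n / 2 * D ^ 2 ≤ G.card * D ^ 2 := by gcongr
      _ ≤ _ := by
        rw [← nsmul_eq_mul]
        refine Finset.card_nsmul_le_sum _ _ _ fun P hP => ?_
        rw [hG, Finset.mem_sdiff, Finset.mem_union, not_or, Finset.mem_filter, Finset.mem_filter, not_and, not_and,
          not_lt, not_lt] at hP
        have d1 := hP.2.1 hP.1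
        have d2 := hP.2.2 hP.1
        rw [sq]
        exact mul_le_mul d1 d2 hD0 (hD0.trans d1)
  have pair : ∀ P1 ∈ Q, ∀ P2 ∈ Q, ∑ P ∈ G, (if T1 P P1 then ww l P P1 else 0) * (if T2 P P2 then ww l P P2 else 0)
      ≤ Λ ^ 16 / r := by
    intro P1 hP1 P2 hP2
    set H := G.filter fun P => T1 P P1 ∧ T2 P P2 with hH
    have hHQ : H ⊆ Q := (Finset.filter_subset _ _).trans hGQ
    set h1 : ℤ → ℝ := fun k => 1 / (|(k : ℝ) - ⌊l * P1.2.2⌋| + 1) with hh1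
    set h2 : ℤ → ℝ := fun k => 1 / (|(k : ℝ) - ⌊l * P2.2.2⌋| + 1) with hh2
    have hp1 : ∀ k, 0 ≤ h1 k := fun k => by rw [hh1]; positivity
    have hp2 : ∀ k, 0 ≤ h2 k := fun k => by rw [hh2]; positivity
    calc _ = ∑ P ∈ H, ww l P P1 * ww l P P2 := by
          rw [hH, Finset.sum_filter]
          refine Finset.sum_congr rfl fun P _ => ?_
          by_cases q1 : T1 P P1 <;> by_cases q2 : T2 P P2 <;> simp [q1, q2]
      _ ≤ ∑ P ∈ H, (fun k => 3 / 2 * (h1 k + h2 k)) ⌊l * P.2.2⌋ := by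
          refine Finset.sum_le_sum fun P _ => ?_
          have w1 := ww_slot hl P P1
          have w2 := ww_slot hl P P2
          have w3 := two_mul_le_add_sq (ww l P P1) (ww l P P2)
          simp only [hh1, hh2]
          linarith only [w1, w2, w3]
      _ ≤ (Λ ^ 14 / r) * ∑ k ∈ Finset.Icc ⌊l⌋ ⌊2 * l⌋, 3 / 2 * (h1 k + h2 k) := by
          refine slot_sum hl H (fun P hP => hQ.t_mem P (hHQ hP)) (fun k => 3 / 2 * (h1 k + h2 k))
            (fun k => by have := hp1 k; have := hp2 k; positivity) fun k => ?_
          have hs : (H.filter fun P => ⌊l * P.2.2⌋ = k) ⊆ Q := (Finset.filter_subset _ _).trans hHQ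
          refine E.two_count hB hr hr1 _ (hQ.mono hs) γ1 γ2 (fun P hP => hγ P (hs hP)) P1 P2 ?_ ?_ ?_
          · intro P hP
            exact (Finset.mem_filter.mp (Finset.mem_filter.mp hP).1).2.1
          · intro P hP
            exact (Finset.mem_filter.mp (Finset.mem_filter.mp hP).1).2.2
          · intro P hP P' hP'
            exact floor_close hl ((Finset.mem_filter.mp hP).2.trans (Finset.mem_filter.mp hP').2.symm)
      _ ≤ (Λ ^ 14 / r) * (3 / 2 * (2 * Λ + 2 * Λ)) := by
          rw [← Finset.mul_sum, Finset.sum_add_distrib]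
          gcongr
          · exact slot_harm hB hl (hQ.t_mem P1 hP1)
          · exact slot_harm hB hl (hQ.t_mem P2 hP2)
      _ = 6 * (Λ ^ 15 / r) := by ring
      _ ≤ Λ * (Λ ^ 15 / r) := by gcongr; linarith
      _ = _ := by ring
  have up : ∑ P ∈ G, deg T1 l Q P * deg T2 l Q P ≤ n ^ 2 * (Λ ^ 16 / r) := by
    calc _ = ∑ P ∈ G, ∑ P1 ∈ Q, ∑ P2 ∈ Q, (if T1 P P1 then ww l P P1 else 0) * (if T2 P P2 then ww l P P2 else 0) := by
          refine Finset.sum_congr rfl fun P _ => ?_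
          rw [deg_eq, deg_eq, Finset.sum_mul_sum]
      _ = ∑ P1 ∈ Q, ∑ P2 ∈ Q, ∑ P ∈ G, (if T1 P P1 then ww l P P1 else 0) * (if T2 P P2 then ww l P P2 else 0) := by
          rw [Finset.sum_comm]
          exact Finset.sum_congr rfl fun P1 _ => Finset.sum_comm
      _ ≤ ∑ P1 ∈ Q, ∑ P2 ∈ Q, Λ ^ 16 / r :=
          Finset.sum_le_sum fun P1 h1 => Finset.sum_le_sum fun P2 h2 => pair P1 h1 P2 h2
      _ = _ := by simp only [Finset.sum_const, nsmul_eq_mul]; ring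
  have fin := low.trans up
  rcases Nat.eq_zero_or_pos Q.card with h0 | h0
  · rw [hn, h0]; simp; positivity
  have hn0 : 0 < n := by rw [hn]; exact_mod_cast h0
  have e1 : n / 2 * D ^ 2 = n ^ 2 * (α ^ 4 * n / (128 * m ^ 2 * K ^ 2 * l ^ 2 * Λ ^ 2)) := by
    rw [hD]; field_simp; ring
  rw [e1] at fin
  have f2 := le_of_mul_le_mul_left fin (by positivity)
  rw [div_le_iff₀ (by positivity)] at f2
  calc α ^ 4 * n ≤ Λ ^ 16 / r * (128 * m ^ 2 * K ^ 2 * l ^ 2 * Λ ^ 2) := f2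
    _ ≤ Λ ^ 16 / r * (128 * m ^ 2 * Λ ^ 2 * l ^ 2 * Λ ^ 2) := by gcongr; exact hB.K_le
    _ = 128 * (Λ ^ 20 * l ^ 2 * m ^ 2 / r) := by ring
    _ ≤ Λ ^ 2 * (Λ ^ 20 * l ^ 2 * m ^ 2 / r) := by gcongr; nlinarith only [hL]
    _ = _ := by ring

end Env

/-- Smooth partition of unity with jet bounds. -/
structure Prt (N : ℕ) (A0 : ℝ) (β : ℝ → ℝ) : Prop where
  sm : Smooth β
  supp : ∀ x, β x ≠ 0 → |x| ≤ 1
  sum : ∀ (n : ℕ) (x : ℝ), |x| ≤ n → ∑ j ∈ Finset.range (2 * n + 1), β (x - ((j : ℝ) - n)) = 1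
  jet : ∀ i ≤ N, ∀ x, |iteratedDeriv i β x| ≤ A0
  one : 1 ≤ A0

theorem exists_prt (N : ℕ) : ∃ (A0 : ℝ) (β : ℝ → ℝ), Prt N A0 β := by
  obtain ⟨β, h1, h2, h3⟩ := exists_part
  obtain ⟨A, hA0, hA⟩ := bdd_jet h1 (hcs_of (p := -1) (q := 1) fun x hx => abs_le.mp (h2 x hx)) N
  exact ⟨A + 1, β, h1, h2, h3, fun i hi x => (hA i hi x).trans (by linarith), by linarith⟩

theorem Cut.mono {N : ℕ} {A A' γ : ℝ} {X : ℝ → ℝ} (h : Cut N A γ X) (hA : A ≤ A') : Cut N A' γ X :=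
  ⟨h.sm, h.supp, fun i hi x => (h.jet i hi x).trans hA⟩

theorem Prt.base {N : ℕ} {A0 : ℝ} {β : ℝ → ℝ} (h : Prt N A0 β) (γ : ℝ) :
    Cut N A0 γ (fun x => β (x - γ)) := by
  refine ⟨h.sm.comp (contDiff_id.sub contDiff_const), fun x hx => h.supp _ hx, fun i hi x => ?_⟩
  rw [iteratedDeriv_comp_sub_const]
  exact h.jet i hi _

theorem Prt.child {N : ℕ} {A0 A γ Λ : ℝ} {β X : ℝ → ℝ} (h : Prt N A0 β) (hX : Cut N A γ X) (hΛ : 1 ≤ Λ) (γ' : ℝ) :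
    Cut N (2 ^ N * A0 * A) γ' (fun x => X (x / Λ) * β (x - γ')) := by
  have hb := h.base γ'
  have hΛ0 : 0 < Λ := by linarith
  have hA : 0 ≤ A := (abs_nonneg _).trans (hX.jet 0 (Nat.zero_le _) 0)
  have hXs : Smooth (fun x => X (x / Λ)) := hX.sm.comp (contDiff_id.div_const _)
  refine ⟨hXs.mul hb.sm, fun x hx => hb.supp x (right_ne_zero_of_mul hx), fun i hi x => ?_⟩
  have j1 : Jet N A 1 (fun x => X (x / Λ)) x := by
    intro k hk
    have e : (fun x => X (x / Λ)) = fun x => X (Λ⁻¹ * x) := by ext x; rw [div_eq_inv_mul]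
    rw [e, iteratedDeriv_comp_const_mul (hX.sm.of_le (by exact_mod_cast le_top))]
    simp only [abs_mul, one_pow, mul_one]
    have : |Λ⁻¹ ^ k| ≤ 1 := by
      rw [abs_of_nonneg (by positivity)]
      exact pow_le_one₀ (by positivity) (inv_le_one_of_one_le₀ hΛ)
    calc _ ≤ 1 * A := mul_le_mul this (hX.jet k hk _) (abs_nonneg _) zero_le_one
      _ = A := one_mul _
  have j2 : Jet N A0 1 (fun x => β (x - γ')) x := fun k hk => by simpa using hb.jet k hk x
  have := Jet.mul hXs hb.sm j1 j2 zero_le_one i hi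
  refine this.trans ?_
  have hA0 := h.one
  have : (1 + 1 : ℝ) ^ i ≤ 2 ^ N := by
    rw [one_add_one_eq_two]; exact pow_le_pow_right₀ (by norm_num) hi
  calc A * A0 * (1 + 1) ^ i ≤ A * A0 * 2 ^ N := by gcongr
    _ = _ := by ring

/-- Abstract broad-narrow dichotomy. -/
theorem broad2 (n : ℕ) (w : ℕ → ℝ) (hw : ∀ j, 0 ≤ w j) {α : ℝ} (hα : 0 < α)
    (hs : α ≤ ∑ j ∈ Finset.range n, w j) :
    (∃ j, α / 114 ≤ w j) ∨ ∃ i j : ℕ, (28 : ℝ) ≤ |(i : ℝ) - j| ∧ α / (2 * n) ≤ w i ∧ α / (2 * n) ≤ w j := by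
  have hn : n ≠ 0 := by
    rintro rfl; simp at hs; linarith
  have hn0 : (0 : ℝ) < n := by exact_mod_cast Nat.pos_of_ne_zero hn
  obtain ⟨i, hi, him⟩ := Finset.exists_max_image (Finset.range n) w ⟨0, by simp; omega⟩
  by_cases hc : α / 114 ≤ w i
  · exact Or.inl ⟨i, hc⟩
  right
  rw [not_le] at hc
  set near := (Finset.range n).filter fun j : ℕ => |(i : ℤ) - j| ≤ 28
  set far := (Finset.range n).filter fun j : ℕ => ¬ |(i : ℤ) - j| ≤ 28
  have hsp : ∑ j ∈ near, w j + ∑ j ∈ far, w j = ∑ j ∈ Finset.range n, w j := Finset.sum_filter_add_sum_filter_not _ _ _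
  have hcn : near.card ≤ 57 := by
    have : near ⊆ Finset.Icc (i - 28) (i + 28) := by
      intro j hj
      have := (Finset.mem_filter.mp hj).2
      rw [Finset.mem_Icc]
      rw [abs_le] at this
      omega
    refine (Finset.card_le_card this).trans ?_
    rw [Nat.card_Icc]; omega
  have hnear : ∑ j ∈ near, w j ≤ α / 2 := by
    calc ∑ j ∈ near, w j ≤ near.card * w i := by
          rw [← nsmul_eq_mul]
          exact Finset.sum_le_card_nsmul _ _ _ fun j hj => him j (Finset.mem_filter.mp hj).1
      _ ≤ 57 * (α / 114) := by
          gcongr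
          · exact hw i
          · exact_mod_cast hcn
      _ = α / 2 := by ring
  have hfar : ∃ j ∈ far, α / (2 * n) ≤ w j := by
    by_contra hcon
    push Not at hcon
    have hfn : far.Nonempty := by
      by_contra h
      rw [Finset.not_nonempty_iff_eq_empty] at h
      rw [h] at hsp; simp at hsp; linarith
    have : ∑ j ∈ far, w j < far.card * (α / (2 * n)) := by
      rw [← nsmul_eq_mul, ← Finset.sum_const]
      exact Finset.sum_lt_sum_of_nonempty hfn hcon
    have h2 : (far.card : ℝ) ≤ n := by
      have := Finset.card_le_card (Finset.filter_subset _ _ : far ⊆ Finset.range n)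
      rw [Finset.card_range] at this
      exact Nat.cast_le.mpr this
    have h3 : (far.card : ℝ) * (α / (2 * n)) ≤ n * (α / (2 * n)) := by gcongr
    have h4 : n * (α / (2 * n)) = α / 2 := by field_simp
    linarith
  obtain ⟨j, hj, hwj⟩ := hfar
  refine ⟨i, j, ?_, hwj.trans (him j (Finset.mem_filter.mp hj).1), hwj⟩
  have := (Finset.mem_filter.mp hj).2
  have h28 : (28 : ℤ) ≤ |(i : ℤ) - j| := by omega
  exact_mod_cast h28

theorem broad3 (n : ℕ) (w : ℕ → ℝ) (hw : ∀ j, 0 ≤ w j) {α : ℝ} (hα : 0 < α)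
    (hs : α ≤ ∑ j ∈ Finset.range n, w j) (hsm : ∀ j, w j ≤ α / 228) :
    ∃ i j k : ℕ, (28 : ℝ) ≤ |(i : ℝ) - j| ∧ (28 : ℝ) ≤ |(i : ℝ) - k| ∧ (28 : ℝ) ≤ |(j : ℝ) - k| ∧
      α / (2 * n) ≤ w i ∧ α / (2 * n) ≤ w j ∧ α / (2 * n) ≤ w k := by
  have nr : ∀ i : ℕ, ∀ T : Finset ℕ, ∑ j ∈ T with |(i : ℤ) - (j : ℕ)| ≤ 28, w j ≤ α / 4 := by
    intro i T
    set near := T.filter fun j : ℕ => |(i : ℤ) - j| ≤ 28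
    have hcn : near.card ≤ 57 := by
      have : near ⊆ Finset.Icc (i - 28) (i + 28) := by
        intro j hj
        have := (Finset.mem_filter.mp hj).2
        rw [Finset.mem_Icc]
        rw [abs_le] at this
        omega
      refine (Finset.card_le_card this).trans ?_
      rw [Nat.card_Icc]; omega
    calc ∑ j ∈ near, w j ≤ near.card * (α / 228) := by
          rw [← nsmul_eq_mul]
          exact Finset.sum_le_card_nsmul _ _ _ fun j hj => hsm j
      _ ≤ 57 * (α / 228) := by
          gcongr
          · exact_mod_cast hcn
      _ = α / 4 := by ring
  have hn : n ≠ 0 := by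
    rintro rfl; simp at hs; linarith
  have hn0 : (0 : ℝ) < n := by exact_mod_cast Nat.pos_of_ne_zero hn
  obtain ⟨i, hi, him⟩ := Finset.exists_max_image (Finset.range n) w ⟨0, by simp; omega⟩
  set far := (Finset.range n).filter fun j : ℕ => ¬ |(i : ℤ) - j| ≤ 28
  have hsp : ∑ j ∈ Finset.range n with |(i : ℤ) - (j : ℕ)| ≤ 28, w j + ∑ j ∈ far, w j = ∑ j ∈ Finset.range n, w j :=
    Finset.sum_filter_add_sum_filter_not _ _ _
  have h1 := nr i (Finset.range n)
  have hfs : 3 * α / 4 ≤ ∑ j ∈ far, w j := by linarith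
  have hfn : far.Nonempty := by
    by_contra h
    rw [Finset.not_nonempty_iff_eq_empty] at h
    rw [h] at hfs; simp at hfs; linarith
  obtain ⟨j, hj, hjm⟩ := Finset.exists_max_image far w hfn
  set far2 := far.filter fun k : ℕ => ¬ |(j : ℤ) - k| ≤ 28
  have hsp2 : ∑ k ∈ far with |(j : ℤ) - (k : ℕ)| ≤ 28, w k + ∑ k ∈ far2, w k = ∑ k ∈ far, w k :=
    Finset.sum_filter_add_sum_filter_not _ _ _
  have h2 := nr j far
  have hfs2 : α / 2 ≤ ∑ k ∈ far2, w k := by linarith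
  have hfar : ∃ k ∈ far2, α / (2 * n) ≤ w k := by
    by_contra hcon
    push Not at hcon
    have hfn : far2.Nonempty := by
      by_contra h
      rw [Finset.not_nonempty_iff_eq_empty] at h
      rw [h] at hfs2; simp at hfs2; linarith
    have : ∑ j ∈ far2, w j < far2.card * (α / (2 * n)) := by
      rw [← nsmul_eq_mul, ← Finset.sum_const]
      exact Finset.sum_lt_sum_of_nonempty hfn hcon
    have h2 : (far2.card : ℝ) ≤ n := by
      have := Finset.card_le_card ((Finset.filter_subset _ _ : far2 ⊆ far).trans (Finset.filter_subset _ _))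
      rw [Finset.card_range] at this
      exact Nat.cast_le.mpr this
    have h3 : (far2.card : ℝ) * (α / (2 * n)) ≤ n * (α / (2 * n)) := by gcongr
    have h4 : n * (α / (2 * n)) = α / 2 := by field_simp
    linarith
  obtain ⟨k, hk, hwk⟩ := hfar
  have hkf := (Finset.mem_filter.mp hk).1
  have a1 := hwk.trans (hjm k hkf)
  refine ⟨i, j, k, ?_, ?_, ?_, a1.trans (him j (Finset.mem_filter.mp hj).1), a1, hwk⟩
  · have := (Finset.mem_filter.mp hj).2
    have h28 : (28 : ℤ) ≤ |(i : ℤ) - j| := by omega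
    exact_mod_cast h28
  · have := (Finset.mem_filter.mp hkf).2
    have h28 : (28 : ℤ) ≤ |(i : ℤ) - k| := by omega
    exact_mod_cast h28
  · have := (Finset.mem_filter.mp hk).2
    have h28 : (28 : ℤ) ≤ |(j : ℤ) - k| := by omega
    exact_mod_cast h28

namespace Env
variable {N : ℕ} {c B A K l Λ : ℝ} {g a S : ℝ → ℝ → ℝ} {ψ : ℝ → ℝ} {f : ℝ × ℝ → ℝ}

theorem wv_sum (E : Env N c B A K l Λ g a S ψ f) {P : ℝ × ℝ × ℝ} (hP : P.2.2 ∈ Icc (1 : ℝ) 2)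
    (J : Finset ℕ) (b : ℝ → ℝ) (bj : ℕ → ℝ → ℝ) (hc : ∀ j, Continuous (bj j))
    (hs : ∀ j s, bj j s ≠ 0 → |s| ≤ 1) (hb : ∀ s, b s = ∑ j ∈ J, bj j s) :
    |wv g ψ l f b P| ≤ ∑ j ∈ J, |wv g ψ l f (bj j) P| := by
  have gc := (E.fam.g_sm _ hP).continuous
  have e : wv g ψ l f b P = ∑ j ∈ J, wv g ψ l f (bj j) P := by
    unfold wv
    rw [← integral_finsetSum]
    · refine integral_congr_ae (Filter.Eventually.of_forall fun x => ?_)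
      simp only [Ker, hb]
      rw [Finset.sum_mul, Finset.mul_sum]
    · intro j _
      have k1 := Ker_cont (l := l) (hc j) E.ψc gc
      obtain ⟨C, hC⟩ := (Ker_hcs E.hl (hs j) E.ψs gc).exists_bound_of_continuous k1
      exact E.fi.mul_bdd k1.aestronglyMeasurable (Filter.Eventually.of_forall hC)
  rw [e]
  exact Finset.abs_sum_le_sum_abs _ _

theorem cut_small (E : Env N c B A K l Λ g a S ψ f) {A' : ℝ} {P : ℝ × ℝ × ℝ} (hP : P.2.2 ∈ Icc (1 : ℝ) 2)
    {X : ℝ → ℝ} {γ r : ℝ} (hX : Cut N A' γ X) (hr : 0 < r) :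
    |wv g ψ l f (amp g a X r P.2.2) P| ≤ 8 * r / c * (B * A') * K := by
  have F := E.fam
  have hc := F.c_pos
  have hB := F.B_pos
  have hA' : 0 ≤ A' := (abs_nonneg _).trans (hX.jet 0 (Nat.zero_le _) 0)
  have hK0 : 0 ≤ K := by linarith [E.hK]
  have h1 := wv_le E.hl (F.amp_sm hP hX r).continuous (fun s => F.amp_supp hP) E.ψc E.ψs
    (F.g_sm _ hP).continuous E.fb
  have h2 : ∫ v, |ψ v| ≤ 2 * 1 * K := by
    refine (le_abs_self _).trans (abs_int_le (s0 := 0) zero_le_one (fun s hs => ?_) fun s => ?_)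
    · rw [sub_zero]; exact E.ψs s (by simpa using hs)
    · rw [abs_abs]; exact E.ψb s
  have h3 : ∫ s, |amp g a X r P.2.2 s| ≤ 2 * (2 * r / c) * (B * A') := by
    by_cases hz : ∃ s0, amp g a X r P.2.2 s0 ≠ 0
    swap
    · push Not at hz
      simp only [hz, abs_zero, integral_zero]; positivity
    obtain ⟨s0, hs0⟩ := hz
    refine (le_abs_self _).trans (abs_int_le (s0 := s0) (by positivity) (fun s hs => ?_) fun s => ?_)
    · have k1 := abs_le.mp (hX.supp _ (right_ne_zero_of_mul hs0))
      have k2 := abs_le.mp (hX.supp _ (right_ne_zero_of_mul (abs_ne_zero.mp hs)))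
      have k3 : |deriv (g P.2.2) s - deriv (g P.2.2) s0| ≤ 2 * r := by
        have : |deriv (g P.2.2) s / r - deriv (g P.2.2) s0 / r| ≤ 2 := by
          rw [abs_le]; constructor <;> linarith only [k1, k2]
        rwa [← sub_div, abs_div, abs_of_pos hr, div_le_iff₀ hr] at this
      rw [le_div_iff₀ hc]
      have k4 := abs_le.mp k3
      rcases le_total s s0 with h | h
      · have := (F.mono1 hP h).1
        rw [abs_of_nonpos (by linarith)]
        linarith only [this, k4]
      · have := (F.mono1 hP h).1
        rw [abs_of_nonneg (by linarith)]
        linarith only [this, k4]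
    · rw [abs_abs]; unfold amp; rw [abs_mul]
      have a1 := F.a_jet _ hP 0 (Nat.zero_le _) s
      have a2 := hX.jet 0 (Nat.zero_le _) (deriv (g P.2.2) s / r)
      rw [iteratedDeriv_zero] at a1 a2
      gcongr
  have h4 : 0 ≤ ∫ v, |ψ v| := integral_nonneg fun _ => abs_nonneg _
  calc _ ≤ _ := h1
    _ ≤ (2 * (2 * r / c) * (B * A')) * (2 * 1 * K) := by gcongr
    _ = _ := by ring

end Env

/-- The complete situation at frequency `l = Λ ^ (2 L)`. -/
structure Sit (N L : ℕ) (c B A0 A K l Λ : ℝ) (g a S : ℝ → ℝ → ℝ) (ψ : ℝ → ℝ) (f : ℝ × ℝ → ℝ)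
    (β : ℝ → ℝ) : Prop where
  env : Env N c B A K l Λ g a S ψ f
  big : Big c B K l Λ
  prt : Prt N A0 β
  hA : A = (2 ^ N * A0) ^ L
  A_le : A ≤ Λ
  p_le : (114 : ℝ) ^ L ≤ Λ
  hL : 2 ≤ L
  hl : l = Λ ^ (2 * L)

namespace Sit
variable {N L : ℕ} {c B A0 A K l Λ : ℝ} {g a S : ℝ → ℝ → ℝ} {ψ : ℝ → ℝ} {f : ℝ × ℝ → ℝ} {β : ℝ → ℝ}

theorem L0 (H : Sit N L c B A0 A K l Λ g a S ψ f β) : 0 < Λ := by linarith [H.big.L100]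

theorem cut_mono (H : Sit N L c B A0 A K l Λ g a S ψ f β) {k : ℕ} (hk : k + 1 ≤ L) {γ : ℝ} {X : ℝ → ℝ}
    (h : Cut N ((2 ^ N * A0) ^ (k + 1)) γ X) : Cut N A γ X := by
  refine h.mono ?_
  rw [H.hA]
  refine pow_le_pow_right₀ ?_ hk
  have := H.prt.one
  have h2 : (1 : ℝ) ≤ 2 ^ N := one_le_pow₀ (by norm_num)
  nlinarith

theorem sit_init (H : Sit N L c B A0 A K l Λ g a S ψ f β) {P : ℝ × ℝ × ℝ} (hP : P.2.2 ∈ Icc (1 : ℝ) 2) :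
    ∃ (m : ℕ) (X : ℕ → ℝ → ℝ) (γ0 : ℝ), (∀ j : ℕ, Cut N (2 ^ N * A0) (γ0 + (j : ℝ)) (X j)) ∧ 2 * (m : ℝ) ≤ Λ ^ 3 ∧
      |wv g ψ l f (a P.2.2) P| ≤ ∑ j ∈ Finset.range m, |wv g ψ l f (amp g a (X j) (1 / Λ) P.2.2) P| := by
  have F := H.env.fam
  have hL := H.big.L100
  have hL0 := H.L0
  have hB := F.B_pos
  set n := ⌈B * Λ⌉₊
  have hn : (n : ℝ) < B * Λ + 1 := Nat.ceil_lt_add_one (by positivity)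
  have hcut : ∀ j : ℕ, Cut N (2 ^ N * A0) (-(n : ℝ) + j) (fun x => β (x - (-(n : ℝ) + j))) := fun j => by
    refine (H.prt.base _).mono ?_
    have := H.prt.one
    have h2 : (1 : ℝ) ≤ 2 ^ N := one_le_pow₀ (by norm_num)
    nlinarith
  refine ⟨2 * n + 1, fun j x => β (x - (-(n : ℝ) + j)), -n, hcut, ?_, ?_⟩
  · push_cast
    have h1 : B * Λ ≤ Λ * Λ := by gcongr; exact H.big.B_le
    have h2 : 100 * (Λ * Λ) ≤ Λ * (Λ * Λ) := by gcongr
    nlinarith only [hn, h1, h2, hL]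
  · refine H.env.wv_sum hP _ _ (fun j => amp g a (fun x => β (x - (-(n : ℝ) + j))) (1 / Λ) P.2.2)
      (fun j => (F.amp_sm hP (hcut j) _).continuous) (fun j s => F.amp_supp hP) fun s => ?_
    unfold amp
    rw [← Finset.mul_sum]
    by_cases ha : a P.2.2 s = 0
    · rw [ha, zero_mul]
    have h1 := F.g_one _ hP s (F.a_supp _ hP s ha)
    have h2 : |deriv (g P.2.2) s / (1 / Λ)| ≤ n := by
      rw [div_div_eq_mul_div, div_one, abs_mul, abs_of_pos hL0]
      exact (mul_le_mul_of_nonneg_right h1 hL0.le).trans (Nat.le_ceil _)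
    have := H.prt.sum n _ h2
    have e : ∀ j : ℕ, (-(n : ℝ) + j) = (j : ℝ) - n := fun j => by ring
    simp only [e]
    rw [this, mul_one]

theorem child (H : Sit N L c B A0 A K l Λ g a S ψ f β) {P : ℝ × ℝ × ℝ} (hP : P.2.2 ∈ Icc (1 : ℝ) 2)
    {A' γ r : ℝ} {Y : ℝ → ℝ} (hY : Cut N A' γ Y) (hr : 0 < r) :
    ∃ (m : ℕ) (X : ℕ → ℝ → ℝ) (γ0 : ℝ), (∀ j : ℕ, Cut N (2 ^ N * A0 * A') (γ0 + (j : ℝ)) (X j)) ∧ 2 * (m : ℝ) ≤ Λ ^ 3 ∧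
      |wv g ψ l f (amp g a Y r P.2.2) P| ≤ ∑ j ∈ Finset.range m, |wv g ψ l f (amp g a (X j) (r / Λ) P.2.2) P| := by
  have F := H.env.fam
  have hL := H.big.L100
  have hL0 := H.L0
  set n := ⌈Λ⌉₊
  have hn : (n : ℝ) < Λ + 1 := Nat.ceil_lt_add_one (by positivity)
  have hcut : ∀ j : ℕ, Cut N (2 ^ N * A0 * A') ((Λ * γ - n) + j)
      (fun x => Y (x / Λ) * β (x - ((Λ * γ - n) + j))) := fun j => H.prt.child hY (by linarith) _
  refine ⟨2 * n + 1, fun j x => Y (x / Λ) * β (x - ((Λ * γ - n) + j)), Λ * γ - n, hcut, ?_, ?_⟩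
  · push_cast
    have h2 : 100 * (Λ * Λ) ≤ Λ * (Λ * Λ) := by gcongr
    nlinarith only [hn, h2, hL]
  · refine H.env.wv_sum hP _ _ (fun j => amp g a (fun x => Y (x / Λ) * β (x - ((Λ * γ - n) + j))) (r / Λ) P.2.2)
      (fun j => (F.amp_sm hP (hcut j) _).continuous) (fun j s => F.amp_supp hP) fun s => ?_
    unfold amp
    rw [← Finset.mul_sum]
    have e0 : deriv (g P.2.2) s / (r / Λ) / Λ = deriv (g P.2.2) s / r := by field_simp
    simp only [e0]
    rw [← Finset.mul_sum]
    by_cases ha : Y (deriv (g P.2.2) s / r) = 0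
    · rw [ha]; simp
    have h1 := hY.supp _ ha
    have h2 : |deriv (g P.2.2) s / (r / Λ) - Λ * γ| ≤ n := by
      have : deriv (g P.2.2) s / (r / Λ) - Λ * γ = Λ * (deriv (g P.2.2) s / r - γ) := by field_simp
      rw [this, abs_mul, abs_of_pos hL0]
      calc _ ≤ Λ * 1 := by gcongr
        _ ≤ n := by rw [mul_one]; exact Nat.le_ceil _
    have := H.prt.sum n _ h2
    have e : ∀ j : ℕ, deriv (g P.2.2) s / (r / Λ) - (Λ * γ - n + j) = deriv (g P.2.2) s / (r / Λ) - Λ * γ - (j - n) :=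
      fun j => by ring
    simp only [e]
    rw [this, mul_one]

/-- Broad alternative at level `k`. -/
def Far (N : ℕ) (A Λ : ℝ) (g a : ℝ → ℝ → ℝ) (ψ : ℝ → ℝ) (l : ℝ) (f : ℝ × ℝ → ℝ) (α : ℝ) (k : ℕ) (P : ℝ × ℝ × ℝ) : Prop :=
  ∃ (X1 X2 : ℝ → ℝ) (γ1 γ2 : ℝ), Cut N A γ1 X1 ∧ Cut N A γ2 X2 ∧ 28 ≤ |γ1 - γ2| ∧
    α / Λ ^ 4 ≤ |wv g ψ l f (amp g a X1 (1 / Λ ^ (k + 1)) P.2.2) P| ∧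
    α / Λ ^ 4 ≤ |wv g ψ l f (amp g a X2 (1 / Λ ^ (k + 1)) P.2.2) P|

theorem levels (H : Sit N L c B A0 A K l Λ g a S ψ f β) {P : ℝ × ℝ × ℝ} (hP : P.2.2 ∈ Icc (1 : ℝ) 2)
    {α : ℝ} (hα : 0 < α) (hw : α ≤ |wv g ψ l f (a P.2.2) P|) (k : ℕ) (hk : k + 1 ≤ L) :
    (∃ k' ≤ k, Far N A Λ g a ψ l f α k' P) ∨ ∃ (X : ℝ → ℝ) (γ : ℝ), Cut N ((2 ^ N * A0) ^ (k + 1)) γ X ∧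
      α / 114 ^ (k + 1) ≤ |wv g ψ l f (amp g a X (1 / Λ ^ (k + 1)) P.2.2) P| := by
  have hL0 := H.L0
  have hL := H.big.L100
  have step : ∀ k : ℕ, k + 1 ≤ L → ∀ (m : ℕ) (X : ℕ → ℝ → ℝ) (γ0 : ℝ),
      (∀ j : ℕ, Cut N ((2 ^ N * A0) ^ (k + 1)) (γ0 + (j : ℝ)) (X j)) → 2 * (m : ℝ) ≤ Λ ^ 3 →
      α / 114 ^ k ≤ ∑ j ∈ Finset.range m, |wv g ψ l f (amp g a (X j) (1 / Λ ^ (k + 1)) P.2.2) P| →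
      Far N A Λ g a ψ l f α k P ∨ ∃ (X : ℝ → ℝ) (γ : ℝ), Cut N ((2 ^ N * A0) ^ (k + 1)) γ X ∧
      α / 114 ^ (k + 1) ≤ |wv g ψ l f (amp g a X (1 / Λ ^ (k + 1)) P.2.2) P| := by
    intro k hk m X γ0 hX hm hs
    rcases broad2 m _ (fun j => abs_nonneg _) (by positivity) hs with ⟨j, hj⟩ | ⟨i, j, hij, hi, hj⟩
    · right
      refine ⟨X j, _, hX j, le_trans (le_of_eq ?_) hj⟩
      rw [div_div, pow_succ]
    · left
      have hm0 : 0 < (m : ℝ) := by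
        rcases Nat.eq_zero_or_pos m with h | h
        · rw [h] at hs; simp at hs
          exact absurd hs (not_le.mpr (by positivity))
        · exact_mod_cast h
      have hle : α / Λ ^ 4 ≤ α / 114 ^ k / (2 * m) := by
        rw [div_div]
        refine div_le_div_of_nonneg_left hα.le (by positivity) ?_
        have : (114 : ℝ) ^ k ≤ Λ := (pow_le_pow_right₀ (by norm_num) (by omega)).trans H.p_le
        calc _ ≤ Λ * Λ ^ 3 := by gcongr
          _ = _ := by ring
      refine ⟨X i, X j, _, _, H.cut_mono hk (hX i), H.cut_mono hk (hX j), ?_, hle.trans hi, hle.trans hj⟩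
      rw [add_sub_add_left_eq_sub]; exact hij
  induction k with
  | zero =>
    obtain ⟨m, X, γ0, hX, hm, hs⟩ := H.sit_init hP
    rcases step 0 hk m X γ0 (by simpa using hX) hm (by simpa using hw.trans hs) with h | h
    · exact Or.inl ⟨0, le_rfl, h⟩
    · exact Or.inr h
  | succ k ih =>
    rcases ih (by omega) with ⟨k', hk', h⟩ | ⟨Y, γ, hY, hYw⟩
    · exact Or.inl ⟨k', by omega, h⟩
    obtain ⟨m, X, γ0, hX, hm, hs⟩ := H.child hP hY (by positivity : 0 < 1 / Λ ^ (k + 1))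
    have e1 : 1 / Λ ^ (k + 1) / Λ = 1 / Λ ^ (k + 1 + 1) := by rw [div_div, ← pow_succ]
    rw [e1] at hs
    rcases step (k + 1) hk m X γ0 (fun j => by
        have := hX j
        rwa [mul_comm (2 ^ N * A0) , ← pow_succ] at this) hm (hYw.trans hs) with h | h
    · exact Or.inl ⟨k + 1, le_rfl, h⟩
    · exact Or.inr h

theorem Lam4 (H : Sit N L c B A0 A K l Λ g a S ψ f β) : Λ ^ 4 ≤ l := by
  rw [H.hl]; exact pow_le_pow_right₀ (by linarith [H.big.L100]) (by have := H.hL; omega)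

theorem small (H : Sit N L c B A0 A K l Λ g a S ψ f β) {P : ℝ × ℝ × ℝ} (hP : P.2.2 ∈ Icc (1 : ℝ) 2)
    {X : ℝ → ℝ} {γ r : ℝ} (hX : Cut N A γ X) (hr : 0 < r) :
    |wv g ψ l f (amp g a X r P.2.2) P| ≤ Λ ^ 5 * r := by
  have hL0 := H.L0
  have hL := H.big.L100
  have hc := H.env.fam.c_pos
  have hB := H.env.fam.B_pos
  have hK := H.env.hK
  have hA := H.env.hA
  have hcl : 1 / c ≤ Λ := by rw [div_le_iff₀ hc]; linarith [H.big.c_le]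
  have h8 := H.env.cut_small hP hX hr
  calc _ ≤ _ := h8
    _ = 8 * r * (1 / c) * (B * A) * K := by ring
    _ ≤ Λ * r * Λ * (Λ * Λ) * Λ := by
        gcongr
        · linarith
        · exact H.big.B_le
        · exact H.A_le
        · exact H.big.K_le
    _ = _ := by ring

/-- Estimate (E2) for the full operator. -/
theorem E2 (H : Sit N L c B A0 A K l Λ g a S ψ f β) (Q : Finset (ℝ × ℝ × ℝ)) (hQ : Pts l Q)
    {α m : ℝ} (hα : 0 < α) (hm : 0 < m) (hmf : ∫ x, |f x| ≤ m)
    (hw : ∀ P ∈ Q, α ≤ |wv g ψ l f (a P.2.2) P|) (htail : m * l * Λ ^ 10 ≤ α ^ 2 * Λ ^ N) :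
    α ^ 2 * Q.card ≤ Λ ^ 18 * l ^ 2 * m := by
  classical
  have hL0 := H.L0
  have hL := H.big.L100
  have hl0 : 0 < l := by linarith [H.env.hl]
  have ex : ∀ P ∈ Q, ∃ (X : ℝ → ℝ) (γ : ℝ), Cut N A γ X ∧ α / Λ ^ 3 ≤ |wv g ψ l f (amp g a X (1 / Λ) P.2.2) P| := by
    intro P hP
    obtain ⟨m, X, γ0, hX, hm, hs⟩ := H.sit_init (hQ.t_mem P hP)
    have hs' := (hw P hP).trans hs
    have hm0 : m ≠ 0 := by rintro rfl; simp at hs'; linarith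
    have hm1 : 0 < (m : ℝ) := by exact_mod_cast Nat.pos_of_ne_zero hm0
    by_contra hcon
    push Not at hcon
    have : ∑ j ∈ Finset.range m, |wv g ψ l f (amp g a (X j) (1 / Λ) P.2.2) P| < ∑ j ∈ Finset.range m, α / Λ ^ 3 :=
      Finset.sum_lt_sum_of_nonempty ⟨0, by simp; omega⟩ fun j _ => hcon (X j) _ (H.cut_mono (k := 0) (by have := H.hL; omega) (by simpa using hX j))
    rw [Finset.sum_const, nsmul_eq_mul, Finset.card_range] at this
    have h2 : (m : ℝ) * (α / Λ ^ 3) ≤ α := by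
      rw [mul_div_assoc', div_le_iff₀ (by positivity)]
      nlinarith only [hm, hα, hm1]
    linarith
  choose! X γ hX hXw using ex
  have := H.env.E2 H.big H.Lam4 Q hQ X γ hX (α := α / Λ ^ 3) (by positivity) hm hmf hXw ?_
  · rw [div_pow, div_mul_eq_mul_div, div_le_iff₀ (by positivity)] at this
    calc _ ≤ _ := this
      _ = _ := by ring
  · have hK := H.big.K_le
    have hK1 := H.env.hK
    rw [div_pow α, le_div_iff₀ (by positivity), one_div, inv_pow]
    rw [← div_eq_mul_inv, div_mul_eq_mul_div, div_le_iff₀ (by positivity)]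
    calc 8 * m * K * l * (Λ ^ 3) ^ 2 ≤ Λ * m * Λ * l * (Λ ^ 3) ^ 2 := by gcongr; linarith
      _ = m * l * Λ ^ 8 := by ring
      _ ≤ m * l * Λ ^ 10 := by gcongr; linarith; norm_num
      _ ≤ _ := htail

/-- Estimate (E5). -/
theorem E5 (H : Sit N L c B A0 A K l Λ g a S ψ f β) (Q : Finset (ℝ × ℝ × ℝ)) (hQ : Pts l Q)
    {α m : ℝ} (hα : 0 < α) (hm : 0 < m) (hmf : ∫ x, |f x| ≤ m)
    (hw : ∀ P ∈ Q, α ≤ |wv g ψ l f (a P.2.2) P|) (htail : m * l * Λ ^ 10 ≤ α ^ 2 * Λ ^ N) :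
    α ^ 5 * Q.card ≤ Λ ^ 48 * l ^ 2 * m ^ 2 := by
  classical
  have hL0 := H.L0
  have hL := H.big.L100
  have h1L : (1 : ℝ) ≤ Λ := by linarith
  have hl0 : 0 < l := by linarith [H.env.hl]
  have hL2 := H.hL
  obtain ⟨k, hk⟩ : ∃ k, L = k + 2 := ⟨L - 2, by omega⟩
  have hK := H.big.K_le
  have hK1 := H.env.hK
  have htail' : 8 * m * K * l * (1 / Λ) ^ N ≤ (α / Λ ^ 4) ^ 2 := by
    rw [div_pow α, le_div_iff₀ (by positivity), one_div, inv_pow]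
    rw [← div_eq_mul_inv, div_mul_eq_mul_div, div_le_iff₀ (by positivity)]
    calc 8 * m * K * l * (Λ ^ 4) ^ 2 ≤ Λ * m * Λ * l * (Λ ^ 4) ^ 2 := by gcongr; linarith
      _ = m * l * Λ ^ 10 := by ring
      _ ≤ _ := htail
  by_cases hnar : ∃ P ∈ Q, ∃ (X : ℝ → ℝ) (γ : ℝ), Cut N A γ X ∧
      α / Λ ≤ |wv g ψ l f (amp g a X (1 / Λ ^ (k + 1)) P.2.2) P|
  · obtain ⟨P, hP, X, γ, hX, hXw⟩ := hnar
    have e2 := H.E2 Q hQ hα hm hmf hw htail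
    have s1 := hXw.trans (H.small (hQ.t_mem P hP) hX (by positivity))
    rw [div_le_iff₀ hL0] at s1
    have s2 : α ≤ Λ ^ 2 * l * m := by
      have F := H.env.fam
      have := wv_le' (g := g) (P := P) (ψ := ψ) (l := l) H.env.hl (b := a P.2.2) (Mb := B) (Mψ := K)
        (fun s => by have := F.a_jet _ (hQ.t_mem P hP) 0 (Nat.zero_le _) s; rwa [iteratedDeriv_zero] at this)
        H.env.ψb H.env.fi
      calc α ≤ _ := hw P hP
        _ ≤ _ := this
        _ ≤ Λ * (l * Λ) * m := by
            have := H.env.hK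
            gcongr
            exact H.big.B_le
        _ = _ := by ring
    have s3 : α ^ 2 * l ≤ Λ ^ 14 := by
      calc α ^ 2 * l ≤ (Λ ^ 5 * (1 / Λ ^ (k + 1)) * Λ) ^ 2 * l := by gcongr
        _ = Λ ^ 14 := by rw [H.hl, hk]; field_simp; ring
    calc α ^ 5 * Q.card = α * α ^ 2 * (α ^ 2 * Q.card) := by ring
      _ ≤ (Λ ^ 2 * l * m) * α ^ 2 * (Λ ^ 18 * l ^ 2 * m) := by gcongr
      _ = (α ^ 2 * l) * (Λ ^ 20 * l ^ 2 * m ^ 2) := by ring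
      _ ≤ Λ ^ 14 * (Λ ^ 20 * l ^ 2 * m ^ 2) := by gcongr
      _ = Λ ^ 34 * l ^ 2 * m ^ 2 := by ring
      _ ≤ _ := by gcongr; norm_num
  · have hfar : ∀ P ∈ Q, ∃ k' ∈ Finset.range (k + 1), Far N A Λ g a ψ l f α k' P := by
      intro P hP
      rcases H.levels (hQ.t_mem P hP) hα (hw P hP) k (by omega) with ⟨k', hk', h⟩ | ⟨X, γ, hX, hXw⟩
      · exact ⟨k', by simp; omega, h⟩
      · exfalso
        refine hnar ⟨P, hP, X, γ, H.cut_mono (by omega) hX, le_trans ?_ hXw⟩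
        refine div_le_div_of_nonneg_left hα.le (by positivity) ?_
        exact (pow_le_pow_right₀ (by norm_num) (by omega)).trans H.p_le
    choose! κ hκ hF using hfar
    have fib : ∀ i ∈ Finset.range (k + 1), ((Q.filter fun P => κ P = i).card : ℝ) ≤ Λ ^ 47 * l ^ 2 * m ^ 2 / α ^ 5 := by
      intro i hi
      set W := Q.filter fun P => κ P = i with hW
      have hWQ : W ⊆ Q := Finset.filter_subset _ _
      rw [Finset.mem_range] at hi
      have hFW : ∀ P ∈ W, Far N A Λ g a ψ l f α i P := fun P hP => by
        have := hF P (hWQ hP)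
        rwa [(Finset.mem_filter.mp hP).2] at this
      rcases W.eq_empty_or_nonempty with h0 | ⟨P0, hP0⟩
      · rw [h0]; simp; positivity
      have hr : 0 < 1 / Λ ^ (i + 1) := by positivity
      have hr1 : 1 / Λ ^ (i + 1) ≤ 1 := by
        rw [div_le_one (by positivity)]; exact one_le_pow₀ h1L
      have hlr : Λ ^ 2 ≤ l * (1 / Λ ^ (i + 1)) ^ 2 := by
        rw [div_pow, one_pow, mul_one_div, le_div_iff₀ (by positivity), H.hl, ← pow_mul, ← pow_add]
        exact pow_le_pow_right₀ h1L (by omega)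
      have hrα : α ≤ Λ ^ 9 * (1 / Λ ^ (i + 1)) := by
        obtain ⟨X1, _, γ1, _, hX1, _, _, hw1, _⟩ := hFW P0 hP0
        have := hw1.trans (H.small (hQ.t_mem P0 (hWQ hP0)) hX1 hr)
        rw [div_le_iff₀ (by positivity)] at this
        calc α ≤ _ := this
          _ = _ := by ring
      choose! X1 X2 γ1 γ2 hX1 hX2 hγ hw1 hw2 using hFW
      have := H.env.bil H.big hr hr1 hlr W (hQ.mono hWQ) X1 X2 γ1 γ2 hX1 hX2 hγ (α := α / Λ ^ 4) (by positivity)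
        hm hmf hw1 hw2 htail'
      rw [div_pow, div_mul_eq_mul_div, div_le_iff₀ (by positivity)] at this
      rw [le_div_iff₀ (by positivity)]
      calc W.card * α ^ 5 = α * (α ^ 4 * W.card) := by ring
        _ ≤ (Λ ^ 9 * (1 / Λ ^ (i + 1))) * (Λ ^ 22 * l ^ 2 * m ^ 2 / (1 / Λ ^ (i + 1)) * (Λ ^ 4) ^ 4) := by gcongr
        _ = _ := by field_simp
    have tot := card_fiber Q _ κ hκ fib
    rw [Finset.card_range, mul_div_assoc', le_div_iff₀ (by positivity)] at tot
    have hkL : ((k + 1 : ℕ) : ℝ) ≤ Λ := by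
      refine le_trans ?_ H.p_le
      have h1 : k + 1 ≤ 114 ^ L := by
        have : L < 114 ^ L := Nat.lt_pow_self (by norm_num)
        omega
      exact_mod_cast h1
    calc α ^ 5 * Q.card = Q.card * α ^ 5 := mul_comm _ _
      _ ≤ _ := tot
      _ ≤ Λ * (Λ ^ 47 * l ^ 2 * m ^ 2) := by gcongr
      _ = _ := by ring

end Sit

namespace Fam
variable {N : ℕ} {c B : ℝ} {g a S : ℝ → ℝ → ℝ}

theorem three_pt' (F : Fam N c B g a S) {P P' : ℝ × ℝ × ℝ} (hP : P.2.2 ∈ Icc (1 : ℝ) 2)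
    (hP' : P'.2.2 ∈ Icc (1 : ℝ) 2) {δ r x1 x2 x3 : ℝ} (hr : 0 < r) (h12 : 10 * r ≤ |x1 - x2|)
    (h13 : 10 * r ≤ |x1 - x3|) (h23 : 10 * r ≤ |x2 - x3|)
    (h1 : |hh g S P x1 - hh g S P' x1| ≤ 2 * δ) (h2 : |hh g S P x2 - hh g S P' x2| ≤ 2 * δ)
    (h3 : |hh g S P x3 - hh g S P' x3| ≤ 2 * δ) :
    10 * c * r ^ 2 * |P.2.2 - P'.2.2| ≤ δ := by
  have k : ∀ {x y : ℝ}, 10 * r ≤ |x - y| → x ≤ y → x + 10 * r ≤ y := by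
    intro x y h h'
    rw [abs_of_nonpos (by linarith)] at h; linarith
  have h21 := h12
  have h31 := h13
  have h32 := h23
  rw [abs_sub_comm] at h21 h31 h32
  rcases le_total x1 x2 with o1 | o1 <;> rcases le_total x2 x3 with o2 | o2 <;> rcases le_total x1 x3 with o3 | o3
  · exact F.three_pt hP hP' hr (k h12 o1) (k h23 o2) h1 h2 h3
  · exact F.three_pt hP hP' hr (k h12 o1) (k h23 o2) h1 h2 h3
  · exact F.three_pt hP hP' hr (k h13 o3) (k h32 o2) h1 h3 h2
  · exact F.three_pt hP hP' hr (k h31 o3) (k h12 o1) h3 h1 h2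
  · exact F.three_pt hP hP' hr (k h21 o1) (k h13 o3) h2 h1 h3
  · exact F.three_pt hP hP' hr (k h23 o2) (k h31 o3) h2 h3 h1
  · exact F.three_pt hP hP' hr (k h32 o2) (k h21 o1) h3 h2 h1
  · exact F.three_pt hP hP' hr (k h32 o2) (k h21 o1) h3 h2 h1

end Fam

namespace Env
variable {N : ℕ} {c B A K l Λ : ℝ} {g a S : ℝ → ℝ → ℝ} {ψ : ℝ → ℝ} {f : ℝ × ℝ → ℝ}

theorem three_count (E : Env N c B A K l Λ g a S ψ f) (hB : Big c B K l Λ)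
    (Q : Finset (ℝ × ℝ × ℝ)) (hQ : Pts l Q) (γ1 γ2 γ3 : ℝ × ℝ × ℝ → ℝ)
    (h12 : ∀ P ∈ Q, 28 ≤ |γ1 P - γ2 P|) (h13 : ∀ P ∈ Q, 28 ≤ |γ1 P - γ3 P|) (h23 : ∀ P ∈ Q, 28 ≤ |γ2 P - γ3 P|)
    (P1 P2 P3 : ℝ × ℝ × ℝ)
    (h1 : ∀ P ∈ Q, Tg g S B K l Λ (1 / Λ) P (γ1 P) P1 (γ1 P1))
    (h2 : ∀ P ∈ Q, Tg g S B K l Λ (1 / Λ) P (γ2 P) P2 (γ2 P2))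
    (h3 : ∀ P ∈ Q, Tg g S B K l Λ (1 / Λ) P (γ3 P) P3 (γ3 P3)) :
    (Q.card : ℝ) ≤ Λ ^ 29 := by
  classical
  have hL := hB.L100
  have hL0 : 0 < Λ := by linarith
  have hl := E.hl
  have hl0 : 0 < l := by linarith
  have hB0 := E.fam.B_pos
  have hc := E.fam.c_pos
  have hK1 := E.hK
  have hr : 0 < 1 / Λ := by positivity
  have lE := lE_le hB hB0 E.fam.c_pos E.hK
  have key : (Q.card : ℝ) ≤ (Finset.univ : Finset (Bool × Bool × Bool)).card * Λ ^ 28 := by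
    refine card_fiber Q Finset.univ
      (fun P => (decide (P.2.2 ≤ P1.2.2), decide (P.2.2 ≤ P2.2.2), decide (P.2.2 ≤ P3.2.2)))
      (fun _ _ => Finset.mem_univ _) fun k _ => ?_
    set W := Q.filter fun P => (decide (P.2.2 ≤ P1.2.2), decide (P.2.2 ≤ P2.2.2), decide (P.2.2 ≤ P3.2.2)) = k with hW
    rcases W.eq_empty_or_nonempty with h0 | ⟨P0, hP0⟩
    · rw [h0]; simp; positivity
    have hWQ : W ⊆ Q := Finset.filter_subset _ _
    have hsg : ∀ P ∈ W, (P.2.2 ≤ P1.2.2 ↔ P0.2.2 ≤ P1.2.2) ∧ (P.2.2 ≤ P2.2.2 ↔ P0.2.2 ≤ P2.2.2) ∧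
        (P.2.2 ≤ P3.2.2 ↔ P0.2.2 ≤ P3.2.2) := by
      intro P hP
      have a1 := (Finset.mem_filter.mp hP).2
      have a2 := (Finset.mem_filter.mp hP0).2
      rw [← a2, Prod.mk.injEq, Prod.mk.injEq, decide_eq_decide, decide_eq_decide, decide_eq_decide] at a1
      exact a1
    have main : ∀ P ∈ W, |P.1 - P0.1| ≤ Λ ^ 13 / l ∧
        |(P.2.1 - P0.2.1) - 0 * (P.1 - P0.1)| ≤ 3 * Λ ^ 14 / l := by
      intro P hP
      have hPQ := hWQ hP
      have hP0Q := hWQ hP0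
      obtain ⟨x1, b1, c1, d1⟩ := E.tg_mid hr (hQ.t_mem P hPQ) (hQ.t_mem P0 hP0Q) (h1 P hPQ) (h1 P0 hP0Q) (hsg P hP).1
      obtain ⟨x2, b2, c2, d2⟩ := E.tg_mid hr (hQ.t_mem P hPQ) (hQ.t_mem P0 hP0Q) (h2 P hPQ) (h2 P0 hP0Q) (hsg P hP).2.1
      obtain ⟨x3, b3, c3, d3⟩ := E.tg_mid hr (hQ.t_mem P hPQ) (hQ.t_mem P0 hP0Q) (h3 P hPQ) (h3 P0 hP0Q) (hsg P hP).2.2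
      have s12 := sep_x hr (h12 P hPQ) (h1 P hPQ).2.1 (h2 P hPQ).2.1 c1 c2
      have s13 := sep_x hr (h13 P hPQ) (h1 P hPQ).2.1 (h3 P hPQ).2.1 c1 c3
      have s23 := sep_x hr (h23 P hPQ) (h2 P hPQ).2.1 (h3 P hPQ).2.1 c2 c3
      have tt := E.fam.three_pt' (hQ.t_mem P hPQ) (hQ.t_mem P0 hP0Q) hr s12 s13 s23 d1 d2 d3
      have ht : |P.2.2 - P0.2.2| ≤ Λ ^ 6 / l := by
        have e1 : |P.2.2 - P0.2.2| ≤ (c * Λ) * |P.2.2 - P0.2.2| := le_mul_of_one_le_left (abs_nonneg _) hB.c_le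
        have e2 : (c * Λ) * |P.2.2 - P0.2.2| = Λ ^ 3 * (10 * c * (1 / Λ) ^ 2 * |P.2.2 - P0.2.2|) / 10 := by
          field_simp
        have e3 : Λ ^ 3 * (10 * c * (1 / Λ) ^ 2 * |P.2.2 - P0.2.2|) ≤ Λ ^ 3 * (Λ * (Λ ^ 2 / l)) := by
          refine mul_le_mul_of_nonneg_left (tt.trans ?_) (by positivity)
          gcongr; exact hB.K_le
        have e4 : Λ ^ 3 * (Λ * (Λ ^ 2 / l)) = Λ ^ 6 / l := by ring
        have e5 : 0 < Λ ^ 6 / l := by positivity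
        rw [e4] at e3
        rw [e2] at e1
        linarith only [e1, e3, e5]
      obtain ⟨w1, w2⟩ := E.fam.two_pt (hQ.t_mem P hPQ) (hQ.t_mem P0 hP0Q) s12 d1 d2 b1 b2 ht
      have he : 2 * (K * (Λ ^ 2 / l)) + B * (1 + (2 * B / c) ^ 2) * (Λ ^ 6 / l) ≤ Λ ^ 12 / l := by
        have f1 : 2 * (K * (Λ ^ 2 / l)) + B * (1 + (2 * B / c) ^ 2) * (Λ ^ 6 / l)
            = (2 * (K * Λ ^ 2) * 1 + B * (1 + (2 * B / c) ^ 2) * Λ ^ 6) / l := by ring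
        rw [f1]
        gcongr
        calc _ ≤ 2 * (K * Λ ^ 2) * Λ ^ 6 + B * (1 + (2 * B / c) ^ 2) * Λ ^ 6 := by
              gcongr; exact one_le_pow₀ (by linarith)
          _ = (2 * (K * Λ ^ 2) + B * (1 + (2 * B / c) ^ 2)) * Λ ^ 6 := by ring
          _ ≤ Λ ^ 6 * Λ ^ 6 := by gcongr
          _ = _ := by ring
      have w3 : |P.1 - P0.1| ≤ Λ ^ 13 / l := by
        have e1 : |P.1 - P0.1| = Λ * (10 * (1 / Λ) * |P.1 - P0.1|) / 10 := by field_simp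
        have e2 : Λ * (10 * (1 / Λ) * |P.1 - P0.1|) ≤ Λ * (2 * (Λ ^ 12 / l)) := by
          refine mul_le_mul_of_nonneg_left (w1.trans ?_) hL0.le
          linarith only [he]
        have e3 : Λ * (2 * (Λ ^ 12 / l)) = 2 * (Λ ^ 13 / l) := by ring
        have e4 : 0 < Λ ^ 13 / l := by positivity
        linarith only [e1, e2, e3, e4]
      refine ⟨w3, ?_⟩
      rw [zero_mul, sub_zero]
      have q : |x1 * (P.1 - P0.1)| ≤ Λ * (Λ ^ 13 / l) := by
        rw [abs_mul]; gcongr; exact b1.trans hB.B_le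
      have q2 := abs_add_le ((P.2.1 - P0.2.1) - x1 * (P.1 - P0.1)) (x1 * (P.1 - P0.1))
      rw [sub_add_cancel] at q2
      have q3 : Λ ^ 12 / l ≤ Λ ^ 14 / l := by
        gcongr
        · linarith
        · norm_num
      have q4 : Λ * (Λ ^ 13 / l) = Λ ^ 14 / l := by ring
      have q5 : 3 * Λ ^ 14 / l = 3 * (Λ ^ 14 / l) := by ring
      have q6 : 0 < Λ ^ 14 / l := by positivity
      linarith only [q, q2, q3, q4, q5, q6, w2, he]
    have cnt := count_le hl W (hQ.mono hWQ).inj P0.1 P0.2.1 0 (Λ ^ 13 / l) (3 * Λ ^ 14 / l) (by positivity)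
      (by positivity) (fun P hP => (main P hP).1) (fun P hP => (main P hP).2)
    rw [abs_zero, mul_div_cancel₀ _ hl0.ne', mul_div_cancel₀ _ hl0.ne'] at cnt
    refine cnt.trans ?_
    have o1 : 1 ≤ Λ ^ 13 := one_le_pow₀ (by linarith)
    have o2 : 1 ≤ Λ ^ 14 := one_le_pow₀ (by linarith)
    calc _ ≤ (4 * Λ ^ 13) * (12 * Λ ^ 14) := by gcongr <;> linarith only [o1, o2]
      _ = 48 * Λ ^ 27 := by ring
      _ ≤ Λ * Λ ^ 27 := by gcongr; linarith
      _ = _ := by ring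
  refine key.trans ?_
  have : ((Finset.univ : Finset (Bool × Bool × Bool)).card : ℝ) = 8 := by simp
  rw [this]
  calc 8 * Λ ^ 28 ≤ Λ * Λ ^ 28 := by gcongr; linarith
    _ = _ := by ring

/-- points within a ball -/
theorem ball_count {l : ℝ} (hl : 1 ≤ l) (Q : Finset (ℝ × ℝ × ℝ)) (hQ : Pts l Q) {y1 y2 e : ℝ} (he : 1 ≤ l * e)
    (h1 : ∀ P ∈ Q, |P.1 - y1| ≤ e) (h2 : ∀ P ∈ Q, |P.2.1 - y2| ≤ e) : (Q.card : ℝ) ≤ 32 * (l * e) ^ 2 := by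
  have he0 : 0 ≤ e := by
    by_contra h
    nlinarith only [not_le.mp h, hl, he]
  have cnt := count_le hl Q hQ.inj y1 y2 0 e e he0 he0 h1 (fun P hP => by rw [zero_mul, sub_zero]; exact h2 P hP)
  rw [abs_zero] at cnt
  refine cnt.trans ?_
  nlinarith only [he]

theorem near_y (E : Env N c B A K l Λ g a S ψ f) (hB : Big c B K l Λ) {P P' : ℝ × ℝ × ℝ} {γ γ' T : ℝ}
    (hT : Λ ≤ T) (h : Tg g S B K l Λ (1 / Λ) P γ P' γ') (ht : l * |P.2.2 - P'.2.2| ≤ T) :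
    |P.1 - P'.1| ≤ 2 * Λ ^ 2 * T / l ∧ |P.2.1 - P'.2.1| ≤ 2 * Λ ^ 2 * T / l := by
  have hL := hB.L100
  have hL0 : 0 < Λ := by linarith
  have hl := E.hl
  have hl0 : 0 < l := by linarith
  have hK1 := E.hK
  have : K * (Λ * (|P.2.2 - P'.2.2| + 1 / (l * (1 / Λ)))) ≤ 2 * Λ ^ 2 * T / l := by
    have e : |P.2.2 - P'.2.2| + 1 / (l * (1 / Λ)) = (l * |P.2.2 - P'.2.2| + Λ) / l := by field_simp
    rw [e]
    calc _ ≤ Λ * (Λ * ((T + T) / l)) := by gcongr; exact hB.K_le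
      _ = _ := by ring
  exact ⟨h.2.2.1.trans this, h.2.2.2.trans this⟩

theorem near_count (E : Env N c B A K l Λ g a S ψ f) (hB : Big c B K l Λ) (Q : Finset (ℝ × ℝ × ℝ)) (hQ : Pts l Q)
    (γ : ℝ × ℝ × ℝ → ℝ) (P : ℝ × ℝ × ℝ) {T : ℝ} (hT : Λ ≤ T)
    (h : ∀ P' ∈ Q, Tg g S B K l Λ (1 / Λ) P (γ P) P' (γ P') ∧ l * |P.2.2 - P'.2.2| ≤ T) :
    (Q.card : ℝ) ≤ Λ ^ 6 * T ^ 2 := by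
  have hL := hB.L100
  have hL0 : 0 < Λ := by linarith
  have hl := E.hl
  have hl0 : 0 < l := by linarith
  have hT0 : 0 < T := by linarith
  have e : l * (2 * Λ ^ 2 * T / l) = 2 * Λ ^ 2 * T := by field_simp
  have h1 := ball_count hl Q hQ (y1 := P.1) (y2 := P.2.1) (e := 2 * Λ ^ 2 * T / l)
    (by rw [e]; nlinarith only [hL, hT, mul_pos hL0 hL0, mul_pos (mul_pos hL0 hL0) hT0])
    (fun P' hP' => by rw [abs_sub_comm]; exact (E.near_y hB hT (h P' hP').1 (h P' hP').2).1)
    (fun P' hP' => by rw [abs_sub_comm]; exact (E.near_y hB hT (h P' hP').1 (h P' hP').2).2)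
  rw [e] at h1
  refine h1.trans ?_
  calc 32 * (2 * Λ ^ 2 * T) ^ 2 = 128 * (Λ ^ 4 * T ^ 2) := by ring
    _ ≤ Λ ^ 2 * (Λ ^ 4 * T ^ 2) := by gcongr; nlinarith only [hL]
    _ = _ := by ring

theorem ww_far {l : ℝ} {P P' : ℝ × ℝ × ℝ} {s : ℝ} (hs : 0 < s) (h : s ^ 2 ≤ l * |P.2.2 - P'.2.2|) : ww l P P' ≤ 1 / s := by
  unfold ww
  refine div_le_div_of_nonneg_left zero_le_one hs ?_
  exact Real.le_sqrt_of_sq_le (h.trans (le_max_left _ _))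

end Env

namespace Env
variable {N : ℕ} {c B A K l Λ : ℝ} {g a S : ℝ → ℝ → ℝ} {ψ : ℝ → ℝ} {f : ℝ × ℝ → ℝ}

open Classical in
/-- far part of the weight -/
noncomputable def Fr (T : (ℝ × ℝ × ℝ) → (ℝ × ℝ × ℝ) → Prop) (l s : ℝ) (P P' : ℝ × ℝ × ℝ) : ℝ :=
  if T P P' ∧ s ^ 2 < l * |P.2.2 - P'.2.2| then ww l P P' else 0

theorem Fr_nonneg (T : (ℝ × ℝ × ℝ) → (ℝ × ℝ × ℝ) → Prop) (l s : ℝ) (P P' : ℝ × ℝ × ℝ) : 0 ≤ Fr T l s P P' := by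
  unfold Fr; split_ifs; exacts [ww_nonneg _ _ _, le_rfl]

theorem Fr_le (T : (ℝ × ℝ × ℝ) → (ℝ × ℝ × ℝ) → Prop) {l s : ℝ} (hs : 0 < s) (P P' : ℝ × ℝ × ℝ) :
    Fr T l s P P' ≤ 1 / s := by
  unfold Fr; split_ifs with h
  · exact ww_far hs h.2.le
  · positivity

theorem Fr_le' (T : (ℝ × ℝ × ℝ) → (ℝ × ℝ × ℝ) → Prop) {l s s1 : ℝ} (hs : 0 < s1) {P P' : ℝ × ℝ × ℝ}
    (h : s1 ^ 2 ≤ l * |P.2.2 - P'.2.2|) : Fr T l s P P' ≤ 1 / s1 := by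
  unfold Fr; split_ifs
  · exact ww_far hs h
  · positivity

theorem deg_far (E : Env N c B A K l Λ g a S ψ f) (hB : Big c B K l Λ) (Q : Finset (ℝ × ℝ × ℝ)) (hQ : Pts l Q)
    (γ : ℝ × ℝ × ℝ → ℝ) (P : ℝ × ℝ × ℝ) {sa s0 : ℝ} (hsa : 0 < sa) (hsa' : Λ ≤ sa ^ 2) (h0 : sa ≤ s0) :
    deg (fun P P' => Tg g S B K l Λ (1 / Λ) P (γ P) P' (γ P')) l Q P ≤
      Λ ^ 6 * sa ^ 4 + Λ ^ 6 * s0 ^ 4 / sa +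
      ∑ P' ∈ Q, Fr (fun P P' => Tg g S B K l Λ (1 / Λ) P (γ P) P' (γ P')) l s0 P P' := by
  classical
  set T := fun P P' => Tg g S B K l Λ (1 / Λ) P (γ P) P' (γ P') with hT
  have hs02 : sa ^ 2 ≤ s0 ^ 2 := by gcongr
  rw [deg_eq]
  set W1 := Q.filter fun P' => T P P' ∧ l * |P.2.2 - P'.2.2| ≤ sa ^ 2 with hW1
  set W2 := Q.filter fun P' => T P P' ∧ l * |P.2.2 - P'.2.2| ≤ s0 ^ 2 with hW2
  have c1 := E.near_count hB W1 (hQ.mono (Finset.filter_subset _ _)) γ P hsa' fun P' hP' => (Finset.mem_filter.mp hP').2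
  have c2 := E.near_count hB W2 (hQ.mono (Finset.filter_subset _ _)) γ P (hsa'.trans hs02) fun P' hP' => (Finset.mem_filter.mp hP').2
  calc _ ≤ ∑ P' ∈ Q, ((if T P P' ∧ l * |P.2.2 - P'.2.2| ≤ sa ^ 2 then (1 : ℝ) else 0) +
        (if T P P' ∧ l * |P.2.2 - P'.2.2| ≤ s0 ^ 2 then 1 / sa else 0) + Fr T l s0 P P') := by
        refine Finset.sum_le_sum fun P' _ => ?_
        have hF := Fr_nonneg T l s0 P P'
        have h1 : (0 : ℝ) ≤ 1 / sa := by positivity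
        by_cases hTP : T P P'
        swap
        · simp only [hTP, false_and, if_false]; linarith
        by_cases ha : l * |P.2.2 - P'.2.2| ≤ sa ^ 2
        · have := ww_le_one l P P'
          have hb := ha.trans hs02
          simp only [hTP, ha, hb, true_and, if_true]; linarith
        by_cases hb : l * |P.2.2 - P'.2.2| ≤ s0 ^ 2
        · have := ww_far (P := P) (P' := P') hsa (not_le.mp ha).le
          simp only [hTP, ha, hb, true_and, if_true, if_false]; linarith
        · have : Fr T l s0 P P' = ww l P P' := by
            unfold Fr; rw [if_pos ⟨hTP, not_le.mp hb⟩]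
          simp only [hTP, ha, hb, true_and, if_true, if_false]; linarith
    _ = W1.card + W2.card * (1 / sa) + ∑ P' ∈ Q, Fr T l s0 P P' := by
        rw [Finset.sum_add_distrib, Finset.sum_add_distrib, ← Finset.sum_filter, ← Finset.sum_filter, Finset.sum_const,
          Finset.sum_const, nsmul_eq_mul, nsmul_eq_mul, mul_one]
    _ ≤ Λ ^ 6 * (sa ^ 2) ^ 2 + Λ ^ 6 * (s0 ^ 2) ^ 2 * (1 / sa) + ∑ P' ∈ Q, Fr T l s0 P P' := by gcongr
    _ = _ := by ring

/-- The trilinear estimate. -/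
theorem tri (E : Env N c B A K l Λ g a S ψ f) (hB : Big c B K l Λ) (hlr : Λ ^ 4 ≤ l)
    (Q : Finset (ℝ × ℝ × ℝ)) (hQ : Pts l Q)
    (X1 X2 X3 : ℝ × ℝ × ℝ → ℝ → ℝ) (γ1 γ2 γ3 : ℝ × ℝ × ℝ → ℝ) (hX1 : ∀ P ∈ Q, Cut N A (γ1 P) (X1 P))
    (hX2 : ∀ P ∈ Q, Cut N A (γ2 P) (X2 P)) (hX3 : ∀ P ∈ Q, Cut N A (γ3 P) (X3 P))
    (h12 : ∀ P ∈ Q, 28 ≤ |γ1 P - γ2 P|) (h13 : ∀ P ∈ Q, 28 ≤ |γ1 P - γ3 P|) (h23 : ∀ P ∈ Q, 28 ≤ |γ2 P - γ3 P|)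
    {α m : ℝ} (hα : 0 < α) (hm : 0 < m) (hmf : ∫ x, |f x| ≤ m)
    (hw1 : ∀ P ∈ Q, α ≤ |wv g ψ l f (amp g a (X1 P) (1 / Λ) P.2.2) P|)
    (hw2 : ∀ P ∈ Q, α ≤ |wv g ψ l f (amp g a (X2 P) (1 / Λ) P.2.2) P|)
    (hw3 : ∀ P ∈ Q, α ≤ |wv g ψ l f (amp g a (X3 P) (1 / Λ) P.2.2) P|)
    (htail : 8 * m * K * l * (1 / Λ) ^ N ≤ α ^ 2) {D sa s0 s1 : ℝ}
    (hD : D = α ^ 2 * Q.card / (8 * m * K * l * Λ)) (hsa : 0 < sa) (hsa' : Λ ≤ sa ^ 2) (h0 : sa ≤ s0) (h1 : s0 ≤ s1)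
    (hDa : 4 * (Λ ^ 6 * sa ^ 4) ≤ D) (hD0 : 4 * (Λ ^ 6 * s0 ^ 4 / sa) ≤ D) :
    Q.card / 4 * (D / 2) ^ 3 ≤ Λ ^ 29 * (Q.card * (Λ ^ 6 * s1 ^ 4) ^ 2 / s0 ^ 3 + (Q.card : ℝ) ^ 3 / (s0 ^ 2 * s1)) := by
  classical
  have hL := hB.L100
  have hL0 : 0 < Λ := by linarith
  have hl := E.hl
  have hl0 : 0 < l := by linarith
  have hK0 : 0 < K := by linarith [E.hK]
  have hs0 : 0 < s0 := by linarith
  have hs1 : 0 < s1 := by linarith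
  have hr : 0 < 1 / Λ := by positivity
  have hr1 : 1 / Λ ≤ 1 := by rw [div_le_one hL0]; linarith
  have hlr' : Λ ^ 2 ≤ l * (1 / Λ) ^ 2 := by
    rw [div_pow, one_pow, mul_one_div, le_div_iff₀ (by positivity)]
    calc _ = Λ ^ 4 := by ring
      _ ≤ l := hlr
  set T1 := fun P P' => Tg g S B K l Λ (1 / Λ) P (γ1 P) P' (γ1 P') with hT1
  set T2 := fun P P' => Tg g S B K l Λ (1 / Λ) P (γ2 P) P' (γ2 P') with hT2
  set T3 := fun P P' => Tg g S B K l Λ (1 / Λ) P (γ3 P) P' (γ3 P') with hT3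
  set n : ℝ := (Q.card : ℝ) with hn
  have hn0 : 0 ≤ n := Nat.cast_nonneg _
  have hDp : 0 ≤ D := by rw [hD]; positivity
  set B1 := Q.filter fun P => deg T1 l Q P < D
  set B2 := Q.filter fun P => deg T2 l Q P < D
  set B3 := Q.filter fun P => deg T3 l Q P < D
  have hb1 := E.few_bad hr hr1 hlr' Q hQ.t_mem X1 γ1 hX1 hα hm hmf hw1 htail B1 (Finset.filter_subset _ _)
    (fun P hP => by rw [← hn, ← hD]; exact (Finset.mem_filter.mp hP).2)
  have hb2 := E.few_bad hr hr1 hlr' Q hQ.t_mem X2 γ2 hX2 hα hm hmf hw2 htail B2 (Finset.filter_subset _ _)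
    (fun P hP => by rw [← hn, ← hD]; exact (Finset.mem_filter.mp hP).2)
  have hb3 := E.few_bad hr hr1 hlr' Q hQ.t_mem X3 γ3 hX3 hα hm hmf hw3 htail B3 (Finset.filter_subset _ _)
    (fun P hP => by rw [← hn, ← hD]; exact (Finset.mem_filter.mp hP).2)
  rw [← hn] at hb1 hb2 hb3
  set G := Q \ (B1 ∪ B2 ∪ B3) with hG
  have hGQ : G ⊆ Q := Finset.sdiff_subset
  have hGc : n / 4 ≤ G.card := by
    have h1 : Q.card - (B1 ∪ B2 ∪ B3).card ≤ G.card := Finset.le_card_sdiff (B1 ∪ B2 ∪ B3) Q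
    have h2 := Finset.card_union_le B1 B2
    have h2' := Finset.card_union_le (B1 ∪ B2) B3
    have h3 : Q.card ≤ G.card + (B1.card + B2.card + B3.card) := by omega
    have h4 : n ≤ (G.card : ℝ) + (B1.card + B2.card + B3.card) := by rw [hn]; exact_mod_cast h3
    linarith
  set f1 := fun P P' => Fr T1 l s0 P P' with hf1
  set f2 := fun P P' => Fr T2 l s0 P P' with hf2
  set f3 := fun P P' => Fr T3 l s0 P P' with hf3
  have low : n / 4 * (D / 2) ^ 3 ≤ ∑ P ∈ G, (∑ P' ∈ Q, f1 P P') * (∑ P' ∈ Q, f2 P P') * (∑ P' ∈ Q, f3 P P') := by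
    calc n / 4 * (D / 2) ^ 3 ≤ G.card * (D / 2) ^ 3 := by gcongr
      _ ≤ _ := by
        rw [← nsmul_eq_mul]
        refine Finset.card_nsmul_le_sum _ _ _ fun P hP => ?_
        rw [hG, Finset.mem_sdiff, Finset.mem_union, Finset.mem_union, not_or, not_or, Finset.mem_filter, Finset.mem_filter,
          Finset.mem_filter, not_and, not_and, not_and, not_lt, not_lt, not_lt] at hP
        have d1 := hP.2.1.1 hP.1
        have d2 := hP.2.1.2 hP.1
        have d3 := hP.2.2 hP.1
        have e1 := E.deg_far hB Q hQ γ1 P hsa hsa' h0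
        have e2 := E.deg_far hB Q hQ γ2 P hsa hsa' h0
        have e3 := E.deg_far hB Q hQ γ3 P hsa hsa' h0
        have q1 : D / 2 ≤ ∑ P' ∈ Q, f1 P P' := by linarith only [d1, e1, hDa, hD0]
        have q2 : D / 2 ≤ ∑ P' ∈ Q, f2 P P' := by linarith only [d2, e2, hDa, hD0]
        have q3 : D / 2 ≤ ∑ P' ∈ Q, f3 P P' := by linarith only [d3, e3, hDa, hD0]
        have hD2 : 0 ≤ D / 2 := by positivity
        rw [pow_three, ← mul_assoc]
        exact mul_le_mul (mul_le_mul q1 q2 hD2 (hD2.trans q1)) q3 hD2 (mul_nonneg (hD2.trans q1) (hD2.trans q2))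
  set J := fun P P' : ℝ × ℝ × ℝ => |P'.1 - P.1| ≤ 4 * Λ ^ 2 * s1 ^ 2 / l ∧ |P'.2.1 - P.2.1| ≤ 4 * Λ ^ 2 * s1 ^ 2 / l with hJ
  have triple : ∀ P1 ∈ Q, ∀ P2 ∈ Q, ∀ P3 ∈ Q, ∑ P ∈ G, f1 P P1 * f2 P P2 * f3 P P3
      ≤ Λ ^ 29 * ((if J P1 P2 then (1 : ℝ) else 0) * (if J P1 P3 then (1 : ℝ) else 0) * (1 / s0 ^ 3) + 1 / (s0 ^ 2 * s1)) := by
    intro P1 hP1 P2 hP2 P3 hP3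
    set H := G.filter fun P => T1 P P1 ∧ T2 P P2 ∧ T3 P P3 with hH
    have hHQ : H ⊆ Q := (Finset.filter_subset _ _).trans hGQ
    have cH : (H.card : ℝ) ≤ Λ ^ 29 := by
      refine E.three_count hB H (hQ.mono hHQ) γ1 γ2 γ3 (fun P hP => h12 P (hHQ hP)) (fun P hP => h13 P (hHQ hP))
        (fun P hP => h23 P (hHQ hP)) P1 P2 P3 ?_ ?_ ?_
      · exact fun P hP => (Finset.mem_filter.mp hP).2.1
      · exact fun P hP => (Finset.mem_filter.mp hP).2.2.1
      · exact fun P hP => (Finset.mem_filter.mp hP).2.2.2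
    set R := (if J P1 P2 then (1 : ℝ) else 0) * (if J P1 P3 then (1 : ℝ) else 0) * (1 / s0 ^ 3) + 1 / (s0 ^ 2 * s1) with hR
    have hi : ∀ p : Prop, ∀ [Decidable p], (0 : ℝ) ≤ if p then (1 : ℝ) else 0 := fun p _ => by split_ifs <;> norm_num
    have hI : 0 ≤ (if J P1 P2 then (1 : ℝ) else 0) * (if J P1 P3 then (1 : ℝ) else 0) * (1 / s0 ^ 3) :=
      mul_nonneg (mul_nonneg (hi _) (hi _)) (by positivity)
    have hR0 : 0 ≤ R := by
      have : 0 ≤ 1 / (s0 ^ 2 * s1) := by positivity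
      linarith only [hI, this, hR]
    calc _ = ∑ P ∈ H, f1 P P1 * f2 P P2 * f3 P P3 := by
          symm
          refine Finset.sum_subset (Finset.filter_subset _ _) fun P hP hPH => ?_
          by_cases q1 : T1 P P1
          swap
          · have : f1 P P1 = 0 := by simp only [hf1, Fr]; rw [if_neg fun h => q1 h.1]
            rw [this]; ring
          by_cases q2 : T2 P P2
          swap
          · have : f2 P P2 = 0 := by simp only [hf2, Fr]; rw [if_neg fun h => q2 h.1]
            rw [this]; ring
          by_cases q3 : T3 P P3
          swap
          · have : f3 P P3 = 0 := by simp only [hf3, Fr]; rw [if_neg fun h => q3 h.1]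
            rw [this]; ring
          exact absurd (Finset.mem_filter.mpr ⟨hP, q1, q2, q3⟩) hPH
      _ ≤ H.card * R := by
          rw [← nsmul_eq_mul]
          refine Finset.sum_le_card_nsmul _ _ _ fun P hP => ?_
          obtain ⟨t1, t2, t3⟩ := (Finset.mem_filter.mp hP).2
          have a1 : f1 P P1 ≤ 1 / s0 := Fr_le T1 hs0 P P1
          have a2 : f2 P P2 ≤ 1 / s0 := Fr_le T2 hs0 P P2
          have a3 : f3 P P3 ≤ 1 / s0 := Fr_le T3 hs0 P P3
          have z1 : 0 ≤ f1 P P1 := Fr_nonneg _ _ _ _ _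
          have z2 : 0 ≤ f2 P P2 := Fr_nonneg _ _ _ _ _
          have z3 : 0 ≤ f3 P P3 := Fr_nonneg _ _ _ _ _
          have hs00 : 0 ≤ 1 / s0 := by positivity
          have fin : ∀ {x y z : ℝ}, 0 ≤ x → 0 ≤ y → 0 ≤ z → x ≤ 1 / s0 → y ≤ 1 / s0 → z ≤ 1 / s1 → x * y * z ≤ R := by
            intro x y z hx hy hz k1 k2 k3
            calc x * y * z ≤ 1 / s0 * (1 / s0) * (1 / s1) := by gcongr
              _ = 1 / (s0 ^ 2 * s1) := by field_simp
              _ ≤ R := by linarith only [hR, hI]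
          by_cases g1 : l * |P.2.2 - P1.2.2| ≤ s1 ^ 2
          swap
          · have := Fr_le' T1 (s := s0) hs1 (not_le.mp g1).le
            rw [mul_assoc, mul_comm]
            exact fin z2 z3 z1 a2 a3 this
          by_cases g2 : l * |P.2.2 - P2.2.2| ≤ s1 ^ 2
          swap
          · have := Fr_le' T2 (s := s0) hs1 (not_le.mp g2).le
            rw [mul_right_comm]
            exact fin z1 z3 z2 a1 a3 this
          by_cases g3 : l * |P.2.2 - P3.2.2| ≤ s1 ^ 2
          swap
          · exact fin z1 z2 z3 a1 a2 (Fr_le' T3 (s := s0) hs1 (not_le.mp g3).le)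
          have hΛ1 : Λ ≤ s1 ^ 2 := hsa'.trans (by gcongr; linarith)
          have y1 := E.near_y hB hΛ1 t1 g1
          have y2 := E.near_y hB hΛ1 t2 g2
          have y3 := E.near_y hB hΛ1 t3 g3
          have hhalf : 4 * Λ ^ 2 * s1 ^ 2 / l = 2 * Λ ^ 2 * s1 ^ 2 / l + 2 * Λ ^ 2 * s1 ^ 2 / l := by ring
          have j2 : J P1 P2 := by
            simp only [hJ]; rw [hhalf]
            constructor
            · refine (abs_sub_le _ P.1 _).trans (add_le_add ?_ y1.1)
              rw [abs_sub_comm]; exact y2.1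
            · refine (abs_sub_le _ P.2.1 _).trans (add_le_add ?_ y1.2)
              rw [abs_sub_comm]; exact y2.2
          have j3 : J P1 P3 := by
            simp only [hJ]; rw [hhalf]
            constructor
            · refine (abs_sub_le _ P.1 _).trans (add_le_add ?_ y1.1)
              rw [abs_sub_comm]; exact y3.1
            · refine (abs_sub_le _ P.2.1 _).trans (add_le_add ?_ y1.2)
              rw [abs_sub_comm]; exact y3.2
          rw [hR, if_pos j2, if_pos j3]
          calc _ ≤ 1 / s0 * (1 / s0) * (1 / s0) := by gcongr
            _ = 1 * 1 * (1 / s0 ^ 3) := by ring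
            _ ≤ _ := by
              have : 0 ≤ 1 / (s0 ^ 2 * s1) := by positivity
              linarith only [this]
      _ ≤ _ := by gcongr
  have Jc : ∀ P1, ∑ P2 ∈ Q, (if J P1 P2 then (1 : ℝ) else 0) ≤ Λ ^ 6 * s1 ^ 4 := by
    intro P1
    rw [← Finset.sum_filter, Finset.sum_const, nsmul_eq_mul, mul_one]
    set W := Q.filter fun P2 => J P1 P2
    have hΛ1 : Λ ≤ s1 ^ 2 := hsa'.trans (by gcongr; linarith)
    have e : l * (4 * Λ ^ 2 * s1 ^ 2 / l) = 4 * Λ ^ 2 * s1 ^ 2 := by field_simp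
    have := ball_count hl W (hQ.mono (Finset.filter_subset _ _)) (y1 := P1.1) (y2 := P1.2.1) (e := 4 * Λ ^ 2 * s1 ^ 2 / l)
      (by rw [e]
          have : 1 ≤ Λ ^ 2 := one_le_pow₀ (by linarith)
          nlinarith only [this, hΛ1, hL]) (fun P hP => (Finset.mem_filter.mp hP).2.1)
      (fun P hP => (Finset.mem_filter.mp hP).2.2)
    rw [e] at this
    refine this.trans ?_
    calc 32 * (4 * Λ ^ 2 * s1 ^ 2) ^ 2 = 512 * (Λ ^ 4 * s1 ^ 4) := by ring
      _ ≤ Λ ^ 2 * (Λ ^ 4 * s1 ^ 4) := by gcongr; nlinarith only [hL]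
      _ = _ := by ring
  have hi : ∀ p : Prop, ∀ [Decidable p], (0 : ℝ) ≤ if p then (1 : ℝ) else 0 := fun p _ => by split_ifs <;> norm_num
  have sumJ : ∑ P1 ∈ Q, ∑ P2 ∈ Q, ∑ P3 ∈ Q, (if J P1 P2 then (1 : ℝ) else 0) * (if J P1 P3 then (1 : ℝ) else 0) ≤
      n * (Λ ^ 6 * s1 ^ 4) ^ 2 := by
    rw [hn, ← nsmul_eq_mul]
    refine Finset.sum_le_card_nsmul _ _ _ fun P1 _ => ?_
    rw [← Finset.sum_mul_sum, sq (Λ ^ 6 * s1 ^ 4)]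
    exact mul_le_mul (Jc P1) (Jc P1) (Finset.sum_nonneg fun _ _ => hi _) (by positivity)
  refine low.trans ?_
  calc _ = ∑ P ∈ G, ∑ P1 ∈ Q, ∑ P2 ∈ Q, ∑ P3 ∈ Q, f1 P P1 * f2 P P2 * f3 P P3 := by
        refine Finset.sum_congr rfl fun P _ => ?_
        rw [Finset.sum_mul_sum, Finset.sum_mul]
        refine Finset.sum_congr rfl fun P1 _ => ?_
        rw [Finset.sum_mul]
        exact Finset.sum_congr rfl fun P2 _ => by rw [Finset.mul_sum]
    _ = ∑ P1 ∈ Q, ∑ P2 ∈ Q, ∑ P3 ∈ Q, ∑ P ∈ G, f1 P P1 * f2 P P2 * f3 P P3 := by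
        rw [Finset.sum_comm]
        refine Finset.sum_congr rfl fun P1 _ => ?_
        rw [Finset.sum_comm]
        exact Finset.sum_congr rfl fun P2 _ => Finset.sum_comm
    _ ≤ ∑ P1 ∈ Q, ∑ P2 ∈ Q, ∑ P3 ∈ Q, Λ ^ 29 * ((if J P1 P2 then (1 : ℝ) else 0) * (if J P1 P3 then (1 : ℝ) else 0) *
          (1 / s0 ^ 3) + 1 / (s0 ^ 2 * s1)) :=
        Finset.sum_le_sum fun P1 h1 => Finset.sum_le_sum fun P2 h2 => Finset.sum_le_sum fun P3 h3 => triple P1 h1 P2 h2 P3 h3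
    _ = Λ ^ 29 * ((∑ P1 ∈ Q, ∑ P2 ∈ Q, ∑ P3 ∈ Q, (if J P1 P2 then (1 : ℝ) else 0) * (if J P1 P3 then (1 : ℝ) else 0)) *
          (1 / s0 ^ 3) + n ^ 3 * (1 / (s0 ^ 2 * s1))) := by
        simp only [← Finset.mul_sum, Finset.sum_add_distrib, ← Finset.sum_mul, Finset.sum_const, nsmul_eq_mul, ← hn]
        ring
    _ ≤ Λ ^ 29 * (n * (Λ ^ 6 * s1 ^ 4) ^ 2 * (1 / s0 ^ 3) + n ^ 3 * (1 / (s0 ^ 2 * s1))) := by gcongr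
    _ = _ := by ring

end Env

/-- Estimate (Eg): the gain for large `α`. -/
theorem Sit.Eg {N : ℕ} {c B A0 A K l Λ : ℝ} {g a S : ℝ → ℝ → ℝ} {ψ : ℝ → ℝ} {f : ℝ × ℝ → ℝ} {β : ℝ → ℝ}
    (H : Sit N 704 c B A0 A K l Λ g a S ψ f β) (hN : 1420 ≤ N) (Q : Finset (ℝ × ℝ × ℝ)) (hQ : Pts l Q)
    {α m : ℝ} (hα : 0 < α) (hm : 0 < m) (hmf : ∫ x, |f x| ≤ m) (hmΛ : m ≤ Λ) (hα1 : 1 ≤ α * Λ)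
    (hα2 : 228 * (8 / c * (B * A) * K) ≤ α * Λ) (hn : (Q.card : ℝ) ≤ Λ * l ^ 2)
    (hw : ∀ P ∈ Q, α ≤ |wv g ψ l f (a P.2.2) P|) :
    (Q.card : ℝ) ≤ l ^ 2 / Λ := by
  have hL0 := H.L0
  have hL := H.big.L100
  have h1L : (1 : ℝ) ≤ Λ := by linarith
  have hK := H.big.K_le
  have hK1 := H.env.hK
  have hK0 : 0 < K := by linarith
  have hc := H.env.fam.c_pos
  have hl : l = Λ ^ 1408 := H.hl
  have hl0 : 0 < l := by rw [hl]; positivity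
  by_contra hcon
  push Not at hcon
  have hn0 : (0 : ℝ) < Q.card := lt_of_le_of_lt (by positivity) hcon
  have ex : ∀ P ∈ Q, ∃ (X1 X2 X3 : ℝ → ℝ) (γ1 γ2 γ3 : ℝ), Cut N A γ1 X1 ∧ Cut N A γ2 X2 ∧ Cut N A γ3 X3 ∧
      28 ≤ |γ1 - γ2| ∧ 28 ≤ |γ1 - γ3| ∧ 28 ≤ |γ2 - γ3| ∧
      α / Λ ^ 3 ≤ |wv g ψ l f (amp g a X1 (1 / Λ) P.2.2) P| ∧
      α / Λ ^ 3 ≤ |wv g ψ l f (amp g a X2 (1 / Λ) P.2.2) P| ∧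
      α / Λ ^ 3 ≤ |wv g ψ l f (amp g a X3 (1 / Λ) P.2.2) P| := by
    intro P hP
    have hPt := hQ.t_mem P hP
    obtain ⟨m, X, γ0, hX, hm, hs⟩ := H.sit_init hPt
    have hs' := (hw P hP).trans hs
    have hm0 : m ≠ 0 := by rintro rfl; simp at hs'; linarith
    have hm1 : 0 < (m : ℝ) := by exact_mod_cast Nat.pos_of_ne_zero hm0
    have hX' : ∀ j : ℕ, Cut N A (γ0 + (j : ℝ)) (X j) := fun j => H.cut_mono (k := 0) (by norm_num) (by simpa using hX j)
    obtain ⟨i, j, k, hij, hik, hjk, hi, hj, hk⟩ := broad3 m _ (fun j => abs_nonneg _) hα hs' (fun j => by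
      have := H.env.cut_small hPt (hX' j) (r := 1 / Λ) (by positivity)
      refine this.trans ?_
      rw [le_div_iff₀ (by norm_num)]
      have e : 8 * (1 / Λ) / c * (B * A) * K * 228 = 228 * (8 / c * (B * A) * K) / Λ := by ring
      rw [e, div_le_iff₀ hL0]; exact hα2)
    have hle : α / Λ ^ 3 ≤ α / (2 * m) := div_le_div_of_nonneg_left hα.le (by positivity) hm
    refine ⟨X i, X j, X k, _, _, _, hX' i, hX' j, hX' k, ?_, ?_, ?_, hle.trans hi, hle.trans hj, hle.trans hk⟩ <;>
    rwa [add_sub_add_left_eq_sub]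
  choose! X1 X2 X3 γ1 γ2 γ3 hX1 hX2 hX3 h12 h13 h23 hw1 hw2 hw3 using ex
  have hα' : 1 / Λ ^ 4 ≤ α / Λ ^ 3 := by
    rw [div_le_div_iff₀ (by positivity) (by positivity)]
    calc 1 * Λ ^ 3 ≤ (α * Λ) * Λ ^ 3 := by gcongr
      _ = _ := by ring
  have ha2 : 1 / Λ ^ 8 ≤ (α / Λ ^ 3) ^ 2 := by
    calc 1 / Λ ^ 8 = (1 / Λ ^ 4) ^ 2 := by rw [div_pow, one_pow, ← pow_mul]
      _ ≤ _ := by gcongr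
  set D := (α / Λ ^ 3) ^ 2 * Q.card / (8 * m * K * l * Λ) with hD
  have hDl : Λ ^ 1395 ≤ D := by
    rw [hD, le_div_iff₀ (by positivity)]
    calc Λ ^ 1395 * (8 * m * K * l * Λ) ≤ Λ ^ 1395 * (Λ * Λ * Λ * l * Λ) := by gcongr; linarith
      _ = 1 / Λ ^ 8 * (l ^ 2 / Λ) := by rw [hl]; field_simp
      _ ≤ _ := by gcongr
  have h4 : 4 ≤ Λ := by linarith
  have key := H.env.tri H.big H.Lam4 Q hQ X1 X2 X3 γ1 γ2 γ3 hX1 hX2 hX3 h12 h13 h23 (α := α / Λ ^ 3) (by positivity) hm hmf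
    hw1 hw2 hw3 ?_ hD (sa := Λ ^ 337) (s0 := Λ ^ 424) (s1 := Λ ^ 660) (by positivity) ?_ ?_ ?_ ?_ ?_
  · have hD0 : 0 < D := lt_of_lt_of_le (by positivity) hDl
    have k1 : (Q.card : ℝ) / 4 * (D / 2) ^ 3 = Q.card * (D ^ 3 / 32) := by ring
    have k2 : Λ ^ 29 * (Q.card * (Λ ^ 6 * (Λ ^ 660) ^ 4) ^ 2 / (Λ ^ 424) ^ 3 + (Q.card : ℝ) ^ 3 / ((Λ ^ 424) ^ 2 * Λ ^ 660)) =
      Q.card * (Λ ^ 29 * ((Λ ^ 6 * (Λ ^ 660) ^ 4) ^ 2 / (Λ ^ 424) ^ 3 + (Q.card : ℝ) ^ 2 / ((Λ ^ 424) ^ 2 * Λ ^ 660))) := by ring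
    rw [k1, k2] at key
    have key2 := le_of_mul_le_mul_left key hn0
    have e1 : (Λ ^ 6 * (Λ ^ 660) ^ 4) ^ 2 / (Λ ^ 424) ^ 3 = Λ ^ 4020 := by
      rw [div_eq_iff (by positivity)]; ring
    have e2 : (Q.card : ℝ) ^ 2 / ((Λ ^ 424) ^ 2 * Λ ^ 660) ≤ Λ ^ 4126 := by
      rw [div_le_iff₀ (by positivity)]
      calc (Q.card : ℝ) ^ 2 ≤ (Λ * l ^ 2) ^ 2 := by gcongr
        _ = _ := by rw [hl]; ring
    have e3 : Λ ^ 4020 ≤ Λ ^ 4126 := by gcongr; norm_num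
    rw [e1] at key2
    have : Λ ^ 4185 < Λ ^ 4158 := by
      calc Λ ^ 4185 = (Λ ^ 1395) ^ 3 := by ring
        _ ≤ D ^ 3 := by gcongr
        _ = 32 * (D ^ 3 / 32) := by ring
        _ ≤ 32 * (Λ ^ 29 * (Λ ^ 4126 + Λ ^ 4126)) := by
            gcongr
            refine key2.trans ?_
            gcongr
        _ = 64 * Λ ^ 4155 := by ring
        _ < Λ * Λ ^ 4155 := by gcongr; linarith
        _ = Λ ^ 4156 := by ring
        _ ≤ Λ ^ 4158 := by gcongr; norm_num
    have h2 : Λ ^ 4158 ≤ Λ ^ 4185 := by gcongr; norm_num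
    linarith only [this, h2]
  · refine le_trans ?_ ha2
    have : (1 / Λ) ^ N ≤ (1 / Λ) ^ 1420 := by
      refine pow_le_pow_of_le_one (by positivity) ?_ hN
      rw [div_le_one hL0]; exact h1L
    calc 8 * m * K * l * (1 / Λ) ^ N ≤ Λ * Λ * Λ * l * (1 / Λ) ^ 1420 := by gcongr; linarith
      _ = 1 / Λ ^ 9 := by rw [hl]; field_simp
      _ ≤ _ := by
        refine div_le_div_of_nonneg_left zero_le_one (by positivity) ?_
        gcongr; norm_num
  · calc Λ = Λ ^ 1 := (pow_one Λ).symm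
      _ ≤ Λ ^ (337 * 2) := by gcongr; norm_num
      _ = _ := pow_mul _ _ _
  · gcongr; norm_num
  · gcongr; norm_num
  · refine le_trans ?_ hDl
    calc 4 * (Λ ^ 6 * (Λ ^ 337) ^ 4) ≤ Λ * (Λ ^ 6 * (Λ ^ 337) ^ 4) := by gcongr
      _ = Λ ^ 1355 := by ring
      _ ≤ _ := by gcongr; norm_num
  · refine le_trans ?_ hDl
    have : Λ ^ 6 * (Λ ^ 424) ^ 4 / Λ ^ 337 = Λ ^ 1365 := by rw [div_eq_iff (by positivity)]; ring
    rw [this]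
    calc 4 * Λ ^ 1365 ≤ Λ * Λ ^ 1365 := by gcongr
      _ = Λ ^ 1366 := by ring
      _ ≤ _ := by gcongr; norm_num

/-- Logarithmic arithmetic behind the restricted estimate. -/
theorem arithD {x κ ε ε1 c' γ la ld ll lm LM lz : ℝ} (hx1 : 1 ≤ x) (hx2 : x < 2) (hκ : 3 * x - 1 < κ)
    (he1 : 0 < ε1) (hc' : 0 < c') (hγ : 0 < γ) (hγ1 : γ ≤ 1) (hLM : 0 ≤ LM) (hlz : 0 ≤ lz)
    (g1 : γ + ε ≤ ε1 * (κ - (3 * x - 1))) (g2 : γ + ε + 5 * ε1 ≤ c' * ((2 - x) / 2)) (g3 : γ + 2 * c' ≤ 1 / 1408)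
    (hll : 0 ≤ ll) (hlm : lm ≤ 0) (f1 : ld ≤ 2) (fa : la ≤ LM) (fb : la ≤ LM + ll + lm)
    (f2 : lz ≤ ll → (2 * la < lm - ll) ∨ (2 * la + ld ≤ ε * ll + lm ∧ 5 * la + ld ≤ ε * ll + 2 * lm))
    (eg : lz ≤ ll → -ε1 * ll ≤ la → ld ≤ -(1 / 1408) * ll) :
    κ * la + ld ≤ (2 + (κ + 5) * LM + (κ + 1) * lz) + (-γ) * ll + x * lm := by
  have hκ2 : 2 < κ := by linarith
  have p1 : 0 ≤ (κ + 5) * LM := by positivity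
  have p2 : 0 ≤ (κ + 1) * lz := by positivity
  have p3 : 0 ≤ γ * ll := by positivity
  rcases le_or_gt lz ll with hz | hz
  · rcases f2 hz with h | ⟨h2, h5⟩
    · nlinarith only [h, hκ2, hlm, mul_nonneg (by linarith : 0 ≤ 1 - γ) hll, p1, p2, f1,
        mul_nonneg (by linarith : 0 ≤ κ / 2 - x) (by linarith : 0 ≤ -lm),
        mul_nonneg (by linarith : 0 ≤ κ / 2 - 1) hll, mul_nonneg (by linarith : 0 ≤ κ / 2) (by linarith : 0 ≤ lm - ll - 2 * la)]
    · have ip : ∀ y : ℝ, 1 ≤ y → y ≤ 2 → (3 * y - 1) * la + ld ≤ ε * ll + y * lm := by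
        intro y y1 y2
        nlinarith only [mul_le_mul_of_nonneg_left h2 (by linarith : 0 ≤ 2 - y),
          mul_le_mul_of_nonneg_left h5 (by linarith : 0 ≤ y - 1)]
      rcases le_or_gt la (-ε1 * ll) with ha | ha
      · have := ip x hx1 hx2.le
        have h3 := mul_le_mul_of_nonneg_left ha (by linarith : 0 ≤ κ - (3 * x - 1))
        have h4 := mul_le_mul_of_nonneg_right g1 hll
        nlinarith only [this, h3, h4, p1, p2]
      · rcases le_or_gt lm (-c' * ll) with hm | hm
        · have := ip ((x + 2) / 2) (by linarith) (by linarith)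
          have h4 := mul_le_mul_of_nonneg_right g2 hll
          have h5 := mul_le_mul_of_nonneg_left hm (by linarith : 0 ≤ (2 - x) / 2)
          have h6 : (κ - (3 * ((x + 2) / 2) - 1)) * la ≤ (κ + 5) * LM + 5 * ε1 * ll := by
            have p4 : 0 ≤ 5 * ε1 * ll := by positivity
            rcases le_or_gt 0 (κ - (3 * ((x + 2) / 2) - 1)) with h | h
            · have k1 := mul_le_mul_of_nonneg_left fa h
              have k2 : (κ - (3 * ((x + 2) / 2) - 1)) * LM ≤ (κ + 5) * LM := by gcongr; linarith
              linarith
            · have k1 := mul_le_mul_of_nonneg_left ha.le (by linarith : 0 ≤ -(κ - (3 * ((x + 2) / 2) - 1)))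
              have k2 : -(κ - (3 * ((x + 2) / 2) - 1)) * (ε1 * ll) ≤ 5 * (ε1 * ll) := by gcongr; linarith
              nlinarith only [k1, k2, p1]
          nlinarith only [this, h4, h5, h6, p2]
        · have h1 := eg hz ha.le
          have h2 := mul_le_mul_of_nonneg_left fa (by linarith : 0 ≤ κ)
          have h3 := mul_le_mul_of_nonneg_right g3 hll
          have h4 := mul_le_mul_of_nonneg_left hm.le (by linarith : 0 ≤ x)
          have h5 : x * (c' * ll) ≤ 2 * (c' * ll) := by gcongr
          nlinarith only [h1, h2, h3, h4, h5, hLM, p2]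
  · have h1 := mul_le_mul_of_nonneg_left fb (by linarith : 0 ≤ κ)
    have h2 : κ * ll ≤ κ * lz := by gcongr
    have h3 : γ * ll ≤ 1 * lz := by gcongr
    have h4 : κ * lm ≤ x * lm := by nlinarith
    nlinarith only [h1, h2, h3, h4, hLM, f1]

/-- The source functions for the Littlewood-Paley kernel. -/
structure Src (N : ℕ) (Mx : ℝ) (Θ : ℝ → ℝ) : Prop where
  sm : Smooth Θ
  bd : ∀ x, |Θ x| ≤ Mx
  bd' : ∀ x, |iteratedDeriv N Θ x| ≤ Mx
  supp : ∀ x, iteratedDeriv N Θ x ≠ 0 → |x| ≤ 1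

theorem exists_sit (N L : ℕ) (hL : 2 ≤ L) (c B Mx : ℝ) (hc : 0 < c) (ω : ℝ) (hω : 0 < ω) :
    ∃ (A0 A K : ℝ) (β : ℝ → ℝ), ∃ l0 : ℝ, 1 ≤ l0 ∧ ∀ l, l0 ≤ l → 228 * (8 / c * (B * A) * K) ≤ l ^ ω ∧
      ∀ (g a S : ℝ → ℝ → ℝ) (Θ : ℝ → ℝ) (f : ℝ × ℝ → ℝ),
      Fam N c B g a S → Src N Mx Θ → (∀ x, |f x| ≤ 1) → Integrable f →
      Sit N L c B A0 A K l (l ^ (1 / (2 * L : ℝ))) g a S (iteratedDeriv N Θ) f β := by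
  obtain ⟨A0, β, hβ⟩ := exists_prt N
  have hA : 0 ≤ (2 ^ N * A0) ^ L := by have := hβ.one; positivity
  obtain ⟨K, hK1, hK⟩ := exists_env N c B ((2 ^ N * A0) ^ L) Mx hA
  have hL0 : (0 : ℝ) < L := by positivity
  have he : 0 < 1 / (2 * L : ℝ) := by positivity
  have t1 : Filter.Tendsto (fun l : ℝ => l ^ (1 / (2 * L : ℝ))) Filter.atTop Filter.atTop := tendsto_rpow_atTop he
  have t2 : Filter.Tendsto (fun l : ℝ => l ^ ω) Filter.atTop Filter.atTop := tendsto_rpow_atTop hω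
  have tl : ∀ᶠ l : ℝ in Filter.atTop, 1 + Real.log (l + 4) ≤ l ^ (1 / (2 * L : ℝ)) := by
    have h0 := (isLittleO_log_rpow_atTop he).bound (c := 1 / 2) (by norm_num)
    filter_upwards [h0, Filter.eventually_ge_atTop (4 : ℝ), t1.eventually_ge_atTop (2 * (1 + Real.log 2))] with l h1 h2 h3
    have h4 : Real.log (l + 4) ≤ Real.log 2 + Real.log l := by
      rw [← Real.log_mul (by norm_num) (by linarith)]
      exact Real.log_le_log (by linarith) (by linarith)
    rw [Real.norm_eq_abs, Real.norm_eq_abs, abs_of_nonneg (by positivity : 0 ≤ l ^ (1 / (2 * L : ℝ)))] at h1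
    have := le_abs_self (Real.log l)
    linarith
  have ev := (((((((t1.eventually_ge_atTop 100).and (t1.eventually_ge_atTop K)).and (t1.eventually_ge_atTop B)).and
    (t1.eventually_ge_atTop (1 / c))).and tl).and (t1.eventually_ge_atTop ((2 ^ N * A0) ^ L))).and
    (t1.eventually_ge_atTop ((114 : ℝ) ^ L))).and (t2.eventually_ge_atTop (228 * (8 / c * (B * ((2 ^ N * A0) ^ L)) * K)))
  obtain ⟨l0, h0⟩ := Filter.eventually_atTop.mp ev
  refine ⟨A0, (2 ^ N * A0) ^ L, K, β, max l0 1, le_max_right _ _, fun l hl => ?_⟩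
  obtain ⟨⟨⟨⟨⟨⟨⟨b1, b2⟩, b3⟩, b4⟩, b5⟩, b6⟩, b7⟩, b8⟩ := h0 l ((le_max_left _ _).trans hl)
  have hl1 : 1 ≤ l := (le_max_right _ _).trans hl
  refine ⟨b8, fun g a S Θ f F T hf hfi => ⟨hK g a S F l _ Θ f (by linarith) hl1 T.sm T.bd T.bd' T.supp hf hfi,
    ⟨b1, b2, b3, ?_, b5⟩, hβ, rfl, b6, b7, hL, ?_⟩⟩
  · rw [div_le_iff₀ hc] at b4; linarith
  · rw [← Real.rpow_natCast, ← Real.rpow_mul (by linarith)]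
    push_cast
    rw [one_div, inv_mul_cancel₀ (by positivity), Real.rpow_one]

/-- The restricted weak type estimate with a gain. -/
theorem thmD (x κ : ℝ) (hx1 : 1 ≤ x) (hx2 : x < 2) (hκ : 3 * x - 1 < κ) : ∃ (γ : ℝ) (N : ℕ), 0 < γ ∧
    ∀ c B Mx : ℝ, 0 < c → ∃ C : ℝ, 0 < C ∧ ∀ (g a S : ℝ → ℝ → ℝ) (Θ : ℝ → ℝ) (f : ℝ × ℝ → ℝ),
      Fam (N + 1) c B g a S → Src (N + 1) Mx Θ → (∀ x, |f x| ≤ 1) → Integrable f → ∀ l m α : ℝ, 1 ≤ l → 0 < m → m ≤ 1 →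
      ∫ x, |f x| ≤ m → 0 < α → ∀ Q : Finset (ℝ × ℝ × ℝ), Pts l Q → (Q.card : ℝ) ≤ 4 * l ^ 2 →
      (∀ P ∈ Q, α ≤ |wv g (iteratedDeriv (N + 1) Θ) l f (a P.2.2) P|) →
      α ^ κ * (Q.card / l ^ 2) ≤ C * l ^ (-γ) * m ^ x := by
  set c' : ℝ := 1 / 5632 with hc'
  set ε1 : ℝ := c' * (2 - x) / 80 with he1
  have hc0 : 0 < c' := by norm_num [hc']
  have hx0 : 0 < 2 - x := by linarith
  have he0 : 0 < ε1 := by positivity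
  have hδ : 0 < κ - (3 * x - 1) := by linarith
  set e0 : ℝ := min (ε1 * (κ - (3 * x - 1)) / 2) (c' * (2 - x) / 16) with hee
  have he00 : 0 < e0 := by positivity
  obtain ⟨L1, hL1⟩ := exists_nat_gt (24 / e0)
  set L := max L1 704 with hLdef
  have hL704 : 704 ≤ L := le_max_right _ _
  have hLpos : (0 : ℝ) < L := by positivity
  have hLe : 24 / (L : ℝ) ≤ e0 := by
    rw [div_le_iff₀ hLpos]
    rw [div_lt_iff₀ he00] at hL1
    have : (L1 : ℝ) ≤ L := by exact_mod_cast le_max_left _ _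
    nlinarith
  set γ : ℝ := min 1 (min (ε1 * (κ - (3 * x - 1)) / 2) (c' * (2 - x) / 4)) with hγ
  have hγ0 : 0 < γ := by positivity
  have hγ1 : γ ≤ 1 := min_le_left _ _
  have hγ2 : γ ≤ ε1 * (κ - (3 * x - 1)) / 2 := (min_le_right _ _).trans (min_le_left _ _)
  have hγ3 : γ ≤ c' * (2 - x) / 4 := (min_le_right _ _).trans (min_le_right _ _)
  have he2 : e0 ≤ ε1 * (κ - (3 * x - 1)) / 2 := min_le_left _ _
  have he3 : e0 ≤ c' * (2 - x) / 16 := min_le_right _ _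
  clear hγ hee hLdef
  clear_value γ e0 L ε1 c'
  refine ⟨γ, 4 * L + 9, hγ0, fun c B Mx hc => ?_⟩
  obtain ⟨A0, A, K, β, l0, hl0, H1⟩ := exists_sit (4 * L + 9 + 1) L (by omega) c B Mx hc 1 one_pos
  obtain ⟨A0', A', K', β', l0', hl0', H2⟩ := exists_sit (4 * L + 9 + 1) 704 (by omega) c B Mx hc (1 / 2816) (by norm_num)
  set M : ℝ := max 1 (4 * (B * Mx)) with hM
  set z := max l0 l0' with hz
  have hz1 : 1 ≤ z := hl0.trans (le_max_left _ _)
  have hM1 : 1 ≤ M := le_max_left _ _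
  refine ⟨Real.exp (2 + (κ + 5) * Real.log M + (κ + 1) * Real.log z), Real.exp_pos _, ?_⟩
  intro g a S Θ f F T hf hfi l m α hl hm hm1 hmf hα Q hQ hn hw
  have hl0p : 0 < l := by linarith
  rcases Q.eq_empty_or_nonempty with hQ0 | ⟨P0, hP0⟩
  · rw [hQ0]; simp; positivity
  have hn0 : (0 : ℝ) < Q.card := by exact_mod_cast Finset.card_pos.mpr ⟨P0, hP0⟩
  have hP0t := hQ.t_mem P0 hP0
  have hMx : 0 ≤ Mx := (abs_nonneg _).trans (T.bd 0)
  have hB := F.B_one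
  have aB : ∀ s, |a P0.2.2 s| ≤ B := fun s => by
    have := F.a_jet _ hP0t 0 (Nat.zero_le _) s; rwa [iteratedDeriv_zero] at this
  have ψc : Continuous (iteratedDeriv (4 * L + 9 + 1) Θ) := (T.sm.iteratedDeriv _).continuous
  have ba : α ≤ M := by
    refine (hw P0 hP0).trans ((wv_le hl (F.a_sm _ hP0t).continuous (F.a_supp _ hP0t) ψc T.supp
      (F.g_sm _ hP0t).continuous hf).trans ?_)
    have h2 : ∫ v, |iteratedDeriv (4 * L + 9 + 1) Θ v| ≤ 2 * 1 * Mx := by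
      refine (le_abs_self _).trans (abs_int_le (s0 := 0) zero_le_one (fun s hs => ?_) fun s => ?_)
      · rw [sub_zero]; exact T.supp s (by simpa using hs)
      · rw [abs_abs]; exact T.bd' s
    have h3 : ∫ v, |a P0.2.2 v| ≤ 2 * 1 * B := by
      refine (le_abs_self _).trans (abs_int_le (s0 := 0) zero_le_one (fun s hs => ?_) fun s => ?_)
      · rw [sub_zero]; exact F.a_supp _ hP0t s (by simpa using hs)
      · rw [abs_abs]; exact aB s
    calc _ ≤ (2 * 1 * B) * (2 * 1 * Mx) := by gcongr
      _ = 4 * (B * Mx) := by ring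
      _ ≤ M := le_max_right _ _
  have bb : α ≤ M * l * m := by
    refine (hw P0 hP0).trans ((wv_le' hl aB T.bd' hfi).trans ?_)
    have h1 : B * Mx ≤ M := le_trans (by nlinarith [mul_nonneg (by linarith : 0 ≤ B) hMx]) (le_max_right _ _)
    calc B * (l * Mx) * ∫ x, |f x| = (B * Mx) * l * ∫ x, |f x| := by ring
      _ ≤ _ := by gcongr
  set d : ℝ := Q.card / l ^ 2 with hd
  have hd0 : 0 < d := by positivity
  have hd4 : d ≤ 4 := by rw [hd, div_le_iff₀ (by positivity)]; exact hn
  have hM0 : 0 < M := by linarith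
  have eC : Real.exp (2 + (κ + 5) * Real.log M + (κ + 1) * Real.log z) * l ^ (-γ) * m ^ x =
      Real.exp ((2 + (κ + 5) * Real.log M + (κ + 1) * Real.log z) + (-γ) * Real.log l + x * Real.log m) := by
    rw [Real.rpow_def_of_pos hl0p, Real.rpow_def_of_pos hm, ← Real.exp_add, ← Real.exp_add]; congr 1; ring
  have eD : α ^ κ * d = Real.exp (κ * Real.log α + Real.log d) := by
    rw [Real.exp_add, Real.exp_log hd0, Real.rpow_def_of_pos hα, mul_comm κ]
  rw [eC, eD, Real.exp_le_exp]
  have hlogl : 0 ≤ Real.log l := Real.log_nonneg hl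
  have hz0 : 0 < z := by linarith
  refine arithD (ε := 24 / L) (ε1 := ε1) (c' := c') hx1 hx2 hκ he0 hc0 hγ0 hγ1 (Real.log_nonneg hM1) (Real.log_nonneg hz1) ?_ ?_ ?_
    hlogl (Real.log_nonpos hm.le hm1) ?_ ?_ ?_ ?_ ?_
  · linarith
  · have : 5 * ε1 = c' * (2 - x) / 16 := by rw [he1]; ring
    have h2 := mul_pos hc0 hx0
    have h3 : c' * ((2 - x) / 2) = c' * (2 - x) / 2 := by ring
    rw [h3]
    linarith only [this, hLe, he3, hγ3, h2]
  · have : c' * (2 - x) ≤ c' * 1 := by gcongr; linarith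
    linarith only [this, hγ3, hc']
  · have : Real.log d ≤ Real.log 4 := Real.log_le_log hd0 hd4
    have h4 : Real.log 4 = 2 * Real.log 2 := by
      rw [show (4 : ℝ) = 2 ^ 2 by norm_num, Real.log_pow]; norm_num
    have := Real.log_two_lt_d9
    linarith
  · exact Real.log_le_log hα ba
  · have := Real.log_le_log hα bb
    rwa [Real.log_mul (by positivity) hm.ne', Real.log_mul hM0.ne' hl0p.ne'] at this
  · intro hzl
    have hzl' : z ≤ l := (Real.log_le_log_iff hz0 hl0p).mp hzl
    have hs := (H1 l ((le_max_left _ _).trans hzl')).2 g a S Θ f F T hf hfi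
    set Λ := l ^ (1 / (2 * L : ℝ)) with hΛ
    have hΛ0 : 0 < Λ := by positivity
    have hlogΛ : Real.log Λ = 1 / (2 * L) * Real.log l := Real.log_rpow hl0p _
    by_cases ht : m * l * Λ ^ 10 ≤ α ^ 2 * Λ ^ (4 * L + 9 + 1)
    · right
      have e2 := hs.E2 Q hQ hα hm hmf hw ht
      have e5 := hs.E5 Q hQ hα hm hmf hw ht
      have h2 : α ^ 2 * d ≤ Λ ^ 48 * m := by
        rw [hd, mul_div_assoc', div_le_iff₀ (by positivity)]
        calc _ ≤ _ := e2
          _ ≤ Λ ^ 48 * l ^ 2 * m := by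
            have : 1 ≤ Λ := by linarith [hs.big.L100]
            gcongr; norm_num
          _ = _ := by ring
      have h5 : α ^ 5 * d ≤ Λ ^ 48 * m ^ 2 := by
        rw [hd, mul_div_assoc', div_le_iff₀ (by positivity)]
        calc _ ≤ _ := e5
          _ = _ := by ring
      have k2 := Real.log_le_log (by positivity) h2
      have k5 := Real.log_le_log (by positivity) h5
      rw [Real.log_mul (by positivity) hd0.ne', Real.log_mul (by positivity) (by positivity), Real.log_pow, Real.log_pow, hlogΛ] at k2 k5
      rw [Real.log_pow] at k5
      have e : ((48 : ℕ) : ℝ) * (1 / (2 * L) * Real.log l) = 24 / L * Real.log l := by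
        push_cast; ring
      rw [e] at k2 k5
      push_cast at k2 k5
      exact ⟨k2, k5⟩
    · left
      push Not at ht
      have := Real.log_lt_log (by positivity) ht
      rw [Real.log_mul (by positivity) (by positivity), Real.log_mul (by positivity) (by positivity),
        Real.log_mul (by positivity) (by positivity), Real.log_pow, Real.log_pow, Real.log_pow, hlogΛ] at this
      push_cast at this
      have e : (4 * (L : ℝ) + 9 + 1) * (1 / (2 * L) * Real.log l) = 2 * Real.log l + 10 * (1 / (2 * L) * Real.log l) := by
        field_simp; ring
      rw [e] at this
      linarith
  · intro hzl hla
    have hzl' : z ≤ l := (Real.log_le_log_iff hz0 hl0p).mp hzl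
    have hls : l0' ≤ l := (le_max_right _ _).trans hzl'
    have hs := (H2 l hls).2 g a S Θ f F T hf hfi
    have hb := (H2 l hls).1
    have e704 : (1 / (2 * ((704 : ℕ) : ℝ))) = 1 / 1408 := by norm_num
    rw [e704] at hs
    set Λ := l ^ (1 / 1408 : ℝ) with hΛ
    have hL100 := hs.big.L100
    have hαΛ : l ^ (1 / 2816 : ℝ) ≤ α * Λ := by
      rw [← Real.log_le_log_iff (by positivity) (by positivity), Real.log_mul hα.ne' (by positivity), Real.log_rpow hl0p,
        Real.log_rpow hl0p]
      have : ε1 ≤ 1 / 2816 := by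
        have : c' * (2 - x) ≤ c' * 1 := by gcongr; linarith
        rw [he1]; linarith only [this, hc']
      nlinarith only [this, hla, hlogl]
    have h1 : 1 ≤ l ^ (1 / 2816 : ℝ) := Real.one_le_rpow hl (by norm_num)
    have := hs.Eg (by omega) Q hQ hα hm hmf (by linarith) (h1.trans hαΛ) (hb.trans hαΛ)
      (hn.trans (by gcongr; linarith)) hw
    have hd' : d ≤ 1 / Λ := by
      rw [hd, div_le_iff₀ (by positivity)]
      calc _ ≤ _ := this
        _ = _ := by ring
    have := Real.log_le_log hd0 hd'
    rw [one_div, Real.log_inv, Real.log_rpow hl0p] at this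
    linarith

/-- Discrete layer cake. -/
theorem layer {ι : Type*} [DecidableEq ι] {M q κ : ℝ} (hM : 0 < M) (hκ : 0 < κ) (hq : κ < q) :
    ∃ C : ℝ, 0 < C ∧ ∀ (Q : Finset ι) (w : ι → ℝ) (R : ℝ), (∀ i ∈ Q, 0 ≤ w i ∧ w i ≤ M) → 0 ≤ R →
      (∀ α : ℝ, 0 < α → α ^ κ * ((Q.filter fun i => α ≤ w i).card : ℝ) ≤ R) → ∑ i ∈ Q, w i ^ q ≤ C * R := by
  set ρ : ℝ := (1 / 2) ^ (q - κ) with hρ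
  have hρ0 : 0 < ρ := by positivity
  have hρ1 : ρ < 1 := Real.rpow_lt_one (by norm_num) (by norm_num) (by linarith)
  have hq0 : 0 < q := by linarith
  have h1ρ : 0 < 1 - ρ := by linarith
  refine ⟨2 ^ κ * M ^ (q - κ) * (1 / (1 - ρ)), by positivity, fun Q w R hw hR h => ?_⟩
  set b : ℕ → ℝ := fun k => M * (1 / 2) ^ k with hb
  have hb0 : ∀ k, 0 < b k := fun k => by positivity
  have ptw : ∀ K : ℕ, ∀ v : ℝ, 0 ≤ v → v ≤ M →
      v ^ q ≤ ∑ k ∈ Finset.range K, (b k) ^ q * (if b k / 2 ≤ v then 1 else 0) + (b K) ^ q := by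
    intro K v hv0 hvM
    induction K with
    | zero => simp [hb]; exact Real.rpow_le_rpow hv0 hvM hq0.le
    | succ K ih =>
      rw [Finset.sum_range_succ]
      have hp := (Real.rpow_pos_of_pos (hb0 (K + 1)) q).le
      split_ifs with hc
      · linarith
      · have e : b (K + 1) = b K / 2 := by simp only [hb, pow_succ]; ring
        have : v ^ q ≤ b (K + 1) ^ q := by
          rw [e]; exact Real.rpow_le_rpow hv0 (by push Not at hc; exact hc.le) hq0.le
        have h0 : 0 ≤ ∑ k ∈ Finset.range K, (b k) ^ q * (if b k / 2 ≤ v then (1 : ℝ) else 0) :=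
          Finset.sum_nonneg fun k _ => mul_nonneg (Real.rpow_pos_of_pos (hb0 _) q).le (by split_ifs <;> norm_num)
        linarith
  have ebk : ∀ (k : ℕ) (e : ℝ), (b k) ^ e = M ^ e * ((1 / 2) ^ e) ^ k := fun k e => by
    simp only [hb]
    rw [Real.mul_rpow hM.le (by positivity), ← Real.rpow_natCast, ← Real.rpow_natCast, ← Real.rpow_mul (by norm_num),
      ← Real.rpow_mul (by norm_num), mul_comm e]
  have bound : ∀ K : ℕ, ∑ i ∈ Q, w i ^ q ≤ 2 ^ κ * M ^ (q - κ) * (1 / (1 - ρ)) * R + Q.card * (b K) ^ q := by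
    intro K
    calc ∑ i ∈ Q, w i ^ q ≤ ∑ i ∈ Q, (∑ k ∈ Finset.range K, (b k) ^ q * (if b k / 2 ≤ w i then 1 else 0) + (b K) ^ q) :=
          Finset.sum_le_sum fun i hi => ptw K (w i) (hw i hi).1 (hw i hi).2
      _ = ∑ k ∈ Finset.range K, (b k) ^ q * ((Q.filter fun i => b k / 2 ≤ w i).card : ℝ) + Q.card * (b K) ^ q := by
          rw [Finset.sum_add_distrib, Finset.sum_comm, Finset.sum_const, nsmul_eq_mul]
          congr 1
          refine Finset.sum_congr rfl fun k _ => ?_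
          rw [← Finset.mul_sum, Finset.sum_boole]
      _ ≤ ∑ k ∈ Finset.range K, 2 ^ κ * M ^ (q - κ) * R * ρ ^ k + Q.card * (b K) ^ q := by
          refine add_le_add (Finset.sum_le_sum fun k _ => ?_) le_rfl
          have h1 := h (b k / 2) (by have := hb0 k; positivity)
          rw [Real.div_rpow (hb0 k).le (by norm_num), div_mul_eq_mul_div, div_le_iff₀ (by positivity)] at h1
          have e1 : (b k) ^ q = (b k) ^ (q - κ) * (b k) ^ κ := by rw [← Real.rpow_add (hb0 k)]; congr 1; ring
          have e2 : (b k) ^ (q - κ) = M ^ (q - κ) * ρ ^ k := ebk k _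
          calc (b k) ^ q * ((Q.filter fun i => b k / 2 ≤ w i).card : ℝ) =
                (b k) ^ (q - κ) * ((b k) ^ κ * ((Q.filter fun i => b k / 2 ≤ w i).card : ℝ)) := by rw [e1]; ring
            _ ≤ (b k) ^ (q - κ) * (R * 2 ^ κ) := by
              have := (Real.rpow_pos_of_pos (hb0 k) (q - κ)).le
              gcongr
            _ = _ := by rw [e2]; ring
      _ ≤ _ := by
          rw [← Finset.mul_sum]
          have : ∑ k ∈ Finset.range K, ρ ^ k ≤ 1 / (1 - ρ) := by
            have := (summable_geometric_of_lt_one hρ0.le hρ1).sum_le_tsum (Finset.range K) (fun _ _ => by positivity)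
            rwa [tsum_geometric_of_lt_one hρ0.le hρ1, ← one_div] at this
          calc _ ≤ 2 ^ κ * M ^ (q - κ) * R * (1 / (1 - ρ)) + Q.card * (b K) ^ q := by gcongr
            _ = _ := by ring
  have lim : Filter.Tendsto (fun K : ℕ => 2 ^ κ * M ^ (q - κ) * (1 / (1 - ρ)) * R + Q.card * (b K) ^ q) Filter.atTop
      (nhds (2 ^ κ * M ^ (q - κ) * (1 / (1 - ρ)) * R + Q.card * (M ^ q * 0))) := by
    refine Filter.Tendsto.const_add _ (Filter.Tendsto.const_mul _ ?_)
    simp only [ebk]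
    exact Filter.Tendsto.const_mul _ (tendsto_pow_atTop_nhds_zero_of_lt_one (by positivity)
      (Real.rpow_lt_one (by norm_num) (by norm_num) hq0))
  have := ge_of_tendsto' lim bound
  simpa using this

/-- The `sup ≤ sum` trick. -/
theorem sup_trick {r q : ℝ} (hr : 0 < r) (hr1 : r < 1) (hq : 0 < q) (K : ℕ) (b : ℕ → ℝ) (hb : ∀ k, 0 ≤ b k) :
    (∑ k ∈ Finset.range K, b k) ^ q ≤ (1 / (1 - r)) ^ q * ∑ k ∈ Finset.range K, (b k / r ^ k) ^ q := by
  have h1r : 0 < 1 - r := by linarith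
  set T := ∑ k ∈ Finset.range K, (b k / r ^ k) ^ q with hT
  have hd : ∀ k, 0 ≤ b k / r ^ k := fun k => div_nonneg (hb k) (by positivity)
  have hT0 : 0 ≤ T := Finset.sum_nonneg fun k _ => Real.rpow_nonneg (hd k) _
  have h1 : ∀ k ∈ Finset.range K, b k ≤ r ^ k * T ^ (1 / q) := fun k hk => by
    have : (b k / r ^ k) ^ q ≤ T := Finset.single_le_sum (f := fun k => (b k / r ^ k) ^ q) (fun k _ => Real.rpow_nonneg (hd k) _) hk
    have h2 := Real.rpow_le_rpow (Real.rpow_nonneg (hd k) _) this (by positivity : 0 ≤ 1 / q)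
    rw [← Real.rpow_mul (hd k), mul_one_div_cancel hq.ne', Real.rpow_one, div_le_iff₀ (by positivity)] at h2
    linarith
  have h3 : ∑ k ∈ Finset.range K, b k ≤ (1 / (1 - r)) * T ^ (1 / q) := by
    refine (Finset.sum_le_sum h1).trans ?_
    rw [← Finset.sum_mul]
    gcongr
    have := (summable_geometric_of_lt_one hr.le hr1).sum_le_tsum (Finset.range K) (fun _ _ => by positivity)
    rwa [tsum_geometric_of_lt_one hr.le hr1, ← one_div] at this
  refine (Real.rpow_le_rpow (Finset.sum_nonneg fun k _ => hb k) h3 hq.le).trans (le_of_eq ?_)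
  rw [Real.mul_rpow (by positivity) (by positivity), ← Real.rpow_mul hT0, one_div_mul_cancel hq.ne', Real.rpow_one]

theorem wv_int {g : ℝ → ℝ → ℝ} {ψ : ℝ → ℝ} {l : ℝ} {b : ℝ → ℝ} {P : ℝ × ℝ × ℝ} {f : ℝ × ℝ → ℝ} (hl : 1 ≤ l)
    (hbc : Continuous b) (hψc : Continuous ψ) (hg : Continuous (g P.2.2)) {Mb Mψ : ℝ} (hb : ∀ s, |b s| ≤ Mb)
    (hψ : ∀ s, |ψ s| ≤ Mψ) (hf : Integrable f) : Integrable (fun x => f x * Ker g ψ l b P x) := by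
  refine hf.mul_bdd (c := Mb * (l * Mψ)) (Ker_cont hbc hψc hg).aestronglyMeasurable ?_
  refine Filter.Eventually.of_forall fun x => ?_
  have hM0 : 0 ≤ Mb := (abs_nonneg _).trans (hb 0)
  have hl0 : 0 ≤ l := by linarith
  unfold Ker
  rw [Real.norm_eq_abs, abs_mul, abs_mul, abs_of_nonneg hl0]
  exact mul_le_mul (hb _) (mul_le_mul_of_nonneg_left (hψ _) hl0) (by positivity) hM0

set_option maxHeartbeats 400000 in
/-- Local discrete strong type estimate. -/
theorem locD (p q : ℝ) (hp : 1 < p) (hpq : p ≤ q) (hq2 : q < 2 * p) (hq3 : 3 * (q / p) - 1 < q) :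
    ∃ (γ : ℝ) (N : ℕ), 0 < γ ∧
    ∀ c B Mx : ℝ, 0 < c → ∃ C : ℝ, 0 < C ∧ ∀ (g a S : ℝ → ℝ → ℝ) (Θ : ℝ → ℝ) (f : ℝ × ℝ → ℝ),
      Fam (N + 1) c B g a S → Src (N + 1) Mx Θ → Measurable f → (∃ b, ∀ x, |f x| ≤ b) → Integrable f → ∫ x, |f x| ≤ 1 →
      Integrable (fun x => |f x| ^ p) → ∫ x, |f x| ^ p ≤ 1 → ∀ l : ℝ, 1 ≤ l → 
      ∀ Q : Finset (ℝ × ℝ × ℝ), Pts l Q → (Q.card : ℝ) ≤ 4 * l ^ 2 →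
      ∑ P ∈ Q, |wv g (iteratedDeriv (N + 1) Θ) l f (a P.2.2) P| ^ q ≤ C * l ^ (-γ) * l ^ 2 := by
  classical
  have hp0 : 0 < p := by linarith
  have hq0 : 0 < q := by linarith
  set x0 := q / p with hx0
  have hx01 : 1 ≤ x0 := by rw [hx0, le_div_iff₀ hp0]; linarith
  have hx02 : x0 < 2 := by rw [hx0, div_lt_iff₀ hp0]; linarith
  obtain ⟨x, hxa, hxb⟩ := exists_between (show x0 < min 2 ((q + 1) / 3) from lt_min hx02 (by linarith))
  have hx2 : x < 2 := hxb.trans_le (min_le_left _ _)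
  have hx3 : 3 * x - 1 < q := by have := hxb.trans_le (min_le_right _ _); linarith
  obtain ⟨κ, hκ1, hκ2⟩ := exists_between hx3
  have hpx : q < p * x := by rw [hx0, div_lt_iff₀ hp0] at hxa; linarith
  obtain ⟨γ, N, hγ, HD⟩ := thmD x κ (by linarith) hx2 hκ1
  refine ⟨γ, N, hγ, fun c B Mx hc => ?_⟩
  obtain ⟨C, hC, HC⟩ := HD c B Mx hc
  obtain ⟨C2, hC2, HL⟩ := layer (ι := ℝ × ℝ × ℝ) (M := max 1 (4 * (B * Mx))) (by positivity) (by linarith : 0 < κ) hκ2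
  set δ := (p * x - q) / (2 * q) with hδ
  have hδ0 : 0 < δ := div_pos (by linarith) (by linarith)
  set r : ℝ := (1 / 2) ^ δ with hr
  have hr0 : 0 < r := by positivity
  have hr1 : r < 1 := Real.rpow_lt_one (by norm_num) (by norm_num) hδ0
  set ρ : ℝ := (1 / 2) ^ ((p * x - q) / 2) with hρ
  have hρ0 : 0 < ρ := by positivity
  have hρ1 : ρ < 1 := Real.rpow_lt_one (by norm_num) (by norm_num) (by linarith)
  have h1r : 0 < 1 - r := by linarith
  have h1ρ : 0 < 1 - ρ := by linarith
  refine ⟨(1 / (1 - r)) ^ q * (C2 * C * 2 ^ (p * x)) * (1 / (1 - ρ)), by positivity, ?_⟩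
  intro g a S Θ f F T hfm ⟨b, hfb⟩ hfi hf1 hfp hfp1 l hl Q hQ hn
  have hl0 : 0 < l := by linarith
  have hB := F.B_one
  have aB : ∀ P ∈ Q, ∀ s, |a P.2.2 s| ≤ B := fun P hP s => by
    have := F.a_jet _ (hQ.t_mem P hP) 0 (Nat.zero_le _) s; rwa [iteratedDeriv_zero] at this
  set ψ := iteratedDeriv (N + 1) Θ with hψ
  have ψc : Continuous ψ := (T.sm.iteratedDeriv _).continuous
  -- one level
  have one : ∀ (h : ℝ × ℝ → ℝ) (m : ℝ), (∀ x, |h x| ≤ 1) → Integrable h → 0 < m → m ≤ 1 → ∫ x, |h x| ≤ m →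
      ∑ P ∈ Q, |wv g ψ l h (a P.2.2) P| ^ q ≤ C2 * (C * l ^ (-γ) * m ^ x * l ^ 2) := by
    intro h m hh hi hm hm1 hhm
    refine HL Q _ _ (fun P hP => ⟨abs_nonneg _, ?_⟩) (by positivity) fun α hα => ?_
    · have hPt := hQ.t_mem P hP
      have hMx : 0 ≤ Mx := (abs_nonneg _).trans (T.bd 0)
      refine ((wv_le hl (F.a_sm _ hPt).continuous (F.a_supp _ hPt) ψc T.supp
        (F.g_sm _ hPt).continuous hh).trans ?_)
      have h2 : ∫ v, |ψ v| ≤ 2 * 1 * Mx := by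
        refine (le_abs_self _).trans (abs_int_le (s0 := 0) zero_le_one (fun s hs => ?_) fun s => ?_)
        · rw [sub_zero]; exact T.supp s (by simpa using hs)
        · rw [abs_abs]; exact T.bd' s
      have h3 : ∫ v, |a P.2.2 v| ≤ 2 * 1 * B := by
        refine (le_abs_self _).trans (abs_int_le (s0 := 0) zero_le_one (fun s hs => ?_) fun s => ?_)
        · rw [sub_zero]; exact F.a_supp _ hPt s (by simpa using hs)
        · rw [abs_abs]; exact aB P hP s
      calc _ ≤ (2 * 1 * B) * (2 * 1 * Mx) := by gcongr
        _ = 4 * (B * Mx) := by ring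
        _ ≤ _ := le_max_right _ _
    · have hs : Q.filter (fun P => α ≤ |wv g ψ l h (a P.2.2) P|) ⊆ Q := Finset.filter_subset _ _
      have := HC g a S Θ h F T hh hi l m α hl hm hm1 hhm hα _ (hQ.mono hs)
        (le_trans (by exact_mod_cast Finset.card_le_card hs) hn) (fun P hP => (Finset.mem_filter.mp hP).2)
      rw [mul_div_assoc', div_le_iff₀ (by positivity)] at this
      exact this
  -- level decomposition
  set E : ℕ → Set (ℝ × ℝ) := fun k => {y | |f y| ≤ 2 ^ k} with hE
  have hEm : ∀ k, MeasurableSet (E k) := fun k => measurableSet_le hfm.abs measurable_const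
  set Fs : ℕ → Set (ℝ × ℝ) := fun k => match k with | 0 => E 0 | (k + 1) => E (k + 1) \ E k with hFs
  have hFm : ∀ k, MeasurableSet (Fs k) := fun k => by
    rcases k with _ | k
    · exact hEm 0
    · exact (hEm _).diff (hEm k)
  set h : ℕ → ℝ × ℝ → ℝ := fun k y => (Fs k).indicator f y / 2 ^ k with hh
  have hhi : ∀ k, Integrable (h k) := fun k => (hfi.indicator (hFm k)).div_const _
  have hFE : ∀ k, Fs k ⊆ E k := fun k => by
    rcases k with _ | k
    · exact fun _ h => h
    · exact sdiff_subset
  have hh1 : ∀ k y, |h k y| ≤ 1 := fun k y => by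
    simp only [hh]
    by_cases hy : y ∈ Fs k
    · rw [indicator_of_mem hy, abs_div, abs_of_pos (by positivity : (0 : ℝ) < 2 ^ k), div_le_one (by positivity)]
      exact hFE k hy
    · rw [indicator_of_notMem hy]; simp
  have hsum : ∀ K : ℕ, ∀ y, ∑ k ∈ Finset.range (K + 1), 2 ^ k * h k y = (E K).indicator f y := by
    intro K y
    have e : ∀ k, 2 ^ k * h k y = (Fs k).indicator f y := fun k => by simp only [hh]; exact mul_div_cancel₀ _ (by positivity)
    simp only [e]
    induction K with
    | zero => simp [hFs]
    | succ K ih =>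
      rw [Finset.sum_range_succ, ih]
      have hsub : E K ⊆ E (K + 1) := fun y hy => by
        have h2 : (2 : ℝ) ^ K ≤ 2 ^ (K + 1) := pow_le_pow_right₀ (by norm_num) (Nat.le_succ K)
        exact le_trans (show |f y| ≤ 2 ^ K from hy) h2
      simp only [hFs, indicator, mem_sdiff]
      by_cases h1 : y ∈ E K
      · simp [h1, hsub h1]
      · by_cases h2 : y ∈ E (K + 1) <;> simp [h1, h2]
  obtain ⟨K, hK⟩ := pow_unbounded_of_one_lt b (by norm_num : (1 : ℝ) < 2)
  have hfsum : ∀ y, f y = ∑ k ∈ Finset.range (K + 1), 2 ^ k * h k y := fun y => by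
    rw [hsum, indicator_of_mem]; exact (hfb y).trans hK.le
  set m : ℕ → ℝ := fun k => ((1 / 2) ^ p) ^ (k - 1) with hm
  have h2p : (1 / 2 : ℝ) ^ p ≤ 1 := Real.rpow_le_one (by norm_num) (by norm_num) hp0.le
  have hm0 : ∀ k, 0 < m k := fun k => by positivity
  have hm1 : ∀ k, m k ≤ 1 := fun k => pow_le_one₀ (by positivity) h2p
  have hhm : ∀ k, ∫ y, |h k y| ≤ m k := by
    intro k
    rcases k with _ | k
    · refine le_trans (integral_mono (hhi 0).abs hfi.abs fun y => ?_) (by simpa [hm] using hf1)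
      simp only [hh, pow_zero, div_one]
      by_cases hy : y ∈ Fs 0
      · rw [indicator_of_mem hy]
      · rw [indicator_of_notMem hy, abs_zero]; exact abs_nonneg _
    · calc ∫ y, |h (k + 1) y| ≤ ∫ y, m (k + 1) * |f y| ^ p := by
            refine integral_mono (f := fun y => |h (k + 1) y|) (g := fun y => m (k + 1) * |f y| ^ p) (hhi (k + 1)).abs (hfp.const_mul (m (k + 1))) fun y => ?_
            change |h (k + 1) y| ≤ m (k + 1) * |f y| ^ p
            have hpos : 0 ≤ m (k + 1) * |f y| ^ p := mul_nonneg (hm0 _).le (by positivity)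
            by_cases hy : y ∈ Fs (k + 1)
            · refine (hh1 (k + 1) y).trans ?_
              have h2 : (2 : ℝ) ^ k ≤ |f y| := (not_le.mp hy.2).le
              have h3 := Real.rpow_le_rpow (by positivity) h2 hp0.le
              have e : m (k + 1) = 1 / ((2 : ℝ) ^ k) ^ p := by
                simp only [hm, Nat.add_sub_cancel]
                rw [Real.div_rpow zero_le_one (by norm_num), Real.one_rpow, div_pow, one_pow, ← Real.rpow_natCast,
                  ← Real.rpow_natCast, ← Real.rpow_mul (by norm_num), ← Real.rpow_mul (by norm_num), mul_comm p]
              rw [e, one_div_mul_eq_div, le_div_iff₀ (by positivity), one_mul]; exact h3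
            · simp only [hh]
              rw [indicator_of_notMem hy]; simpa using hpos
        _ = m (k + 1) * ∫ y, |f y| ^ p := integral_const_mul _ _
        _ ≤ m (k + 1) * 1 := mul_le_mul_of_nonneg_left hfp1 (hm0 _).le
        _ = _ := mul_one _
  have hwv : ∀ P ∈ Q, |wv g ψ l f (a P.2.2) P| ≤ ∑ k ∈ Finset.range (K + 1), 2 ^ k * |wv g ψ l (h k) (a P.2.2) P| := by
    intro P hP
    have hPt := hQ.t_mem P hP
    have e : wv g ψ l f (a P.2.2) P = ∑ k ∈ Finset.range (K + 1), 2 ^ k * wv g ψ l (h k) (a P.2.2) P := by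
      unfold wv
      simp only [← integral_const_mul]
      rw [← integral_finsetSum _ fun k _ => (wv_int hl (F.a_sm _ hPt).continuous ψc (F.g_sm _ hPt).continuous (aB P hP) T.bd'
        (hhi k)).const_mul _]
      congr 1; funext y
      rw [hfsum y, Finset.sum_mul]
      exact Finset.sum_congr rfl fun k _ => by ring
    rw [e]
    refine (Finset.abs_sum_le_sum_abs _ _).trans (le_of_eq (Finset.sum_congr rfl fun k _ => ?_))
    rw [abs_mul, abs_of_pos (by positivity)]
  have mx : ∀ k, (m k) ^ x ≤ 2 ^ (p * x) * ((1 / 2) ^ (p * x)) ^ k := by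
    intro k
    have e : (m k) ^ x = ((1 / 2) ^ (p * x)) ^ (k - 1) := by
      simp only [hm]
      rw [← Real.rpow_natCast, ← Real.rpow_natCast, ← Real.rpow_mul (by positivity), ← Real.rpow_mul (by positivity),
        ← Real.rpow_mul (by positivity)]
      congr 1; ring
    have e2 : (2 : ℝ) ^ (p * x) * (1 / 2) ^ (p * x) = 1 := by
      rw [← Real.mul_rpow (by norm_num) (by norm_num)]; norm_num
    rw [e]
    rcases k with _ | k
    · simp only [zero_le, Nat.sub_eq_zero_of_le, pow_zero, mul_one]
      exact Real.one_le_rpow (by norm_num) (by nlinarith)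
    · rw [Nat.add_sub_cancel, pow_succ, mul_comm _ ((1 / 2 : ℝ) ^ (p * x)), ← mul_assoc, e2, one_mul]
  have rk : ∀ k : ℕ, ((2 : ℝ) ^ k / r ^ k) ^ q * ((1 / 2) ^ (p * x)) ^ k = ρ ^ k := by
    intro k
    have e1 : ((2 : ℝ) ^ k / r ^ k) = (1 / 2) ^ ((-1 - δ) * k) := by
      rw [hr, Real.rpow_mul (by norm_num), Real.rpow_natCast, Real.rpow_sub (by norm_num), div_pow, Real.rpow_neg (by norm_num),
        Real.rpow_one]; norm_num
    rw [e1, hρ, ← Real.rpow_mul (by norm_num), ← Real.rpow_natCast, ← Real.rpow_natCast, ← Real.rpow_mul (by norm_num),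
      ← Real.rpow_mul (by norm_num), ← Real.rpow_add (by norm_num)]
    congr 1
    rw [hδ]; field_simp; ring
  have hgeo : ∑ k ∈ Finset.range (K + 1), ρ ^ k ≤ 1 / (1 - ρ) := by
    have := (summable_geometric_of_lt_one hρ0.le hρ1).sum_le_tsum (Finset.range (K + 1)) (fun _ _ => by positivity)
    rwa [tsum_geometric_of_lt_one hρ0.le hρ1, ← one_div] at this
  calc ∑ P ∈ Q, |wv g ψ l f (a P.2.2) P| ^ q
      ≤ ∑ P ∈ Q, (1 / (1 - r)) ^ q * ∑ k ∈ Finset.range (K + 1), ((2 ^ k / r ^ k) ^ q * |wv g ψ l (h k) (a P.2.2) P| ^ q) := by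
        refine Finset.sum_le_sum fun P hP => ?_
        refine (Real.rpow_le_rpow (abs_nonneg _) (hwv P hP) hq0.le).trans ?_
        refine (sup_trick hr0 hr1 hq0 _ _ fun k => by positivity).trans (le_of_eq ?_)
        congr 1
        refine Finset.sum_congr rfl fun k _ => ?_
        rw [← Real.mul_rpow (by positivity) (by positivity)]; congr 1; ring
    _ = (1 / (1 - r)) ^ q * ∑ k ∈ Finset.range (K + 1), (2 ^ k / r ^ k) ^ q * ∑ P ∈ Q, |wv g ψ l (h k) (a P.2.2) P| ^ q := by
        rw [← Finset.mul_sum, Finset.sum_comm]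
        simp only [Finset.mul_sum]
    _ ≤ (1 / (1 - r)) ^ q * ∑ k ∈ Finset.range (K + 1), (C2 * C * 2 ^ (p * x) * l ^ (-γ) * l ^ 2) * ρ ^ k := by
        refine mul_le_mul_of_nonneg_left (Finset.sum_le_sum fun k _ => ?_) (by positivity)
        calc _ ≤ (2 ^ k / r ^ k) ^ q * (C2 * (C * l ^ (-γ) * (2 ^ (p * x) * ((1 / 2) ^ (p * x)) ^ k) * l ^ 2)) := by
              refine mul_le_mul_of_nonneg_left ((one (h k) (m k) (hh1 k) (hhi k) (hm0 k) (hm1 k) (hhm k)).trans ?_) (by positivity)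
              have := mx k
              gcongr
          _ = (C2 * C * 2 ^ (p * x) * l ^ (-γ) * l ^ 2) * ((2 ^ k / r ^ k) ^ q * ((1 / 2) ^ (p * x)) ^ k) := by ring
          _ = _ := by rw [rk]
    _ ≤ (1 / (1 - r)) ^ q * ((C2 * C * 2 ^ (p * x) * l ^ (-γ) * l ^ 2) * (1 / (1 - ρ))) := by
        rw [← Finset.mul_sum]
        gcongr
    _ = _ := by ring

/-- cells of side `1/n` -/
noncomputable def cell (n : ℕ) (i : ℤ × ℤ) : Set (ℝ × ℝ) := {x | ⌊(n : ℝ) * x.1⌋ = i.1 ∧ ⌊(n : ℝ) * x.2⌋ = i.2}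

theorem cell_meas (n : ℕ) (i : ℤ × ℤ) : MeasurableSet (cell n i) := by
  have h1 : Measurable fun x : ℝ × ℝ => ⌊(n : ℝ) * x.1⌋ := Int.measurable_floor.comp (by fun_prop)
  have h2 : Measurable fun x : ℝ × ℝ => ⌊(n : ℝ) * x.2⌋ := Int.measurable_floor.comp (by fun_prop)
  exact (h1 (measurableSet_singleton i.1)).inter (h2 (measurableSet_singleton i.2))

theorem cell_vol {n : ℕ} (hn : 1 ≤ n) (i : ℤ × ℤ) : volume (cell n i) = ENNReal.ofReal (1 / (n : ℝ) ^ 2) := by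
  have hn0 : (0 : ℝ) < n := by exact_mod_cast hn
  have e : cell n i = Ico ((i.1 : ℝ) / n) ((i.1 + 1 : ℝ) / n) ×ˢ Ico ((i.2 : ℝ) / n) ((i.2 + 1 : ℝ) / n) := by
    ext x
    simp only [cell, mem_ofPred_eq, Int.floor_eq_iff, mem_prod, mem_Ico, div_le_iff₀ hn0, lt_div_iff₀ hn0, mul_comm (n : ℝ)]
  have e2 : ∀ j : ℝ, (j + 1) / n - j / n = 1 / n := fun j => by ring
  rw [e, Measure.volume_eq_prod, Measure.prod_prod, Real.volume_Ico, Real.volume_Ico, e2, e2,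
    ← ENNReal.ofReal_mul (by positivity)]
  congr 1; ring

/-- index shifts -/
noncomputable def shifts (R : ℕ) : Finset (ℤ × ℤ) := Finset.Icc (-(R : ℤ)) R ×ˢ Finset.Icc (-(R : ℤ)) R

/-- enlarged unit box -/
noncomputable def big (R : ℕ) (z : ℤ × ℤ) : Set (ℝ × ℝ) := ⋃ k ∈ shifts R, cell 1 (z + k)

theorem mem_big {R : ℕ} {z : ℤ × ℤ} {x : ℝ × ℝ} :
    x ∈ big R z ↔ |⌊x.1⌋ - z.1| ≤ R ∧ |⌊x.2⌋ - z.2| ≤ R := by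
  simp only [big, shifts, mem_iUnion, cell, mem_ofPred_eq, Nat.cast_one, one_mul, Finset.mem_product, Finset.mem_Icc, abs_le,
    exists_prop, Prod.exists, Prod.fst_add, Prod.snd_add]
  constructor
  · rintro ⟨a, b, h, h1, h2⟩
    omega
  · intro h
    exact ⟨⌊x.1⌋ - z.1, ⌊x.2⌋ - z.2, by omega, by omega, by omega⟩

theorem big_meas (R : ℕ) (z : ℤ × ℤ) : MeasurableSet (big R z) :=
  Finset.measurableSet_biUnion _ fun _ _ => cell_meas _ _

theorem big_vol (R : ℕ) (z : ℤ × ℤ) : volume (big R z) ≤ ENNReal.ofReal (shifts R).card := by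
  refine (measure_biUnion_finset_le _ _).trans ?_
  simp [cell_vol le_rfl]

theorem shifts_card (R : ℕ) : (1 : ℝ) ≤ (shifts R).card := by
  have : 0 < (shifts R).card := Finset.card_pos.mpr ⟨(0, 0), by simp [shifts]⟩
  exact_mod_cast this

theorem le_one_add_rpow {x p : ℝ} (hx : 0 ≤ x) (hp : 1 ≤ p) : x ≤ 1 + x ^ p := by
  rcases le_total x 1 with h | h
  · have := Real.rpow_nonneg hx p; linarith
  · have := Real.self_le_rpow_of_one_le h hp; linarith

/-- local estimate at a box, arbitrary normalisation -/
theorem locZ {T : (ℝ × ℝ → ℝ) → ℝ × ℝ × ℝ → ℝ} {n R : ℕ} {p q D : ℝ} (hp : 1 < p) (hq : 0 < q)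
    (hT : ∀ (c : ℝ) h P, T (fun x => c * h x) P = c * T h P)
    (hloc : ∀ h (P : ℝ × ℝ × ℝ), P.2.2 ∈ Icc (1 : ℝ) 2 → T h P = T ((big R (⌊P.1⌋, ⌊P.2.1⌋)).indicator h) P)
    (hH : ∀ h : ℝ × ℝ → ℝ, Measurable h → (∃ b, ∀ x, |h x| ≤ b) → Integrable h → ∫ x, |h x| ≤ 1 →
      Integrable (fun x => |h x| ^ p) → ∫ x, |h x| ^ p ≤ 1 → ∀ Q : Finset (ℝ × ℝ × ℝ), Pts n Q →
      (Q.card : ℝ) ≤ 4 * (n : ℝ) ^ 2 → ∑ P ∈ Q, |T h P| ^ q ≤ D * (n : ℝ) ^ 2)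
    {f : ℝ × ℝ → ℝ} (hfm : Measurable f) {b : ℝ} (hfb : ∀ x, |f x| ≤ b) (hfi : Integrable f)
    (hfp : Integrable (fun x => |f x| ^ p)) (z : ℤ × ℤ) {lam : ℝ} (hlam : 0 < lam)
    (hE : ∫ x in big R z, |f x| ^ p ≤ lam ^ p) (Q : Finset (ℝ × ℝ × ℝ)) (hQ : Pts n Q)
    (hn : (Q.card : ℝ) ≤ 4 * (n : ℝ) ^ 2) (hz : ∀ P ∈ Q, (⌊P.1⌋, ⌊P.2.1⌋) = z) :
    ∑ P ∈ Q, |T f P| ^ q ≤ (2 * (shifts R).card * lam) ^ q * (D * (n : ℝ) ^ 2) := by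
  have hA := shifts_card R
  set A : ℝ := ((shifts R).card : ℝ) with hAdef
  have hb0 : 0 ≤ b := (abs_nonneg _).trans (hfb 0)
  have hmp : 0 < 2 * A * lam := by positivity
  set m := big R z with hm
  have hmm : MeasurableSet m := big_meas R z
  have hmv : volume.real m ≤ A := by
    have := ENNReal.toReal_mono ENNReal.ofReal_ne_top (big_vol R z)
    rwa [ENNReal.toReal_ofReal (by positivity)] at this
  have hmfin : volume m ≠ ⊤ := ((big_vol R z).trans_lt ENNReal.ofReal_lt_top).ne
  set F := m.indicator f with hF
  have hFp : ∀ x, |F x| ^ p = m.indicator (fun x => |f x| ^ p) x := fun x => by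
    by_cases hx : x ∈ m
    · rw [hF, indicator_of_mem hx, indicator_of_mem hx]
    · rw [hF, indicator_of_notMem hx, indicator_of_notMem hx, abs_zero, Real.zero_rpow (by linarith)]
  have hFpi : Integrable (fun x => |F x| ^ p) := by
    simp only [hFp]; exact hfp.indicator hmm
  have hFpE : ∫ x, |F x| ^ p ≤ lam ^ p := by
    simp only [hFp]; rwa [integral_indicator hmm]
  have hFi : Integrable F := hfi.indicator hmm
  have hh := hH (fun x => (2 * A * lam)⁻¹ * F x) ((hfm.indicator hmm).const_mul _)
    ⟨(2 * A * lam)⁻¹ * b, fun x => by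
      rw [abs_mul, abs_of_pos (by positivity : 0 < (2 * A * lam)⁻¹)]
      refine mul_le_mul_of_nonneg_left ?_ (by positivity)
      rw [hF]; by_cases hx : x ∈ m
      · rw [indicator_of_mem hx]; exact hfb x
      · rw [indicator_of_notMem hx, abs_zero]; exact hb0⟩
    (hFi.const_mul _) ?_ ?_ ?_ Q hQ hn
  · have e : ∀ P ∈ Q, |T f P| ^ q = (2 * A * lam) ^ q * |T (fun x => (2 * A * lam)⁻¹ * F x) P| ^ q := fun P hP => by
      rw [hT, hloc f P (hQ.t_mem P hP), hz P hP, ← Real.mul_rpow (by positivity) (abs_nonneg _), abs_mul,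
        abs_of_pos (by positivity : 0 < (2 * A * lam)⁻¹), ← mul_assoc, mul_inv_cancel₀ hmp.ne', one_mul]
    rw [Finset.sum_congr rfl e, ← Finset.mul_sum]
    exact mul_le_mul_of_nonneg_left hh (by positivity)
  · have h1 : ∀ x, |(2 * A * lam)⁻¹ * F x| ≤ (2 * A)⁻¹ * (m.indicator (fun _ => (1 : ℝ)) x + (lam ^ p)⁻¹ * |F x| ^ p) := by
      intro x
      rw [abs_mul, abs_of_pos (by positivity : 0 < (2 * A * lam)⁻¹), mul_inv, mul_assoc]
      refine mul_le_mul_of_nonneg_left ?_ (by positivity)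
      by_cases hx : x ∈ m
      · rw [indicator_of_mem hx, ← Real.inv_rpow hlam.le, ← Real.mul_rpow (by positivity) (abs_nonneg _)]
        exact le_one_add_rpow (by positivity) hp.le
      · rw [hF, indicator_of_notMem hx, indicator_of_notMem hx, abs_zero]
        rw [Real.zero_rpow (by linarith)]; simp
    have hi1 : Integrable (m.indicator fun _ : ℝ × ℝ => (1 : ℝ)) := (integrable_indicator_iff hmm).mpr (integrableOn_const hmfin)
    refine (integral_mono (hFi.const_mul _).abs ((hi1.add (hFpi.const_mul _)).const_mul _) h1).trans ?_
    rw [integral_const_mul, integral_add' hi1 (hFpi.const_mul _), integral_indicator_const _ hmm, integral_const_mul, smul_eq_mul,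
      mul_one, inv_mul_le_iff₀ (by positivity)]
    have : (lam ^ p)⁻¹ * ∫ x, |F x| ^ p ≤ 1 := by
      rw [inv_mul_le_iff₀ (by positivity), mul_one]; exact hFpE
    linarith
  · simp only [abs_mul, Real.mul_rpow (abs_nonneg _) (abs_nonneg _)]
    exact hFpi.const_mul _
  · simp only [abs_mul, Real.mul_rpow (abs_nonneg _) (abs_nonneg _)]
    rw [integral_const_mul, abs_of_pos (by positivity : 0 < (2 * A * lam)⁻¹), Real.inv_rpow (by positivity),
      inv_mul_le_iff₀ (by positivity), mul_one]
    refine hFpE.trans (Real.rpow_le_rpow hlam.le ?_ (by linarith))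
    nlinarith only [hA, hlam]

/-- indices of cells inside a unit box -/
noncomputable def subI (n : ℕ) (z : ℤ × ℤ) : Finset (ℤ × ℤ) :=
  Finset.Ico ((n : ℤ) * z.1) (n * z.1 + n) ×ˢ Finset.Ico ((n : ℤ) * z.2) (n * z.2 + n)

theorem floor_cell {n : ℕ} (hn : 1 ≤ n) (x : ℝ) : ⌊x⌋ = ⌊(n : ℝ) * x⌋ / n := by
  have hn0 : (n : ℝ) ≠ 0 := by positivity
  rw [← Int.floor_div_natCast, mul_div_cancel_left₀ _ hn0]

theorem mem_sub {n : ℕ} (hn : 1 ≤ n) {z i : ℤ × ℤ} : i ∈ subI n z ↔ i.1 / n = z.1 ∧ i.2 / n = z.2 := by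
  have hn0 : (0 : ℤ) < n := by exact_mod_cast hn
  have : ∀ a b : ℤ, a / n = b ↔ n * b ≤ a ∧ a < n * b + n := fun a b => by
    rw [Int.ediv_eq_iff_of_pos hn0]
    constructor <;> rintro ⟨h1, h2⟩ <;> constructor <;> nlinarith only [h1, h2]
  simp only [subI, Finset.mem_product, Finset.mem_Ico, this]

theorem sub_card {n : ℕ} (z : ℤ × ℤ) : ((subI n z).card : ℝ) = (n : ℝ) ^ 2 := by
  simp [subI, sq]

theorem cell_sub {n : ℕ} (hn : 1 ≤ n) (z : ℤ × ℤ) : cell 1 z ⊆ ⋃ i ∈ subI n z, cell n i := by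
  intro x hx
  simp only [mem_iUnion, exists_prop]
  refine ⟨(⌊(n : ℝ) * x.1⌋, ⌊(n : ℝ) * x.2⌋), ?_, rfl, rfl⟩
  rw [mem_sub hn, ← floor_cell hn, ← floor_cell hn]
  simpa [cell] using hx

theorem cell_disj (n : ℕ) : Pairwise (Function.onFun Disjoint (cell n)) := by
  intro i j hij
  rw [Function.onFun, Set.disjoint_left]
  intro x hx hy
  exact hij (Prod.ext (hx.1.symm.trans hy.1) (hx.2.symm.trans hy.2))

theorem cell_univ (n : ℕ) : ⋃ i, cell n i = univ :=
  eq_univ_of_forall fun x => mem_iUnion.mpr ⟨(⌊(n : ℝ) * x.1⌋, ⌊(n : ℝ) * x.2⌋), rfl, rfl⟩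

/-- Local to global. -/
theorem loc_glob {T : (ℝ × ℝ → ℝ) → ℝ × ℝ × ℝ → ℝ} {n R : ℕ} {p q D : ℝ} (hn : 1 ≤ n) (hp : 1 < p) (hpq : p ≤ q) (hD : 0 ≤ D)
    (hT : ∀ (c : ℝ) h P, T (fun x => c * h x) P = c * T h P)
    (hloc : ∀ h (P : ℝ × ℝ × ℝ), P.2.2 ∈ Icc (1 : ℝ) 2 → T h P = T ((big R (⌊P.1⌋, ⌊P.2.1⌋)).indicator h) P)
    (hH : ∀ h : ℝ × ℝ → ℝ, Measurable h → (∃ b, ∀ x, |h x| ≤ b) → Integrable h → ∫ x, |h x| ≤ 1 →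
      Integrable (fun x => |h x| ^ p) → ∫ x, |h x| ^ p ≤ 1 → ∀ Q : Finset (ℝ × ℝ × ℝ), Pts n Q →
      (Q.card : ℝ) ≤ 4 * (n : ℝ) ^ 2 → ∑ P ∈ Q, |T h P| ^ q ≤ D * (n : ℝ) ^ 2)
    {f : ℝ × ℝ → ℝ} (hfm : Measurable f) {b : ℝ} (hfb : ∀ x, |f x| ≤ b) (hfi : Integrable f)
    (hfp : Integrable (fun x => |f x| ^ p)) {K : ℝ} (hK : ∀ P : ℝ × ℝ × ℝ, P.2.2 ∈ Icc (1 : ℝ) 2 → |T f P| ≤ K) :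
    ∃ W : ℝ × ℝ → ℝ≥0∞, Measurable W ∧ (∀ y : ℝ × ℝ, ∀ t ∈ Icc (1 : ℝ) 2, ENNReal.ofReal |T f (y.1, y.2, t)| ≤ W y) ∧
      ∫⁻ y, W y ^ q ≤ ENNReal.ofReal (2 ^ q * (2 * (shifts R).card) ^ q * (shifts R).card * D) *
        (∫⁻ x, ENNReal.ofReal (|f x| ^ p)) ^ (q / p) := by
  classical
  have hp0 : 0 < p := by linarith
  have hq0 : 0 < q := by linarith
  have hn0 : (0 : ℝ) < n := by exact_mod_cast hn
  have hA := shifts_card R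
  set A : ℝ := ((shifts R).card : ℝ) with hAdef
  clear_value A
  have hA0 : 0 < A := by linarith
  let Z : ℤ × ℤ → Type := fun i => {P : ℝ × ℝ × ℝ // (P.1, P.2.1) ∈ cell n i ∧ P.2.2 ∈ Icc (1 : ℝ) 2}
  let w : ℤ × ℤ → ℝ≥0∞ := fun i => ⨆ P : Z i, ENNReal.ofReal |T f P.1|
  have hw : ∀ i, ∃ P : ℝ × ℝ × ℝ, ((P.1, P.2.1) ∈ cell n i ∧ P.2.2 ∈ Icc (1 : ℝ) 2) ∧ w i ≤ ENNReal.ofReal (2 * |T f P|) := by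
    intro i
    by_cases h0 : w i = 0
    · refine ⟨(i.1 / n, i.2 / n, 1), ⟨?_, by norm_num, by norm_num⟩, by rw [h0]; exact bot_le⟩
      simp only [cell, mem_ofPred_eq, mul_div_cancel₀ _ hn0.ne']
      constructor <;> rw [Int.floor_intCast]
    · have hfin : w i ≠ ⊤ := ((iSup_le fun (P : Z i) => ENNReal.ofReal_le_ofReal (hK P.1 P.2.2)).trans_lt (ENNReal.ofReal_lt_top (r := K))).ne
      obtain ⟨P, hP⟩ := lt_iSup_iff.mp (ENNReal.half_lt_self h0 hfin)
      refine ⟨P.1, P.2, ?_⟩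
      rw [ENNReal.ofReal_mul (by norm_num), ENNReal.ofReal_ofNat, mul_comm]
      exact (ENNReal.div_le_iff_le_mul (by simp) (by simp)).mp hP.le
  choose P hP hwP using hw
  set E : ℤ × ℤ → ℝ := fun z => ∫ x in big R z, |f x| ^ p with hE
  have hE0 : ∀ z, 0 ≤ E z := fun z => integral_nonneg fun x => by positivity
  have Pfl : ∀ i, ⌊(n : ℝ) * (P i).1⌋ = i.1 ∧ ⌊(n : ℝ) * (P i).2.1⌋ = i.2 := fun i => (hP i).1
  have hPinj : ∀ i j, P i = P j → i = j := fun i j h => by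
    have h1 := Pfl i
    rw [h] at h1
    exact Prod.ext (h1.1.symm.trans (Pfl j).1) (h1.2.symm.trans (Pfl j).2)
  have loc : ∀ z, ∑ i ∈ subI n z, |T f (P i)| ^ q ≤ (2 * A) ^ q * E z ^ (q / p) * (D * (n : ℝ) ^ 2) := by
    intro z
    have hs : ∑ i ∈ subI n z, |T f (P i)| ^ q = ∑ P' ∈ (subI n z).image P, |T f P'| ^ q := by
      rw [Finset.sum_image fun i _ j _ h => hPinj i j h]
    rw [hs]
    have hall : ∀ lam, E z ^ (1 / p) < lam → ∑ P' ∈ (subI n z).image P, |T f P'| ^ q ≤ (2 * A * lam) ^ q * (D * (n : ℝ) ^ 2) := by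
      intro lam hlam
      have hl0 : 0 < lam := (Real.rpow_nonneg (hE0 z) _).trans_lt hlam
      rw [hAdef]
      refine locZ hp hq0 hT hloc hH hfm hfb hfi hfp z hl0 ?_ _ ⟨?_, ?_⟩ ?_ ?_
      · have := Real.rpow_le_rpow (Real.rpow_nonneg (hE0 z) _) hlam.le hp0.le
        rwa [← Real.rpow_mul (hE0 z), one_div_mul_cancel hp0.ne', Real.rpow_one] at this
      · intro P' hP'
        obtain ⟨i, _, rfl⟩ := Finset.mem_image.mp hP'
        exact (hP i).2
      · intro P1 hP1 P2 hP2 h1 h2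
        obtain ⟨i, _, rfl⟩ := Finset.mem_image.mp hP1
        obtain ⟨j, _, rfl⟩ := Finset.mem_image.mp hP2
        rw [(Pfl i).1, (Pfl j).1] at h1
        rw [(Pfl i).2, (Pfl j).2] at h2
        rw [Prod.ext h1 h2]
      · have : (((subI n z).image P).card : ℝ) ≤ (subI n z).card := by exact_mod_cast Finset.card_image_le
        rw [sub_card] at this
        nlinarith only [this, sq_nonneg (n : ℝ)]
      · intro P' hP'
        obtain ⟨i, hi, rfl⟩ := Finset.mem_image.mp hP'
        rw [mem_sub hn] at hi
        rw [floor_cell hn, floor_cell hn (P i).2.1, (Pfl i).1, (Pfl i).2]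
        exact Prod.ext hi.1 hi.2
    have lim : Filter.Tendsto (fun lam : ℝ => (2 * A * lam) ^ q * (D * (n : ℝ) ^ 2)) (nhdsWithin (E z ^ (1 / p)) (Ioi (E z ^ (1 / p))))
        (nhds ((2 * A * (E z ^ (1 / p))) ^ q * (D * (n : ℝ) ^ 2))) := by
      refine Filter.Tendsto.mono_left ?_ nhdsWithin_le_nhds
      exact (((Real.continuous_rpow_const hq0.le).comp (continuous_const.mul continuous_id)).mul continuous_const).tendsto _
    have h2 := ge_of_tendsto lim (Filter.eventually_of_mem self_mem_nhdsWithin hall)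
    rwa [Real.mul_rpow (by positivity) (Real.rpow_nonneg (hE0 z) _), ← Real.rpow_mul (hE0 z), one_div_mul_eq_div] at h2
  have eE : ∀ z, ENNReal.ofReal (E z) = ∫⁻ x in big R z, ENNReal.ofReal (|f x| ^ p) := fun z =>
    ofReal_integral_eq_lintegral_ofReal hfp.restrict (Filter.Eventually.of_forall fun x => by positivity)
  have wz : ∀ z, ∑ i ∈ subI n z, w i ^ q ≤ ENNReal.ofReal (2 ^ q * (2 * A) ^ q * D * (n : ℝ) ^ 2) * ENNReal.ofReal (E z) ^ (q / p) := by
    intro z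
    calc ∑ i ∈ subI n z, w i ^ q ≤ ∑ i ∈ subI n z, ENNReal.ofReal (2 ^ q * |T f (P i)| ^ q) := by
          refine Finset.sum_le_sum fun i _ => (ENNReal.rpow_le_rpow (hwP i) hq0.le).trans (le_of_eq ?_)
          rw [ENNReal.ofReal_rpow_of_nonneg (by positivity) hq0.le, Real.mul_rpow (by norm_num) (abs_nonneg _)]
      _ = ENNReal.ofReal (∑ i ∈ subI n z, 2 ^ q * |T f (P i)| ^ q) := (ENNReal.ofReal_sum_of_nonneg fun i _ => by positivity).symm
      _ ≤ ENNReal.ofReal (2 ^ q * ((2 * A) ^ q * E z ^ (q / p) * (D * (n : ℝ) ^ 2))) := by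
          rw [← Finset.mul_sum]
          exact ENNReal.ofReal_le_ofReal (mul_le_mul_of_nonneg_left (loc z) (by positivity))
      _ = _ := by
          rw [ENNReal.ofReal_rpow_of_nonneg (hE0 z) (by positivity), ← ENNReal.ofReal_mul (by positivity)]
          congr 1; ring
  set Et := ∫⁻ x, ENNReal.ofReal (|f x| ^ p) with hEt
  have sumE : ∑' z, ENNReal.ofReal (E z) ≤ ENNReal.ofReal A * Et := by
    calc ∑' z, ENNReal.ofReal (E z) ≤ ∑' z, ∑ k ∈ shifts R, ∫⁻ x in cell 1 (z + k), ENNReal.ofReal (|f x| ^ p) := by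
          refine ENNReal.tsum_le_tsum fun z => ?_
          rw [eE, big]
          refine le_of_eq (lintegral_biUnion_finset ?_ (fun _ _ => cell_meas _ _) _)
          intro i _ j _ hij
          exact cell_disj 1 (fun h => hij (add_left_cancel h))
      _ = ∑ k ∈ shifts R, ∑' z, ∫⁻ x in cell 1 (z + k), ENNReal.ofReal (|f x| ^ p) :=
          Summable.tsum_finsetSum fun _ _ => ENNReal.summable
      _ = ∑ k ∈ shifts R, Et := by
          refine Finset.sum_congr rfl fun k _ => ?_
          have := (Equiv.addRight k).tsum_eq (fun z => ∫⁻ x in cell 1 z, ENNReal.ofReal (|f x| ^ p))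
          simp only [Equiv.coe_addRight] at this
          rw [this, ← lintegral_iUnion (fun i => cell_meas 1 i) (cell_disj 1), cell_univ, Measure.restrict_univ]
      _ = _ := by
          rw [Finset.sum_const, nsmul_eq_mul, hAdef, ENNReal.ofReal_natCast]
  have hr : 0 ≤ q / p - 1 := by rw [sub_nonneg, le_div_iff₀ hp0]; linarith
  refine ⟨fun y => w (⌊(n : ℝ) * y.1⌋, ⌊(n : ℝ) * y.2⌋), ?_, ?_, ?_⟩
  · have h1 : Measurable fun x : ℝ × ℝ => (⌊(n : ℝ) * x.1⌋, ⌊(n : ℝ) * x.2⌋) :=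
      (Int.measurable_floor.comp (by fun_prop)).prodMk (Int.measurable_floor.comp (by fun_prop))
    exact (measurable_of_countable w).comp h1
  · intro y t ht
    exact le_iSup (fun P : Z (⌊(n : ℝ) * y.1⌋, ⌊(n : ℝ) * y.2⌋) => ENNReal.ofReal |T f P.1|) ⟨(y.1, y.2, t), ⟨rfl, rfl⟩, ht⟩
  · calc ∫⁻ y : ℝ × ℝ, w (⌊(n : ℝ) * y.1⌋, ⌊(n : ℝ) * y.2⌋) ^ q
        = ∫⁻ y in ⋃ z, cell 1 z, w (⌊(n : ℝ) * y.1⌋, ⌊(n : ℝ) * y.2⌋) ^ q := by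
          rw [cell_univ, Measure.restrict_univ]
      _ ≤ ∑' z, ∫⁻ y in cell 1 z, w (⌊(n : ℝ) * y.1⌋, ⌊(n : ℝ) * y.2⌋) ^ q := lintegral_iUnion_le _ _
      _ ≤ ∑' z, ∑ i ∈ subI n z, w i ^ q * ENNReal.ofReal (1 / (n : ℝ) ^ 2) := by
          refine ENNReal.tsum_le_tsum fun z => (lintegral_mono_set (cell_sub hn z)).trans ?_
          rw [lintegral_biUnion_finset (fun i _ j _ hij => cell_disj n hij) (fun _ _ => cell_meas _ _)]
          refine Finset.sum_le_sum fun i _ => ?_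
          rw [← cell_vol hn i, ← setLIntegral_const]
          refine setLIntegral_mono' (cell_meas n i) fun x hx => ?_
          rw [hx.1, hx.2]
      _ ≤ ∑' z, ENNReal.ofReal (2 ^ q * (2 * A) ^ q * D) * Et ^ (q / p - 1) * ENNReal.ofReal (E z) := by
          refine ENNReal.tsum_le_tsum fun z => ?_
          rw [← Finset.sum_mul]
          calc _ ≤ (ENNReal.ofReal (2 ^ q * (2 * A) ^ q * D * (n : ℝ) ^ 2) * ENNReal.ofReal (E z) ^ (q / p)) *
                ENNReal.ofReal (1 / (n : ℝ) ^ 2) := mul_le_mul_left (wz z) _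
            _ = ENNReal.ofReal (2 ^ q * (2 * A) ^ q * D) * ENNReal.ofReal (E z) ^ (q / p) := by
                rw [mul_right_comm, ← ENNReal.ofReal_mul (by positivity)]
                congr 2; field_simp
            _ = ENNReal.ofReal (2 ^ q * (2 * A) ^ q * D) * (ENNReal.ofReal (E z) ^ (q / p - 1) * ENNReal.ofReal (E z)) := by
                congr 1
                nth_rewrite 3 [← ENNReal.rpow_one (ENNReal.ofReal (E z))]
                rw [← ENNReal.rpow_add_of_nonneg _ _ hr zero_le_one, sub_add_cancel]
            _ ≤ _ := by
                rw [← mul_assoc]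
                refine mul_le_mul_left (mul_le_mul_right (ENNReal.rpow_le_rpow ?_ hr) _) _
                rw [eE]; exact setLIntegral_le_lintegral _ _
      _ = ENNReal.ofReal (2 ^ q * (2 * A) ^ q * D) * Et ^ (q / p - 1) * ∑' z, ENNReal.ofReal (E z) := ENNReal.tsum_mul_left
      _ ≤ ENNReal.ofReal (2 ^ q * (2 * A) ^ q * D) * Et ^ (q / p - 1) * (ENNReal.ofReal A * Et) := by gcongr
      _ = ENNReal.ofReal (2 ^ q * (2 * A) ^ q * A * D) * Et ^ (q / p) := by
          have : Et ^ (q / p) = Et ^ (q / p - 1) * Et := by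
            nth_rewrite 3 [← ENNReal.rpow_one Et]
            rw [← ENNReal.rpow_add_of_nonneg _ _ hr zero_le_one, sub_add_cancel]
          rw [this, show 2 ^ q * (2 * A) ^ q * A * D = (2 ^ q * (2 * A) ^ q * D) * A by ring, ENNReal.ofReal_mul (p := 2 ^ q * (2 * A) ^ q * D) (by positivity)]
          ring

theorem geo_ofReal {r : ℝ} (h0 : 0 ≤ r) (h1 : r < 1) : ∑' k : ℕ, ENNReal.ofReal (r ^ k) = ENNReal.ofReal (1 / (1 - r)) := by
  rw [one_div, ← tsum_geometric_of_lt_one h0 h1, ENNReal.ofReal_tsum_of_nonneg (fun n => by positivity)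
    (summable_geometric_of_lt_one h0 h1)]

theorem tsum_Lq {α : Type*} [MeasurableSpace α] {μ : Measure α} {W : ℕ → α → ℝ≥0∞} (hW : ∀ j, Measurable (W j)) {q ρ : ℝ} (hq : 0 < q)
    (hρ : 0 < ρ) (hρ1 : ρ < 1) {X : ℝ≥0∞} (h : ∀ j, ∫⁻ y, W j y ^ q ∂μ ≤ ENNReal.ofReal (ρ ^ (2 * j)) * X) :
    ∫⁻ y, (∑' j, W j y) ^ q ∂μ ≤ ENNReal.ofReal ((1 / (1 - ρ ^ (1 / q))) ^ q * (1 / (1 - ρ))) * X := by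
  have hr0 : 0 < ρ ^ (1 / q) := by positivity
  have hr1 : ρ ^ (1 / q) < 1 := Real.rpow_lt_one hρ.le hρ1 (by positivity)
  have h1r : 0 < 1 - ρ ^ (1 / q) := by linarith
  have h1ρ : 0 < 1 - ρ := by linarith
  have pt : ∀ y, (∑' j, W j y) ^ q ≤ ENNReal.ofReal ((1 / (1 - ρ ^ (1 / q))) ^ q) * ∑' j, ENNReal.ofReal ((ρ⁻¹) ^ j) * W j y ^ q := by
    intro y
    set T := ∑' j, ENNReal.ofReal ((ρ⁻¹) ^ j) * W j y ^ q with hT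
    have hk : ∀ k, W k y ≤ ENNReal.ofReal ((ρ ^ (1 / q)) ^ k) * T ^ (1 / q) := by
      intro k
      have e1 : W k y ^ q ≤ ENNReal.ofReal (ρ ^ k) * T := by
        calc W k y ^ q = ENNReal.ofReal (ρ ^ k) * (ENNReal.ofReal ((ρ⁻¹) ^ k) * W k y ^ q) := by
              rw [← mul_assoc, ← ENNReal.ofReal_mul (by positivity), ← mul_pow, mul_inv_cancel₀ hρ.ne', one_pow, ENNReal.ofReal_one, one_mul]
          _ ≤ _ := mul_le_mul_right (ENNReal.le_tsum k) _
      have e2 := ENNReal.rpow_le_rpow e1 (by positivity : 0 ≤ 1 / q)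
      rw [← ENNReal.rpow_mul, mul_one_div_cancel hq.ne', ENNReal.rpow_one, ENNReal.mul_rpow_of_nonneg _ _ (by positivity),
        ENNReal.ofReal_rpow_of_nonneg (by positivity) (by positivity)] at e2
      convert e2 using 3
      rw [← Real.rpow_natCast, ← Real.rpow_natCast, ← Real.rpow_mul hρ.le, ← Real.rpow_mul hρ.le, mul_comm]
    have h3 : ∑' j, W j y ≤ ENNReal.ofReal (1 / (1 - ρ ^ (1 / q))) * T ^ (1 / q) := by
      refine (ENNReal.tsum_le_tsum hk).trans ?_
      rw [ENNReal.tsum_mul_right, geo_ofReal hr0.le hr1]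
    refine (ENNReal.rpow_le_rpow h3 hq.le).trans (le_of_eq ?_)
    rw [ENNReal.mul_rpow_of_nonneg _ _ hq.le, ← ENNReal.rpow_mul, one_div_mul_cancel hq.ne', ENNReal.rpow_one,
      ENNReal.ofReal_rpow_of_nonneg (by positivity) hq.le]
  refine (lintegral_mono pt).trans ?_
  rw [lintegral_const_mul _ (Measurable.tsum fun j => ((hW j).pow_const q).const_mul _),
    lintegral_tsum fun j => (((hW j).pow_const q).const_mul _).aemeasurable, ENNReal.ofReal_mul (by positivity), mul_assoc]
  refine mul_le_mul_right ?_ _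
  rw [← geo_ofReal hρ.le hρ1, ← ENNReal.tsum_mul_right]
  refine ENNReal.tsum_le_tsum fun j => ?_
  rw [lintegral_const_mul _ ((hW j).pow_const q)]
  refine (mul_le_mul_right (h j) _).trans (le_of_eq ?_)
  rw [← mul_assoc, ← ENNReal.ofReal_mul (by positivity), inv_pow, two_mul, pow_add, inv_mul_cancel_left₀ (by positivity)]

theorem wv_smul (g : ℝ → ℝ → ℝ) (χ : ℝ → ℝ) (l : ℝ) (b : ℝ → ℝ) (c : ℝ) (h : ℝ × ℝ → ℝ) (P : ℝ × ℝ × ℝ) :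
    wv g χ l (fun x => c * h x) b P = c * wv g χ l h b P := by
  unfold wv
  rw [← integral_const_mul]
  congr 1; funext x; ring

theorem floor_near {x y B : ℝ} {R : ℕ} (h : |x - y| ≤ B + 1) (hR : B + 2 ≤ R) : |⌊y⌋ - ⌊x⌋| ≤ R := by
  have h1 := Int.floor_le x
  have h2 := Int.lt_floor_add_one x
  have h3 := Int.floor_le y
  have h4 := Int.lt_floor_add_one y
  rw [abs_le] at h
  have : |((⌊y⌋ - ⌊x⌋ : ℤ) : ℝ)| ≤ R := by
    push_cast
    rw [abs_le]; constructor <;> linarith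
  rw [← Int.cast_abs] at this
  exact_mod_cast this

theorem wv_loc {g a : ℝ → ℝ → ℝ} {χ : ℝ → ℝ} {l B : ℝ} {R : ℕ} (hl : 1 ≤ l) (hB : 1 ≤ B) (hR : B + 2 ≤ R)
    (ha : ∀ t ∈ Icc (1 : ℝ) 2, ∀ s, a t s ≠ 0 → |s| ≤ 1) (hg : ∀ t ∈ Icc (1 : ℝ) 2, ∀ s, |s| ≤ 1 → |g t s| ≤ B)
    (hχ : ∀ s, χ s ≠ 0 → |s| ≤ 1) (h : ℝ × ℝ → ℝ) (P : ℝ × ℝ × ℝ) (hP : P.2.2 ∈ Icc (1 : ℝ) 2) :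
    wv g χ l h (a P.2.2) P = wv g χ l ((big R (⌊P.1⌋, ⌊P.2.1⌋)).indicator h) (a P.2.2) P := by
  unfold wv
  congr 1; funext x
  by_cases hx : x ∈ big R (⌊P.1⌋, ⌊P.2.1⌋)
  · rw [indicator_of_mem hx]
  rw [indicator_of_notMem hx, zero_mul]
  have : Ker g χ l (a P.2.2) P x = 0 := by
    by_contra hne
    refine hx (mem_big.mpr ?_)
    unfold Ker at hne
    have h1 := ha _ hP _ (left_ne_zero_of_mul hne)
    have h2 := hχ _ (right_ne_zero_of_mul (right_ne_zero_of_mul hne))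
    have h3 := hg _ hP _ h1
    rw [abs_mul, abs_of_pos (by linarith)] at h2
    have h4 : |P.2.1 - x.2 - g P.2.2 (P.1 - x.1)| ≤ 1 := by
      have := abs_nonneg (P.2.1 - x.2 - g P.2.2 (P.1 - x.1))
      nlinarith only [this, h2, hl]
    refine ⟨floor_near (B := B) (by linarith) hR, floor_near (B := B) ?_ hR⟩
    have := abs_add_le (P.2.1 - x.2 - g P.2.2 (P.1 - x.1)) (g P.2.2 (P.1 - x.1))
    rw [sub_add_cancel] at this
    linarith
  rw [this, mul_zero]

theorem wv_tele {g : ℝ → ℝ → ℝ} {φ ψ : ℝ → ℝ} (hψ : ∀ x, 2 * φ (2 * x) - φ x = ψ x) {l : ℝ} (hl : 1 ≤ l) {b : ℝ → ℝ}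
    {P : ℝ × ℝ × ℝ} (hbc : Continuous b) (hφc : Continuous φ) (hg : Continuous (g P.2.2)) {Mb Mφ : ℝ} (hb : ∀ s, |b s| ≤ Mb)
    (hφ : ∀ s, |φ s| ≤ Mφ) {f : ℝ × ℝ → ℝ} (hf : Integrable f) :
    wv g φ (2 * l) f b P = wv g φ l f b P + wv g ψ l f b P := by
  have h1 := wv_int (g := g) (P := P) hl hbc hφc hg hb hφ hf
  have h2 := wv_int (g := g) (P := P) (by linarith : 1 ≤ 2 * l) hbc hφc hg hb hφ hf
  rw [← sub_eq_iff_eq_add']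
  unfold wv
  rw [← integral_sub h2 h1]
  congr 1; funext x
  unfold Ker
  rw [← hψ]
  have e : 2 * l * (P.2.1 - x.2 - g P.2.2 (P.1 - x.1)) = 2 * (l * (P.2.1 - x.2 - g P.2.2 (P.1 - x.1))) := by ring
  rw [e]; ring

theorem wv_lim {g : ℝ → ℝ → ℝ} {φ : ℝ → ℝ} {b : ℝ → ℝ} {P : ℝ × ℝ × ℝ} (hbc : Continuous b) (hb : ∀ s, b s ≠ 0 → |s| ≤ 1)
    (hφc : Continuous φ) (hφ : ∀ s, φ s ≠ 0 → |s| ≤ 1) (hφ1 : ∫ x, φ x = 1) (hg : Continuous (g P.2.2)) {f : ℝ × ℝ → ℝ}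
    (hf : Continuous f) :
    Filter.Tendsto (fun J : ℕ => wv g φ (2 ^ J) f b P) Filter.atTop (nhds (∫ s, b s * f (P.1 - s, P.2.1 - g P.2.2 s))) := by
  set G : ℝ → ℝ × ℝ → ℝ := fun ε z => b z.1 * φ z.2 * f (P.1 - z.1, P.2.1 - ε * z.2 - g P.2.2 z.1) with hG
  have hGc : Continuous (Function.uncurry G) := by simp only [hG, Function.uncurry_def]; fun_prop
  have hsupp : ∀ ε z, G ε z ≠ 0 → |z.1| ≤ 1 ∧ |z.2| ≤ 1 := fun ε z hz =>
    ⟨hb _ (left_ne_zero_of_mul (left_ne_zero_of_mul hz)), hφ _ (right_ne_zero_of_mul (left_ne_zero_of_mul hz))⟩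
  have hset : ∀ ε, ∫ z in Icc (-1 : ℝ) 1 ×ˢ Icc (-1 : ℝ) 1, G ε z = ∫ z, G ε z := fun ε => by
    refine setIntegral_eq_integral_of_forall_compl_eq_zero fun z hz => ?_
    by_contra h
    have := hsupp ε z h
    rw [abs_le, abs_le] at this
    exact hz ⟨this.1, this.2⟩
  have hcont : Continuous fun ε => ∫ z, G ε z := by
    simp only [← hset]
    exact continuous_parametric_integral_of_continuous hGc (isCompact_Icc.prod isCompact_Icc)
  have hintg : ∀ ε, Integrable (G ε) := fun ε => by
    refine Continuous.integrable_of_hasCompactSupport (hGc.comp (by fun_prop : Continuous fun z : ℝ × ℝ => (ε, z))) ?_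
    refine HasCompactSupport.intro (isCompact_Icc.prod isCompact_Icc : IsCompact (Icc (-1 : ℝ) 1 ×ˢ Icc (-1 : ℝ) 1)) fun z hz => ?_
    by_contra h
    have := hsupp ε z h
    rw [abs_le, abs_le] at this
    exact hz ⟨this.1, this.2⟩
  have hprod : ∀ ε, ∫ z, G ε z = ∫ s, ∫ w, G ε (s, w) := fun ε => by
    rw [Measure.volume_eq_prod, integral_prod _ (by rw [← Measure.volume_eq_prod]; exact hintg ε)]
  have e0 : ∫ z, G 0 z = ∫ s, b s * f (P.1 - s, P.2.1 - g P.2.2 s) := by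
    rw [hprod]
    congr 1; funext s
    simp only [hG, zero_mul, sub_zero]
    have : ∀ w, b s * φ w * f (P.1 - s, P.2.1 - g P.2.2 s) = (b s * f (P.1 - s, P.2.1 - g P.2.2 s)) * φ w := fun w => by ring
    simp only [this]
    rw [integral_const_mul, hφ1, mul_one]
  have eJ : ∀ l : ℝ, 1 ≤ l → wv g φ l f b P = ∫ z, G (1 / l) z := by
    intro l hl
    have hl0 : 0 < l := by linarith
    rw [hprod]
    have := int_shear (H := fun z => f (P.1 - z.1, P.2.1 - z.2 - g P.2.2 z.1) * (b z.1 * (l * φ (l * z.2)))) (γ := g P.2.2) hg (by fun_prop)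
      (R := 1) (fun z hz => bpsi_supp hl hb hφ z (right_ne_zero_of_mul hz)) P.1 P.2.1
    unfold wv Ker
    convert this using 1
    · congr 1; funext x
      congr 2
      ext
      · simp
      · simp only []; ring
    · congr 1; funext s
      rw [← int_dil hl]
      congr 1; funext v
      simp only [hG]
      rw [show 1 / l * (l * v) = v by field_simp]
      ring
  have hl : Filter.Tendsto (fun J : ℕ => 1 / (2 : ℝ) ^ J) Filter.atTop (nhds 0) := by
    have := tendsto_pow_atTop_nhds_zero_of_lt_one (by norm_num : (0 : ℝ) ≤ 1 / 2) (by norm_num)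
    simpa [one_div] using this
  have := (hcont.tendsto 0).comp hl
  rw [e0] at this
  refine this.congr fun J => ?_
  rw [eJ _ (one_le_pow₀ (by norm_num))]; rfl

/-- The two-dimensional maximal theorem. -/
theorem thm2D (p q : ℝ) (hp : 1 < p) (hpq : p ≤ q) (hq2 : q < 2 * p) (hq3 : 3 * (q / p) - 1 < q) :
    ∃ N : ℕ, ∀ c B : ℝ, 0 < c → ∃ C : ℝ, 0 < C ∧ ∀ (g a S : ℝ → ℝ → ℝ) (f : ℝ × ℝ → ℝ),
      Fam (N + 1) c B g a S → (∀ t ∈ Icc (1 : ℝ) 2, ∀ s, |s| ≤ 1 → |g t s| ≤ B) → Continuous f → HasCompactSupport f →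
      ∫⁻ y : ℝ × ℝ, (⨆ t : Icc (1 : ℝ) 2, ENNReal.ofReal |∫ s, a t s * f (y.1 - s, y.2 - g t s)|) ^ q ≤
        ENNReal.ofReal C * (∫⁻ x, ENNReal.ofReal (|f x| ^ p)) ^ (q / p) := by
  have hp0 : 0 < p := by linarith
  have hq0 : 0 < q := by linarith
  obtain ⟨γ, N, hγ, HL⟩ := locD p q hp hpq hq2 hq3
  obtain ⟨φ, Θ, hφ, hΘ, hφs, hΘs, hφ1, hψ⟩ := exists_moll N
  obtain ⟨Mφ, hMφ0, hMφ⟩ := bdd_jet hφ (hcs_of fun x hx => abs_le.mp (hφs x hx)) 0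
  obtain ⟨Mx, hMx0, hMx⟩ := bdd_jet hΘ (hcs_of fun x hx => abs_le.mp (hΘs x hx)) (N + 1)
  have hφb : ∀ x, |φ x| ≤ Mφ := fun x => by simpa using hMφ 0 le_rfl x
  have hSrc : Src (N + 1) Mx Θ := ⟨hΘ, fun x => by simpa using hMx 0 (Nat.zero_le _) x, hMx _ le_rfl, fun x hx => by
    by_contra h
    push Not at h
    apply hx
    have h1 : φ x = 0 := by_contra fun h' => absurd (hφs x h') (not_le.mpr h)
    have h2 : φ (2 * x) = 0 := by_contra fun h' => by
      have := hφs _ h'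
      rw [abs_mul, abs_two] at this
      linarith
    rw [← hψ, h1, h2]; ring⟩
  refine ⟨N, fun c B hc => ?_⟩
  obtain ⟨C, hC, HC⟩ := HL c B Mx hc
  set R : ℕ := ⌈B + 2⌉₊ with hR
  have hRB : B + 2 ≤ R := Nat.le_ceil _
  have hA := shifts_card R
  set A : ℝ := ((shifts R).card : ℝ) with hAdef
  have hA0 : 0 < A := by linarith
  set K0 : ℝ := 2 ^ q * (2 * A) ^ q * A with hK0
  have hK0p : 0 < K0 := by positivity
  set D1 : ℝ := max (4 * (|B| * Mφ) ^ q) (C * 2 ^ γ) with hD1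
  have hD1p : 0 < D1 := lt_of_lt_of_le (by positivity) (le_max_right _ _)
  set ρ : ℝ := 2 ^ (-(γ / 2)) with hρ
  have hρ0 : 0 < ρ := by positivity
  have hρ1 : ρ < 1 := Real.rpow_lt_one_of_one_lt_of_neg (by norm_num) (by linarith)
  have h1ρ : 0 < 1 - ρ := by linarith
  have h1r : 0 < 1 - ρ ^ (1 / q) := by
    have : ρ ^ (1 / q) < 1 := Real.rpow_lt_one hρ0.le hρ1 (by positivity)
    linarith
  refine ⟨(1 / (1 - ρ ^ (1 / q))) ^ q * (1 / (1 - ρ)) * (K0 * D1), by positivity, ?_⟩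
  intro g a S f F hgB hf hfc
  have hB := F.B_one
  have hfi : Integrable f := hf.integrable_of_hasCompactSupport hfc
  obtain ⟨b, hfb⟩ := hfc.exists_bound_of_continuous hf
  have hfp : Integrable fun x => |f x| ^ p := by
    refine Continuous.integrable_of_hasCompactSupport (hf.abs.rpow_const fun _ => Or.inr hp0.le) ?_
    exact hfc.comp_left (g := fun x => |x| ^ p) (by simp [Real.zero_rpow hp0.ne'])
  have aB : ∀ t ∈ Icc (1 : ℝ) 2, ∀ s, |a t s| ≤ B := fun t ht s => by
    simpa using F.a_jet _ ht 0 (Nat.zero_le _) s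
  set ψ := iteratedDeriv (N + 1) Θ with hψd
  -- majorants
  have HW : ∀ (χ : ℝ → ℝ) (n : ℕ) (D M : ℝ), 1 ≤ n → 0 ≤ D → (∀ s, |χ s| ≤ M) → (∀ s, χ s ≠ 0 → |s| ≤ 1) →
      (∀ h : ℝ × ℝ → ℝ, Measurable h → (∃ b, ∀ x, |h x| ≤ b) → Integrable h → ∫ x, |h x| ≤ 1 →
      Integrable (fun x => |h x| ^ p) → ∫ x, |h x| ^ p ≤ 1 → ∀ Q : Finset (ℝ × ℝ × ℝ), Pts n Q →
      (Q.card : ℝ) ≤ 4 * (n : ℝ) ^ 2 → ∑ P ∈ Q, |wv g χ n h (a P.2.2) P| ^ q ≤ D * (n : ℝ) ^ 2) →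
      ∃ W : ℝ × ℝ → ℝ≥0∞, Measurable W ∧ (∀ y : ℝ × ℝ, ∀ t ∈ Icc (1 : ℝ) 2, ENNReal.ofReal |wv g χ n f (a t) (y.1, y.2, t)| ≤ W y) ∧
        ∫⁻ y, W y ^ q ≤ ENNReal.ofReal (K0 * D) * (∫⁻ x, ENNReal.ofReal (|f x| ^ p)) ^ (q / p) := by
    intro χ n D M hn hD hχ hχs hH
    have hn1 : (1 : ℝ) ≤ n := by exact_mod_cast hn
    exact loc_glob (T := fun h P => wv g χ n h (a P.2.2) P) hn hp hpq hD (fun c h P => wv_smul _ _ _ _ c h P)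
      (fun h P hP => wv_loc hn1 hB hRB F.a_supp hgB hχs h P hP) hH hf.measurable hfb hfi hfp
      (K := B * (n * M) * ∫ x, |f x|) (fun P hP => wv_le' hn1 (aB _ hP) hχ hfi)
  have W0 : ∃ W : ℝ × ℝ → ℝ≥0∞, Measurable W ∧ (∀ y : ℝ × ℝ, ∀ t ∈ Icc (1 : ℝ) 2, ENNReal.ofReal |wv g φ 1 f (a t) (y.1, y.2, t)| ≤ W y) ∧
        ∫⁻ y, W y ^ q ≤ ENNReal.ofReal (K0 * D1) * (∫⁻ x, ENNReal.ofReal (|f x| ^ p)) ^ (q / p) := by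
    have := HW φ 1 D1 Mφ le_rfl hD1p.le hφb hφs ?_
    · simpa using this
    · intro h _ _ hi h1 _ _ Q hQ hcard
      have hle : ∀ P ∈ Q, |wv g φ (1 : ℕ) h (a P.2.2) P| ^ q ≤ (|B| * Mφ) ^ q := fun P hP => by
        refine Real.rpow_le_rpow (abs_nonneg _) ?_ hq0.le
        rw [Nat.cast_one]
        refine (wv_le' le_rfl (aB _ (hQ.t_mem P hP)) hφb hi).trans ?_
        rw [abs_of_pos (by linarith), one_mul]
        exact mul_le_of_le_one_right (by positivity) h1
      refine (Finset.sum_le_sum hle).trans ?_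
      rw [Finset.sum_const, nsmul_eq_mul]
      have h4 : (Q.card : ℝ) ≤ 4 := by simpa using hcard
      calc (Q.card : ℝ) * (|B| * Mφ) ^ q ≤ 4 * (|B| * Mφ) ^ q := mul_le_mul_of_nonneg_right h4 (by positivity)
        _ ≤ D1 := le_max_left _ _
        _ = _ := by simp
  have Wj : ∀ j : ℕ, ∃ W : ℝ × ℝ → ℝ≥0∞, Measurable W ∧ (∀ y : ℝ × ℝ, ∀ t ∈ Icc (1 : ℝ) 2,
      ENNReal.ofReal |wv g ψ (2 ^ j) f (a t) (y.1, y.2, t)| ≤ W y) ∧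
        ∫⁻ y, W y ^ q ≤ ENNReal.ofReal (K0 * (D1 * ρ ^ (2 * (j + 1)))) * (∫⁻ x, ENNReal.ofReal (|f x| ^ p)) ^ (q / p) := by
    intro j
    have := HW ψ (2 ^ j) (D1 * ρ ^ (2 * (j + 1))) Mx Nat.one_le_two_pow (by positivity) hSrc.bd' hSrc.supp ?_
    · simpa using this
    · intro h hm hb hi h1 hip h1p Q hQ hcard
      have hl1 : (1 : ℝ) ≤ ((2 ^ j : ℕ) : ℝ) := by exact_mod_cast Nat.one_le_two_pow
      refine (HC g a S Θ h F hSrc hm hb hi h1 hip h1p _ hl1 Q hQ hcard).trans ?_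
      refine mul_le_mul_of_nonneg_right ?_ (by positivity)
      have e : (((2 ^ j : ℕ) : ℝ)) ^ (-γ) = 2 ^ γ * ρ ^ (2 * (j + 1)) := by
        rw [hρ, ← Real.rpow_natCast (2 ^ (-(γ / 2)) : ℝ), ← Real.rpow_mul (by norm_num), ← Real.rpow_add (by norm_num)]
        push_cast
        rw [← Real.rpow_natCast, ← Real.rpow_mul (by norm_num)]
        congr 1; ring
      rw [e, ← mul_assoc]
      exact mul_le_mul_of_nonneg_right (le_max_right _ _) (by positivity)
  obtain ⟨V0, hV0m, hV0, hV0i⟩ := W0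
  choose V hVm hV hVi using Wj
  set X := (∫⁻ x, ENNReal.ofReal (|f x| ^ p)) ^ (q / p) with hX
  let U : ℕ → ℝ × ℝ → ℝ≥0∞ := fun j => match j with | 0 => V0 | (j + 1) => V j
  have hUm : ∀ j, Measurable (U j) := fun j => by
    rcases j with _ | j
    · exact hV0m
    · exact hVm j
  have hUi : ∀ j, ∫⁻ y, U j y ^ q ≤ ENNReal.ofReal (ρ ^ (2 * j)) * (ENNReal.ofReal (K0 * D1) * X) := fun j => by
    rcases j with _ | j
    · simpa using hV0i
    · refine (hVi j).trans (le_of_eq ?_)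
      rw [← mul_assoc (ENNReal.ofReal (ρ ^ _)), ← ENNReal.ofReal_mul (by positivity)]
      congr 2; ring
  have main := tsum_Lq hUm hq0 hρ0 hρ1 hUi
  rw [← mul_assoc, ← ENNReal.ofReal_mul (by positivity)] at main
  refine le_trans (lintegral_mono fun y => ENNReal.rpow_le_rpow (iSup_le fun t => ?_) hq0.le) main
  obtain ⟨t, ht⟩ := t
  have lim := wv_lim (g := g) (φ := φ) (b := a t) (P := (y.1, y.2, t)) (F.a_sm t ht).continuous (F.a_supp t ht) hφ.continuous hφs hφ1
    (F.g_sm t ht).continuous hf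
  have lim2 := (ENNReal.continuous_ofReal.tendsto _).comp lim.abs
  refine le_of_tendsto' lim2 fun J => ?_
  have tele : |wv g φ (2 ^ J) f (a t) (y.1, y.2, t)| ≤ |wv g φ 1 f (a t) (y.1, y.2, t)| + ∑ j ∈ Finset.range J, |wv g ψ (2 ^ j) f (a t) (y.1, y.2, t)| := by
    induction J with
    | zero => simp
    | succ J ih =>
      rw [pow_succ, mul_comm, wv_tele hψ (one_le_pow₀ (by norm_num)) (F.a_sm t ht).continuous hφ.continuous (F.g_sm t ht).continuous
        (aB t ht) hφb hfi, Finset.sum_range_succ, ← add_assoc]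
      exact (abs_add_le _ _).trans (add_le_add ih le_rfl)
  calc _ ≤ ENNReal.ofReal (|wv g φ 1 f (a t) (y.1, y.2, t)| + ∑ j ∈ Finset.range J, |wv g ψ (2 ^ j) f (a t) (y.1, y.2, t)|) :=
        ENNReal.ofReal_le_ofReal tele
    _ = ENNReal.ofReal |wv g φ 1 f (a t) (y.1, y.2, t)| + ∑ j ∈ Finset.range J, ENNReal.ofReal |wv g ψ (2 ^ j) f (a t) (y.1, y.2, t)| := by
        rw [ENNReal.ofReal_add (abs_nonneg _) (Finset.sum_nonneg fun _ _ => abs_nonneg _),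
          ENNReal.ofReal_sum_of_nonneg fun _ _ => abs_nonneg _]
    _ ≤ ∑ j ∈ Finset.range (J + 1), U j y := by
        rw [Finset.sum_range_succ', add_comm]
        exact add_le_add (Finset.sum_le_sum fun j _ => hV j y t ht) (hV0 y t ht)
    _ ≤ _ := ENNReal.sum_le_tsum _

lemma mink_aux {Y : Type*} [MeasurableSpace Y] (μ : Measure ℝ) (ν : Measure Y) [IsFiniteMeasure μ]
    [SFinite ν] (V : ℝ → Y → ℝ≥0∞) (hV : Measurable (Function.uncurry V)) (n : ℝ → ℝ≥0∞)
    (hn : Measurable n) (hfin : ∀ u, n u ≠ ∞) (q : ℝ) (hq : 1 < q) (C : ℝ≥0∞) (hC : C ≠ 0)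
    (hCt : C ≠ ∞)
    (hb : ∀ u, ∫⁻ y, (V u y)^q ∂ν ≤ C * (n u)^q) :
    ∫⁻ y, (∫⁻ u, V u y ∂μ)^q ∂ν ≤ C * (∫⁻ u, n u ∂μ)^q := by
  have hq0 : 0 < q := by linarith
  by_cases hI : ∫⁻ u, n u ∂μ = ∞
  · rw [hI, ENNReal.top_rpow_of_pos hq0, ENNReal.mul_top hC]; exact le_top
  have key : ∀ ε : ℝ≥0∞, ε ≠ 0 → ε ≠ ∞ →
      ∫⁻ y, (∫⁻ u, V u y ∂μ)^q ∂ν ≤ C * (∫⁻ u, n u ∂μ + ε * μ univ)^q := by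
    intro ε he0 het
    have hw0 : ∀ u, n u + ε ≠ 0 := fun u => by simp [he0]
    have hwt : ∀ u, n u + ε ≠ ∞ := fun u => by simp [hfin u, het]
    have hwm : Measurable (fun u => n u + ε) := hn.add_const _
    have hwI : ∫⁻ u, (n u + ε) ∂μ = ∫⁻ u, n u ∂μ + ε * μ univ := by
      rw [lintegral_add_right _ measurable_const, lintegral_const]
    set r : ℝ := q / (q - 1) with hr
    have hconj : q.HolderConjugate r := Real.HolderConjugate.conjExponent hq
    have hr0 : 0 < r := by rw [hr]; apply div_pos <;> linarith
    have hrinv : 1 / r = (q - 1) / q := by rw [hr]; field_simp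
    have h1 : ∀ y, (∫⁻ u, V u y ∂μ)^q ≤
        (∫⁻ u, (V u y)^q * (n u + ε)^(1 - q) ∂μ) * (∫⁻ u, (n u + ε) ∂μ)^(q - 1) := by
      intro y
      have hVy : Measurable (fun u => V u y) := hV.comp measurable_prodMk_right
      have h := ENNReal.lintegral_mul_le_Lp_mul_Lq μ hconj
        (f := fun u => V u y * (n u + ε)^(-(1/r))) (g := fun u => (n u + ε)^(1/r))
        (hVy.mul (hwm.pow_const _)).aemeasurable (hwm.pow_const _).aemeasurable
      have e1 : ∫⁻ u, ((fun u => V u y * (n u + ε)^(-(1/r))) * fun u => (n u + ε)^(1/r)) u ∂μ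
          = ∫⁻ u, V u y ∂μ := by
        apply lintegral_congr
        intro u
        simp only [Pi.mul_apply]
        rw [mul_assoc, ← ENNReal.rpow_add _ _ (hw0 u) (hwt u)]
        simp
      have e2 : ∫⁻ u, (V u y * (n u + ε)^(-(1/r)))^q ∂μ = ∫⁻ u, (V u y)^q * (n u + ε)^(1 - q) ∂μ := by
        apply lintegral_congr
        intro u
        rw [ENNReal.mul_rpow_of_nonneg _ _ hq0.le, ← ENNReal.rpow_mul, hrinv]
        congr 2
        field_simp
        ring
      have e3 : ∫⁻ u, ((n u + ε)^(1/r))^r ∂μ = ∫⁻ u, (n u + ε) ∂μ := by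
        apply lintegral_congr
        intro u
        rw [← ENNReal.rpow_mul, one_div_mul_cancel hr0.ne', ENNReal.rpow_one]
      rw [e1] at h
      simp only [e2, e3] at h
      calc _ ≤ _ := ENNReal.rpow_le_rpow h hq0.le
        _ = _ := by
          rw [ENNReal.mul_rpow_of_nonneg _ _ hq0.le, ← ENNReal.rpow_mul, ← ENNReal.rpow_mul,
            one_div_mul_cancel hq0.ne', ENNReal.rpow_one, hrinv]
          congr 2
          field_simp
    have hm : Measurable (Function.uncurry fun (y : Y) (u : ℝ) => (V u y)^q * (n u + ε)^(1 - q)) := by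
      have a1 : Measurable (fun z : Y × ℝ => V z.2 z.1) := hV.comp measurable_swap
      exact (a1.pow_const _).mul ((hwm.comp measurable_snd).pow_const _)
    calc _ ≤ ∫⁻ y, (∫⁻ u, (V u y)^q * (n u + ε)^(1 - q) ∂μ) * (∫⁻ u, (n u + ε) ∂μ)^(q - 1) ∂ν :=
          lintegral_mono h1
      _ = (∫⁻ y, (∫⁻ u, (V u y)^q * (n u + ε)^(1 - q) ∂μ) ∂ν) * (∫⁻ u, (n u + ε) ∂μ)^(q - 1) := by
          rw [lintegral_mul_const]
          exact hm.lintegral_prod_right'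
      _ = (∫⁻ u, (∫⁻ y, (V u y)^q * (n u + ε)^(1 - q) ∂ν) ∂μ) * (∫⁻ u, (n u + ε) ∂μ)^(q - 1) := by
          rw [lintegral_lintegral_swap hm.aemeasurable]
      _ ≤ (∫⁻ u, C * (n u + ε) ∂μ) * (∫⁻ u, (n u + ε) ∂μ)^(q - 1) := by
          refine mul_le_mul_left (lintegral_mono fun u => ?_) _
          have hVu : Measurable (fun y => V u y) := hV.comp measurable_prodMk_left
          rw [lintegral_mul_const _ (hVu.pow_const _)]
          calc _ ≤ C * (n u)^q * (n u + ε)^(1 - q) := mul_le_mul_left (hb u) _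
            _ ≤ C * (n u + ε)^q * (n u + ε)^(1 - q) := by
                refine mul_le_mul_left (mul_le_mul_right (ENNReal.rpow_le_rpow ?_ hq0.le) _) _
                exact le_self_add
            _ = C * (n u + ε) := by
                rw [mul_assoc, ← ENNReal.rpow_add _ _ (hw0 u) (hwt u)]
                simp
      _ = C * (∫⁻ u, (n u + ε) ∂μ)^q := by
          rw [lintegral_const_mul _ hwm, mul_assoc]
          congr 1
          conv_lhs => rw [← ENNReal.rpow_one (∫⁻ u, (n u + ε) ∂μ)]
          rw [← ENNReal.rpow_mul, ← ENNReal.rpow_add_of_nonneg]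
          · congr 1; ring
          · norm_num
          · linarith
      _ = _ := by rw [hwI]
  have hlim : Filter.Tendsto (fun ε : ℝ≥0∞ => C * (∫⁻ u, n u ∂μ + ε * μ univ)^q)
      (nhdsWithin 0 (Ioi 0)) (nhds (C * (∫⁻ u, n u ∂μ)^q)) := by
    have h0 : Filter.Tendsto (fun ε : ℝ≥0∞ => ∫⁻ u, n u ∂μ + ε * μ univ)
      (nhds 0) (nhds (∫⁻ u, n u ∂μ + 0 * μ univ)) := by
      refine Filter.Tendsto.add tendsto_const_nhds ?_
      exact ENNReal.Tendsto.mul_const Filter.tendsto_id (Or.inr (measure_ne_top _ _))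
    rw [zero_mul, add_zero] at h0
    refine Filter.Tendsto.mono_left ?_ nhdsWithin_le_nhds
    exact ENNReal.Tendsto.const_mul (((ENNReal.continuous_rpow_const).tendsto _).comp h0) (Or.inr hCt)
  refine ge_of_tendsto hlim ?_
  have hlt : ∀ᶠ ε : ℝ≥0∞ in nhdsWithin 0 (Ioi 0), ε < ∞ :=
    nhdsWithin_le_nhds (Iio_mem_nhds ENNReal.zero_lt_top)
  filter_upwards [self_mem_nhdsWithin, hlt] with ε h1 h2
  exact key ε (ne_of_gt h1) h2.ne

lemma holder_aux (n : ℝ → ℝ≥0∞) (hn : Measurable n) (p q : ℝ) (hp : 1 < p) (hpq : p ≤ q) :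
    ∫⁻ y : ℝ, (∫⁻ u in Icc (-1:ℝ) 1, n (y - u))^q ≤
      (2:ℝ≥0∞)^(q + 1) * (∫⁻ v, (n v)^p)^(q/p) := by
  have hp0 : 0 < p := by linarith
  have hq0 : 0 < q := by linarith
  set F := ∫⁻ v, (n v)^p with hF
  have hvol : (volume.restrict (Icc (-1:ℝ) 1)) univ = 2 := by
    simp only [Measure.restrict_apply_univ, Real.volume_Icc]; norm_num
  have hmm : Measurable (Function.uncurry fun (y u : ℝ) => (n (y - u))^p) :=
    (hn.comp (measurable_fst.sub measurable_snd)).pow_const _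
  have h1 : ∀ y : ℝ, (∫⁻ u in Icc (-1:ℝ) 1, n (y - u))^q ≤
      (2:ℝ≥0∞)^q * F^(q/p - 1) * ∫⁻ u in Icc (-1:ℝ) 1, (n (y - u))^p := by
    intro y
    have hny : Measurable (fun u => n (y - u)) := hn.comp (measurable_const.sub measurable_id)
    have hconj := Real.HolderConjugate.conjExponent hp
    have h := ENNReal.lintegral_mul_le_Lp_mul_Lq (volume.restrict (Icc (-1:ℝ) 1)) hconj
        (f := fun u => n (y - u)) (g := fun u => 1) hny.aemeasurable aemeasurable_const
    simp only [ENNReal.one_rpow, lintegral_const, one_mul, hvol] at h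
    have h2 : ∫⁻ u in Icc (-1:ℝ) 1, n (y - u) ≤
      (∫⁻ u in Icc (-1:ℝ) 1, (n (y - u))^p)^(1/p) * 2 := by
      have h' : ∫⁻ u in Icc (-1:ℝ) 1, n (y - u) ≤
        (∫⁻ u in Icc (-1:ℝ) 1, (n (y - u))^p)^(1/p) * 2^(1/p.conjExponent) := by
        refine le_trans (le_of_eq (lintegral_congr fun u => ?_)) h
        simp
      calc _ ≤ _ := h'
        _ ≤ _ := by
          refine mul_le_mul_right ?_ _
          conv_rhs => rw [← ENNReal.rpow_one 2]
          apply ENNReal.rpow_le_rpow_of_exponent_le (by norm_num)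
          have := hconj.symm.lt
          first
          | exact inv_le_one_of_one_le₀ this.le
          | (rw [one_div]; exact inv_le_one_of_one_le₀ this.le)
    have hX : ∫⁻ u in Icc (-1:ℝ) 1, (n (y - u))^p ≤ F := by
      calc _ ≤ ∫⁻ u, (n (y - u))^p := setLIntegral_le_lintegral _ _
        _ = F := lintegral_sub_left_eq_self (fun v => (n v)^p) y
    calc _ ≤ _ := ENNReal.rpow_le_rpow h2 hq0.le
      _ = (2:ℝ≥0∞)^q * (∫⁻ u in Icc (-1:ℝ) 1, (n (y - u))^p)^(q/p) := by
        rw [ENNReal.mul_rpow_of_nonneg _ _ hq0.le, ← ENNReal.rpow_mul, mul_comm]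
        congr 2; field_simp
      _ = (2:ℝ≥0∞)^q * ((∫⁻ u in Icc (-1:ℝ) 1, (n (y - u))^p)^(q/p - 1) *
            (∫⁻ u in Icc (-1:ℝ) 1, (n (y - u))^p)) := by
        congr 1
        conv_rhs => rw [← ENNReal.rpow_one (∫⁻ u in Icc (-1:ℝ) 1, (n (y - u))^p)]
        rw [← ENNReal.rpow_mul, one_mul, ← ENNReal.rpow_add_of_nonneg]
        · congr 1; ring
        · rw [sub_nonneg, le_div_iff₀ hp0]; linarith
        · norm_num
      _ ≤ _ := by
        rw [mul_assoc]
        refine mul_le_mul_right (mul_le_mul_left (ENNReal.rpow_le_rpow hX ?_) _) _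
        rw [sub_nonneg, le_div_iff₀ hp0]; linarith
  calc _ ≤ ∫⁻ y : ℝ, (2:ℝ≥0∞)^q * F^(q/p - 1) * ∫⁻ u in Icc (-1:ℝ) 1, (n (y - u))^p :=
        lintegral_mono h1
    _ = (2:ℝ≥0∞)^q * F^(q/p - 1) * ∫⁻ y : ℝ, ∫⁻ u in Icc (-1:ℝ) 1, (n (y - u))^p := by
        rw [lintegral_const_mul]
        exact hmm.lintegral_prod_right'
    _ = (2:ℝ≥0∞)^q * F^(q/p - 1) * (F * 2) := by
        congr 1
        rw [lintegral_lintegral_swap hmm.aemeasurable]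
        have : ∀ u : ℝ, ∫⁻ y : ℝ, (n (y - u))^p = F := fun u =>
          lintegral_sub_right_eq_self (fun v => (n v)^p) u
        simp only [this, lintegral_const, hvol]
    _ = _ := by
        have e1 : (2:ℝ≥0∞)^(q+1) = 2^q * 2 := by
          rw [ENNReal.rpow_add_of_nonneg _ _ hq0.le (by norm_num), ENNReal.rpow_one]
        have e2 : F^(q/p) = F^(q/p - 1) * F := by
          conv_rhs => rw [← ENNReal.rpow_one F]
          rw [← ENNReal.rpow_mul, one_mul, ← ENNReal.rpow_add_of_nonneg]
          · congr 1; ring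
          · rw [sub_nonneg, le_div_iff₀ hp0]; linarith
          · norm_num
        rw [e1, e2]; ring

theorem thm3D (p q : ℝ) (hp : 1 < p) (hpq : p ≤ q) (hq2 : q < 2*p) (hq3 : 3*(q/p)-1 < q) :
    ∃ N : ℕ, ∀ c B : ℝ, 0 < c → ∃ C : ℝ, 0 < C ∧ ∀ (u0 : ℝ) (g a S : ℝ → ℝ → ℝ → ℝ) (f : ℝ × ℝ × ℝ → ℝ),
      u0 ≤ 1 →
      (∀ u, |u| ≤ u0 → Fam (N+1) c B (g u) (a u) (S u)) →
      (∀ u, |u| ≤ u0 → ∀ t ∈ Icc (1:ℝ) 2, ∀ s, |s| ≤ 1 → |g u t s| ≤ B) →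
      (∀ u, ∀ t ∈ Icc (1:ℝ) 2, ∀ s, a u t s ≠ 0 → |u| ≤ u0) →
      (∀ t ∈ Icc (1:ℝ) 2, Continuous (fun x : ℝ × ℝ => g x.1 t x.2)) →
      (∀ t ∈ Icc (1:ℝ) 2, Continuous (fun x : ℝ × ℝ => a x.1 t x.2)) →
      Continuous f → HasCompactSupport f →
      ∫⁻ y : ℝ × ℝ × ℝ, (⨆ t : Icc (1:ℝ) 2, ENNReal.ofReal
          |∫ x : ℝ × ℝ, a x.1 t x.2 * f (y.1 - x.1, y.2.1 - x.2, y.2.2 - g x.1 t x.2)|)^q ≤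
        ENNReal.ofReal C * (∫⁻ x, ENNReal.ofReal (|f x|^p))^(q/p) := by
  have hp0 : 0 < p := by linarith
  have hq0 : 0 < q := by linarith
  obtain ⟨N, hN⟩ := thm2D p q hp hpq hq2 hq3
  refine ⟨N, fun c B hc => ?_⟩
  obtain ⟨C1, hC1, h2⟩ := hN c B hc
  refine ⟨C1 * 2^(q+1), by positivity, ?_⟩
  intro u0 g a S f hu0 hF hgB ha0 hgc hac hf hfs
  have hasupp : ∀ u, ∀ t ∈ Icc (1:ℝ) 2, ∀ s, a u t s ≠ 0 → |s| ≤ 1 := fun u t ht s h =>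
    (hF u (ha0 u t ht s h)).a_supp t ht s h
  set A : Icc (1:ℝ) 2 → ℝ → ℝ → ℝ × ℝ → ℝ := fun t u v y =>
    ∫ s, a u t s * f (v, y.1 - s, y.2 - g u t s) with hA
  set V : ℝ → ℝ → ℝ × ℝ → ℝ≥0∞ := fun u v y => ⨆ t : Icc (1:ℝ) 2, ENNReal.ofReal |A t u v y| with hV
  have hAc : ∀ t, Continuous (fun z : ℝ × ℝ × ℝ × ℝ => A t z.1 z.2.1 z.2.2) := by
    intro t
    have e : (fun z : ℝ × ℝ × ℝ × ℝ => A t z.1 z.2.1 z.2.2) = fun z : ℝ × ℝ × ℝ × ℝ =>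
        ∫ s in Icc (-1:ℝ) 1, a z.1 t s * f (z.2.1, z.2.2.1 - s, z.2.2.2 - g z.1 t s) := by
      funext z
      simp only [hA]
      symm
      apply setIntegral_eq_integral_of_forall_compl_eq_zero
      intro s hs
      by_contra h
      exact hs (abs_le.mp (hasupp z.1 t t.2 s (left_ne_zero_of_mul h)))
    rw [e]
    apply continuous_parametric_integral_of_continuous _ isCompact_Icc
    have k1 : Continuous (fun w : (ℝ × ℝ × ℝ × ℝ) × ℝ => a w.1.1 t w.2) :=
      (hac t t.2).comp (f := fun w : (ℝ × ℝ × ℝ × ℝ) × ℝ => (w.1.1, w.2)) (by fun_prop)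
    have k2 : Continuous (fun w : (ℝ × ℝ × ℝ × ℝ) × ℝ => g w.1.1 t w.2) :=
      (hgc t t.2).comp (f := fun w : (ℝ × ℝ × ℝ × ℝ) × ℝ => (w.1.1, w.2)) (by fun_prop)
    refine k1.mul (hf.comp ?_)
    exact Continuous.prodMk (by fun_prop) (Continuous.prodMk (by fun_prop)
      (Continuous.sub (by fun_prop) k2))
  have hVm : Measurable (fun z : ℝ × ℝ × ℝ × ℝ => V z.1 z.2.1 z.2.2) := by
    apply LowerSemicontinuous.measurable
    apply lowerSemicontinuous_iSup
    intro t
    exact (ENNReal.continuous_ofReal.comp (hAc t).abs).lowerSemicontinuous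
  set n : ℝ → ℝ≥0∞ := fun v => (∫⁻ x : ℝ × ℝ, ENNReal.ofReal (|f (v, x)|^p))^(1/p) with hn
  have hfm : Measurable (fun z : ℝ × ℝ × ℝ => ENNReal.ofReal (|f z|^p)) :=
    (((hf.abs).rpow_const (fun _ => Or.inr hp0.le)).measurable).ennreal_ofReal
  have hnm : Measurable n := (hfm.lintegral_prod_right').pow_const _
  have hsl : ∀ v, HasCompactSupport (fun x : ℝ × ℝ => f (v, x)) := by
    intro v
    apply HasCompactSupport.intro (hfs.isCompact.image continuous_snd)
    intro x hx
    by_contra h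
    exact hx ⟨(v, x), subset_tsupport _ h, rfl⟩
  have hslc : ∀ v, Continuous (fun x : ℝ × ℝ => f (v, x)) := fun v => by fun_prop
  have hnf : ∀ v, n v ≠ ∞ := by
    intro v
    apply ENNReal.rpow_ne_top_of_nonneg (by positivity)
    have hi : Integrable (fun x : ℝ × ℝ => |f (v, x)|^p) := by
      apply Continuous.integrable_of_hasCompactSupport
      · exact ((hslc v).abs).rpow_const (fun _ => Or.inr hp0.le)
      · apply (hsl v).comp_left (g := fun r : ℝ => |r|^p)
        simp [Real.zero_rpow hp0.ne']
    exact hi.lintegral_lt_top.ne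
  have hV2 : ∀ u v, ∫⁻ y, (V u v y)^q ≤ ENNReal.ofReal C1 * (n v)^q := by
    intro u v
    by_cases hu : |u| ≤ u0
    · have h := h2 (g u) (a u) (S u) (fun x => f (v, x)) (hF u hu) (hgB u hu) (hslc v) (hsl v)
      refine h.trans (le_of_eq ?_)
      rw [hn]
      simp only
      rw [← ENNReal.rpow_mul]
      congr 2
      field_simp
    · have hz : ∀ y, V u v y = 0 := by
        intro y
        simp only [hV, hA]
        refine le_antisymm (iSup_le fun t => ?_) bot_le
        have : ∀ s, a u t s = 0 := fun s => by
          by_contra h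
          exact hu (ha0 u t t.2 s h)
        simp [this]
      simp [hz, ENNReal.zero_rpow_of_pos hq0]
  have hpt : ∀ y : ℝ × ℝ × ℝ, (⨆ t : Icc (1:ℝ) 2, ENNReal.ofReal
          |∫ x : ℝ × ℝ, a x.1 t x.2 * f (y.1 - x.1, y.2.1 - x.2, y.2.2 - g x.1 t x.2)|) ≤
        ∫⁻ u in Icc (-1:ℝ) 1, V u (y.1 - u) y.2 := by
    intro y
    refine iSup_le fun t => ?_
    have hintg : Integrable (fun x : ℝ × ℝ => a x.1 t x.2 * f (y.1 - x.1, y.2.1 - x.2, y.2.2 - g x.1 t x.2)) := by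
      apply Continuous.integrable_of_hasCompactSupport
      · refine (hac t t.2).mul (hf.comp ?_)
        exact Continuous.prodMk (by fun_prop) (Continuous.prodMk (by fun_prop)
          (Continuous.sub (by fun_prop) (hgc t t.2)))
      · apply HasCompactSupport.intro ((isCompact_Icc (a := (-1:ℝ)) (b := 1)).prod (isCompact_Icc (a := (-1:ℝ)) (b := 1)))
        intro x hx
        by_contra h
        have h' := left_ne_zero_of_mul h
        exact hx ⟨abs_le.mp ((ha0 _ t t.2 _ h').trans hu0), abs_le.mp (hasupp _ t t.2 _ h')⟩
    have e : ∫ x : ℝ × ℝ, a x.1 t x.2 * f (y.1 - x.1, y.2.1 - x.2, y.2.2 - g x.1 t x.2)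
        = ∫ u, A t u (y.1 - u) y.2 := by
      rw [Measure.volume_eq_prod] at hintg ⊢
      rw [integral_prod _ hintg]
    have e2 : ∫ u, A t u (y.1 - u) y.2 = ∫ u in Icc (-1:ℝ) 1, A t u (y.1 - u) y.2 := by
      symm
      apply setIntegral_eq_integral_of_forall_compl_eq_zero
      intro u hu
      have : ∀ s, a u t s = 0 := fun s => by
        by_contra h
        exact hu (abs_le.mp ((ha0 u t t.2 s h).trans hu0))
      simp [hA, this]
    rw [e, e2, ← Real.norm_eq_abs, ofReal_norm_eq_enorm]
    refine (enorm_integral_le_lintegral_enorm _).trans (lintegral_mono fun u => ?_)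
    rw [← ofReal_norm_eq_enorm, Real.norm_eq_abs]
    exact le_iSup (fun t : Icc (1:ℝ) 2 => ENNReal.ofReal |A t u (y.1 - u) y.2|) t
  have hTm : Measurable (fun y : ℝ × ℝ × ℝ => (∫⁻ u in Icc (-1:ℝ) 1, V u (y.1 - u) y.2)^q) := by
    refine Measurable.pow_const ?_ _
    have : Measurable (fun w : (ℝ × ℝ × ℝ) × ℝ => V w.2 (w.1.1 - w.2) w.1.2) :=
      hVm.comp (g := fun z : ℝ × ℝ × ℝ × ℝ => V z.1 z.2.1 z.2.2)
        (f := fun w : (ℝ × ℝ × ℝ) × ℝ => (w.2, w.1.1 - w.2, w.1.2)) (by fun_prop)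
    exact this.lintegral_prod_right'
  have hFn : ∫⁻ x, ENNReal.ofReal (|f x|^p) = ∫⁻ v, (n v)^p := by
    rw [Measure.volume_eq_prod, lintegral_prod _ hfm.aemeasurable]
    apply lintegral_congr
    intro v
    simp only [hn]
    rw [← ENNReal.rpow_mul, one_div_mul_cancel hp0.ne', ENNReal.rpow_one]
  have hC1' : ENNReal.ofReal C1 ≠ 0 := by simpa using hC1
  calc _ ≤ ∫⁻ y : ℝ × ℝ × ℝ, (∫⁻ u in Icc (-1:ℝ) 1, V u (y.1 - u) y.2)^q :=
        lintegral_mono fun y => ENNReal.rpow_le_rpow (hpt y) hq0.le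
    _ = ∫⁻ y1 : ℝ, ∫⁻ y' : ℝ × ℝ, (∫⁻ u in Icc (-1:ℝ) 1, V u (y1 - u) y')^q := by
        rw [Measure.volume_eq_prod, lintegral_prod _ hTm.aemeasurable]
    _ ≤ ∫⁻ y1 : ℝ, ENNReal.ofReal C1 * (∫⁻ u in Icc (-1:ℝ) 1, n (y1 - u))^q := by
        refine lintegral_mono fun y1 => ?_
        refine mink_aux _ _ (fun u y' => V u (y1 - u) y') ?_ (fun u => n (y1 - u)) ?_ (fun u => hnf _) q
          (by linarith) _ hC1' ENNReal.ofReal_ne_top (fun u => hV2 u _)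
        · exact hVm.comp (g := fun z : ℝ × ℝ × ℝ × ℝ => V z.1 z.2.1 z.2.2)
            (f := fun w : ℝ × ℝ × ℝ => (w.1, y1 - w.1, w.2)) (by fun_prop)
        · exact hnm.comp (measurable_const.sub measurable_id)
    _ = ENNReal.ofReal C1 * ∫⁻ y1 : ℝ, (∫⁻ u in Icc (-1:ℝ) 1, n (y1 - u))^q := by
        rw [lintegral_const_mul]
        refine Measurable.pow_const ?_ _
        have : Measurable (fun w : ℝ × ℝ => n (w.1 - w.2)) := hnm.comp (by fun_prop)
        exact this.lintegral_prod_right'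
    _ ≤ ENNReal.ofReal C1 * ((2:ℝ≥0∞)^(q + 1) * (∫⁻ v, (n v)^p)^(q/p)) :=
        mul_le_mul_right (holder_aux n hnm p q hp hpq) _
    _ = _ := by
        rw [hFn, ← mul_assoc, ENNReal.ofReal_mul hC1.le, ← ENNReal.ofReal_rpow_of_nonneg (by norm_num) (by positivity)]
        simp

/-- partial derivative in the second variable -/
noncomputable def D2 (r : ℝ × ℝ → ℝ) : ℝ × ℝ → ℝ := fun x => fderiv ℝ r x (0, 1)

lemma D2_smooth {r : ℝ × ℝ → ℝ} (hr : ContDiff ℝ (⊤:ℕ∞) r) : ContDiff ℝ (⊤:ℕ∞) (D2 r) := by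
  unfold D2
  exact (hr.fderiv_right (m := (⊤:ℕ∞)) (by simp)).clm_apply contDiff_const

lemma D2_hcs {r : ℝ × ℝ → ℝ} (hr : HasCompactSupport r) : HasCompactSupport (D2 r) := by
  have := hr.fderiv (𝕜 := ℝ)
  exact this.comp_left (g := fun L : ℝ × ℝ →L[ℝ] ℝ => L (0, 1)) (by simp)

lemma D2_iter_smooth {r : ℝ × ℝ → ℝ} (hr : ContDiff ℝ (⊤:ℕ∞) r) (j : ℕ) :
    ContDiff ℝ (⊤:ℕ∞) (D2^[j] r) := by
  induction j with
  | zero => exact hr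
  | succ j ih => rw [Function.iterate_succ_apply']; exact D2_smooth ih

lemma D2_iter_hcs {r : ℝ × ℝ → ℝ} (hr : HasCompactSupport r) (j : ℕ) :
    HasCompactSupport (D2^[j] r) := by
  induction j with
  | zero => exact hr
  | succ j ih => rw [Function.iterate_succ_apply']; exact D2_hcs ih

lemma D2_hasDeriv {r : ℝ × ℝ → ℝ} (hr : ContDiff ℝ (⊤:ℕ∞) r) (v s : ℝ) :
    HasDerivAt (fun y => r (v, y)) (D2 r (v, s)) s := by
  have h1 : HasFDerivAt r (fderiv ℝ r (v, s)) (v, s) :=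
    (hr.differentiable (by simp)).differentiableAt.hasFDerivAt
  have h2 : HasDerivAt (fun y : ℝ => (v, y)) ((0:ℝ), (1:ℝ)) s :=
    (hasDerivAt_const s v).prodMk (hasDerivAt_id s)
  exact h1.comp_hasDerivAt s h2

lemma D2_scale {r : ℝ × ℝ → ℝ} (hr : ContDiff ℝ (⊤:ℕ∞) r) (v t s : ℝ) :
    HasDerivAt (fun y => r (v, y / t)) (D2 r (v, s / t) / t) s := by
  have h := (D2_hasDeriv hr v (s / t)).comp s ((hasDerivAt_id s).div_const t)
  rw [div_eq_mul_one_div]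
  exact h

lemma D2_iter_scale {r : ℝ × ℝ → ℝ} (hr : ContDiff ℝ (⊤:ℕ∞) r) (v t : ℝ) (j : ℕ) :
    iteratedDeriv j (fun y => r (v, y / t)) = fun s => (D2^[j] r) (v, s / t) / t^j := by
  induction j with
  | zero => simp
  | succ j ih =>
    rw [iteratedDeriv_succ, ih]
    funext s
    rw [((D2_scale (D2_iter_smooth hr j) v t s).div_const (t^j)).deriv, Function.iterate_succ_apply',
      pow_succ', div_div]

lemma lip_one {r : ℝ × ℝ → ℝ} (hr : ContDiff ℝ (⊤:ℕ∞) r) (hc : HasCompactSupport r) :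
    ∃ L : ℝ, 0 ≤ L ∧ (∀ x, |r x| ≤ L) ∧
      ∀ x x' : ℝ × ℝ, |r x - r x'| ≤ L * (|x.1 - x'.1| + |x.2 - x'.2|) := by
  obtain ⟨K, hK⟩ := (hr.of_le (m := 1) (by simp)).lipschitzWith_of_hasCompactSupport hc (by norm_num)
  obtain ⟨M, hM⟩ := hc.exists_bound_of_continuous hr.continuous
  refine ⟨max (K:ℝ) M, le_max_of_le_left K.2, fun x => (hM x).trans (le_max_right _ _), fun x x' => ?_⟩
  have h := hK.dist_le_mul x x'
  rw [Real.dist_eq, Prod.dist_eq, Real.dist_eq, Real.dist_eq] at h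
  have h1 : max |x.1 - x'.1| |x.2 - x'.2| ≤ |x.1 - x'.1| + |x.2 - x'.2| :=
    max_le (le_add_of_nonneg_right (abs_nonneg _)) (le_add_of_nonneg_left (abs_nonneg _))
  calc _ ≤ _ := h
    _ ≤ (max (K:ℝ) M) * (|x.1 - x'.1| + |x.2 - x'.2|) := by
      apply mul_le_mul (le_max_left _ _) h1 (by positivity) (le_max_of_le_left K.2)

lemma lip_all {r : ℝ × ℝ → ℝ} (hr : ContDiff ℝ (⊤:ℕ∞) r) (hc : HasCompactSupport r) (N : ℕ) :
    ∃ L : ℝ, 0 ≤ L ∧ ∀ j ≤ N, (∀ x, |(D2^[j] r) x| ≤ L) ∧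
      ∀ x x' : ℝ × ℝ, |(D2^[j] r) x - (D2^[j] r) x'| ≤ L * (|x.1 - x'.1| + |x.2 - x'.2|) := by
  choose L h0 h1 h2 using fun j => lip_one (D2_iter_smooth hr j) (D2_iter_hcs hc j)
  refine ⟨∑ j ∈ Finset.range (N+1), L j, Finset.sum_nonneg fun j _ => h0 j, fun j hj => ?_⟩
  have hle : L j ≤ ∑ j ∈ Finset.range (N+1), L j :=
    Finset.single_le_sum (fun i _ => h0 i) (Finset.mem_range.mpr (by omega))
  refine ⟨fun x => (h1 j x).trans hle, fun x x' => (h2 j x x').trans ?_⟩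
  exact mul_le_mul_of_nonneg_right hle (by positivity)

lemma itd_id_abs (j : ℕ) (s : ℝ) (hs : |s| ≤ 1) : |iteratedDeriv j (fun x : ℝ => x) s| ≤ 1 := by
  rcases j with _ | _ | j
  · simpa using hs
  · simp
  · rw [iteratedDeriv_succ', iteratedDeriv_succ']; simp

lemma itd_id_abs' (j : ℕ) (s : ℝ) : |iteratedDeriv (j+1) (fun x : ℝ => x) s| ≤ 1 := by
  rcases j with _ | j
  · simp
  · rw [iteratedDeriv_succ', iteratedDeriv_succ']; simp

lemma inv_lip {t t' : ℝ} (ht : 1 ≤ t) (ht' : 1 ≤ t') (j : ℕ) :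
    |1 / t^j - 1 / t'^j| ≤ j * |t - t'| := by
  have e : |t⁻¹ - t'⁻¹| ≤ |t - t'| := by
    rw [inv_sub_inv (by linarith) (by linarith), abs_div, abs_sub_comm t' t]
    apply div_le_self (abs_nonneg _)
    rw [abs_of_pos (by positivity)]
    nlinarith
  have a1 : |t⁻¹| ≤ 1 := by rw [abs_of_pos (by positivity)]; exact inv_le_one_of_one_le₀ ht
  have a2 : |t'⁻¹| ≤ 1 := by rw [abs_of_pos (by positivity)]; exact inv_le_one_of_one_le₀ ht'
  simp only [one_div, ← inv_pow]
  induction j with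
  | zero => simp
  | succ j ih =>
    have : t⁻¹^(j+1) - t'⁻¹^(j+1) = t⁻¹ * (t⁻¹^j - t'⁻¹^j) + (t⁻¹ - t'⁻¹) * t'⁻¹^j := by ring
    rw [this]
    refine (abs_add_le _ _).trans ?_
    rw [abs_mul, abs_mul, abs_pow]
    have p1 : |t'⁻¹|^j ≤ 1 := pow_le_one₀ (abs_nonneg _) a2
    have := mul_le_mul a1 ih (abs_nonneg _) zero_le_one
    have := mul_le_mul e p1 (by positivity) (abs_nonneg _)
    push_cast
    linarith

/-- Lipschitz dependence of the inverse function increments -/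
lemma inv_incr {ρ ρ2 : ℝ × ℝ → ℝ} {κ L : ℝ} (hκ : 0 < κ) (hL : 0 ≤ L)
    (hd : ∀ v y, HasDerivAt (fun y => ρ (v, y)) (ρ2 (v, y)) y)
    (hb : ∀ x, |ρ2 x| ≤ κ / 2)
    (h1 : ∀ x x' : ℝ × ℝ, |ρ x - ρ x'| ≤ L * (|x.1 - x'.1| + |x.2 - x'.2|))
    (h2 : ∀ x x' : ℝ × ℝ, |ρ2 x - ρ2 x'| ≤ L * (|x.1 - x'.1| + |x.2 - x'.2|))
    {v v' a b a' b' σ' σ : ℝ} (hσ : σ' ≤ σ)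
    (ha : κ * a + ρ (v, a) = σ') (hb1 : κ * b + ρ (v, b) = σ)
    (ha' : κ * a' + ρ (v', a') = σ') (hb' : κ * b' + ρ (v', b') = σ) :
    2 / (3 * κ) * (σ - σ') ≤ b - a ∧
    |(b - a) - (b' - a')| ≤ 4 * L / κ^2 * (1 + 2 * L / κ) * |v - v'| * (σ - σ') := by
  have hlip : ∀ v y z, |ρ (v, y) - ρ (v, z)| ≤ κ / 2 * |y - z| := by
    intro v y z
    have := Convex.norm_image_sub_le_of_norm_hasDerivWithin_le (s := univ) (f := fun y => ρ (v, y))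
      (f' := fun y => ρ2 (v, y)) (C := κ / 2) (x := z) (y := y)
      (fun x _ => (hd v x).hasDerivWithinAt) (fun x _ => hb _) convex_univ (mem_univ _) (mem_univ _)
    simpa using this
  -- `|y-z| ≤ (2/κ) |F y - F z|`
  have hinv : ∀ v y z, κ / 2 * |y - z| ≤ |(κ * y + ρ (v, y)) - (κ * z + ρ (v, z))| := by
    intro v y z
    have e : κ * (y - z) = ((κ * y + ρ (v, y)) - (κ * z + ρ (v, z))) - (ρ (v, y) - ρ (v, z)) := by ring
    have : |κ * (y - z)| ≤ |(κ * y + ρ (v, y)) - (κ * z + ρ (v, z))| + |ρ (v, y) - ρ (v, z)| := by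
      rw [e]; exact abs_sub _ _
    rw [abs_mul, abs_of_pos hκ] at this
    linarith [hlip v y z]
  have hab : κ / 2 * |b - a| ≤ σ - σ' := by
    have := hinv v b a
    rwa [ha, hb1, abs_of_nonneg (sub_nonneg.mpr hσ)] at this
  have haa : κ / 2 * |a - a'| ≤ L * |v - v'| := by
    have := hinv v' a a'
    rw [ha', ← ha] at this
    have h3 := h1 (v', a) (v, a)
    simp only [sub_self, abs_zero, add_zero] at h3
    rw [abs_sub_comm v' v] at h3
    have e : κ * a + ρ (v', a) - (κ * a + ρ (v, a)) = ρ (v', a) - ρ (v, a) := by ring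
    rw [e] at this
    linarith
  have hbb : κ / 2 * |b - b'| ≤ L * |v - v'| := by
    have := hinv v' b b'
    rw [hb', ← hb1] at this
    have h3 := h1 (v', b) (v, b)
    simp only [sub_self, abs_zero, add_zero] at h3
    rw [abs_sub_comm v' v] at h3
    have e : κ * b + ρ (v', b) - (κ * b + ρ (v, b)) = ρ (v', b) - ρ (v, b) := by ring
    rw [e] at this
    linarith
  constructor
  · have h := hlip v b a
    have hle : a ≤ b := by
      by_contra hc
      push Not at hc
      rw [abs_of_neg (by linarith : b - a < 0)] at h
      have := (abs_le.mp h).2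
      have : κ * (b - a) < 0 := mul_neg_of_pos_of_neg hκ (by linarith)
      linarith
    rw [abs_of_nonneg (by linarith : 0 ≤ b - a)] at h
    have := (abs_le.mp h).2
    rw [div_mul_eq_mul_div, div_le_iff₀ (by positivity)]
    linarith
  · set W := L * (|v - v'| + 2 / κ * (L * |v - v'|)) with hW
    have hdd : ∀ θ : ℝ, HasDerivAt (fun θ => ρ (v', a' + θ * (b' - a')) - ρ (v, a + θ * (b - a)))
        (ρ2 (v', a' + θ * (b' - a')) * (b' - a') - ρ2 (v, a + θ * (b - a)) * (b - a)) θ := by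
      intro θ
      have k : ∀ p q : ℝ, HasDerivAt (fun θ : ℝ => p + θ * q) q θ := fun p q => by
        simpa using ((hasDerivAt_id θ).mul_const q).const_add p
      exact ((hd v' _).comp θ (k a' (b' - a'))).sub ((hd v _).comp θ (k a (b - a)))
    have hm := norm_image_sub_le_of_norm_deriv_le_segment_01'
      (f := fun θ => ρ (v', a' + θ * (b' - a')) - ρ (v, a + θ * (b - a)))
      (f' := fun θ => ρ2 (v', a' + θ * (b' - a')) * (b' - a') - ρ2 (v, a + θ * (b - a)) * (b - a))
      (C := κ / 2 * |(b - a) - (b' - a')| + W * |b - a|)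
      (fun θ _ => (hdd θ).hasDerivWithinAt) ?_
    · simp only [one_mul, zero_mul, add_zero, Real.norm_eq_abs, add_sub_cancel] at hm
      have e : κ * ((b - a) - (b' - a')) = ρ (v', b') - ρ (v, b) - (ρ (v', a') - ρ (v, a)) := by
        linarith
      rw [← e, abs_mul, abs_of_pos hκ] at hm
      have hWn : 0 ≤ W := by positivity
      have k1 : κ / 2 * |(b - a) - (b' - a')| ≤ W * |b - a| := by linarith
      have k2 : |b - a| ≤ 2 / κ * (σ - σ') := by
        rw [div_mul_eq_mul_div, le_div_iff₀ hκ]; linarith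
      have k3 : κ / 2 * |(b - a) - (b' - a')| ≤ W * (2 / κ * (σ - σ')) :=
        k1.trans (mul_le_mul_of_nonneg_left k2 hWn)
      have k4 : |(b - a) - (b' - a')| ≤ 2 / κ * (W * (2 / κ * (σ - σ'))) := by
        rw [div_mul_eq_mul_div, le_div_iff₀ hκ]; linarith
      refine k4.trans (le_of_eq ?_)
      rw [hW]; field_simp; ring
    · intro θ hθ
      have e : ρ2 (v', a' + θ * (b' - a')) * (b' - a') - ρ2 (v, a + θ * (b - a)) * (b - a)
        = -(ρ2 (v', a' + θ * (b' - a')) * ((b - a) - (b' - a'))) +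
          (ρ2 (v', a' + θ * (b' - a')) - ρ2 (v, a + θ * (b - a))) * (b - a) := by ring
      rw [e, Real.norm_eq_abs]
      refine (abs_add_le _ _).trans ?_
      rw [abs_neg, abs_mul, abs_mul]
      refine add_le_add (mul_le_mul_of_nonneg_right (hb _) (abs_nonneg _))
        (mul_le_mul_of_nonneg_right ((h2 _ _).trans ?_) (abs_nonneg _))
      simp only
      refine mul_le_mul_of_nonneg_left (add_le_add (le_of_eq (abs_sub_comm _ _)) ?_) hL
      have ea : |a - a'| ≤ 2 / κ * (L * |v - v'|) := by
        rw [div_mul_eq_mul_div, le_div_iff₀ hκ]; linarith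
      have eb : |b - b'| ≤ 2 / κ * (L * |v - v'|) := by
        rw [div_mul_eq_mul_div, le_div_iff₀ hκ]; linarith
      have e3 : a' + θ * (b' - a') - (a + θ * (b - a)) = -((1 - θ) * (a - a') + θ * (b - b')) := by ring
      rw [e3, abs_neg]
      refine (abs_add_le _ _).trans ?_
      rw [abs_mul, abs_mul, abs_of_nonneg hθ.1, abs_of_nonneg (by linarith [hθ.2] : 0 ≤ 1 - θ)]
      have := mul_le_mul_of_nonneg_left ea (by linarith [hθ.2] : 0 ≤ 1 - θ)
      have := mul_le_mul_of_nonneg_left eb hθ.1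
      linarith

lemma exists_inv {ρ : ℝ × ℝ → ℝ} {κ L : ℝ} (hκ : 0 < κ) (hc : Continuous ρ) (hb : ∀ x, |ρ x| ≤ L) :
    ∃ X : ℝ → ℝ → ℝ, ∀ v σ, κ * X v σ + ρ (v, X v σ) = σ := by
  have h : ∀ v σ, ∃ y, κ * y + ρ (v, y) = σ := by
    intro v
    have hcont : Continuous (fun y => κ * y + ρ (v, y)) :=
      (continuous_const.mul continuous_id).add (hc.comp (by fun_prop))
    refine hcont.surjective ?_ ?_
    · refine Filter.tendsto_atTop_mono (f := fun y => κ * y + -L) (fun y => ?_) ?_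
      · have := (abs_le.mp (hb (v, y))).1
        linarith
      · exact Filter.tendsto_atTop_add_const_right _ _ (Filter.Tendsto.const_mul_atTop hκ Filter.tendsto_id)
    · refine Filter.tendsto_atBot_mono (f := fun y => κ * y + L) (fun y => ?_) ?_
      · have := (abs_le.mp (hb (v, y))).2
        linarith
      · exact Filter.tendsto_atBot_add_const_right _ _ (Filter.Tendsto.const_mul_atBot hκ Filter.tendsto_id)
  choose X hX using h
  exact ⟨X, hX⟩

/-- the phase family -/
noncomputable def gF (A κ : ℝ) (r : ℝ × ℝ → ℝ) (u t s : ℝ) : ℝ :=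
  t * (A + κ * (s / t)^2 / 2 + r (u / t, s / t))

/-- the amplitude family -/
noncomputable def aF (η : ℝ × ℝ → ℝ) (u t s : ℝ) : ℝ := (1 / t^2) * η (u / t, s / t)

lemma gF_deriv {A κ : ℝ} {r : ℝ × ℝ → ℝ} (hr : ContDiff ℝ (⊤:ℕ∞) r) (u t : ℝ) (ht : 1 ≤ t) :
    deriv (gF A κ r u t) = fun s => κ / t * s + D2 r (u / t, s / t) := by
  funext s
  have ht0 : t ≠ 0 := by linarith
  have h1 : HasDerivAt (fun s : ℝ => κ * (s / t)^2 / 2) (κ * (2 * (s / t) * (1 / t)) / 2) s := by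
    have := ((((hasDerivAt_id s).div_const t).pow 2).const_mul κ).div_const 2
    simpa using this
  have h2 : HasDerivAt (gF A κ r u t) (t * (κ * (2 * (s / t) * (1 / t)) / 2 + D2 r (u / t, s / t) / t)) s := by
    have := ((h1.const_add A).add (D2_scale hr (u / t) t s)).const_mul t
    exact this
  rw [h2.deriv]
  field_simp

lemma gF_itd {A κ : ℝ} {r : ℝ × ℝ → ℝ} (hr : ContDiff ℝ (⊤:ℕ∞) r) (u t : ℝ) (ht : 1 ≤ t) (j : ℕ) (s : ℝ) :
    iteratedDeriv j (deriv (gF A κ r u t)) s =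
      κ / t * iteratedDeriv j (fun x : ℝ => x) s + (D2^[j+1] r) (u / t, s / t) / t^j := by
  rw [gF_deriv hr u t ht]
  have hs : ContDiff ℝ (⊤:ℕ∞) (fun y => D2 r (u / t, y / t)) := (D2_smooth hr).comp (by fun_prop)
  have e : iteratedDeriv j (fun y => D2 r (u / t, y / t)) s = (D2^[j+1] r) (u / t, s / t) / t^j := by
    rw [D2_iter_scale (D2_smooth hr) (u / t) t j, Function.iterate_succ_apply]
  rw [← e]
  have hj : (j : WithTop ℕ∞) ≤ ((⊤ : ℕ∞) : WithTop ℕ∞) := by exact_mod_cast le_top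
  have h := iteratedDeriv_fun_add (n := j) (x := s) (f := fun s : ℝ => κ / t * s)
    (g := fun y => D2 r (u / t, y / t))
    ((contDiff_const.mul contDiff_id).contDiffAt) ((hs.of_le hj).contDiffAt)
  rw [h, iteratedDeriv_const_mul_field]

set_option maxHeartbeats 2000000 in
lemma fam_build {A κ : ℝ} {r : ℝ × ℝ → ℝ} (hκ : 0 < κ) (hr : ContDiff ℝ (⊤:ℕ∞) r)
    (hrc : HasCompactSupport r) (hr2 : ∀ x, |D2 (D2 r) x| ≤ κ / 2) :
    ∃ u0 c : ℝ, 0 < u0 ∧ u0 ≤ 1 ∧ 0 < c ∧ ∃ S : ℝ → ℝ → ℝ → ℝ, ∀ η : ℝ × ℝ → ℝ,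
      ContDiff ℝ (⊤:ℕ∞) η → HasCompactSupport η → (∀ x, η x ≠ 0 → |x.1| ≤ u0 / 2 ∧ |x.2| ≤ 1 / 2) →
      ∀ N : ℕ, ∃ B : ℝ,
        (∀ u, |u| ≤ u0 → Fam N c B (gF A κ r u) (aF η u) (S u)) ∧
        (∀ u, |u| ≤ u0 → ∀ t ∈ Icc (1:ℝ) 2, ∀ s, |s| ≤ 1 → |gF A κ r u t s| ≤ B) ∧
        (∀ u, ∀ t ∈ Icc (1:ℝ) 2, ∀ s, aF η u t s ≠ 0 → |u| ≤ u0) := by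
  obtain ⟨L2, hL2, hl2⟩ := lip_all hr hrc 2
  have hb1 := (hl2 1 (by norm_num)).1
  have hp1 := (hl2 1 (by norm_num)).2
  have hp2 := (hl2 2 (by norm_num)).2
  simp only [Function.iterate_succ, Function.iterate_zero, Function.comp_apply, id_eq] at hb1 hp1 hp2
  obtain ⟨X, hX⟩ := exists_inv (ρ := D2 r) hκ (D2_smooth hr).continuous hb1
  set K := 4 * L2 / κ^2 * (1 + 2 * L2 / κ) with hK
  have hK0 : 0 ≤ K := by positivity
  have hincr := fun v v' σ' σ (h : σ' ≤ σ) => inv_incr hκ hL2 (fun v y => D2_hasDeriv (D2_smooth hr) v y)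
    hr2 hp1 hp2 h (hX v σ') (hX v σ) (hX v' σ') (hX v' σ)
  rw [← hK] at hincr
  clear_value K
  obtain ⟨u0, hu0, hu01, huK⟩ : ∃ u0 : ℝ, 0 < u0 ∧ u0 ≤ 1 ∧ 2 * K * u0 ≤ 1 / (3 * κ) := by
    refine ⟨min 1 (1 / (3 * κ) / (2 * K + 1)), by positivity, min_le_left _ _, ?_⟩
    calc 2 * K * min 1 (1 / (3 * κ) / (2 * K + 1)) ≤ (2 * K + 1) * (1 / (3 * κ) / (2 * K + 1)) := by
          apply mul_le_mul (by linarith) (min_le_right _ _) (by positivity) (by positivity)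
      _ = _ := by field_simp
  refine ⟨u0, min (κ / 4) (1 / (3 * κ)), hu0, hu01, by positivity, fun u t σ => t * X (u / t) σ, ?_⟩
  intro η hη hηc hηs N
  obtain ⟨L, hL, hl⟩ := lip_all hr hrc (N + 3)
  obtain ⟨M, hM, hm⟩ := lip_all hη hηc N
  have hl0 := (hl 0 (by omega)).1
  have hl0' := (hl 0 (by omega)).2
  have hl1 := (hl 1 (by omega)).1
  simp only [Function.iterate_succ, Function.iterate_zero, Function.comp_apply, id_eq] at hl0 hl0' hl1
  obtain ⟨B, hB⟩ : ∃ B : ℝ, B = 1 + M + 2 * |A| + κ + (N + 10) * L := ⟨_, rfl⟩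
  have hNL : 0 ≤ N * L := by positivity
  have hA := abs_nonneg A
  -- basic facts about `t`
  have hdiv : ∀ t ∈ Icc (1:ℝ) 2, ∀ z : ℝ, |z / t| ≤ |z| := fun t ht z => by
    rw [abs_div]; apply div_le_self (abs_nonneg _); rw [abs_of_pos (by linarith [ht.1])]; exact ht.1
  have hdivl : ∀ t ∈ Icc (1:ℝ) 2, ∀ t' ∈ Icc (1:ℝ) 2, ∀ z : ℝ, |z / t - z / t'| ≤ |z| * |t - t'| := by
    intro t ht t' ht' z
    have := inv_lip ht.1 ht'.1 1
    simp only [pow_one, Nat.cast_one, one_mul] at this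
    have e : z / t - z / t' = z * (1 / t - 1 / t') := by ring
    rw [e, abs_mul]
    exact mul_le_mul_of_nonneg_left this (abs_nonneg _)
  have hpw : ∀ t ∈ Icc (1:ℝ) 2, ∀ (j : ℕ) (z : ℝ), |z / t^j| ≤ |z| := fun t ht j z => by
    have h1 : 1 ≤ t^j := one_le_pow₀ ht.1
    rw [abs_div]; apply div_le_self (abs_nonneg _); rw [abs_of_pos (by linarith)]; exact h1
  have hsupp : ∀ u, ∀ t ∈ Icc (1:ℝ) 2, ∀ s, aF η u t s ≠ 0 → |u| ≤ u0 ∧ |s| ≤ 1 := by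
    intro u t ht s h
    have h1 := hηs _ (right_ne_zero_of_mul h)
    simp only [abs_div, abs_of_pos (show 0 < t by linarith [ht.1])] at h1
    rw [div_le_iff₀ (by linarith [ht.1]), div_le_iff₀ (by linarith [ht.1])] at h1
    constructor
    · nlinarith [h1.1, ht.2]
    · nlinarith [h1.2, ht.2]
  refine ⟨B, fun u hu => ?_, fun u hu t ht s hs => ?_, fun u t ht s h => (hsupp u t ht s h).1⟩
  swap
  · have h1 : |s / t| ≤ 1 := (hdiv t ht s).trans hs
    have h2 : (s / t)^2 ≤ 1 := by rw [← sq_abs]; exact pow_le_one₀ (abs_nonneg _) h1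
    have h3 : |A + κ * (s / t)^2 / 2 + r (u / t, s / t)| ≤ |A| + κ / 2 + L := by
      refine (abs_add_le _ _).trans (add_le_add ((abs_add_le _ _).trans (add_le_add le_rfl ?_)) (hl0 _))
      rw [abs_of_nonneg (by positivity)]
      nlinarith
    unfold gF
    rw [abs_mul, abs_of_pos (by linarith [ht.1])]
    calc _ ≤ 2 * (|A| + κ / 2 + L) := mul_le_mul ht.2 h3 (abs_nonneg _) (by norm_num)
      _ ≤ B := by rw [hB]; nlinarith
  · have hu1 : |u| ≤ 1 := hu.trans hu01
    constructor
    · positivity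
    · rw [hB]; nlinarith
    · intro t ht
      have ht0 : t ≠ 0 := by linarith [ht.1]
      have : ContDiff ℝ (⊤:ℕ∞) (fun s => r (u / t, s / t)) := hr.comp (by fun_prop)
      change ContDiff ℝ (⊤:ℕ∞) (fun s => t * (A + κ * (s / t)^2 / 2 + r (u / t, s / t)))
      fun_prop
    · intro t ht
      have : ContDiff ℝ (⊤:ℕ∞) (fun s => η (u / t, s / t)) := hη.comp (by fun_prop)
      exact contDiff_const.mul this
    · exact fun t ht s h => (hsupp u t ht s h).2
    · intro t ht j hj s
      have e : iteratedDeriv j (aF η u t) s = (1 / t^2) * ((D2^[j] η) (u / t, s / t) / t^j) := by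
        have := D2_iter_scale hη (u / t) t j
        rw [show aF η u t = fun s => (1 / t^2) * η (u / t, s / t) from rfl,
          iteratedDeriv_const_mul_field, this]
      rw [e]
      have h1 := (hpw t ht j ((D2^[j] η) (u / t, s / t))).trans ((hm j hj).1 _)
      have h2 := hpw t ht 2 ((D2^[j] η) (u / t, s / t) / t^j)
      rw [one_div_mul_eq_div]
      refine h2.trans (h1.trans ?_)
      rw [hB]; nlinarith
    · intro t ht s hs
      rw [gF_deriv hr u t ht.1]
      simp only
      refine (abs_add_le _ _).trans ?_
      have h1 : |κ / t * s| ≤ κ := by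
        rw [abs_mul]
        have := hdiv t ht κ
        rw [abs_of_pos hκ] at this
        nlinarith [abs_nonneg (κ / t), abs_nonneg s]
      have := hl1 (u / t, s / t)
      rw [hB]; nlinarith
    · intro t ht j hj s
      rw [gF_itd hr u t ht.1]
      refine (abs_add_le _ _).trans ?_
      have h1 : |κ / t * iteratedDeriv (j+1) (fun x : ℝ => x) s| ≤ κ := by
        rw [abs_mul]
        have h3 := hdiv t ht κ
        rw [abs_of_pos hκ] at h3
        have h4 := itd_id_abs' j s
        have := mul_le_mul h3 h4 (abs_nonneg _) hκ.le
        linarith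
      have h2 := (hpw t ht (j+1) ((D2^[j+1+1] r) (u / t, s / t))).trans ((hl (j+1+1) (by omega)).1 _)
      rw [hB]; nlinarith
    · intro t ht s
      have e : deriv (deriv (gF A κ r u t)) s = (κ + D2 (D2 r) (u / t, s / t)) / t := by
        have h := gF_itd (A := A) (κ := κ) hr u t ht.1 1 s
        simp only [iteratedDeriv_one, Function.iterate_succ, Function.iterate_zero, Function.comp_apply, id_eq,
          pow_one] at h
        rw [h]
        simp
        ring
      rw [e]
      refine (min_le_left _ _).trans ?_
      rw [le_div_iff₀ (by linarith [ht.1])]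
      have := (abs_le.mp (hr2 (u / t, s / t))).1
      nlinarith [ht.2]
    · intro t ht t' ht' s
      have ht0 : t ≠ 0 := by linarith [ht.1]
      have ht0' : t' ≠ 0 := by linarith [ht'.1]
      have e : gF A κ r u t s - gF A κ r u t' s = A * (t - t') + κ / 2 * s^2 * (1 / t^1 - 1 / t'^1)
          + (t - t') * r (u / t, s / t) + t' * (r (u / t, s / t) - r (u / t', s / t')) := by
        unfold gF; field_simp; ring
      have b1 : |A * (t - t')| = |A| * |t - t'| := abs_mul _ _
      have b2 : |κ / 2 * s^2 * (1 / t^1 - 1 / t'^1)| ≤ κ / 2 * s^2 * |t - t'| := by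
        rw [abs_mul, abs_of_nonneg (by positivity : 0 ≤ κ / 2 * s^2)]
        have := inv_lip ht.1 ht'.1 1
        rw [Nat.cast_one, one_mul] at this
        exact mul_le_mul_of_nonneg_left this (by positivity)
      have b3 : |(t - t') * r (u / t, s / t)| ≤ |t - t'| * L := by
        rw [abs_mul]; exact mul_le_mul_of_nonneg_left (hl0 _) (abs_nonneg _)
      have b4 : |t' * (r (u / t, s / t) - r (u / t', s / t'))| ≤ 2 * (L * (2 + s^2) * |t - t'|) := by
        rw [abs_mul, abs_of_pos (by linarith [ht'.1])]
        refine mul_le_mul ht'.2 ((hl0' _ _).trans ?_) (abs_nonneg _) (by norm_num)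
        rw [mul_assoc]
        refine mul_le_mul_of_nonneg_left ?_ hL
        have c1 := hdivl t ht t' ht' u
        have c2 := hdivl t ht t' ht' s
        have c3 : |s| ≤ 1 + s^2 := by nlinarith [sq_abs s, sq_nonneg (|s| - 1), abs_nonneg s]
        have c4 := mul_le_mul_of_nonneg_right hu1 (abs_nonneg (t - t'))
        have c5 := mul_le_mul_of_nonneg_right c3 (abs_nonneg (t - t'))
        simp only
        linarith
      rw [e]
      have tri : ∀ a b c d : ℝ, |a + b + c + d| ≤ |a| + |b| + |c| + |d| := fun a b c d =>
        (abs_add_le _ _).trans (add_le_add ((abs_add_le _ _).trans (add_le_add (abs_add_le _ _) le_rfl)) le_rfl)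
      refine (tri _ _ _ _).trans ?_
      have fin : |A| + κ / 2 * s^2 + L + 2 * (L * (2 + s^2)) ≤ B * (1 + s^2) := by
        rw [hB]
        have := sq_nonneg s
        have i1 : 0 ≤ L * s^2 := by positivity
        have i2 : 0 ≤ |A| * s^2 := by positivity
        have i3 : 0 ≤ κ * s^2 := by positivity
        have i4 : 0 ≤ M * s^2 := by positivity
        have i5 : 0 ≤ N * L * s^2 := by positivity
        nlinarith
      have := mul_le_mul_of_nonneg_right fin (abs_nonneg (t - t'))
      linarith
    · intro t ht t' ht' j hj s hs
      rw [gF_itd hr u t ht.1, gF_itd hr u t' ht'.1]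
      set P := (D2^[j+1] r) (u / t, s / t) with hP
      set P' := (D2^[j+1] r) (u / t', s / t') with hP'
      set I := iteratedDeriv j (fun x : ℝ => x) s with hI
      have hI1 : |I| ≤ 1 := itd_id_abs j s hs
      have d1 : |P - P'| ≤ L * (2 * |t - t'|) := by
        refine ((hl (j+1) (by omega)).2 _ _).trans (mul_le_mul_of_nonneg_left ?_ hL)
        have c1 := hdivl t ht t' ht' u
        have c2 := hdivl t ht t' ht' s
        have c4 := mul_le_mul_of_nonneg_right hu1 (abs_nonneg (t - t'))
        have c5 := mul_le_mul_of_nonneg_right hs (abs_nonneg (t - t'))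
        simp only
        linarith
      have d2 : |P'| ≤ L := (hl (j+1) (by omega)).1 _
      clear_value P P' I
      have e : κ / t * I + P / t^j - (κ / t' * I + P' / t'^j) =
          (κ / t - κ / t') * I + (P - P') / t^j + P' * (1 / t^j - 1 / t'^j) := by ring
      rw [e]
      have b1 : |(κ / t - κ / t') * I| ≤ κ * |t - t'| := by
        rw [abs_mul]
        have := hdivl t ht t' ht' κ
        rw [abs_of_pos hκ] at this
        have := mul_le_mul this hI1 (abs_nonneg _) (by positivity)
        linarith
      have b2 : |(P - P') / t^j| ≤ L * (2 * |t - t'|) := (hpw t ht j _).trans d1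
      have b3 : |P' * (1 / t^j - 1 / t'^j)| ≤ L * (N * |t - t'|) := by
        rw [abs_mul]
        refine mul_le_mul d2 ((inv_lip ht.1 ht'.1 j).trans ?_) (abs_nonneg _) hL
        exact mul_le_mul_of_nonneg_right (by exact_mod_cast hj) (abs_nonneg _)
      refine (abs_add_le _ _).trans ?_
      have := abs_add_le ((κ / t - κ / t') * I) ((P - P') / t^j)
      have fin : κ + 2 * L + N * L ≤ B := by rw [hB]; nlinarith
      have := mul_le_mul_of_nonneg_right fin (abs_nonneg (t - t'))
      linarith
    · intro t ht σ
      have ht0 : t ≠ 0 := by linarith [ht.1]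
      rw [gF_deriv hr u t ht.1]
      simp only
      rw [mul_div_cancel_left₀ _ ht0]
      conv_rhs => rw [← hX (u / t) σ]
      field_simp
    · intro t ht t' ht' htt σ' σ hσ
      obtain ⟨i1, i2⟩ := hincr (u / t) (u / t') σ' σ hσ
      have e : t * X (u / t) σ - t' * X (u / t') σ - (t * X (u / t) σ' - t' * X (u / t') σ') =
        (t - t') * (X (u / t) σ - X (u / t) σ') +
          t' * (X (u / t) σ - X (u / t) σ' - (X (u / t') σ - X (u / t') σ')) := by ring
      simp only
      rw [e]
      set D := X (u / t) σ - X (u / t) σ' with hD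
      set D' := X (u / t') σ - X (u / t') σ' with hD'
      clear_value D D'
      have hs0 : 0 ≤ σ - σ' := sub_nonneg.mpr hσ
      have ht0 : 0 ≤ t - t' := sub_nonneg.mpr htt
      have j1 : (t - t') * (2 / (3 * κ) * (σ - σ')) ≤ (t - t') * D := mul_le_mul_of_nonneg_left i1 ht0
      have j2 : |u / t - u / t'| ≤ u0 * (t - t') := by
        refine (hdivl t ht t' ht' u).trans ?_
        rw [abs_of_nonneg ht0]
        exact mul_le_mul_of_nonneg_right hu ht0
      have j3 : |D - D'| ≤ K * (u0 * (t - t')) * (σ - σ') :=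
        i2.trans (mul_le_mul_of_nonneg_right (mul_le_mul_of_nonneg_left j2 hK0) hs0)
      have j4 : |t' * (D - D')| ≤ 2 * (K * (u0 * (t - t')) * (σ - σ')) := by
        rw [abs_mul, abs_of_pos (by linarith [ht'.1])]
        exact mul_le_mul ht'.2 j3 (abs_nonneg _) (by norm_num)
      have j5 := (abs_le.mp j4).1
      have hts : 0 ≤ (t - t') * (σ - σ') := mul_nonneg ht0 hs0
      have j6 := mul_le_mul_of_nonneg_right huK hts
      have j7 := mul_le_mul_of_nonneg_right (min_le_right (κ / 4) (1 / (3 * κ))) hts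
      have e2 : 2 / (3 * κ) = 1 / (3 * κ) + 1 / (3 * κ) := by ring
      rw [e2] at j1
      nlinarith

lemma D2_eq {h : ℝ × ℝ → ℝ} (hh : ContDiff ℝ (⊤:ℕ∞) h) {v y d : ℝ}
    (hd : HasDerivAt (fun y => h (v, y)) d y) : D2 h (v, y) = d :=
  (D2_hasDeriv hh v y).unique hd

lemma mvt_zero {h h' : ℝ → ℝ} (hd : ∀ z, HasDerivAt h (h' z) z) (h0 : h 0 = 0) {C y : ℝ}
    (hb : ∀ z, |z| ≤ |y| → |h' z| ≤ C) : |h y| ≤ C * |y| := by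
  have := Convex.norm_image_sub_le_of_norm_hasDerivWithin_le (s := Icc (-|y|) |y|) (f := h)
      (f' := h') (C := C) (x := 0) (y := y)
      (fun x _ => (hd x).hasDerivWithinAt) (fun x hx => hb x (abs_le.mpr hx)) (convex_Icc _ _)
      ⟨by simp, by simp⟩ (abs_le.mp le_rfl)
  simpa [h0] using this

lemma cut_zero {ω : ℝ → ℝ} (h : ∀ x, ω x ≠ 0 → |x| ≤ 2) {z : ℝ} (hz : 2 < |z|) (j : ℕ) :
    iteratedDeriv j ω z = 0 := by
  have ho : IsOpen {z : ℝ | 2 < |z|} := isOpen_lt continuous_const continuous_abs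
  have he : ω =ᶠ[nhds z] fun _ => 0 := by
    filter_upwards [ho.mem_nhds hz] with x hx
    by_contra hc
    exact absurd (h x hc) (not_le.mpr hx)
  rw [he.iteratedDeriv_eq]
  cases j with
  | zero => simp
  | succ j => rw [iteratedDeriv_succ']; simp

lemma globalize {Ω : Set (ℝ × ℝ)} (hΩ : IsOpen Ω) (hΩ0 : ((0 : ℝ), (0 : ℝ)) ∈ Ω)
    {Φ : ℝ × ℝ → ℝ} (hΦ : ContDiffOn ℝ (⊤ : ℕ∞) Φ Ω) :
    ∃ (Ψ : ℝ × ℝ → ℝ) (ρ : ℝ), 0 < ρ ∧ ContDiff ℝ (⊤:ℕ∞) Ψ ∧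
      ∀ x : ℝ × ℝ, |x.1| ≤ ρ → |x.2| ≤ ρ → x ∈ Ω ∧ Ψ x = Φ x := by
  obtain ⟨ω, hω, hωs, hω1, -⟩ := exists_cut
  obtain ⟨ε, hε, hball⟩ := Metric.isOpen_iff.mp hΩ _ hΩ0
  have hin : ∀ x : ℝ × ℝ, |x.1| < ε → |x.2| < ε → x ∈ Ω := by
    intro x h1 h2
    apply hball
    rw [Metric.mem_ball, Prod.dist_eq, Real.dist_eq, Real.dist_eq]
    simpa using ⟨h1, h2⟩
  set ρ := ε / 4 with hρ
  have hρ0 : 0 < ρ := by positivity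
  have hres : ∀ z : ℝ, ω (z / ρ) ≠ 0 → |z| ≤ 2 * ρ := by
    intro z hz
    have := hωs _ hz
    rwa [abs_div, abs_of_pos hρ0, div_le_iff₀ hρ0] at this
  have hone : ∀ z : ℝ, |z| ≤ ρ → ω (z / ρ) = 1 := by
    intro z hz
    apply hω1
    rw [abs_div, abs_of_pos hρ0, div_le_one hρ0]; exact hz
  refine ⟨fun x => ω (x.1 / ρ) * ω (x.2 / ρ) * Φ x, ρ, hρ0, ?_, fun x h1 h2 => ⟨?_, ?_⟩⟩
  · rw [contDiff_iff_contDiffAt]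
    intro x
    have hc1 : ContDiff ℝ (⊤:ℕ∞) (fun x : ℝ × ℝ => ω (x.1 / ρ)) := hω.comp (by fun_prop)
    have hc2 : ContDiff ℝ (⊤:ℕ∞) (fun x : ℝ × ℝ => ω (x.2 / ρ)) := hω.comp (by fun_prop)
    by_cases hx : x ∈ Ω
    · exact (hc1.mul hc2).contDiffAt.mul (hΦ.contDiffAt (hΩ.mem_nhds hx))
    · have hcl : IsClosed {x : ℝ × ℝ | |x.1| ≤ 2 * ρ ∧ |x.2| ≤ 2 * ρ} :=
        IsClosed.inter (s₁ := {x : ℝ × ℝ | |x.1| ≤ 2 * ρ}) (s₂ := {x : ℝ × ℝ | |x.2| ≤ 2 * ρ})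
          (isClosed_le continuous_fst.abs continuous_const) (isClosed_le continuous_snd.abs continuous_const)
      have hxn : x ∈ {x : ℝ × ℝ | |x.1| ≤ 2 * ρ ∧ |x.2| ≤ 2 * ρ}ᶜ := by
        intro h
        exact hx (hin x (by linarith [h.1]) (by linarith [h.2]))
      have he : (fun x : ℝ × ℝ => ω (x.1 / ρ) * ω (x.2 / ρ) * Φ x) =ᶠ[nhds x] fun _ => 0 := by
        filter_upwards [hcl.isOpen_compl.mem_nhds hxn] with z hz
        by_contra hc
        have h1 := left_ne_zero_of_mul hc
        exact hz ⟨hres _ (left_ne_zero_of_mul h1), hres _ (right_ne_zero_of_mul h1)⟩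
      exact contDiffAt_const.congr_of_eventuallyEq he
  · exact hin x (by linarith) (by linarith)
  · simp only [hone _ h1, hone _ h2, one_mul]

lemma build_r {Ω : Set (ℝ × ℝ)} (hΩ : IsOpen Ω) (hΩ0 : ((0 : ℝ), (0 : ℝ)) ∈ Ω)
    {Φ : ℝ × ℝ → ℝ} (hΦ : ContDiffOn ℝ (⊤ : ℕ∞) Φ Ω)
    (hd1 : deriv (fun u : ℝ => Φ (0, u)) 0 = 0)
    (hd2 : 0 < iteratedDeriv 2 (fun u : ℝ => Φ (0, u)) 0) :
    ∃ (A κ ρ : ℝ) (r : ℝ × ℝ → ℝ), 0 < κ ∧ 0 < ρ ∧ ContDiff ℝ (⊤:ℕ∞) r ∧ HasCompactSupport r ∧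
      (∀ x, |D2 (D2 r) x| ≤ κ / 2) ∧
      ∀ x : ℝ × ℝ, |x.1| ≤ ρ → |x.2| ≤ ρ → x ∈ Ω ∧ Φ x = A + κ * x.2^2 / 2 + r x := by
  obtain ⟨Ψ, ρ1, hρ1, hΨ, hΨΦ⟩ := globalize hΩ hΩ0 hΦ
  obtain ⟨κ, hκe⟩ : ∃ κ, κ = iteratedDeriv 2 (fun u : ℝ => Φ (0, u)) 0 := ⟨_, rfl⟩
  rw [← hκe] at hd2
  have hev : (fun u : ℝ => Ψ (0, u)) =ᶠ[nhds 0] fun u => Φ (0, u) := by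
    have : Icc (-ρ1) ρ1 ∈ nhds (0:ℝ) := Icc_mem_nhds (by linarith) hρ1
    filter_upwards [this] with u hu
    exact (hΨΦ (0, u) (by simpa using hρ1.le) (abs_le.mpr hu)).2
  have hΨ1 : D2 Ψ (0, 0) = 0 := by
    rw [← (D2_hasDeriv hΨ 0 0).deriv, hev.deriv_eq, hd1]
  have hΨ2 : D2 (D2 Ψ) (0, 0) = κ := by
    have h := hev.iteratedDeriv_eq 2
    have h2 := D2_iter_scale hΨ 0 1 2
    simp only [div_one, one_pow] at h2
    rw [← hκe, h2] at h
    simpa using h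
  set A := Ψ (0, 0) with hA
  set E : ℝ × ℝ → ℝ := fun x => Ψ x - A - κ * x.2^2 / 2 with hE
  have hEs : ContDiff ℝ (⊤:ℕ∞) E := by fun_prop
  have hE1 : ∀ v y, D2 E (v, y) = D2 Ψ (v, y) - κ * y := by
    intro v y
    apply D2_eq hEs
    have h1 : HasDerivAt (fun y : ℝ => κ * y^2 / 2) (κ * y) y := by
      have := (((hasDerivAt_id y).pow 2).const_mul κ).div_const 2
      refine this.congr_deriv ?_
      simp
      ring
    exact ((D2_hasDeriv hΨ v y).sub_const A).sub h1
  have hE2 : ∀ v y, D2 (D2 E) (v, y) = D2 (D2 Ψ) (v, y) - κ := by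
    intro v y
    apply D2_eq (D2_smooth hEs)
    simp only [hE1]
    have h1 : HasDerivAt (fun y : ℝ => κ * y) κ y := by
      simpa using (hasDerivAt_id y).const_mul κ
    exact (D2_hasDeriv (D2_smooth hΨ) v y).sub h1
  have z0 : E (0, 0) = 0 := by simp [hE, hA]
  have z1 : D2 E (0, 0) = 0 := by rw [hE1, hΨ1]; simp
  have z2 : D2 (D2 E) (0, 0) = 0 := by rw [hE2, hΨ2]; simp
  clear_value E A
  clear hE1 hE2
  -- third derivative bound
  obtain ⟨K, hK0, hK⟩ : ∃ K : ℝ, 0 ≤ K ∧ ∀ y : ℝ, |y| ≤ 2 → |D2 (D2 (D2 E)) (0, y)| ≤ K := by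
    have hc : Continuous (fun y : ℝ => D2 (D2 (D2 E)) (0, y)) :=
      (D2_smooth (D2_smooth (D2_smooth hEs))).continuous.comp (by fun_prop)
    obtain ⟨K, hK⟩ := isCompact_Icc.exists_bound_of_continuousOn (s := Icc (-2:ℝ) 2) hc.continuousOn
    exact ⟨K, (norm_nonneg _).trans (hK 0 (by norm_num)), fun y hy => hK y (abs_le.mp hy)⟩
  have b2 : ∀ y : ℝ, |y| ≤ 2 → |D2 (D2 E) (0, y)| ≤ K * |y| := fun y hy =>
    mvt_zero (h := fun y => D2 (D2 E) (0, y)) (fun z => D2_hasDeriv (D2_smooth (D2_smooth hEs)) 0 z) z2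
      (fun z hz => hK z (hz.trans hy))
  have b1 : ∀ y : ℝ, |y| ≤ 2 → |D2 E (0, y)| ≤ K * |y| * |y| := fun y hy =>
    mvt_zero (h := fun y => D2 E (0, y)) (fun z => D2_hasDeriv (D2_smooth hEs) 0 z) z1
      (fun z hz => (b2 z (hz.trans hy)).trans (mul_le_mul_of_nonneg_left hz hK0))
  have b0 : ∀ y : ℝ, |y| ≤ 2 → |E (0, y)| ≤ K * |y| * |y| * |y| := fun y hy =>
    mvt_zero (h := fun y => E (0, y)) (fun z => D2_hasDeriv hEs 0 z) z0
      (fun z hz => (b1 z (hz.trans hy)).trans (by gcongr))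
  obtain ⟨ω, hω, hωs, hω1, hω01⟩ := exists_cut
  have hωc : HasCompactSupport ω := hcs_of (p := -2) (q := 2) fun x hx => abs_le.mp (hωs x hx)
  obtain ⟨W, hW0, hW⟩ := bdd_jet hω hωc 2
  obtain ⟨δ, hδ0, hδ1, hδ⟩ : ∃ δ : ℝ, 0 < δ ∧ δ ≤ 1 ∧ (16 * W + 2) * K * δ < κ / 2 := by
    refine ⟨min 1 (κ / 4 / ((16 * W + 2) * K + 1)), by positivity, min_le_left _ _, ?_⟩
    calc (16 * W + 2) * K * min 1 (κ / 4 / ((16 * W + 2) * K + 1))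
        ≤ ((16 * W + 2) * K + 1) * (κ / 4 / ((16 * W + 2) * K + 1)) := by
          apply mul_le_mul (by linarith) (min_le_right _ _) (by positivity) (by positivity)
      _ = κ / 4 := by field_simp
      _ < κ / 2 := by linarith
  have hωd : ∀ y, HasDerivAt (fun y => ω (y / δ)) (iteratedDeriv 1 ω (y / δ) / δ) y := by
    intro y
    have h : HasDerivAt ω (deriv ω (y / δ)) (y / δ) := (hω.differentiable (by simp) _).hasDerivAt
    have := h.comp y ((hasDerivAt_id y).div_const δ)
    rw [iteratedDeriv_one, div_eq_mul_one_div]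
    exact this
  have hωd2 : ∀ y, HasDerivAt (fun y => iteratedDeriv 1 ω (y / δ) / δ) (iteratedDeriv 2 ω (y / δ) / δ / δ) y := by
    intro y
    have h : HasDerivAt (iteratedDeriv 1 ω) (deriv (iteratedDeriv 1 ω) (y / δ)) (y / δ) :=
      ((hω.iteratedDeriv 1).differentiable (by simp) _).hasDerivAt
    have := (h.comp y ((hasDerivAt_id y).div_const δ)).div_const δ
    refine this.congr_deriv ?_
    rw [iteratedDeriv_succ (n := 1)]
    ring
  obtain ⟨H, hHe⟩ : ∃ H : ℝ × ℝ → ℝ, H = fun x => ω (x.2 / δ) * E x := ⟨_, rfl⟩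
  have hHs : ContDiff ℝ (⊤:ℕ∞) H := by
    rw [hHe]
    have : ContDiff ℝ (⊤:ℕ∞) (fun x : ℝ × ℝ => ω (x.2 / δ)) := hω.comp (by fun_prop)
    exact this.mul hEs
  have hH1 : ∀ v y, D2 H (v, y) = iteratedDeriv 1 ω (y / δ) / δ * E (v, y) + ω (y / δ) * D2 E (v, y) := by
    intro v y
    apply D2_eq hHs
    rw [hHe]
    exact (hωd y).mul (D2_hasDeriv hEs v y)
  have hH2 : ∀ v y, D2 (D2 H) (v, y) = iteratedDeriv 2 ω (y / δ) / δ / δ * E (v, y) +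
      2 * (iteratedDeriv 1 ω (y / δ) / δ * D2 E (v, y)) + ω (y / δ) * D2 (D2 E) (v, y) := by
    intro v y
    apply D2_eq (D2_smooth hHs)
    simp only [hH1]
    have := ((hωd2 y).mul (D2_hasDeriv hEs v y)).add ((hωd y).mul (D2_hasDeriv (D2_smooth hEs) v y))
    refine this.congr_deriv ?_
    ring
  have hHz : ∀ v y, ¬ (y ∈ Icc (-(2 * δ)) (2 * δ)) → D2 (D2 H) (v, y) = 0 := by
    intro v y hy
    have h2 : 2 < |y / δ| := by
      rw [abs_div, abs_of_pos hδ0, lt_div_iff₀ hδ0]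
      by_contra hc
      push Not at hc
      exact hy (abs_le.mp hc)
    have c0 := cut_zero hωs h2 0
    rw [iteratedDeriv_zero] at c0
    rw [hH2, cut_zero hωs h2 2, cut_zero hωs h2 1, c0]
    simp
  have hHb : ∀ y ∈ Icc (-(2 * δ)) (2 * δ), |D2 (D2 H) (0, y)| < κ / 2 := by
    intro y hy
    have hy2 : |y| ≤ 2 * δ := abs_le.mpr hy
    have hy' : |y| ≤ 2 := by linarith
    refine lt_of_le_of_lt ?_ hδ
    rw [hH2]
    have tri : ∀ a b c : ℝ, |a + b + c| ≤ |a| + |b| + |c| := fun a b c =>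
      (abs_add_le _ _).trans (add_le_add (abs_add_le _ _) le_rfl)
    refine (tri _ _ _).trans ?_
    have t1 : |iteratedDeriv 2 ω (y / δ) / δ / δ * E (0, y)| ≤ W / δ / δ * (K * (2 * δ) * (2 * δ) * (2 * δ)) := by
      rw [abs_mul, abs_div, abs_div, abs_of_pos hδ0]
      have := hW 2 le_rfl (y / δ)
      refine mul_le_mul (by gcongr) ((b0 y hy').trans (by gcongr)) (abs_nonneg _) (by positivity)
    have t2 : |2 * (iteratedDeriv 1 ω (y / δ) / δ * D2 E (0, y))| ≤ 2 * (W / δ * (K * (2 * δ) * (2 * δ))) := by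
      rw [abs_mul, abs_mul, abs_div, abs_of_pos hδ0, abs_two]
      have := hW 1 (by norm_num) (y / δ)
      refine mul_le_mul_of_nonneg_left ?_ (by norm_num)
      refine mul_le_mul (by gcongr) ((b1 y hy').trans (by gcongr)) (abs_nonneg _) (by positivity)
    have t3 : |ω (y / δ) * D2 (D2 E) (0, y)| ≤ 1 * (K * (2 * δ)) := by
      rw [abs_mul, abs_of_nonneg (hω01 _).1]
      exact mul_le_mul (hω01 _).2 ((b2 y hy').trans (by gcongr)) (abs_nonneg _) (by norm_num)
    have e1 : W / δ / δ * (K * (2 * δ) * (2 * δ) * (2 * δ)) = 8 * W * K * δ := by field_simp; ring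
    have e2 : 2 * (W / δ * (K * (2 * δ) * (2 * δ))) = 8 * W * K * δ := by field_simp; ring
    rw [e1] at t1
    rw [e2] at t2
    linarith
  have hHc : Continuous (D2 (D2 H)) := (D2_smooth (D2_smooth hHs)).continuous
  have htube : ∀ᶠ v in nhds (0:ℝ), ∀ y ∈ Icc (-(2 * δ)) (2 * δ), |D2 (D2 H) (v, y)| < κ / 2 := by
    apply isCompact_Icc.eventually_forall_of_forall_eventually
    intro y hy
    exact (hHc.abs.tendsto (0, y)).eventually (gt_mem_nhds (hHb y hy))
  obtain ⟨δ', hδ'0, hδ'⟩ := Metric.eventually_nhds_iff.mp htube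
  obtain ⟨ε, hε⟩ : ∃ ε, ε = δ' / 4 := ⟨_, rfl⟩
  have hε0 : 0 < ε := by rw [hε]; positivity
  obtain ⟨r, hre⟩ : ∃ r : ℝ × ℝ → ℝ, r = fun x => ω (x.1 / ε) * H x := ⟨_, rfl⟩
  have hrs : ContDiff ℝ (⊤:ℕ∞) r := by
    rw [hre]
    have : ContDiff ℝ (⊤:ℕ∞) (fun x : ℝ × ℝ => ω (x.1 / ε)) := hω.comp (by fun_prop)
    exact this.mul hHs
  have hr1 : ∀ v y, D2 r (v, y) = ω (v / ε) * D2 H (v, y) := by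
    intro v y
    apply D2_eq hrs
    rw [hre]
    exact (D2_hasDeriv hHs v y).const_mul (ω (v / ε))
  have hr2 : ∀ v y, D2 (D2 r) (v, y) = ω (v / ε) * D2 (D2 H) (v, y) := by
    intro v y
    apply D2_eq (D2_smooth hrs)
    simp only [hr1]
    exact (D2_hasDeriv (D2_smooth hHs) v y).const_mul _
  have hres : ∀ d : ℝ, 0 < d → ∀ z : ℝ, ω (z / d) ≠ 0 → |z| ≤ 2 * d := by
    intro d hd z hz
    have := hωs _ hz
    rwa [abs_div, abs_of_pos hd, div_le_iff₀ hd] at this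
  have hone : ∀ d : ℝ, 0 < d → ∀ z : ℝ, |z| ≤ d → ω (z / d) = 1 := by
    intro d hd z hz
    apply hω1
    rw [abs_div, abs_of_pos hd, div_le_one hd]; exact hz
  refine ⟨A, κ, min ρ1 (min δ ε), r, hd2, by positivity, hrs, ?_, ?_, ?_⟩
  · apply HasCompactSupport.intro ((isCompact_Icc (a := -(2 * ε)) (b := 2 * ε)).prod
      (isCompact_Icc (a := -(2 * δ)) (b := 2 * δ)))
    intro x hx
    by_contra hc
    rw [hre, hHe] at hc
    exact hx ⟨abs_le.mp (hres ε hε0 _ (left_ne_zero_of_mul hc)),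
      abs_le.mp (hres δ hδ0 _ (left_ne_zero_of_mul (right_ne_zero_of_mul hc)))⟩
  · rintro ⟨v, y⟩
    rw [hr2]
    by_cases hv : ω (v / ε) = 0
    · rw [hv]; simp; positivity
    by_cases hy : y ∈ Icc (-(2 * δ)) (2 * δ)
    · have h1 : |v| ≤ 2 * ε := hres ε hε0 _ hv
      have h2 := hδ' (y := v) (by rw [Real.dist_eq, sub_zero]; linarith) y hy
      rw [abs_mul, abs_of_nonneg (hω01 _).1]
      have := mul_le_mul (hω01 (v / ε)).2 h2.le (abs_nonneg _) (by norm_num)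
      linarith
    · rw [hHz v y hy]; simp; positivity
  · intro x h1 h2
    obtain ⟨hx, he⟩ := hΨΦ x (h1.trans (min_le_left _ _)) (h2.trans (min_le_left _ _))
    refine ⟨hx, ?_⟩
    have o1 := hone ε hε0 x.1 (h1.trans ((min_le_right _ _).trans (min_le_right _ _)))
    have o2 := hone δ hδ0 x.2 (h2.trans ((min_le_right _ _).trans (min_le_left _ _)))
    rw [hre]
    simp only
    rw [hHe]
    simp only
    rw [o1, o2, hE]
    linarith

lemma pos_case {Ω : Set (ℝ × ℝ)} (hΩ : IsOpen Ω) (hΩ0 : ((0 : ℝ), (0 : ℝ)) ∈ Ω)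
    {Φ : ℝ × ℝ → ℝ} (hΦ : ContDiffOn ℝ (⊤ : ℕ∞) Φ Ω)
    (hd1 : deriv (fun u : ℝ => Φ (0, u)) 0 = 0)
    (hd2 : 0 < iteratedDeriv 2 (fun u : ℝ => Φ (0, u)) 0)
    (p q : ℝ) (hp : 1 < p) (hpq : p ≤ q) (hq2 : q < 2*p) (hq3 : 3*(q/p)-1 < q) :
    ∃ U ⊆ Ω, IsOpen U ∧ ((0 : ℝ), (0 : ℝ)) ∈ U ∧
      ∀ η : ℝ × ℝ → ℝ, ContDiff ℝ (⊤ : ℕ∞) η → HasCompactSupport η → tsupport η ⊆ U →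
      ∃ C : ℝ, 0 < C ∧ ∀ f : ℝ × ℝ × ℝ → ℝ, Continuous f → HasCompactSupport f →
        ∫⁻ y : ℝ × ℝ × ℝ, (⨆ t : Icc (1:ℝ) 2, ENNReal.ofReal
          |∫ x : ℝ × ℝ, f (y.1 - t * x.1, y.2.1 - t * x.2, y.2.2 - t * Φ x) * η x|)^q ≤
        ENNReal.ofReal C * (∫⁻ x, ENNReal.ofReal (|f x|^p))^(q/p) := by
  obtain ⟨A, κ, ρ, r, hκ, hρ, hrs, hrc, hr2, hrΦ⟩ := build_r hΩ hΩ0 hΦ hd1 hd2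
  obtain ⟨u0, c, hu0, hu01, hc, S, hS⟩ := fam_build (A := A) hκ hrs hrc hr2
  obtain ⟨N, hN⟩ := thm3D p q hp hpq hq2 hq3
  refine ⟨{x : ℝ × ℝ | |x.1| < min ρ (u0 / 2)} ∩ {x : ℝ × ℝ | |x.2| < min ρ (1 / 2)}, ?_, ?_, ?_, ?_⟩
  · rintro x ⟨h1, h2⟩
    exact (hrΦ x ((lt_min_iff.mp h1).1.le) ((lt_min_iff.mp h2).1.le)).1
  · exact (isOpen_lt continuous_fst.abs continuous_const).inter (isOpen_lt continuous_snd.abs continuous_const)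
  · constructor
    · change |(0:ℝ)| < min ρ (u0 / 2)
      rw [abs_zero]; positivity
    · change |(0:ℝ)| < min ρ (1 / 2)
      rw [abs_zero]; positivity
  intro η hη hηc hηU
  have hη1 : ∀ x, η x ≠ 0 → |x.1| < min ρ (u0 / 2) ∧ |x.2| < min ρ (1 / 2) := fun x hx =>
    hηU (subset_tsupport _ hx)
  obtain ⟨B, hF, hgB, ha0⟩ := hS η hη hηc (fun x hx => ⟨(lt_min_iff.mp (hη1 x hx).1).2.le,
    (lt_min_iff.mp (hη1 x hx).2).2.le⟩) (N + 1)
  obtain ⟨C, hC, hmain⟩ := hN c B hc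
  refine ⟨C, hC, fun f hf hfs => ?_⟩
  have h := hmain u0 (gF A κ r) (aF η) S f hu01 hF hgB ha0 ?_ ?_ hf hfs
  rotate_left
  · intro t ht
    have ht0 : t ≠ 0 := by linarith [ht.1]
    have h1 : Continuous (fun x : ℝ × ℝ => r (x.1 / t, x.2 / t)) := hrs.continuous.comp (by fun_prop)
    change Continuous (fun x : ℝ × ℝ => t * (A + κ * (x.2 / t)^2 / 2 + r (x.1 / t, x.2 / t)))
    fun_prop
  · intro t ht
    have h1 : Continuous (fun x : ℝ × ℝ => η (x.1 / t, x.2 / t)) := hη.continuous.comp (by fun_prop)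
    exact continuous_const.mul h1
  refine le_trans (le_of_eq ?_) h
  apply lintegral_congr
  intro y
  congr 2
  funext t
  obtain ⟨t, ht⟩ := t
  have ht0 : t ≠ 0 := by linarith [ht.1]
  have htp : 0 < t := by linarith [ht.1]
  congr 2
  have hcv := Measure.integral_comp_smul (volume : Measure (ℝ × ℝ))
    (fun x : ℝ × ℝ => aF η x.1 t x.2 * f (y.1 - x.1, y.2.1 - x.2, y.2.2 - gF A κ r x.1 t x.2)) t
  have hfr : Module.finrank ℝ (ℝ × ℝ) = 2 := by simp
  rw [hfr, abs_of_pos (by positivity), smul_eq_mul] at hcv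
  have e : ∀ x : ℝ × ℝ, aF η (t • x).1 t (t • x).2 * f (y.1 - (t • x).1, y.2.1 - (t • x).2,
      y.2.2 - gF A κ r (t • x).1 t (t • x).2) =
      (t^2)⁻¹ * (f (y.1 - t * x.1, y.2.1 - t * x.2, y.2.2 - t * Φ x) * η x) := by
    intro x
    have e1 : ∀ z : ℝ, t * z / t = z := fun z => mul_div_cancel_left₀ z ht0
    simp only [aF, gF, Prod.smul_fst, Prod.smul_snd, smul_eq_mul, e1]
    by_cases hx : η x = 0
    · simp [hx]
    · obtain ⟨k1, k2⟩ := hη1 x hx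
      rw [(hrΦ x (lt_min_iff.mp k1).1.le (lt_min_iff.mp k2).1.le).2]
      ring
  simp only [e] at hcv
  rw [integral_const_mul] at hcv
  exact mul_left_cancel₀ (by positivity) hcv

lemma neg_case {Φ : ℝ × ℝ → ℝ} {p q : ℝ} {η : ℝ × ℝ → ℝ} {C : ℝ}
    (h : ∀ f : ℝ × ℝ × ℝ → ℝ, Continuous f → HasCompactSupport f →
        ∫⁻ y : ℝ × ℝ × ℝ, (⨆ t : Icc (1:ℝ) 2, ENNReal.ofReal
          |∫ x : ℝ × ℝ, f (y.1 - t * x.1, y.2.1 - t * x.2, y.2.2 - t * -Φ x) * η x|)^q ≤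
        ENNReal.ofReal C * (∫⁻ x, ENNReal.ofReal (|f x|^p))^(q/p))
    (f : ℝ × ℝ × ℝ → ℝ) (hf : Continuous f) (hfs : HasCompactSupport f) :
        ∫⁻ y : ℝ × ℝ × ℝ, (⨆ t : Icc (1:ℝ) 2, ENNReal.ofReal
          |∫ x : ℝ × ℝ, f (y.1 - t * x.1, y.2.1 - t * x.2, y.2.2 - t * Φ x) * η x|)^q ≤
        ENNReal.ofReal C * (∫⁻ x, ENNReal.ofReal (|f x|^p))^(q/p) := by
  let R : (ℝ × ℝ × ℝ) ≃ₜ (ℝ × ℝ × ℝ) :=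
    (Homeomorph.refl ℝ).prodCongr ((Homeomorph.refl ℝ).prodCongr (Homeomorph.neg ℝ))
  have hRe : ∀ y, R y = (y.1, y.2.1, -y.2.2) := fun y => rfl
  have hR : MeasurePreserving R volume volume := by
    have h2 : MeasurePreserving (Prod.map id (fun x : ℝ => -x)) (volume : Measure (ℝ × ℝ)) volume :=
      (MeasurePreserving.id (volume : Measure ℝ)).prod (Measure.measurePreserving_neg (volume : Measure ℝ))
    exact (MeasurePreserving.id (volume : Measure ℝ)).prod h2
  have hRemb : MeasurableEmbedding R := R.measurableEmbedding
  have h1 := h (f ∘ R) (hf.comp R.continuous) (hfs.comp_homeomorph R)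
  have e2 : ∫⁻ x, ENNReal.ofReal (|(f ∘ R) x|^p) = ∫⁻ x, ENNReal.ofReal (|f x|^p) :=
    hR.lintegral_comp_emb hRemb (fun x => ENNReal.ofReal (|f x|^p))
  rw [e2] at h1
  rw [← hR.lintegral_comp_emb hRemb]
  refine le_trans (le_of_eq ?_) h1
  apply lintegral_congr
  intro y
  congr 2
  funext t
  congr 3
  funext x
  simp only [hRe, Function.comp_apply]
  congr 3
  ring_nf

lemma enorm_maxOp_le (Φ η : ℝ × ℝ → ℝ) (f : ℝ × ℝ × ℝ → ℝ) (y : ℝ × ℝ × ℝ) :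
    ‖maxOpSurfIso Φ η f y‖ₑ ≤ ⨆ t : Icc (1:ℝ) 2, ENNReal.ofReal
          |∫ x : ℝ × ℝ, f (y.1 - t * x.1, y.2.1 - t * x.2, y.2.2 - t * Φ x) * η x| := by
  set a : Icc (1:ℝ) 2 → ℝ := fun t =>
    |∫ x : ℝ × ℝ, f (y.1 - t * x.1, y.2.1 - t * x.2, y.2.2 - t * Φ x) * η x| with ha
  change ‖⨆ t, a t‖ₑ ≤ ⨆ t, ENNReal.ofReal (a t)
  have h0 : ∀ t, 0 ≤ a t := fun t => abs_nonneg _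
  rw [← ofReal_norm_eq_enorm, Real.norm_eq_abs, abs_of_nonneg (Real.iSup_nonneg h0)]
  by_cases ht : (⨆ t, ENNReal.ofReal (a t)) = ∞
  · rw [ht]; exact le_top
  · rw [ENNReal.ofReal_le_iff_le_toReal ht]
    have : Nonempty (Icc (1:ℝ) 2) := ⟨⟨1, by norm_num⟩⟩
    refine ciSup_le fun t => ?_
    rw [← ENNReal.ofReal_le_iff_le_toReal ht]
    exact le_iSup (fun t => ENNReal.ofReal (a t)) t

lemma to_eLpNorm {Φ η : ℝ × ℝ → ℝ} {p q C : ℝ} (hp : 1 < p) (hq : 1 < q) (hC : 0 < C) {f : ℝ × ℝ × ℝ → ℝ}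
    (h : ∫⁻ y : ℝ × ℝ × ℝ, (⨆ t : Icc (1:ℝ) 2, ENNReal.ofReal
          |∫ x : ℝ × ℝ, f (y.1 - t * x.1, y.2.1 - t * x.2, y.2.2 - t * Φ x) * η x|)^q ≤
        ENNReal.ofReal C * (∫⁻ x, ENNReal.ofReal (|f x|^p))^(q/p)) :
    eLpNorm (maxOpSurfIso Φ η f) (ENNReal.ofReal q) volume ≤
          ENNReal.ofReal (C^(1/q)) * eLpNorm f (ENNReal.ofReal p) volume := by
  have hp0 : 0 < p := by linarith
  have hq0 : 0 < q := by linarith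
  rw [eLpNorm_eq_lintegral_rpow_enorm_toReal (by simpa using hq0) ENNReal.ofReal_ne_top,
    eLpNorm_eq_lintegral_rpow_enorm_toReal (by simpa using hp0) ENNReal.ofReal_ne_top,
    ENNReal.toReal_ofReal hp0.le, ENNReal.toReal_ofReal hq0.le]
  have h1 : ∫⁻ y, ‖maxOpSurfIso Φ η f y‖ₑ^q ≤ ENNReal.ofReal C * (∫⁻ x, ENNReal.ofReal (|f x|^p))^(q/p) :=
    le_trans (lintegral_mono fun y => ENNReal.rpow_le_rpow (enorm_maxOp_le Φ η f y) hq0.le) h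
  have e : ∀ x, ENNReal.ofReal (|f x|^p) = ‖f x‖ₑ^p := fun x => by
    rw [← ofReal_norm_eq_enorm, Real.norm_eq_abs, ENNReal.ofReal_rpow_of_nonneg (abs_nonneg _) hp0.le]
  simp only [e] at h1
  refine (ENNReal.rpow_le_rpow h1 (by positivity)).trans (le_of_eq ?_)
  rw [ENNReal.mul_rpow_of_nonneg _ _ (by positivity), ← ENNReal.rpow_mul,
    ENNReal.ofReal_rpow_of_nonneg hC.le (by positivity)]
  congr 2
  field_simp

/-- **Corollary 1.4.**  Let `Ω ⊆ ℝ²` be an open neighborhood of the origin and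
`Φ ∈ C^∞(Ω)` with `∂₂Φ(0,0) = 0` and `∂₂²Φ(0,0) ≠ 0`.  Let `1 < p, q < ∞` satisfy
`1/(2p) < 1/q ≤ 1/p` and `1/q > 3/p − 1`.  Then there is a neighborhood `U ⊆ Ω` of the
origin such that for every smooth cutoff `η` supported in `U` there is a constant `C` with
`‖Mf‖_{L^q(ℝ³)} ≤ C ‖f‖_{L^p(ℝ³)}` for all `f ∈ C₀^∞(ℝ³)`. -/
theorem maximal_surface_isotropic_Lp_Lq
    (Ω : Set (ℝ × ℝ)) (hΩ : IsOpen Ω) (hΩ0 : ((0 : ℝ), (0 : ℝ)) ∈ Ω)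
    (Φ : ℝ × ℝ → ℝ) (hΦ : ContDiffOn ℝ (⊤ : ℕ∞) Φ Ω)
    (hd1 : deriv (fun u : ℝ => Φ (0, u)) 0 = 0)
    (hd2 : iteratedDeriv 2 (fun u : ℝ => Φ (0, u)) 0 ≠ 0)
    (p q : ℝ) (hp : 1 < p) (hq : 1 < q)
    (hpq₁ : 1 / (2 * p) < 1 / q) (hpq₂ : 1 / q ≤ 1 / p) (hpq₃ : 3 / p - 1 < 1 / q) :
    ∃ U ⊆ Ω, IsOpen U ∧ ((0 : ℝ), (0 : ℝ)) ∈ U ∧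
      ∀ η : ℝ × ℝ → ℝ, ContDiff ℝ (⊤ : ℕ∞) η → HasCompactSupport η → tsupport η ⊆ U →
      ∃ C > 0, ∀ f : ℝ × ℝ × ℝ → ℝ, ContDiff ℝ (⊤ : ℕ∞) f → HasCompactSupport f →
        eLpNorm (maxOpSurfIso Φ η f) (ENNReal.ofReal q) volume ≤
          ENNReal.ofReal C * eLpNorm f (ENNReal.ofReal p) volume := by
  have hp0 : 0 < p := by linarith
  have hq0 : 0 < q := by linarith
  have k1 : p ≤ q := (one_div_le_one_div hq0 hp0).mp hpq₂
  have k2 : q < 2 * p := (one_div_lt_one_div (by positivity) hq0).mp hpq₁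
  have k3 : 3 * (q / p) - 1 < q := by
    have := mul_lt_mul_of_pos_right hpq₃ hq0
    rw [one_div_mul_cancel hq0.ne'] at this
    have e : (3 / p - 1) * q = 3 * (q / p) - q := by ring
    linarith
  rcases lt_or_gt_of_ne hd2 with hneg | hpos
  · have hd1' : deriv (fun u : ℝ => (fun x => -Φ x) (0, u)) 0 = 0 := by
      simp only
      rw [deriv.fun_neg, hd1, neg_zero]
    have hd2' : 0 < iteratedDeriv 2 (fun u : ℝ => (fun x => -Φ x) (0, u)) 0 := by
      simp only
      rw [iteratedDeriv_fun_neg]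
      linarith
    obtain ⟨U, hU, hUo, hU0, hmain⟩ := pos_case hΩ hΩ0 hΦ.neg hd1' hd2' p q hp k1 k2 k3
    refine ⟨U, hU, hUo, hU0, fun η hη hηc hηU => ?_⟩
    obtain ⟨C, hC, hb⟩ := hmain η hη hηc hηU
    exact ⟨C^(1/q), by positivity, fun f hf hfs => to_eLpNorm hp hq hC (neg_case hb f hf.continuous hfs)⟩
  · obtain ⟨U, hU, hUo, hU0, hmain⟩ := pos_case hΩ hΩ0 hΦ hd1 hpos p q hp k1 k2 k3
    refine ⟨U, hU, hUo, hU0, fun η hη hηc hηU => ?_⟩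
    obtain ⟨C, hC, hb⟩ := hmain η hη hηc hηU
    exact ⟨C^(1/q), by positivity, fun f hf hfs => to_eLpNorm hp hq hC (hb f hf.continuous hfs)⟩
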